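/- There exist constants ν > 0 and δ ∈ (1/2, 1) such that Σ_{n ≤ x, n practical} τ(n) = ν x (log x)^δ + O(x) for x ≥ 2. (This confirms Conjecture 4 of Margenstern; here δ = 0.7136125... is the real number in (0,1) satisfying 0 = 1 + ∫₀^∞ (ξ(v) − (v+2)e^{−2γ}) (v+1)^{−δ−1} dv + e^{−2γ}/δ + e^{−2γ}/(δ−1).) -/

import Mathlib

open Real MeasureTheory

/-- `n` is practical: every `m` with `1 ≤ m ≤ n` is a sum of distinct positive divisors
of `n`. -/
def IsPractical (n : ℕ) : Prop :=
  0 < n ∧ ∀ m : ℕ, 1 ≤ m → m ≤ n → ∃ s : Finset ℕ, s ⊆ n.divisors ∧ ∑ d ∈ s, d = m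

open Classical in
/-- `∑_{n ≤ x, n practical} τ(n)`. -/
noncomputable def Tprac (x : ℝ) : ℝ :=
  ∑ n ∈ (Finset.Icc 1 ⌊x⌋₊).filter (fun n => IsPractical n), (n.divisors.card : ℝ)

section
open Real MeasureTheory Set intervalIntegral Filter Topology

structure Xi (ξ : ℝ → ℝ) : Prop where
  h0 : ∀ u : ℝ, u < 1 → ξ u = 0
  h1 : ∀ u : ℝ, 1 ≤ u → u * ξ u = 2 + 2 * ∫ t in (1:ℝ)..(u - 1), ξ t

namespace Xi
variable {ξ : ℝ → ℝ} (H : Xi ξ)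
include H

theorem int_of_cont {n : ℝ} (hn : 1 ≤ n) (h : ContinuousOn ξ (Icc 1 n)) (a : ℝ) (ha : a ≤ 1) :
    IntervalIntegrable ξ volume a n := by
  have h1 : IntervalIntegrable ξ volume 1 n := by
    apply ContinuousOn.intervalIntegrable; rwa [uIcc_of_le hn]
  refine IntervalIntegrable.trans (b := 1) ?_ h1
  refine (intervalIntegrable_const (c := (0:ℝ))).congr_ae ?_
  rw [uIoc_of_le ha]
  have : ∀ᵐ x : ℝ, x ≠ 1 := by simp [ae_iff, measure_singleton]
  filter_upwards [ae_restrict_mem measurableSet_Ioc, ae_restrict_of_ae this] with x hx hx1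
  exact (H.h0 x (lt_of_le_of_ne hx.2 hx1)).symm

theorem cont_aux (n : ℕ) : ContinuousOn ξ (Icc 1 (n+1)) := by
  induction n with
  | zero => simp
  | succ n ih =>
    have hI := H.int_of_cont (by linarith [n.cast_nonneg (α := ℝ)]) ih 0 (by norm_num)
    have hc := continuousOn_primitive_interval' (hI) (a := 1)
      (by rw [uIcc_of_le (by positivity)]; constructor <;> linarith [n.cast_nonneg (α := ℝ)])
    have : ContinuousOn (fun u : ℝ => (2 + 2 * ∫ t in (1:ℝ)..(u-1), ξ t)/u) (Icc 1 (n+1+1)) := by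
      apply ContinuousOn.div _ continuousOn_id (fun x hx => by simp only [id]; linarith [hx.1])
      refine continuousOn_const.add (continuousOn_const.mul (hc.comp (by fun_prop) ?_))
      intro x hx
      rw [uIcc_of_le (by positivity)]; constructor <;> simp <;> linarith [hx.1, hx.2]
    push_cast
    refine this.congr fun u hu => ?_
    have := H.h1 u hu.1
    have hu0 : u ≠ 0 := by linarith [hu.1]
    field_simp; linarith

theorem cont : ContinuousOn ξ (Ici 1) := by
  intro x hx
  obtain ⟨n, hn⟩ := exists_nat_gt x
  have := H.cont_aux n x ⟨hx, by linarith⟩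
  refine this.mono_of_mem_nhdsWithin ?_
  have : Iio (n+1:ℝ) ∈ 𝓝 x := Iio_mem_nhds (by linarith)
  filter_upwards [self_mem_nhdsWithin, mem_nhdsWithin_of_mem_nhds this] with y h1 h2
  exact ⟨h1, h2.le⟩

theorem ii (a b : ℝ) : IntervalIntegrable ξ volume a b := by
  have : ∀ n : ℕ, IntervalIntegrable ξ volume (-n) (n+1) := fun n =>
    H.int_of_cont (by linarith [n.cast_nonneg (α := ℝ)]) (H.cont_aux n) _ (by linarith [n.cast_nonneg (α := ℝ)])
  obtain ⟨n, hn⟩ := exists_nat_gt (max |a| |b|)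
  refine (this n).mono_set ?_
  rw [uIcc_of_le (a := -(n:ℝ)) (by linarith [n.cast_nonneg (α := ℝ)])]
  have h1 := (le_max_left _ _).trans_lt hn
  have h2 := (le_max_right _ _).trans_lt hn
  rw [abs_lt] at h1 h2
  apply uIcc_subset_Icc <;> constructor <;> linarith

theorem int0 {a b : ℝ} (ha : a ≤ 1) (hb : b ≤ 1) : ∫ t in a..b, ξ t = 0 := by
  rw [intervalIntegral.integral_congr_ae (g := fun _ => (0:ℝ))]
  · simp
  have : ∀ᵐ x : ℝ, x ≠ 1 := by simp [ae_iff, measure_singleton]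
  filter_upwards [this] with x hx1 hx
  refine (H.h0 x (lt_of_le_of_ne ?_ hx1))
  have := hx.2
  simp only [le_sup_iff] at this
  rcases this with h | h <;> linarith

theorem v12 {u : ℝ} (h : 1 ≤ u) (h2 : u ≤ 2) : ξ u = 2 / u := by
  have := H.h1 u h
  rw [H.int0 le_rfl (by linarith)] at this
  rw [eq_div_iff (by linarith)]; linarith

theorem v23 {u : ℝ} (h : 2 ≤ u) (h2 : u ≤ 3) : ξ u = (2 + 4 * Real.log (u-1)) / u := by
  have := H.h1 u (by linarith)
  rw [integral_congr (g := fun t => 2 * (1 / t))] at this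
  · rw [intervalIntegral.integral_const_mul, integral_one_div_of_pos one_pos (by linarith)] at this
    rw [eq_div_iff (by linarith)]; simp at this; linarith
  · intro t ht
    rw [uIcc_of_le (by linarith)] at ht
    simp only
    rw [H.v12 ht.1 (by linarith [ht.2])]; ring

theorem contAt {u : ℝ} (h : u ≠ 1) : ContinuousAt ξ u := by
  rcases lt_or_gt_of_ne h with h | h
  · refine (continuousAt_const (y := (0:ℝ))).congr ?_
    filter_upwards [Iio_mem_nhds h] with x hx
    exact (H.h0 x hx).symm
  · exact H.cont.continuousAt (Ici_mem_nhds h)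

theorem meas : Measurable ξ := by
  have h := H.cont.measurable_piecewise (continuousOn_const (c := (0:ℝ)) (s := (Ici (1:ℝ))ᶜ)) measurableSet_Ici
  convert h using 1
  ext u; by_cases h : u ∈ Ici (1:ℝ)
  · simp only [piecewise, h, if_true]
  · simp only [piecewise, h, if_false, H.h0 u (by simpa using h)]

theorem hd {u : ℝ} (h : 1 < u) (h2 : u ≠ 2) : HasDerivAt ξ ((2 * ξ (u-1) - ξ u) / u) u := by
  have hu : u ≠ 0 := by linarith
  have e1 := H.h1 u h.le
  have h3 : HasDerivAt (fun x => ∫ t in (1:ℝ)..x, ξ t) (ξ (u-1)) (u-1) :=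
    integral_hasDerivAt_right (H.ii _ _) H.meas.stronglyMeasurable.stronglyMeasurableAtFilter
      (H.contAt (by contrapose! h2; linarith))
  have h4 := h3.comp u ((hasDerivAt_id u).sub_const 1)
  have h5 := ((h4.const_mul 2).const_add 2).div (hasDerivAt_id u) hu
  refine (h5.congr_of_eventuallyEq ?_).congr_deriv ?_
  · filter_upwards [Ioi_mem_nhds h] with x hx
    have := H.h1 x (le_of_lt hx)
    have : x ≠ 0 := by have := mem_Ioi.1 hx; linarith
    simp only [id, Pi.div_apply, Function.comp]
    rw [eq_div_iff this]; linarith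
  · simp only [id, Function.comp]
    field_simp; linarith

theorem nonneg (u : ℝ) : 0 ≤ ξ u := by
  by_cases h1 : u < 1
  · rw [H.h0 u h1]
  push Not at h1
  by_contra hc
  push Not at hc
  obtain ⟨n, hn⟩ := exists_nat_gt u
  have : ∀ n : ℕ, ∀ u ≤ (n:ℝ)+1, 0 ≤ ξ u := by
    intro n
    induction n with
    | zero =>
      intro u hu; rcases lt_or_eq_of_le hu with h | h
      · rw [H.h0 u (by simpa using h)]
      · rw [H.v12 (by simp [h]) (by simp [h])]; simp [h]
    | succ n ih =>
      intro u hu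
      by_cases h : u < 1
      · rw [H.h0 u h]
      push Not at h
      have e := H.h1 u h
      have : 0 ≤ ∫ t in (1:ℝ)..(u-1), ξ t := by
        rcases le_total u 2 with h2 | h2
        · rw [H.int0 le_rfl (by linarith)]
        · refine integral_nonneg (by linarith) fun x hx => ih x ?_
          have := hx.2; push_cast at hu; linarith
      by_contra hc
      push Not at hc
      nlinarith
  linarith [this n u (by linarith)]
end Xi

theorem decay_prim {g g' : ℝ → ℝ} {a K : ℝ} (hc : ContinuousOn g (Ici a))
    (hd : ∀ x, a < x → HasDerivAt g (g' x) x) (hb : ∀ x, a < x → |g' x| ≤ K * exp (-x)) :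
    ∃ L, ∀ x, a ≤ x → |g x - L| ≤ K * exp (-x) := by
  have he : ∀ x : ℝ, HasDerivAt (fun x : ℝ => K * exp (-x)) (-(K * exp (-x))) x := fun x => by
    have := ((hasDerivAt_id x).neg.exp).const_mul K
    simpa using this
  have hce : ContinuousOn (fun x : ℝ => K * exp (-x)) (Ici a) := by fun_prop
  have hP : AntitoneOn (fun x => g x + K * exp (-x)) (Ici a) := by
    refine antitoneOn_of_deriv_nonpos (convex_Ici a) (hc.add hce) ?_ ?_ <;> rw [interior_Ici] <;> intro x hx
    · exact ((hd x hx).add (he x)).differentiableAt.differentiableWithinAt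
    · have := ((hd x hx).add (he x)).deriv
      rw [show (fun x => g x + K * exp (-x)) = g + fun x => K * exp (-x) from rfl, this]
      linarith [abs_le.1 (hb x hx)]
  have hN : MonotoneOn (fun x => g x - K * exp (-x)) (Ici a) := by
    refine monotoneOn_of_deriv_nonneg (convex_Ici a) (hc.sub hce) ?_ ?_ <;> rw [interior_Ici] <;> intro x hx
    · exact ((hd x hx).sub (he x)).differentiableAt.differentiableWithinAt
    · have := ((hd x hx).sub (he x)).deriv
      rw [show (fun x => g x - K * exp (-x)) = g - fun x => K * exp (-x) from rfl, this]
      linarith [abs_le.1 (hb x hx)]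
  have hK : 0 ≤ K := by
    have := (abs_nonneg _).trans (hb (a+1) (by linarith))
    exact nonneg_of_mul_nonneg_left this (exp_pos _)
  have key : ∀ x ∈ Ici a, ∀ y ∈ Ici a, g x - K * exp (-x) ≤ g y + K * exp (-y) := fun x hx y hy => by
    have h1 := hN hx (mem_Ici.2 (le_max_of_le_left hx) : max x y ∈ Ici a) (le_max_left _ _)
    have h2 := hP hy (mem_Ici.2 (le_max_of_le_left hx) : max x y ∈ Ici a) (le_max_right _ _)
    have : 0 ≤ K * exp (-(max x y)) := by positivity
    simp only at h1 h2; linarith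
  refine ⟨sSup ((fun x => g x - K * exp (-x)) '' Ici a), fun x hx => ?_⟩
  have h1 := le_csSup ⟨_, by rintro _ ⟨y, hy, rfl⟩; exact key y hy a self_mem_Ici⟩
    (mem_image_of_mem (fun x => g x - K * exp (-x)) (mem_Ici.2 hx))
  have h2 : sSup ((fun x => g x - K * exp (-x)) '' Ici a) ≤ g x + K * exp (-x) :=
    csSup_le ⟨_, mem_image_of_mem _ self_mem_Ici⟩ (by rintro _ ⟨y, hy, rfl⟩; exact key y hy x hx)
  rw [abs_le]; constructor <;> linarith

namespace Xi
noncomputable def h (ξ : ℝ → ℝ) (u : ℝ) : ℝ := (2 * ξ (u-1) - ξ u) / u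
noncomputable def w (ξ : ℝ → ℝ) (u : ℝ) : ℝ := 2 * (h ξ (u-1) - h ξ u) / u

variable {ξ : ℝ → ℝ} (H : Xi ξ)
include H

theorem hcont : ContinuousOn (h ξ) (Ici 2) := by
  unfold h
  refine ContinuousOn.div (ContinuousOn.sub (continuousOn_const.mul (H.cont.comp (by fun_prop) ?_))
    (H.cont.mono ?_)) continuousOn_id ?_ <;> intro x hx <;> simp at * <;> linarith

theorem wcont : ContinuousOn (w ξ) (Ici 3) := by
  unfold w
  refine ContinuousOn.div (continuousOn_const.mul (ContinuousOn.sub (H.hcont.comp (by fun_prop) ?_)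
    (H.hcont.mono ?_))) continuousOn_id ?_ <;> intro x hx <;> simp at * <;> linarith

theorem hdd {u : ℝ} (hu : 3 < u) : HasDerivAt (h ξ) (w ξ u) u := by
  have h1 := (H.hd (u := u-1) (by linarith) (by linarith)).comp_sub_const u 1
  have h2 := H.hd (u := u) (by linarith) (by linarith)
  have h3 := ((h1.const_mul 2).sub h2).div (hasDerivAt_id u) (by simp; linarith)
  refine h3.congr_deriv ?_
  have : u ≠ 0 := by linarith
  have : u - 1 ≠ 0 := by linarith
  unfold w h; simp; field_simp; ring

theorem wmv {u : ℝ} (hu : 4 ≤ u) : ∃ s ∈ Ioo (u-1) u, w ξ u = -(2/u) * w ξ s := by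
  obtain ⟨s, hs, e⟩ := exists_hasDerivAt_eq_slope (h ξ) (w ξ) (show u - 1 < u by linarith)
    (H.hcont.mono fun x hx => by simp at *; linarith) (fun x hx => H.hdd (by linarith [hx.1]))
  refine ⟨s, hs, ?_⟩
  rw [e]; unfold w; ring

theorem wdecay' {K : ℝ} (h0 : 0 ≤ K) (hK : ∀ u ∈ Icc (5:ℝ) 6, |w ξ u| * exp u ≤ K) {u : ℝ} (hu : 5 ≤ u) : |w ξ u| * exp u ≤ K := by
  have hg : ContinuousOn (fun u => |w ξ u| * exp u) (Ici 3) := H.wcont.abs.mul (by fun_prop)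
  obtain ⟨x, hx, hm⟩ := (isCompact_Icc (a := (5:ℝ)) (b := u)).exists_isMaxOn ⟨u, hu, le_rfl⟩
    (hg.mono fun x hx => by simp at *; linarith)
  have hm' := hm ⟨hu, le_rfl⟩
  simp only [mem_ofPred] at hm'
  refine hm'.trans ?_
  rcases le_total x 6 with h6 | h6
  · exact hK x ⟨hx.1, h6⟩
  · obtain ⟨s, hs, e⟩ := H.wmv (show 4 ≤ x by linarith)
    have h1 : |w ξ s| * exp s ≤ |w ξ x| * exp x := hm ⟨by linarith [hs.1], hs.2.le.trans hx.2⟩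
    have h2 : |w ξ x| * exp x ≤ (1/3) * exp 1 * (|w ξ s| * exp s) := by
      rw [e, abs_mul, abs_neg, abs_of_pos (by positivity : 0 < 2 / x)]
      have : exp x ≤ exp 1 * exp s := by rw [← exp_add]; apply exp_le_exp.2; linarith [hs.1]
      have h3 : 2 / x ≤ 1/3 := by rw [div_le_iff₀ (by linarith)]; linarith
      calc 2 / x * |w ξ s| * exp x ≤ 1/3 * |w ξ s| * (exp 1 * exp s) := by gcongr
        _ = _ := by ring
    have h4 := exp_one_lt_d9
    have h5 : 0 ≤ |w ξ x| * exp x := by positivity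
    have h7 : 1/3 * exp 1 * (|w ξ s| * exp s) ≤ 0.95 * (|w ξ x| * exp x) := by gcongr; norm_num at h4 ⊢; linarith
    linarith

theorem wdecay : ∃ K, ∀ u, 3 ≤ u → |w ξ u| ≤ K * exp (-u) := by
  have hg : ContinuousOn (fun u => |w ξ u| * exp u) (Ici 3) := H.wcont.abs.mul (by fun_prop)
  obtain ⟨K, hK⟩ := (isCompact_Icc (a := (3:ℝ)) (b := 6)).bddAbove_image (hg.mono Icc_subset_Ici_self)
  have hK' : ∀ u ∈ Icc (3:ℝ) 6, |w ξ u| * exp u ≤ max K 0 := fun u hu => le_max_of_le_left (hK (mem_image_of_mem _ hu))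
  refine ⟨max K 0, fun u hu => ?_⟩
  rw [exp_neg, ← div_eq_mul_inv, le_div_iff₀ (exp_pos _)]
  rcases le_total u 5 with h | h
  · exact hK' u ⟨hu, by linarith⟩
  · exact H.wdecay' (le_max_right _ _) (fun x hx => hK' x ⟨by linarith [hx.1], hx.2⟩) h

theorem asym : ∃ c K, ∀ u, 3 ≤ u → |ξ u - c * (u + 2)| ≤ K * exp (-u) ∧ |h ξ u - c| ≤ K * exp (-u) := by
  obtain ⟨K, hK⟩ := H.wdecay
  obtain ⟨c, hc⟩ := decay_prim (a := 3) (H.hcont.mono fun x hx => by simp at *; linarith)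
    (fun x hx => H.hdd hx) (fun x hx => hK x hx.le)
  obtain ⟨b, hb⟩ := decay_prim (a := 3) (g := fun u => ξ u - c * u) (g' := fun u => h ξ u - c) (K := K)
    ((H.cont.mono fun x hx => by simp at *; linarith).sub (by fun_prop))
    (fun x hx => (H.hd (by linarith) (by linarith)).sub (by simpa using (hasDerivAt_id x).const_mul c))
    (fun x hx => hc x hx.le)
  have hbc : b = 2 * c := by
    have key : ∀ u, 4 ≤ u → |b - 2 * c| ≤ K * (u * exp (-u)) + K * exp (-u) + 2 * K * exp 1 * exp (-u) := by
      intro u hu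
      have h1 := hc u (by linarith)
      have h2 := hb u (by linarith)
      have h3 := hb (u-1) (by linarith)
      have e : u * h ξ u = 2 * ξ (u-1) - ξ u := by unfold h; field_simp
      have e2 : b - 2 * c = u * (h ξ u - c) + (ξ u - c * u - b) - 2 * (ξ (u-1) - c * (u-1) - b) := by linear_combination -e
      rw [show -(u-1) = 1 + -u by ring, exp_add] at h3
      rw [e2]
      refine (abs_sub _ _).trans ?_
      have := abs_add_le (u * (h ξ u - c)) (ξ u - c * u - b)
      rw [abs_mul, abs_of_pos (by linarith : 0 < u)] at this
      rw [abs_mul (2:ℝ), abs_two]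
      nlinarith
    have t1 : Tendsto (fun u : ℝ => exp (-u)) atTop (𝓝 0) := tendsto_exp_neg_atTop_nhds_zero
    have t2 : Tendsto (fun u : ℝ => u * exp (-u)) atTop (𝓝 0) := by
      simpa using tendsto_pow_mul_exp_neg_atTop_nhds_zero 1
    have t3 := ((t2.const_mul K).add (t1.const_mul K)).add (t1.const_mul (2 * K * exp 1))
    simp only [mul_zero, add_zero] at t3
    have := ge_of_tendsto t3 (eventually_atTop.2 ⟨4, key⟩)
    have := abs_nonpos_iff.1 this
    linarith
  refine ⟨c, K, fun u hu => ⟨?_, hc u hu⟩⟩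
  have := hb u hu
  rw [hbc] at this
  convert this using 2; ring

end Xi

theorem log_exp_int : IntegrableOn (fun t : ℝ => log t * exp (-t)) (Ioi 0) := by
  have h1 := integrableOn_rpow_mul_exp_neg_mul_rpow (p := 1) (s := -1/2) (b := 1) (by norm_num) one_pos one_pos
  have h2 := integrableOn_rpow_mul_exp_neg_mul_rpow (p := 1) (s := 1) (b := 1) (by norm_num) one_pos one_pos
  refine ((h1.const_mul 2).add h2).mono' (by fun_prop) ?_
  filter_upwards [ae_restrict_mem measurableSet_Ioi] with t ht
  have ht : 0 < t := ht
  simp only [rpow_one, Pi.add_apply, neg_mul, one_mul]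
  rw [norm_mul, norm_of_nonneg (exp_pos _).le, ← mul_assoc, ← add_mul]
  gcongr
  rw [norm_eq_abs, abs_le]
  have a := log_le_rpow_div (x := t⁻¹) (by positivity) (show (0:ℝ) < 1/2 by norm_num)
  rw [log_inv, inv_rpow ht.le, ← rpow_neg ht.le, show -(1/2:ℝ) = -1/2 by norm_num] at a
  have b := log_le_self ht.le
  have : 0 ≤ t ^ (-1/2:ℝ) := by positivity
  constructor <;> linarith

theorem gamma_int : ∫ t in Ioi (0:ℝ), log t * exp (-t) = -eulerMascheroniConstant := by
  have h1 := Complex.hasDerivAt_GammaIntegral (s := 1) (by simp)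
  have h2 : HasDerivAt Complex.GammaIntegral (-(eulerMascheroniConstant : ℂ)) 1 := by
    refine Complex.hasDerivAt_Gamma_one.congr_of_eventuallyEq ?_
    have : {s : ℂ | 0 < s.re} ∈ 𝓝 (1:ℂ) := (isOpen_lt continuous_const Complex.continuous_re).mem_nhds (by simp)
    filter_upwards [this] with s hs using (Complex.Gamma_eq_integral hs).symm
  have h3 := h1.unique h2
  have h4 : (∫ t in Ioi (0:ℝ), (t:ℂ) ^ ((1:ℂ)-1) * ((log t : ℂ) * (exp (-t) : ℂ))) = ((∫ t in Ioi (0:ℝ), log t * exp (-t) : ℝ) : ℂ) := by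
    rw [← integral_complex_ofReal]; congr 1; ext t; simp
  rw [← Complex.ofReal_inj, ← h4, ]
  simpa using h3

/-- exponential integral -/
noncomputable def E1 (q : ℝ) : ℝ := (∫ t in Ioi q, log t * exp (-t)) - exp (-q) * log q

theorem E1_split {q : ℝ} (hq : 0 < q) : ∫ t in Ioi q, log t * exp (-t) = -eulerMascheroniConstant - ∫ t in (0:ℝ)..q, log t * exp (-t) := by
  rw [← gamma_int, ← Ioc_union_Ioi_eq_Ioi hq.le, setIntegral_union (Ioc_disjoint_Ioi le_rfl) measurableSet_Ioi
    (log_exp_int.mono_set Ioc_subset_Ioi_self) (log_exp_int.mono_set (Ioi_subset_Ioi hq.le)), integral_of_le hq.le]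
  ring

theorem log_exp_ii (q : ℝ) (hq : 0 ≤ q) : IntervalIntegrable (fun t : ℝ => log t * exp (-t)) volume 0 q :=
  (intervalIntegrable_iff_integrableOn_Ioc_of_le hq).2 (log_exp_int.mono_set Ioc_subset_Ioi_self)

theorem E1_deriv {q : ℝ} (hq : 0 < q) : HasDerivAt E1 (-(exp (-q) / q)) q := by
  have h1 : HasDerivAt (fun q => ∫ t in (0:ℝ)..q, log t * exp (-t)) (log q * exp (-q)) q :=
    integral_hasDerivAt_right (log_exp_ii q hq.le) (by
      apply Measurable.stronglyMeasurable _ |>.stronglyMeasurableAtFilter; fun_prop)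
      ((continuousAt_log hq.ne').mul (by fun_prop))
  have h2 := ((hasDerivAt_id q).neg.exp).mul (hasDerivAt_log hq.ne')
  have h3 := (h1.const_sub (-eulerMascheroniConstant)).sub h2
  refine (h3.congr_of_eventuallyEq ?_).congr_deriv ?_
  · filter_upwards [Ioi_mem_nhds hq] with x hx
    simp only [E1, Pi.sub_apply, Pi.mul_apply, id]; rw [E1_split hx]; rfl
  · simp; field_simp; ring

theorem E1_top : Tendsto E1 atTop (𝓝 0) := by
  have h1 : Tendsto (fun q => -eulerMascheroniConstant - ∫ t in (0:ℝ)..q, log t * exp (-t)) atTop (𝓝 0) := by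
    have := intervalIntegral_tendsto_integral_Ioi 0 log_exp_int tendsto_id
    rw [gamma_int] at this
    simpa using this.const_sub (-eulerMascheroniConstant)
  have h2 : Tendsto (fun q : ℝ => exp (-q) * log q) atTop (𝓝 0) := by
    have := tendsto_pow_mul_exp_neg_atTop_nhds_zero 1
    refine squeeze_zero' ?_ ?_ this
    · filter_upwards [eventually_ge_atTop 1] with q hq
      have := log_nonneg hq; positivity
    · filter_upwards [eventually_ge_atTop 1] with q hq
      rw [mul_comm, pow_one]
      gcongr; exact log_le_self (by linarith)
  have := h1.sub h2
  simp only [sub_zero] at this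
  refine this.congr' ?_
  filter_upwards [eventually_gt_atTop 0] with q hq
  rw [E1, E1_split hq]

theorem E1_zero : Tendsto (fun q => E1 q + log q) (𝓝[>] 0) (𝓝 (-eulerMascheroniConstant)) := by
  have h1 : Tendsto (fun q => ∫ t in (0:ℝ)..q, log t * exp (-t)) (𝓝[>] 0) (𝓝 0) := by
    have := (continuousOn_primitive_interval' (log_exp_ii 1 zero_le_one) left_mem_uIcc) 0 left_mem_uIcc
    simp only [ContinuousWithinAt, integral_same, uIcc_of_le zero_le_one] at this
    exact this.mono_left (nhdsWithin_le_iff.2 (Icc_mem_nhdsGT one_pos))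
  have h2 : Tendsto (fun q : ℝ => (1 - exp (-q)) * log q) (𝓝[>] 0) (𝓝 0) := by
    have h3 : Tendsto (fun q : ℝ => log q * q) (𝓝[>] 0) (𝓝 0) := by
      simpa using tendsto_log_mul_rpow_nhdsGT_zero one_pos
    refine squeeze_zero_norm' ?_ (by simpa using h3.neg)
    filter_upwards [Ioc_mem_nhdsGT one_pos] with q hq
    have := add_one_le_exp (-q)
    have h5 : exp (-q) ≤ 1 := by simp; exact hq.1.le
    rw [norm_mul, norm_of_nonneg (by linarith), norm_of_nonpos (log_nonpos hq.1.le hq.2)]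
    nlinarith [log_nonpos hq.1.le hq.2]
  have := (h1.const_sub (-eulerMascheroniConstant)).add h2
  simp only [sub_zero, add_zero] at this
  refine this.congr' ?_
  filter_upwards [self_mem_nhdsWithin] with q hq
  rw [E1, E1_split hq]; ring

theorem pow_exp_int (n : ℕ) {q : ℝ} (hq : 0 < q) : IntegrableOn (fun u : ℝ => u ^ n * exp (-q * u)) (Ioi 0) := by
  have := integrableOn_rpow_mul_exp_neg_mul_rpow (p := 1) (s := n) (b := q) (by linarith [n.cast_nonneg (α := ℝ)]) one_pos hq
  simpa using this

theorem pow_exp_val (n : ℕ) {q : ℝ} (hq : 0 < q) : ∫ u in Ioi (0:ℝ), u ^ n * exp (-q * u) = n.factorial / q ^ (n+1) := by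
  have := integral_rpow_mul_exp_neg_mul_Ioi (a := n+1) (r := q) (by positivity) hq
  rw [Gamma_nat_eq_factorial] at this
  rw [show (n:ℝ)+1 = ((n+1:ℕ):ℝ) by push_cast; rfl, rpow_natCast] at this
  rw [div_eq_inv_mul, ← one_div, ← one_div_pow, ← this]
  congr 1; ext u; simp

theorem grow_int {g : ℝ → ℝ} (hg : Measurable g) {K q : ℝ} (hK : ∀ u, 0 < u → |g u| ≤ K * (1 + u)^2) (hq : 0 < q) :
    IntegrableOn (fun u : ℝ => g u * exp (-q * u)) (Ioi 0) := by
  have := (((pow_exp_int 0 hq).add ((pow_exp_int 1 hq).const_mul 2)).add (pow_exp_int 2 hq)).const_mul K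
  refine this.mono' (by fun_prop) ?_
  filter_upwards [ae_restrict_mem measurableSet_Ioi] with u hu
  rw [norm_mul, norm_of_nonneg (exp_pos _).le, norm_eq_abs]
  refine (mul_le_mul_of_nonneg_right (hK u hu) (exp_pos _).le).trans (le_of_eq ?_)
  simp only [Pi.add_apply]; ring

namespace Xi
variable {ξ : ℝ → ℝ} (H : Xi ξ)
include H

theorem asym' : ∃ c K, (∀ u, 0 ≤ u → |ξ u - c * (u + 2)| ≤ K * exp (-u)) ∧ (∀ u, 2 ≤ u → |h ξ u - c| ≤ K * exp (-u)) := by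
  obtain ⟨c, K, hK⟩ := H.asym
  obtain ⟨A, hA⟩ := (isCompact_Icc (a := (1:ℝ)) (b := 3)).exists_bound_of_continuousOn (H.cont.mono Icc_subset_Ici_self)
  obtain ⟨B, hB⟩ := (isCompact_Icc (a := (2:ℝ)) (b := 3)).exists_bound_of_continuousOn (H.hcont.mono Icc_subset_Ici_self)
  have hA' : ∀ u ≤ 3, |ξ u| ≤ max A 0 := fun u hu => by
    by_cases h : u < 1
    · rw [H.h0 u h]; simp
    · exact le_max_of_le_left (hA u ⟨not_lt.1 h, hu⟩)
  have aux : ∀ D u : ℝ, 0 ≤ D → u ≤ 3 → D ≤ D * exp 3 * exp (-u) := fun D u hD hu => by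
    rw [mul_assoc, ← exp_add]
    exact le_mul_of_one_le_right hD (one_le_exp (by linarith))
  refine ⟨c, max K (max ((max A 0 + 5 * |c|) * exp 3) ((max B 0 + |c|) * exp 3)), fun u hu => ?_, fun u hu => ?_⟩
  · rcases le_total u 3 with h | h
    · have h2 := aux (max A 0 + 5 * |c|) u (by positivity) h
      have h4 : |c| * |u+2| ≤ |c| * 5 := by gcongr; rw [abs_of_nonneg (by linarith)]; linarith
      refine (abs_sub _ _).trans ?_
      rw [abs_mul]
      refine le_trans (by linarith [hA' u h]) (h2.trans ?_)
      gcongr; simp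
    · exact ((hK u h).1).trans (by gcongr; simp)
  · rcases le_total u 3 with h | h
    · have h2 := aux (max B 0 + |c|) u (by positivity) h
      refine (abs_sub _ _).trans ?_
      have := hB u ⟨hu, h⟩
      rw [norm_eq_abs] at this
      refine le_trans (by linarith [le_max_left B 0]) (h2.trans ?_)
      gcongr; simp
    · exact ((hK u h).2).trans (by gcongr; simp)

theorem grow : ∃ K, 0 ≤ K ∧ ∀ u, 0 ≤ u → |ξ u| ≤ K * (1 + u) := by
  obtain ⟨c, K, hK, -⟩ := H.asym'
  have hK0 : 0 ≤ K := by simpa using (abs_nonneg _).trans (hK 0 le_rfl)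
  refine ⟨2 * |c| + K, by positivity, fun u hu => ?_⟩
  have h1 := hK u hu
  have h2 : K * exp (-u) ≤ K * 1 := by gcongr; simpa using hu
  have h3 := abs_add_le (ξ u - c * (u+2)) (c * (u+2))
  rw [abs_mul c, abs_of_pos (by linarith : 0 < u + 2)] at h3
  simp only [sub_add_cancel] at h3
  nlinarith [abs_nonneg c, mul_nonneg (abs_nonneg c) hu, mul_nonneg hK0 hu]

theorem lap_deriv {q : ℝ} (hq : 0 < q) : IntegrableOn (fun u => u * ξ u * exp (-q * u)) (Ioi 0) ∧
    HasDerivAt (fun q => ∫ u in Ioi (0:ℝ), ξ u * exp (-q * u)) (-∫ u in Ioi (0:ℝ), u * ξ u * exp (-q * u)) q := by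
  obtain ⟨K, hK0, hK⟩ := H.grow
  have m := H.meas
  have b1 : ∀ u, 0 < u → |u * ξ u| ≤ K * (1 + u)^2 := fun u hu => by
    rw [abs_mul, abs_of_pos hu]; nlinarith [hK u hu.le, mul_nonneg hK0 hu.le]
  have b0 : ∀ u, 0 < u → |ξ u| ≤ K * (1 + u)^2 := fun u hu => by
    nlinarith [hK u hu.le, mul_nonneg hK0 hu.le, mul_nonneg (mul_nonneg hK0 hu.le) hu.le]
  have := hasDerivAt_integral_of_dominated_loc_of_deriv_le (μ := volume.restrict (Ioi (0:ℝ)))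
    (F := fun q u => ξ u * exp (-q * u)) (F' := fun q u => -(u * ξ u * exp (-q * u))) (x₀ := q)
    (s := Ioi (q/2)) (bound := fun u => |u * ξ u| * exp (-(q/2) * u)) (Ioi_mem_nhds (by linarith))
    (Eventually.of_forall fun x => (by fun_prop)) (grow_int m b0 hq) (by fun_prop) ?_ ?_ ?_
  · refine ⟨grow_int (by fun_prop) b1 hq, ?_⟩
    rw [← MeasureTheory.integral_neg]; exact this.2
  · filter_upwards [ae_restrict_mem measurableSet_Ioi] with u hu x hx
    rw [norm_neg, norm_mul, norm_of_nonneg (exp_pos _).le, norm_eq_abs]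
    gcongr; exact (mem_Ioi.1 hu).le; exact (mem_Ioi.1 hx).le
  · exact grow_int (by fun_prop) (fun u hu => by rw [abs_abs]; exact b1 u hu) (by linarith)
  · filter_upwards with u x hx
    have := (((hasDerivAt_id x).neg.mul_const u).exp).const_mul (ξ u)
    refine this.congr_deriv ?_
    simp; ring

theorem lap_ode {q : ℝ} (hq : 0 < q) : q * ∫ u in Ioi (0:ℝ), u * ξ u * exp (-q * u) =
    2 * exp (-q) * (1 + ∫ u in Ioi (0:ℝ), ξ u * exp (-q * u)) := by
  obtain ⟨K, hK0, hK⟩ := H.grow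
  have m := H.meas
  have i1 := (H.lap_deriv hq).1
  have b0 : ∀ u, 0 < u → |ξ u| ≤ K * (1 + u)^2 := fun u hu => by
    nlinarith [hK u hu.le, mul_nonneg hK0 hu.le, mul_nonneg (mul_nonneg hK0 hu.le) hu.le]
  have i0 := grow_int m b0 hq
  have e3 : ∫ u in Ioi (2:ℝ), 2 * ξ (u-1) * exp (-q * u) = 2 * exp (-q) * ∫ u in Ioi (0:ℝ), ξ u * exp (-q * u) := by
    rw [← MeasureTheory.integral_const_mul]
    rw [← MeasureTheory.integral_indicator measurableSet_Ioi, ← MeasureTheory.integral_indicator measurableSet_Ioi,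
      ← integral_sub_right_eq_self ((Ioi (0:ℝ)).indicator _) (1:ℝ)]
    refine MeasureTheory.integral_congr_ae ?_
    have : ∀ᵐ x : ℝ, x ≠ 2 := by simp [ae_iff, measure_singleton]
    filter_upwards [this] with x hx
    by_cases h2 : 2 < x
    · rw [indicator_of_mem (mem_Ioi.2 h2), indicator_of_mem (by rw [mem_Ioi]; linarith)]
      rw [show -q * x = -q + -q * (x-1) by ring, exp_add]; ring
    · rw [indicator_of_notMem (by simpa using h2)]
      by_cases h1 : 1 < x
      · rw [indicator_of_mem (by rw [mem_Ioi]; linarith), H.h0 _ (by linarith [lt_of_le_of_ne (not_lt.1 h2) hx])]; simp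
      · rw [indicator_of_notMem (by simpa using h1)]
  have i3 : IntegrableOn (fun u => 2 * ξ (u-1) * exp (-q * u)) (Ioi 2) := by
    refine (grow_int (K := 2 * K) (g := fun u => 2 * ξ (u-1)) (by fun_prop) ?_ hq).mono_set (Ioi_subset_Ioi (by norm_num))
    intro u hu
    by_cases h1 : u < 1
    · rw [H.h0 _ (by linarith)]; simp; positivity
    · have := hK (u-1) (by linarith)
      rw [abs_mul, abs_two]; nlinarith [mul_nonneg hK0 hu.le, mul_nonneg (mul_nonneg hK0 hu.le) hu.le]
  have e1 : ∫ u in Ioi (2:ℝ), (2 * ξ (u-1) * exp (-q * u) - q * (u * ξ u * exp (-q * u))) = 0 - 2 * exp (-q * 2) := by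
    have h2 : (2:ℝ) * ξ 2 = 2 := by rw [H.v12 (by norm_num) le_rfl]; norm_num
    have := integral_Ioi_of_hasDerivAt_of_tendsto (a := 2) (f := fun u => u * ξ u * exp (-q * u)) ?_ ?_ (i3.sub
      ((i1.mono_set (Ioi_subset_Ioi (by norm_num))).const_mul q)) (m := 0) ?_
    · rw [h2] at this; exact this
    · exact ((continuousAt_id.mul (H.contAt (by norm_num))).mul (by fun_prop)).continuousWithinAt
    · intro u hu
      have hu : 2 < u := hu
      have := ((hasDerivAt_id u).mul (H.hd (by linarith) (by linarith))).mul (((hasDerivAt_id u).const_mul (-q)).exp)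
      refine this.congr_deriv ?_
      have : u ≠ 0 := by linarith
      simp; field_simp; ring
    · have t : ∀ n : ℕ, Tendsto (fun u : ℝ => u ^ n * exp (-q * u)) atTop (𝓝 0) := fun n => by
        simpa using tendsto_rpow_mul_exp_neg_mul_atTop_nhds_zero n q hq
      have := ((t 1).const_mul K).add ((t 2).const_mul K)
      simp only [mul_zero, add_zero] at this
      refine squeeze_zero_norm' ?_ this
      filter_upwards [eventually_gt_atTop 0] with u hu
      rw [norm_mul, norm_of_nonneg (exp_pos _).le, norm_mul, norm_of_nonneg hu.le, norm_eq_abs]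
      have := mul_le_mul_of_nonneg_right (mul_le_mul_of_nonneg_left (hK u hu.le) hu.le) (exp_pos (-q*u)).le
      linarith
  rw [integral_sub i3 ((i1.mono_set (Ioi_subset_Ioi (by norm_num))).const_mul q), e3, MeasureTheory.integral_const_mul] at e1
  have e4 : ∫ u in Ioi (0:ℝ), u * ξ u * exp (-q * u) = (∫ u in (0:ℝ)..2, u * ξ u * exp (-q * u)) + ∫ u in Ioi (2:ℝ), u * ξ u * exp (-q * u) := by
    rw [← Ioc_union_Ioi_eq_Ioi (zero_le_two (α := ℝ)), setIntegral_union (Ioc_disjoint_Ioi le_rfl) measurableSet_Ioi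
      (i1.mono_set Ioc_subset_Ioi_self) (i1.mono_set (Ioi_subset_Ioi zero_le_two)), integral_of_le zero_le_two]
  have ii : ∀ a b : ℝ, 0 ≤ a → a ≤ b → IntervalIntegrable (fun u => u * ξ u * exp (-q * u)) volume a b := fun a b h0 h =>
    (intervalIntegrable_iff_integrableOn_Ioc_of_le h).2 (i1.mono_set (Ioc_subset_Ioi_self.trans (Ioi_subset_Ioi h0)))
  have e5 : ∫ u in (0:ℝ)..2, u * ξ u * exp (-q * u) = 2 * (exp (-q) - exp (-q * 2)) / q := by
    rw [← integral_add_adjacent_intervals (ii 0 1 le_rfl zero_le_one) (ii 1 2 zero_le_one one_le_two)]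
    have z1 : ∫ u in (0:ℝ)..1, u * ξ u * exp (-q * u) = 0 := by
      rw [intervalIntegral.integral_congr_ae (g := fun _ => (0:ℝ))]
      · simp
      have : ∀ᵐ x : ℝ, x ≠ 1 := by simp [ae_iff, measure_singleton]
      filter_upwards [this] with x hx1 hx
      rw [uIoc_of_le zero_le_one] at hx
      rw [H.h0 x (lt_of_le_of_ne hx.2 hx1)]; simp
    have z2 : ∫ u in (1:ℝ)..2, u * ξ u * exp (-q * u) = ∫ u in (1:ℝ)..2, 2 * exp (-q * u) := by
      refine integral_congr fun u hu => ?_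
      rw [uIcc_of_le one_le_two] at hu
      have : u ≠ 0 := by linarith [hu.1]
      rw [H.v12 hu.1 hu.2]; field_simp
    rw [z1, z2, zero_add, intervalIntegral.integral_const_mul, integral_comp_mul_left (fun x => exp x) (by linarith : -q ≠ 0), integral_exp]
    simp; field_simp; ring
  rw [e4, mul_add, e5, mul_div_cancel₀ _ hq.ne']
  linarith

theorem c_eq {c K : ℝ} (hK : ∀ u, 0 ≤ u → |ξ u - c * (u + 2)| ≤ K * exp (-u)) :
    c = exp (-2 * eulerMascheroniConstant) := by
  have m := H.meas
  set X := fun q : ℝ => ∫ u in Ioi (0:ℝ), ξ u * exp (-q * u) with hX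
  have hX' : ∀ q, 0 < q → HasDerivAt X (-(2 * exp (-q) / q * (1 + X q))) q := fun q hq => by
    refine (H.lap_deriv hq).2.congr_deriv ?_
    have := H.lap_ode hq
    rw [neg_inj, ← mul_left_cancel_iff_of_pos hq, this, ← mul_assoc, mul_div_cancel₀ _ hq.ne']
  set G := fun q => (1 + X q) * exp (-2 * E1 q) with hG
  have hG' : ∀ q, 0 < q → HasDerivAt G 0 q := fun q hq => by
    have := ((hX' q hq).const_add 1).mul (((E1_deriv hq).const_mul (-2)).exp)
    refine this.congr_deriv ?_
    field_simp; ring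
  have hXb : ∀ q, 0 < q → |X q - c * (1 / q^2 + 2 / q)| ≤ K / (1 + q) := fun q hq => by
    have i1 : IntegrableOn (fun u : ℝ => c * (u^1 * exp (-q * u) + 2 * (u^0 * exp (-q * u)))) (Ioi 0) :=
      ((pow_exp_int 1 hq).add ((pow_exp_int 0 hq).const_mul 2)).const_mul c
    have i2 := pow_exp_int 0 (q := 1 + q) (by linarith)
    have i3 : IntegrableOn (fun u => (ξ u - c * (u+2)) * exp (-q * u)) (Ioi 0) := by
      refine grow_int (K := |K|) (by fun_prop) (fun u hu => ?_) hq
      refine (hK u hu.le).trans (mul_le_mul (le_abs_self K) ?_ (exp_pos _).le (abs_nonneg K))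
      refine (exp_le_one_iff.2 (by linarith)).trans ?_
      nlinarith
    have e : X q - c * (1/q^2 + 2/q) = ∫ u in Ioi (0:ℝ), (ξ u - c * (u+2)) * exp (-q * u) := by
      have v1 := pow_exp_val 1 hq
      have v0 := pow_exp_val 0 hq
      have : X q = ∫ u in Ioi (0:ℝ), ((ξ u - c * (u+2)) * exp (-q * u) + c * (u^1 * exp (-q * u) + 2 * (u^0 * exp (-q * u)))) := by
        simp only [hX]; congr 1; ext u; ring
      rw [this, integral_add i3 i1, MeasureTheory.integral_const_mul, integral_add (pow_exp_int 1 hq) ((pow_exp_int 0 hq).const_mul 2), MeasureTheory.integral_const_mul, v1, v0]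
      simp; ring
    have v2 := pow_exp_val 0 (q := 1 + q) (by linarith)
    rw [e]
    refine (MeasureTheory.norm_integral_le_of_norm_le (f := fun u => (ξ u - c * (u+2)) * exp (-q * u)) (g := fun u : ℝ => K * (u^0 * exp (-(1+q) * u))) (i2.const_mul K) ?_).trans (le_of_eq ?_)
    · filter_upwards [ae_restrict_mem measurableSet_Ioi] with u hu
      rw [norm_mul, norm_of_nonneg (exp_pos _).le, norm_eq_abs]
      refine (mul_le_mul_of_nonneg_right (hK u (le_of_lt hu)) (exp_pos _).le).trans (le_of_eq ?_)
      rw [mul_assoc, ← exp_add, pow_zero, one_mul]; ring_nf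
    · rw [MeasureTheory.integral_const_mul, v2]; simp; ring
  have hconst : ∀ q, 0 < q → G q = G 1 := fun q hq =>
    (convex_Ioi (0:ℝ)).is_const_of_fderivWithin_eq_zero (𝕜 := ℝ)
      (fun x hx => (hG' x hx).differentiableAt.differentiableWithinAt)
      (fun x hx => by
        rw [((hG' x hx).hasFDerivAt.hasFDerivWithinAt).fderivWithin (isOpen_Ioi.uniqueDiffWithinAt hx)]; ext; simp) hq (mem_Ioi.2 one_pos)
  have t1 : Tendsto G atTop (𝓝 1) := by
    have hX0 : Tendsto X atTop (𝓝 0) := by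
      have a1 : Tendsto (fun q : ℝ => K / (1 + q)) atTop (𝓝 0) :=
        tendsto_const_nhds.div_atTop (tendsto_atTop_add_const_left _ _ tendsto_id)
      have a2 : Tendsto (fun q => X q - c * (1 / q^2 + 2 / q)) atTop (𝓝 0) := by
        refine squeeze_zero_norm' ?_ a1
        filter_upwards [eventually_gt_atTop 0] with q hq using hXb q hq
      have a3 : Tendsto (fun q : ℝ => c * (1 / q^2 + 2 / q)) atTop (𝓝 (c * (0 + 0))) :=
        ((tendsto_const_nhds.div_atTop (tendsto_pow_atTop two_ne_zero)).add (tendsto_const_nhds.div_atTop tendsto_id)).const_mul c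
      have := a2.add a3
      simpa using this
    have := (hX0.const_add 1).mul ((continuous_exp.tendsto _).comp (E1_top.const_mul (-2)))
    simpa [hG, Function.comp_def] using this
  have hG1 : G 1 = 1 := by
    refine tendsto_nhds_unique (tendsto_const_nhds.congr' ?_) t1
    filter_upwards [eventually_gt_atTop 0] with q hq using (hconst q hq).symm
  have t2 : Tendsto (fun q => q^2 * (1 + X q) * exp (-2 * (E1 q + log q))) (𝓝[>] 0) (𝓝 (c * exp (-2 * -eulerMascheroniConstant))) := by
    have p' : ∀ (f : ℝ → ℝ) (a : ℝ), Continuous f → f 0 = a → Tendsto f (𝓝[>] 0) (𝓝 a) := fun f a hf ha => ha ▸ hf.continuousAt.tendsto.mono_left nhdsWithin_le_nhds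
    have a2 : Tendsto (fun q => q^2 * (X q - c * (1 / q^2 + 2 / q))) (𝓝[>] 0) (𝓝 0) := by
      refine squeeze_zero_norm' ?_ (p' (fun q : ℝ => q^2 * |K|) 0 (by fun_prop) (by norm_num))
      filter_upwards [self_mem_nhdsWithin] with q hq
      have hq : 0 < q := hq
      rw [norm_mul, norm_of_nonneg (by positivity)]
      refine mul_le_mul_of_nonneg_left ((hXb q hq).trans ?_) (by positivity)
      rw [div_le_iff₀ (by linarith)]
      nlinarith [le_abs_self K, abs_nonneg K]
    have a3 : Tendsto (fun q : ℝ => q^2 + c * (1 + 2 * q)) (𝓝[>] 0) (𝓝 c) := by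
      exact p' (fun q : ℝ => q^2 + c * (1 + 2 * q)) c (by fun_prop) (by norm_num)
    have a4 := (a2.add a3).mul ((continuous_exp.tendsto _).comp (E1_zero.const_mul (-2)))
    rw [zero_add] at a4
    refine a4.congr' ?_
    filter_upwards [self_mem_nhdsWithin] with q hq
    have hq : 0 < q := hq
    simp only [Function.comp]
    congr 1; field_simp; ring
  have t3 := tendsto_nhds_unique t2 ((tendsto_const_nhds (x := (1:ℝ))).congr' ?_)
  · rw [← mul_left_inj' (exp_ne_zero (-2 * -eulerMascheroniConstant)), t3, ← exp_add]; simp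
  · filter_upwards [self_mem_nhdsWithin] with q hq
    have hq : 0 < q := hq
    have h7 : (1 + X q) * exp (-2 * E1 q) = 1 := (hconst q hq).trans hG1
    rw [mul_add (-2), exp_add, show -2 * log q = log (q^2)⁻¹ by rw [log_inv, log_pow]; push_cast; ring, exp_log (by positivity)]
    calc (1:ℝ) = (1 + X q) * exp (-2 * E1 q) := h7.symm
      _ = _ := by field_simp
end Xi

noncomputable def cc : ℝ := exp (-2 * eulerMascheroniConstant)

set_option maxRecDepth 100000 in
theorem harm1 : (8.20159:ℚ) ≤ harmonic 2047 := by decide +kernel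
set_option maxRecDepth 100000 in
theorem harm2 : harmonic 2048 ≤ (8.20208:ℚ) := by decide +kernel

theorem cc_bd : 0.315 ≤ cc ∧ cc ≤ 0.3154 := by
  obtain ⟨p, hp⟩ : ∃ p : ℚ, p = harmonic 2047 := ⟨_, rfl⟩
  obtain ⟨r, hr⟩ : ∃ p : ℚ, p = harmonic 2048 := ⟨_, rfl⟩
  have h1 := hp ▸ harm1
  have h2 := hr ▸ harm2
  have a1 := eulerMascheroniSeq_lt_eulerMascheroniConstant 2047
  have a2 := eulerMascheroniConstant_lt_eulerMascheroniSeq' 2048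
  have e : log 2048 = 11 * log 2 := by rw [show (2048:ℝ) = 2^11 by norm_num, log_pow]; norm_num
  rw [eulerMascheroniSeq, ← hp, show ((2047:ℕ):ℝ) + 1 = 2048 by norm_num, e] at a1
  rw [eulerMascheroniSeq', if_neg (by norm_num), ← hr, show ((2048:ℕ):ℝ) = 2048 by norm_num, e] at a2
  clear hp hr
  have h1' : ((8.20159:ℚ):ℝ) ≤ (p : ℝ) := by exact_mod_cast h1
  have h2' : (r:ℝ) ≤ ((8.20208:ℚ):ℝ) := by exact_mod_cast h2
  norm_num at h1' h2'
  have l1 := log_two_gt_d9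
  have l2 := log_two_lt_d9
  have g1 : eulerMascheroniConstant > 0.57697 := by norm_num at *; linarith
  have g2 : eulerMascheroniConstant < 0.57747 := by norm_num at *; linarith
  have b1 := exp_one_gt_d9
  have b2 := exp_one_lt_d9
  have t1 := Real.exp_bound' (x := 0.15394) (by norm_num) (by norm_num) (n := 4) (by norm_num)
  have t2 := Real.sum_le_exp_of_nonneg (x := 0.15394) (by norm_num) 4
  have t3 := Real.exp_bound' (x := 0.15494) (by norm_num) (by norm_num) (n := 4) (by norm_num)
  norm_num [Finset.sum_range_succ, Nat.factorial] at t1 t2 t3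
  have e1 : exp 1.15394 = exp 1 * exp 0.15394 := by rw [← exp_add]; norm_num
  have e2 : exp 1.15494 = exp 1 * exp 0.15494 := by rw [← exp_add]; norm_num
  unfold cc
  rw [show -2 * eulerMascheroniConstant = -(2 * eulerMascheroniConstant) by ring, exp_neg]
  have k1 : exp 1.15394 ≤ exp (2 * eulerMascheroniConstant) := exp_le_exp.2 (by norm_num at *; linarith)
  have k2 : exp (2 * eulerMascheroniConstant) ≤ exp 1.15494 := exp_le_exp.2 (by norm_num at *; linarith)
  norm_num at b1 b2
  norm_num at t1 t2 t3
  constructor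
  · rw [le_inv_comm₀ (by norm_num) (exp_pos _)]; refine k2.trans ?_; rw [e2]; norm_num at *; nlinarith
  · rw [inv_le_comm₀ (exp_pos _) (by norm_num)]; refine le_trans ?_ k1; rw [e1]; norm_num at *; nlinarith

theorem lin_bd {g : ℝ → ℝ} {a b : ℝ} (p r : ℝ) (hab : a ≤ b) (hg : IntervalIntegrable g volume a b)
    (h : ∀ x ∈ Icc a b, g x ≤ p + r * (x - a)) : ∫ x in a..b, g x ≤ p * (b - a) + r * (b - a)^2/2 := by
  refine (integral_mono_on hab hg (Continuous.intervalIntegrable (by fun_prop) _ _) h).trans (le_of_eq ?_)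
  rw [intervalIntegral.integral_add (by simp) (Continuous.intervalIntegrable (by fun_prop) _ _), intervalIntegral.integral_const_mul,
    intervalIntegral.integral_sub (by simp) (by simp)]
  simp; ring

theorem logs : (1.0985 ≤ log 3 ∧ log 3 ≤ 1.0990) ∧ (1.6093 ≤ log 5 ∧ log 5 ≤ 1.6096) ∧ (1.9452 ≤ log 7 ∧ log 7 ≤ 1.9461) ∧ (2.3975 ≤ log 11 ∧ log 11 ≤ 2.3985) := by
  have l1 := log_two_gt_d9
  have l2 := log_two_lt_d9
  have key : ∀ (x y : ℝ), 0 < x → 0 < y → log x - log y ≤ x / y - 1 := fun x y hx hy => by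
    rw [← log_div hx.ne' hy.ne']; exact log_le_sub_one_of_pos (by positivity)
  have a1 := key 243 256 (by norm_num) (by norm_num)
  have a2 := key 256 243 (by norm_num) (by norm_num)
  have a3 := key 125 128 (by norm_num) (by norm_num)
  have a4 := key 128 125 (by norm_num) (by norm_num)
  have a5 := key 2401 2400 (by norm_num) (by norm_num)
  have a6 := key 2400 2401 (by norm_num) (by norm_num)
  have a7 := key 121 120 (by norm_num) (by norm_num)
  have a8 := key 120 121 (by norm_num) (by norm_num)
  have a9 := key 80 81 (by norm_num) (by norm_num)
  have a10 := key 81 80 (by norm_num) (by norm_num)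
  have e1 : log 243 = 5 * log 3 := by rw [show (243:ℝ) = 3^5 by norm_num, log_pow]; norm_num
  have e2 : log 256 = 8 * log 2 := by rw [show (256:ℝ) = 2^8 by norm_num, log_pow]; norm_num
  have e3 : log 125 = 3 * log 5 := by rw [show (125:ℝ) = 5^3 by norm_num, log_pow]; norm_num
  have e4 : log 128 = 7 * log 2 := by rw [show (128:ℝ) = 2^7 by norm_num, log_pow]; norm_num
  have e5 : log 2401 = 4 * log 7 := by rw [show (2401:ℝ) = 7^4 by norm_num, log_pow]; norm_num
  have e6 : log 2400 = 5 * log 2 + log 3 + 2 * log 5 := by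
    rw [show (2400:ℝ) = 2^5 * 3 * 5^2 by norm_num, log_mul (by norm_num) (by norm_num), log_mul (by norm_num) (by norm_num), log_pow, log_pow]; norm_num
  have e7 : log 121 = 2 * log 11 := by rw [show (121:ℝ) = 11^2 by norm_num, log_pow]; norm_num
  have e8 : log 120 = 3 * log 2 + log 3 + log 5 := by
    rw [show (120:ℝ) = 2^3 * 3 * 5 by norm_num, log_mul (by norm_num) (by norm_num), log_mul (by norm_num) (by norm_num), log_pow]; norm_num
  have e9 : log 80 = 4 * log 2 + log 5 := by
    rw [show (80:ℝ) = 2^4 * 5 by norm_num, log_mul (by norm_num) (by norm_num), log_pow]; norm_num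
  have e10 : log 81 = 4 * log 3 := by rw [show (81:ℝ) = 3^4 by norm_num, log_pow]; norm_num
  rw [e1, e2] at a1 a2
  rw [e3, e4] at a3 a4
  rw [e5, e6] at a5 a6
  rw [e7, e8] at a7 a8
  rw [e9, e10] at a9 a10
  norm_num at *
  refine ⟨⟨?_, ?_⟩, ⟨?_, ?_⟩, ⟨?_, ?_⟩, ⟨?_, ?_⟩⟩ <;> linarith

theorem logchord {a b t : ℝ} (ha : 0 < a) (hab : a < b) (h1 : a ≤ t) (h2 : t ≤ b) :
    log a + (log b - log a) / (b - a) * (t - a) ≤ log t := by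
  have hp : 0 < b - a := by linarith
  have := strictConcaveOn_log_Ioi.concaveOn.2 (show a ∈ Ioi (0:ℝ) from ha) (show b ∈ Ioi (0:ℝ) from ha.trans hab)
    (show 0 ≤ (b - t)/(b-a) by apply div_nonneg <;> linarith) (show 0 ≤ (t-a)/(b-a) by apply div_nonneg <;> linarith) (by field_simp; ring)
  simp only [smul_eq_mul] at this
  rw [show (b - t)/(b-a) * a + (t-a)/(b-a) * b = t by field_simp; ring] at this
  refine le_trans (le_of_eq ?_) this
  field_simp; ring

theorem logtan {b t : ℝ} (hb : 0 < b) (ht : 0 < t) : log t ≤ log b + (t - b) / b := by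
  have := log_le_sub_one_of_pos (show 0 < t / b by positivity)
  rw [log_div ht.ne' hb.ne'] at this
  have : (t - b)/b = t / b - 1 := by field_simp
  linarith

noncomputable def qq (x : ℝ) : ℝ := 2 - 8 * cc - 6 * cc * x - cc * x^2 + 4 * log (1 + x)

theorem qq1 {x : ℝ} (h0 : 0 ≤ x) (h1 : x ≤ 0.2) : -(0.5232 - 1.681 * x) ≤ qq x ∧ qq x ≤ -0.179 - 1.3 * (0.2 - x) := by
  obtain ⟨⟨a1, a2⟩, ⟨a3, a4⟩, -, -⟩ := logs
  obtain ⟨c1, c2⟩ := cc_bd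
  have l1 := log_two_gt_d9
  have l2 := log_two_lt_d9
  have e : log 1.2 = log 2 + log 3 - log 5 := by rw [← log_mul (by norm_num) (by norm_num), ← log_div (by norm_num) (by norm_num)]; norm_num
  have t1 := logchord (a := 1) (b := 1.2) (t := 1 + x) one_pos (by norm_num) (by linarith) (by linarith)
  have t2 := logtan (b := 1.2) (t := 1 + x) (by norm_num) (by linarith)
  rw [log_one, e] at t1
  rw [e] at t2
  unfold qq
  norm_num at *
  constructor
  · nlinarith
  · nlinarith

theorem qq2 {x : ℝ} (h0 : 0.2 ≤ x) (h1 : x ≤ 0.4) : -(0.187 - 0.935 * (x - 0.2)) ≤ qq x ∧ qq x ≤ 0.021 := by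
  obtain ⟨⟨a1, a2⟩, ⟨a3, a4⟩, ⟨a5, a6⟩, -⟩ := logs
  obtain ⟨c1, c2⟩ := cc_bd
  have l1 := log_two_gt_d9
  have l2 := log_two_lt_d9
  have e : log 1.2 = log 2 + log 3 - log 5 := by rw [← log_mul (by norm_num) (by norm_num), ← log_div (by norm_num) (by norm_num)]; norm_num
  have e2 : log 1.4 = log 7 - log 5 := by rw [← log_div (by norm_num) (by norm_num)]; norm_num
  have t1 := logchord (a := 1.2) (b := 1.4) (t := 1 + x) (by norm_num) (by norm_num) (by linarith) (by linarith)
  have t2 := logtan (b := 1.4) (t := 1 + x) (by norm_num) (by linarith)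
  rw [e, e2] at t1
  rw [e2] at t2
  unfold qq
  norm_num at *
  constructor
  · nlinarith
  · nlinarith

theorem qq3 {x : ℝ} (h0 : 0.4 ≤ x) (h1 : x ≤ 1) : 0 ≤ qq x ∧ qq x ≤ 0.131 := by
  obtain ⟨⟨a1, a2⟩, ⟨a3, a4⟩, ⟨a5, a6⟩, -⟩ := logs
  obtain ⟨c1, c2⟩ := cc_bd
  have l1 := log_two_gt_d9
  have l2 := log_two_lt_d9
  have e : log (5/3) = log 5 - log 3 := by rw [← log_div (by norm_num) (by norm_num)]
  have e2 : log 1.4 = log 7 - log 5 := by rw [← log_div (by norm_num) (by norm_num)]; norm_num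
  have t1 := logchord (a := 1.4) (b := 2) (t := 1 + x) (by norm_num) (by norm_num) (by linarith) (by linarith)
  have t2 := logtan (b := 5/3) (t := 1 + x) (by norm_num) (by linarith)
  rw [e2] at t1
  rw [e] at t2
  unfold qq
  norm_num at *
  constructor
  · nlinarith
  · nlinarith [sq_nonneg (x - 0.81), mul_nonneg (sub_nonneg.2 c1) (by positivity : 0 ≤ 8 + 6 * x + x^2)]

theorem qq_one : 0.0415 ≤ qq 1 ∧ qq 1 ≤ 0.0477 := by
  obtain ⟨c1, c2⟩ := cc_bd
  have l1 := log_two_gt_d9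
  have l2 := log_two_lt_d9
  unfold qq; norm_num at *; constructor <;> linarith

namespace Xi
noncomputable def rho (ξ : ℝ → ℝ) (v : ℝ) : ℝ := ξ v - cc * (v + 2)
variable {ξ : ℝ → ℝ} (H : Xi ξ)
include H

theorem rho_bd : ∃ K, 0 ≤ K ∧ (∀ v, 0 ≤ v → |rho ξ v| ≤ K * exp (-v)) ∧ ∀ v, 2 ≤ v → |h ξ v - cc| ≤ K * exp (-v) := by
  obtain ⟨c, K, h1, h2⟩ := H.asym'
  have := H.c_eq h1
  subst this
  exact ⟨K, by have := (abs_nonneg _).trans (h1 0 le_rfl); simpa using this, h1, h2⟩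

theorem rho_meas : Measurable (rho ξ) := H.meas.sub (by fun_prop)

theorem rint {g : ℝ → ℝ} (hg : Measurable g) {M : ℝ} (hM : ∀ v, 0 < v → |g v| ≤ M) :
    IntegrableOn (fun v => rho ξ v * g v) (Ioi 0) := by
  obtain ⟨K, K0, hK, -⟩ := H.rho_bd
  refine Integrable.mono' (g := fun v => K * M * exp (-v)) (Integrable.const_mul (by simpa [IntegrableOn] using exp_neg_integrableOn_Ioi 0 one_pos) _) (H.rho_meas.mul hg).aestronglyMeasurable ?_
  refine (ae_restrict_iff' measurableSet_Ioi).2 (ae_of_all _ fun v hv => ?_)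
  rw [norm_mul, norm_eq_abs, norm_eq_abs]
  have hv : 0 < v := hv
  nlinarith [mul_le_mul (hK v hv.le) (hM v hv) (abs_nonneg _) ((abs_nonneg _).trans (hK v hv.le))]

theorem rho_ii (a b : ℝ) : IntervalIntegrable (rho ξ) volume a b := (H.ii a b).sub (Continuous.intervalIntegrable (by fun_prop) _ _)

theorem rho01 {u : ℝ} (h : u < 1) : rho ξ u = -(cc * (u + 2)) := by rw [rho, H.h0 u h]; ring
theorem rho12 {u : ℝ} (h : 1 ≤ u) (h2 : u ≤ 2) : rho ξ u = 2 / u - cc * (u + 2) := by rw [rho, H.v12 h h2]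
theorem rho23 {u : ℝ} (h : 2 ≤ u) (h2 : u ≤ 3) : rho ξ u = qq (u - 2) / u := by
  rw [rho, H.v23 h h2, qq, show 1 + (u - 2) = u - 1 by ring]; field_simp; ring

theorem rhoI {a u : ℝ} (ha : 1 ≤ a) (hu : 1 ≤ u) : u * rho ξ u = a * rho ξ a + 2 * ∫ t in (a-1)..(u-1), rho ξ t := by
  have h1 := H.h1 a ha
  have h2 := H.h1 u hu
  have h3 := integral_add_adjacent_intervals (H.ii 1 (a-1)) (H.ii (a-1) (u-1))
  have h4 : ∫ t in (a-1)..(u-1), rho ξ t = (∫ t in (a-1)..(u-1), ξ t) - cc * (((u-1)^2 - (a-1)^2)/2 + 2 * (u - a)) := by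
    unfold rho
    rw [intervalIntegral.integral_sub (H.ii _ _) (Continuous.intervalIntegrable (by fun_prop) _ _), intervalIntegral.integral_const_mul, intervalIntegral.integral_add (by simp) (by simp)]
    simp; ring_nf; simp
  rw [h4]; unfold rho
  linear_combination h2 - h1 - 2 * h3

/-- values of `∫_2^x ρ`. -/
theorem Ibd {x : ℝ} (h2 : 2 ≤ x) (h3 : x ≤ 3) : -0.0445 ≤ ∫ t in (2:ℝ)..x, rho ξ t ∧ ∫ t in (2:ℝ)..x, rho ξ t ≤ 0.0067 := by
  have b1 : ∀ y ∈ Icc (2:ℝ) 2.2, -(0.2616 - 0.8405 * (y - 2)) ≤ rho ξ y ∧ rho ξ y ≤ (-0.439 + 1.3 * (y - 2)) / 2.2 := fun y hy => by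
    have := qq1 (x := y - 2) (by linarith [hy.1]) (by linarith [hy.2])
    rw [H.rho23 hy.1 (by linarith [hy.2]), le_div_iff₀ (by linarith [hy.1]), div_le_iff₀ (by linarith [hy.1])]
    norm_num at *
    constructor <;> nlinarith
  have b2 : ∀ y ∈ Icc (2.2:ℝ) 2.4, -(0.085 - 0.425 * (y - 2.2)) ≤ rho ξ y ∧ rho ξ y ≤ 0.0096 := fun y hy => by
    have := qq2 (x := y - 2) (by linarith [hy.1]) (by linarith [hy.2])
    have h22 := hy.1
    rw [H.rho23 (by linarith [hy.1]) (by linarith [hy.2]), le_div_iff₀ (by linarith [hy.1]), div_le_iff₀ (by linarith [hy.1])]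
    norm_num at *
    constructor <;> nlinarith
  have b3 : ∀ y ∈ Icc (2.4:ℝ) 3, 0 ≤ rho ξ y ∧ rho ξ y ≤ 0.0546 := fun y hy => by
    have := qq3 (x := y - 2) (by linarith [hy.1]) (by linarith [hy.2])
    have h22 := hy.1
    rw [H.rho23 (by linarith [hy.1]) (by linarith [hy.2]), le_div_iff₀ (by linarith [hy.1]), div_le_iff₀ (by linarith [hy.1])]
    norm_num at *
    constructor <;> nlinarith
  have I1 : ∀ x, 2 ≤ x → x ≤ 2.2 → -(0.2616 * (x - 2) - 0.8405 * (x-2)^2/2) ≤ ∫ t in (2:ℝ)..x, rho ξ t ∧ ∫ t in (2:ℝ)..x, rho ξ t ≤ -0.439/2.2 * (x - 2) + 1.3/2.2 * (x-2)^2/2 := fun x h1 h2 => by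
    constructor
    · have := lin_bd (g := fun t => -rho ξ t) 0.2616 (-0.8405) h1 (H.rho_ii _ _).neg (fun y hy => by linarith [(b1 y ⟨hy.1, hy.2.trans h2⟩).1])
      rw [intervalIntegral.integral_neg] at this; linarith
    · exact lin_bd _ _ h1 (H.rho_ii _ _) (fun y hy => (b1 y ⟨hy.1, hy.2.trans h2⟩).2.trans (le_of_eq (by ring)))
  have I2 : ∀ x, 2.2 ≤ x → x ≤ 2.4 → -(0.085 * (x - 2.2) - 0.425 * (x-2.2)^2/2) ≤ ∫ t in (2.2:ℝ)..x, rho ξ t ∧ ∫ t in (2.2:ℝ)..x, rho ξ t ≤ 0.0096 * (x - 2.2) := fun x h1 h2 => by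
    constructor
    · have := lin_bd (g := fun t => -rho ξ t) 0.085 (-0.425) h1 (H.rho_ii _ _).neg (fun y hy => by linarith [(b2 y ⟨hy.1, hy.2.trans h2⟩).1])
      rw [intervalIntegral.integral_neg] at this; linarith
    · have := lin_bd (g := rho ξ) 0.0096 0 h1 (H.rho_ii _ _) (fun y hy => by linarith [(b2 y ⟨hy.1, hy.2.trans h2⟩).2])
      linarith
  have I3 : ∀ x, 2.4 ≤ x → x ≤ 3 → 0 ≤ ∫ t in (2.4:ℝ)..x, rho ξ t ∧ ∫ t in (2.4:ℝ)..x, rho ξ t ≤ 0.0546 * (x - 2.4) := fun x h1 h2 => by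
    constructor
    · have := lin_bd (g := fun t => -rho ξ t) 0 0 h1 (H.rho_ii _ _).neg (fun y hy => by linarith [(b3 y ⟨hy.1, hy.2.trans h2⟩).1])
      rw [intervalIntegral.integral_neg] at this; linarith
    · have := lin_bd (g := rho ξ) 0.0546 0 h1 (H.rho_ii _ _) (fun y hy => by linarith [(b3 y ⟨hy.1, hy.2.trans h2⟩).2])
      linarith
  rcases le_total x 2.2 with hx | hx
  · have := I1 x h2 hx
    norm_num at *; constructor <;> nlinarith
  · have e1 := integral_add_adjacent_intervals (H.rho_ii 2 2.2) (H.rho_ii 2.2 x)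
    have J1 := I1 2.2 (by norm_num) le_rfl
    rcases le_total x 2.4 with hx' | hx'
    · have := I2 x hx hx'
      norm_num at *; constructor <;> nlinarith
    · have e2 := integral_add_adjacent_intervals (H.rho_ii 2.2 2.4) (H.rho_ii 2.4 x)
      have J2 := I2 2.4 (by norm_num) le_rfl
      have := I3 x hx' h3
      norm_num at *; constructor <;> linarith

theorem tail_a {u : ℝ} (h : 3 ≤ u) (h' : u ≤ 4) : |u * rho ξ u| ≤ 0.062 := by
  have := H.Ibd (x := u - 1) (by linarith) (by linarith)
  have e := H.rhoI (a := 3) (u := u) (by norm_num) (by linarith)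
  have q := qq_one
  have e3 := H.rho23 (u := 3) (by norm_num) le_rfl
  rw [e3] at e
  rw [e, abs_le]; norm_num at *; constructor <;> linarith

theorem step_b {a A B : ℝ} (ha : 3 ≤ a) (hA : |a * rho ξ a| ≤ A) (hB : ∀ t, a - 1 ≤ t → t ≤ a → |rho ξ t| ≤ B) {u : ℝ} (h : a ≤ u) (h' : u ≤ a + 1) :
    |u * rho ξ u| ≤ A + 2 * B := by
  have e := H.rhoI (a := a) (u := u) (by linarith) (by linarith)
  have := intervalIntegral.norm_integral_le_of_norm_le_const (f := rho ξ) (a := a - 1) (b := u - 1) (C := B) (fun t ht => by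
    rw [uIoc_of_le (by linarith)] at ht; exact hB t ht.1.le (by linarith [ht.2]))
  rw [norm_eq_abs, abs_of_nonneg (show 0 ≤ u - 1 - (a - 1) by linarith)] at this
  have hB0 := (abs_nonneg _).trans (hB a (by linarith) le_rfl)
  rw [e]
  refine (abs_add_le _ _).trans ?_
  rw [abs_mul 2, abs_two]; nlinarith

theorem tail_b : (∀ u, 3 ≤ u → u ≤ 6 → |rho ξ u| ≤ 0.062 * u / 9) ∧ ∀ u, 6 ≤ u → |rho ξ u| ≤ 0.0137 * exp (6 - u) := by
  have d : ∀ {u A a: ℝ}, 0 < a → a ≤ u → |u * rho ξ u| ≤ A → |rho ξ u| ≤ A / a := fun {u A a} h0 h hA => by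
    rw [abs_mul, abs_of_pos (by linarith)] at hA
    rw [le_div_iff₀ h0]; nlinarith [abs_nonneg (rho ξ u)]
  have a1 : ∀ u, 3 ≤ u → u ≤ 4 → |u * rho ξ u| ≤ 0.062 := fun u h h' => H.tail_a h h'
  have a2 : ∀ u, 4 ≤ u → u ≤ 5 → |u * rho ξ u| ≤ 0.1034 := fun u h h' => by
    refine (H.step_b (a := 4) (A := 0.062) (B := 0.062/3) (by norm_num) (a1 4 (by norm_num) le_rfl) (fun t h1 h2 => d (by norm_num) (by linarith) (a1 t (by linarith) h2)) h (by linarith)).trans (by norm_num)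
  have a3 : ∀ u, 5 ≤ u → u ≤ 6 → |u * rho ξ u| ≤ 0.1551 := fun u h h' => by
    refine (H.step_b (a := 5) (A := 0.1034) (B := 0.1034/4) (by norm_num) (a2 5 (by norm_num) le_rfl) (fun t h1 h2 => d (by norm_num) (by linarith) (a2 t (by linarith) h2)) h (by linarith)).trans (by norm_num)
  constructor
  · intro u h h'
    have hu : 0 < u := by linarith
    suffices |u * rho ξ u| ≤ 0.062 * u^2/9 by
      rw [abs_mul, abs_of_pos hu] at this
      refine le_of_mul_le_mul_left ?_ hu; linarith
    rcases le_total u 4 with g | g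
    · have := a1 u h g; nlinarith
    · rcases le_total u 5 with g' | g'
      · have := a2 u g g'; nlinarith
      · have := a3 u g' h'; nlinarith
  have hh : ∀ u, 3 ≤ u → h ξ u - cc = (2 * rho ξ (u-1) - rho ξ u) / u := fun u hu => by
    unfold h rho; field_simp; ring
  have hw : ∀ u ∈ Icc (5:ℝ) 6, |w ξ u| ≤ 0.0137 := fun u hu => by
    have e : w ξ u = 2 * ((h ξ (u-1) - cc) - (h ξ u - cc)) / u := by unfold w; ring
    have r1 := d (a := 3) (by norm_num) (by linarith [hu.1]) (a1 (u-1-1) (by linarith [hu.1]) (by linarith [hu.2]))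
    have r2 := d (a := 4) (by norm_num) (by linarith [hu.1]) (a2 (u-1) (by linarith [hu.1]) (by linarith [hu.2]))
    have r3 := d (a := 5) (by norm_num) hu.1 (a3 u hu.1 hu.2)
    have k1 : |h ξ (u-1) - cc| ≤ 0.0169 := by
      rw [hh _ (by linarith [hu.1]), abs_div, abs_of_pos (show 0 < u - 1 by linarith [hu.1]), div_le_iff₀ (by linarith [hu.1]), abs_le]
      rw [abs_le] at r1 r2
      have := hu.1
      norm_num at *
      constructor <;> nlinarith
    have k2 : |h ξ u - cc| ≤ 0.0166 := by
      rw [hh _ (by linarith [hu.1]), abs_div, abs_of_pos (show 0 < u by linarith [hu.1]), div_le_iff₀ (by linarith [hu.1]), abs_le]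
      rw [abs_le] at r2 r3
      have := hu.1
      norm_num at *
      constructor <;> nlinarith
    rw [e, abs_div, abs_of_pos (show 0 < u by linarith [hu.1]), div_le_iff₀ (by linarith [hu.1]), abs_le]
    rw [abs_le] at k1 k2
    have := hu.1
    norm_num at *
    constructor <;> nlinarith
  have hw' : ∀ u, 5 < u → |w ξ u| ≤ 0.0137 * exp 6 * exp (-u) := fun u hu => by
    have := H.wdecay' (K := 0.0137 * exp 6) (by positivity) (fun x hx => mul_le_mul (hw x hx) (exp_le_exp.2 hx.2) (exp_pos _).le (by norm_num)) hu.le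
    rw [exp_neg, ← div_eq_mul_inv, le_div_iff₀ (exp_pos _)]; exact this
  obtain ⟨K, K0, g1, g2⟩ := H.rho_bd
  have lim : ∀ {g : ℝ → ℝ} {L : ℝ}, (∀ x, 5 ≤ x → |g x| ≤ K * exp (-x)) → (∀ x, 5 ≤ x → |g x - L| ≤ 0.0137 * exp 6 * exp (-x)) → L = 0 := fun {g L} p1 p2 => by
    have t1 : Tendsto (fun u : ℝ => (K + 0.0137 * exp 6) * exp (-u)) atTop (𝓝 0) := by
      simpa using tendsto_exp_neg_atTop_nhds_zero.const_mul (K + 0.0137 * exp 6)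
    refine abs_nonpos_iff.1 (ge_of_tendsto t1 (eventually_atTop.2 ⟨5, fun x hx => ?_⟩))
    have := p1 x hx
    have := p2 x hx
    have := abs_sub (g x) (g x - L)
    rw [sub_sub_cancel] at this; linarith
  obtain ⟨L, hL⟩ := decay_prim (a := 5) (g := fun u => h ξ u - cc) (g' := w ξ) ((H.hcont.mono fun x hx => by simp at *; linarith).sub continuousOn_const) (fun x hx => (H.hdd (by linarith)).sub_const _) hw'
  have := lim (fun x hx => g2 x (by linarith)) hL
  subst this
  obtain ⟨L, hL2⟩ := decay_prim (a := 5) (g := rho ξ) (g' := fun u => h ξ u - cc) (K := 0.0137 * exp 6)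
    ((H.cont.mono fun x hx => by simp at *; linarith).sub (by fun_prop))
    (fun x hx => (H.hd (by linarith) (by linarith)).sub (by simpa using ((hasDerivAt_id x).add_const 2).const_mul cc))
    (fun x hx => by simpa using hL x hx.le)
  have := lim (fun x hx => g1 x (by linarith)) hL2
  subst this
  intro u hu
  have := hL2 u (by linarith)
  rw [sub_zero, mul_assoc, ← exp_add] at this
  exact this
end Xi

theorem splitI {g : ℝ → ℝ} {a b : ℝ} (h : a ≤ b) (hg : IntegrableOn g (Ioi a)) :
    ∫ v in Ioi a, g v = (∫ v in a..b, g v) + ∫ v in Ioi b, g v :=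
  (integral_interval_add_Ioi hg (hg.mono_set (Ioi_subset_Ioi h))).symm

theorem iiI {g : ℝ → ℝ} {a b c : ℝ} (h : a ≤ b) (h' : b ≤ c) (hg : IntegrableOn g (Ioi a)) : IntervalIntegrable g volume b c :=
  (intervalIntegrable_iff_integrableOn_Ioc_of_le h').2 (hg.mono_set (Ioc_subset_Ioi_self.trans (Ioi_subset_Ioi h)))

theorem tailI {g : ℝ → ℝ} {a C : ℝ} (hg : IntegrableOn g (Ioi a)) (h : ∀ v, a < v → g v ≤ C * exp (a - v)) : ∫ v in Ioi a, g v ≤ C := by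
  have i : IntegrableOn (fun v => C * exp (a - v)) (Ioi a) := by
    have := (exp_neg_integrableOn_Ioi a one_pos).const_mul (C * exp a)
    refine this.congr (ae_of_all _ fun v => ?_)
    simp only; rw [mul_assoc, ← exp_add]; ring_nf
  refine (setIntegral_mono_on hg i measurableSet_Ioi h).trans (le_of_eq ?_)
  have : ∀ v, C * exp (a - v) = C * exp a * exp (-v) := fun v => by rw [mul_assoc, ← exp_add]; ring_nf
  simp_rw [this]
  rw [MeasureTheory.integral_const_mul, integral_exp_neg_Ioi, mul_assoc, ← exp_add]; simp

namespace Xi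
noncomputable def rz (ξ : ℝ → ℝ) (v : ℝ) : ℝ := |rho ξ v| / (v + 1)
variable {ξ : ℝ → ℝ} (H : Xi ξ)
include H

theorem rzint : IntegrableOn (rz ξ) (Ioi 0) := by
  refine (H.rint (g := fun v => 1 / (v + 1)) (M := 1) (by fun_prop) fun v hv => ?_).abs.congr ?_
  · rw [abs_of_pos (by positivity), div_le_one (by linarith)]; linarith
  · refine (ae_restrict_iff' measurableSet_Ioi).2 (ae_of_all _ fun v hv => ?_)
    have hv : 0 < v := hv
    simp only [abs_mul, rz]; rw [abs_of_pos (show 0 < 1/(v+1) by positivity)]; ring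

theorem rzint' {a : ℝ} (ha : 0 ≤ a) : IntegrableOn (rz ξ) (Ioi a) := H.rzint.mono_set (Ioi_subset_Ioi ha)
theorem rzii {a b : ℝ} (ha : 0 ≤ a) (h : a ≤ b) : IntervalIntegrable (rz ξ) volume a b := iiI le_rfl h (H.rzint' ha)

theorem T6 {v : ℝ} (hv : 6 ≤ v) : ∫ w in Ioi v, rz ξ w ≤ 0.002 * exp (6 - v) := by
  refine tailI (H.rzint' (by linarith)) fun u hu => ?_
  have := H.tail_b.2 u (by linarith)
  rw [rz, div_le_iff₀ (by linarith), mul_assoc (0.002:ℝ), ← exp_add, show 6 - v + (v - u) = 6 - u by ring]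
  have := exp_pos (6 - u)
  nlinarith

theorem T3 : ∫ v in Ioi 3, rz ξ v ≤ 0.0227 := by
  rw [splitI (b := 6) (by norm_num) (H.rzint' (by norm_num))]
  have h1 := lin_bd (g := rz ξ) (a := 3) (b := 6) (0.062/9) 0 (by norm_num) (H.rzii (by norm_num) (by norm_num)) fun v hv => by
    have := H.tail_b.1 v hv.1 hv.2
    rw [rz, div_le_iff₀ (by linarith [hv.1])]; linarith
  have h2 := H.T6 le_rfl
  norm_num at *; linarith

theorem r23 {v : ℝ} : (2 ≤ v → v ≤ 2.2 → v * |rho ξ v| ≤ 0.5232 - 1.681 * (v - 2)) ∧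
    (2.2 ≤ v → v ≤ 2.4 → v * |rho ξ v| ≤ 0.208 - 0.935 * (v - 2.2)) ∧ (2.4 ≤ v → v ≤ 3 → v * |rho ξ v| ≤ 0.131) := by
  have e : 2 ≤ v → v ≤ 3 → v * |rho ξ v| = |qq (v-2)| := fun h1 h2 => by
    rw [H.rho23 h1 h2, abs_div, abs_of_pos (by linarith : 0 < v)]; field_simp
  refine ⟨fun h1 h2 => ?_, fun h1 h2 => ?_, fun h1 h2 => ?_⟩
  · have := qq1 (x := v-2) (by linarith) (by linarith)
    rw [e h1 (by linarith), abs_le]; norm_num at *; constructor <;> linarith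
  · have := qq2 (x := v-2) (by linarith) (by linarith)
    rw [e (by linarith) (by linarith), abs_le]; norm_num at *; constructor <;> linarith
  · have := qq3 (x := v-2) (by linarith) (by linarith)
    rw [e (by linarith) (by linarith), abs_le]; norm_num at *; constructor <;> linarith

theorem T2 : ∫ v in Ioi 2, rz ξ v ≤ 0.0476 := by
  rw [splitI (b := 3) (by norm_num) (H.rzint' (by norm_num)),
    ← integral_add_adjacent_intervals (H.rzii (a := 2) (b := 2.2) (by norm_num) (by norm_num)) (H.rzii (by norm_num) (by norm_num)),
    ← integral_add_adjacent_intervals (H.rzii (a := 2.2) (b := 2.4) (by norm_num) (by norm_num)) (H.rzii (by norm_num) (by norm_num))]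
  have key : ∀ {v a B : ℝ}, 2 ≤ a → a ≤ v → v * |rho ξ v| ≤ B → rz ξ v ≤ B / (a * (a + 1)) := fun {v a B} h1 h2 h => by
    rw [rz, div_le_div_iff₀ (by linarith) (by nlinarith)]
    calc |rho ξ v| * (a * (a+1)) ≤ |rho ξ v| * (v * (v+1)) := by gcongr; linarith
      _ = v * |rho ξ v| * (v + 1) := by ring
      _ ≤ _ := by gcongr; linarith
  have h1 := lin_bd (g := rz ξ) (a := 2) (b := 2.2) (0.5232/6) (-1.681/6) (by norm_num) (H.rzii (by norm_num) (by norm_num)) fun v hv =>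
    (key le_rfl hv.1 (H.r23.1 hv.1 hv.2)).trans (le_of_eq (by ring))
  have h2 := lin_bd (g := rz ξ) (a := 2.2) (b := 2.4) (0.208/7.04) (-0.935/7.04) (by norm_num) (H.rzii (by norm_num) (by norm_num)) fun v hv =>
    (key (by norm_num) hv.1 (H.r23.2.1 hv.1 hv.2)).trans (le_of_eq (by ring))
  have h3 := lin_bd (g := rz ξ) (a := 2.4) (b := 3) (0.131/8.16) 0 (by norm_num) (H.rzii (by norm_num) (by norm_num)) fun v hv =>
    (key (by norm_num) hv.1 (H.r23.2.2 hv.1 hv.2)).trans (le_of_eq (by ring))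
  have h4 := H.T3
  norm_num at *; linarith

theorem shint : IntegrableOn (fun v => |rho ξ (v+1)| / (v+1)) (Ioi 0) := by
  obtain ⟨K, K0, hK, -⟩ := H.rho_bd
  have hi : IntegrableOn (fun v : ℝ => exp (-v)) (Ioi 0) := by simpa using exp_neg_integrableOn_Ioi 0 one_pos
  refine Integrable.mono' (hi.const_mul K) ?_ ?_
  · exact ((((H.rho_meas.comp (measurable_id.add_const 1)).abs).div (measurable_id.add_const 1))).aestronglyMeasurable
  refine (ae_restrict_iff' measurableSet_Ioi).2 (ae_of_all _ fun v hv => ?_)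
  have hv : 0 < v := hv
  rw [norm_eq_abs, abs_div, abs_abs, abs_of_pos (show 0 < v + 1 by linarith), div_le_iff₀ (by linarith)]
  have := hK (v+1) (by linarith)
  have h2 : exp (-(v+1)) ≤ exp (-v) := exp_le_exp.2 (by linarith)
  nlinarith [mul_le_mul_of_nonneg_left h2 K0, exp_pos (-v), mul_nonneg K0 (exp_pos (-v)).le]

theorem QQ : ∫ v in Ioi 1, |rho ξ (v+1)| / (v+1) ≤ 0.0593 := by
  have hi := H.shint
  have ii : ∀ {a b : ℝ}, 0 ≤ a → a ≤ b → IntervalIntegrable (fun v => |rho ξ (v+1)| / (v+1)) volume a b := fun h0 h => iiI h0 h hi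
  rw [splitI (b := 5) (by norm_num) (hi.mono_set (Ioi_subset_Ioi (by norm_num))),
    ← integral_add_adjacent_intervals (ii (a := 1) (b := 1.2) (by norm_num) (by norm_num)) (ii (by norm_num) (by norm_num)),
    ← integral_add_adjacent_intervals (ii (a := 1.2) (b := 1.4) (by norm_num) (by norm_num)) (ii (by norm_num) (by norm_num)),
    ← integral_add_adjacent_intervals (ii (a := 1.4) (b := 2) (by norm_num) (by norm_num)) (ii (by norm_num) (by norm_num))]
  have key : ∀ {v a B : ℝ}, 2 ≤ a → a ≤ v → v * |rho ξ v| ≤ B → |rho ξ v| / v ≤ B / (a * a) := fun {v a B} h1 h2 h => by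
    rw [div_le_div_iff₀ (by linarith) (by nlinarith)]
    calc |rho ξ v| * (a * a) ≤ |rho ξ v| * (v * v) := by gcongr; linarith
      _ = v * |rho ξ v| * v := by ring
      _ ≤ _ := by gcongr; linarith
  have h1 := lin_bd (g := fun v => |rho ξ (v+1)| / (v+1)) (a := 1) (b := 1.2) (0.5232/4) (-1.681/4) (by norm_num) (ii (by norm_num) (by norm_num)) fun v hv =>
    (key le_rfl (by linarith [hv.1]) (H.r23.1 (by linarith [hv.1]) (by linarith [hv.2]))).trans (le_of_eq (by ring))
  have h2 := lin_bd (g := fun v => |rho ξ (v+1)| / (v+1)) (a := 1.2) (b := 1.4) (0.208/4.84) (-0.935/4.84) (by norm_num) (ii (by norm_num) (by norm_num)) fun v hv =>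
    (key (a := 2.2) (by norm_num) (by linarith [hv.1]) (H.r23.2.1 (by linarith [hv.1]) (by linarith [hv.2]))).trans (le_of_eq (by ring))
  have h3 := lin_bd (g := fun v => |rho ξ (v+1)| / (v+1)) (a := 1.4) (b := 2) (0.131/5.76) 0 (by norm_num) (ii (by norm_num) (by norm_num)) fun v hv =>
    (key (a := 2.4) (by norm_num) (by linarith [hv.1]) (H.r23.2.2 (by linarith [hv.1]) (by linarith [hv.2]))).trans (le_of_eq (by ring))
  have h4 := lin_bd (g := fun v => |rho ξ (v+1)| / (v+1)) (a := 2) (b := 5) (0.062/9) 0 (by norm_num) (ii (by norm_num) (by norm_num)) fun v hv => by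
    have := H.tail_b.1 (v+1) (by linarith [hv.1]) (by linarith [hv.2])
    rw [div_le_iff₀ (by linarith [hv.1])]; linarith
  have h5 := tailI (C := 0.0023) (hi.mono_set (Ioi_subset_Ioi (show (0:ℝ) ≤ 5 by norm_num))) fun v hv => by
    have := H.tail_b.2 (v+1) (by linarith)
    rw [div_le_iff₀ (by linarith)]
    rw [show 6 - (v+1) = 5 - v by ring] at this
    nlinarith [exp_pos (5 - v)]
  norm_num at *; linarith

theorem T53a : ∫ v in Ioi (5/3), rz ξ v ≤ 0.066 ∧ ∫ v in Ioi 1, rz ξ v ≤ 0.2118 := by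
  obtain ⟨⟨a1, a2⟩, ⟨a3, a4⟩, ⟨a5, a6⟩, ⟨a7, a8⟩⟩ := logs
  obtain ⟨c1, c2⟩ := cc_bd
  have l1 := log_two_gt_d9
  have l2 := log_two_lt_d9
  rw [splitI (a := 1) (b := 5/3) (by norm_num) (H.rzint' (by norm_num)), splitI (a := 5/3) (b := 2) (by norm_num) (H.rzint' (by norm_num)),
    ← integral_add_adjacent_intervals (H.rzii (a := 5/3) (b := 7/4) (by norm_num) (by norm_num)) (H.rzii (by norm_num) (by norm_num))]
  have ex : ∀ a b : ℝ, 1 ≤ a → a ≤ b → ∫ v in a..b, (2 / v - (2 + cc) / (v + 1) - cc) = 2 * (log b - log a) - (2 + cc) * (log (b+1) - log (a+1)) - cc * (b - a) := fun a b h1 h2 => by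
    rw [integral_eq_sub_of_hasDerivAt (f := fun v => 2 * log v - (2 + cc) * log (v+1) - cc * v)]
    · ring
    · intro v hv
      rw [uIcc_of_le h2] at hv
      have := (((hasDerivAt_log (show v ≠ 0 by linarith [hv.1])).const_mul 2).sub ((((hasDerivAt_id v).add_const 1).log (show v + 1 ≠ 0 by linarith [hv.1])).const_mul (2 + cc))).sub ((hasDerivAt_id v).const_mul cc)
      refine this.congr_deriv ?_; simp; ring
    · refine ContinuousOn.intervalIntegrable ?_
      rw [uIcc_of_le h2]
      refine ((continuousOn_const.div continuousOn_id fun v hv => ?_).sub (continuousOn_const.div (continuousOn_id.add continuousOn_const) fun v hv => ?_)).sub continuousOn_const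
      · simp; linarith [hv.1]
      · simp; linarith [hv.1]
  have fe : ∀ v : ℝ, 1 ≤ v → (2 / v - cc * (v + 2)) / (v + 1) = 2 / v - (2 + cc) / (v + 1) - cc := fun v h => by field_simp; ring
  have i1 : ∫ v in (1:ℝ)..5/3, rz ξ v = ∫ v in (1:ℝ)..5/3, (2 / v - (2 + cc) / (v + 1) - cc) := by
    refine intervalIntegral.integral_congr fun v hv => ?_
    rw [uIcc_of_le (by norm_num)] at hv
    have h1 := hv.1; have h2 := hv.2
    simp only [rz]
    rw [H.rho12 hv.1 (by linarith [hv.2]), abs_of_nonneg, fe v hv.1]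
    have : 6/5 ≤ 2 / v := by rw [le_div_iff₀ (by linarith)]; linarith
    norm_num at *; nlinarith
  have i3 : ∫ v in (7/4:ℝ)..2, rz ξ v = - ∫ v in (7/4:ℝ)..2, (2 / v - (2 + cc) / (v + 1) - cc) := by
    rw [← intervalIntegral.integral_neg]
    refine intervalIntegral.integral_congr fun v hv => ?_
    rw [uIcc_of_le (by norm_num)] at hv
    have h1 := hv.1; have h2 := hv.2
    simp only [rz]
    rw [H.rho12 (by linarith [hv.1]) hv.2, abs_of_nonpos, ← fe v (by linarith), neg_div]
    have : 2 / v ≤ 8/7 := by rw [div_le_iff₀ (by linarith)]; linarith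
    norm_num at *; nlinarith
  have i2 := lin_bd (g := rz ξ) (a := 5/3) (b := 7/4) 0.01875 0 (by norm_num) (H.rzii (by norm_num) (by norm_num)) fun v hv => by
    have h1 := hv.1; have h2 := hv.2
    have t1 : 2 / v ≤ 6/5 := by rw [div_le_iff₀ (by linarith)]; linarith
    have t2 : 8/7 ≤ 2 / v := by rw [le_div_iff₀ (by linarith)]; linarith
    have : |rho ξ v| ≤ 0.05 := by
      rw [H.rho12 (by linarith) (by linarith), abs_le]; norm_num at *; constructor <;> nlinarith
    rw [rz, div_le_iff₀ (by linarith)]; norm_num at *; linarith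
  have i4 := H.T2
  have e1 : log (5/3) = log 5 - log 3 := log_div (by norm_num) (by norm_num)
  have e2 : log (8/3) = 3 * log 2 - log 3 := by rw [log_div (by norm_num) (by norm_num), show (8:ℝ) = 2^3 by norm_num, log_pow]; norm_num
  have e3 : log (7/4) = log 7 - 2 * log 2 := by rw [log_div (by norm_num) (by norm_num), show (4:ℝ) = 2^2 by norm_num, log_pow]; norm_num
  have e4 : log (11/4) = log 11 - 2 * log 2 := by rw [log_div (by norm_num) (by norm_num), show (4:ℝ) = 2^2 by norm_num, log_pow]; norm_num
  rw [i1, i3, ex _ _ le_rfl (by norm_num), ex _ _ (by norm_num) (by norm_num)]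
  rw [show (7/4:ℝ) + 1 = 11/4 by norm_num, show (5/3:ℝ)+1 = 8/3 by norm_num, show (1:ℝ) + 1 = 2 by norm_num, show (2:ℝ)+1 = 3 by norm_num, e1, e2, e3, e4, log_one]
  norm_num at *
  constructor <;> nlinarith
end Xi

theorem wt_le {x s : ℝ} (hx : 1 ≤ x) (h0 : 0 ≤ s) : x ^ (-s-1) ≤ 1 / x := by
  rw [one_div, ← rpow_neg_one]; exact rpow_le_rpow_of_exponent_le hx (by linarith)
theorem wt_ge {x s : ℝ} (hx : 1 ≤ x) (h0 : s ≤ 1) : 1 / x^2 ≤ x ^ (-s-1) := by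
  rw [one_div, ← rpow_natCast, ← rpow_neg (by linarith)]; exact rpow_le_rpow_of_exponent_le hx (by push_cast; linarith)
theorem wt_am {x s : ℝ} (hx : 1 ≤ x) (h0 : 0 ≤ s) (h1 : s ≤ 1) : x ^ (-s-1) ≤ (1-s) * (1/x) + s * (1/x^2) := by
  refine le_trans (le_of_eq ?_) (geom_mean_le_arith_mean2_weighted (sub_nonneg.2 h1) h0 (show 0 ≤ 1/x by positivity) (show 0 ≤ 1/x^2 by positivity) (by ring))
  have : (1:ℝ)/x^2 = x^(-2:ℝ) := by rw [rpow_neg (by linarith), one_div]; norm_cast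
  rw [this, one_div, ← rpow_neg_one, ← rpow_mul (by linarith), ← rpow_mul (by linarith), ← rpow_add (by linarith)]; ring_nf

namespace Xi
noncomputable def J (ξ : ℝ → ℝ) (s : ℝ) : ℝ := ∫ v in Ioi (0:ℝ), rho ξ v * (v+1) ^ (-s-1)
variable {ξ : ℝ → ℝ} (H : Xi ξ)
include H

theorem Jint {s : ℝ} (hs : 0 ≤ s) : IntegrableOn (fun v => rho ξ v * (v+1) ^ (-s-1)) (Ioi 0) := by
  refine H.rint (M := 1) (by fun_prop) fun v hv => ?_
  have := wt_le (x := v+1) (by linarith) hs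
  rw [abs_of_pos (by positivity)]
  refine this.trans ?_
  rw [div_le_one (by linarith)]; linarith

theorem Jcont : ContinuousOn (J ξ) (Icc (2/3) (4/5)) := by
  have hi : Integrable (fun v => |rho ξ v * 1|) (volume.restrict (Ioi 0)) := (H.rint (g := fun _ => 1) (M := 1) (by fun_prop) (by simp)).abs
  refine continuousOn_of_dominated (bound := fun v => |rho ξ v * 1|) (fun s hs => ?_) (fun s hs => ?_) hi ?_
  · exact (H.Jint (by linarith [hs.1])).aestronglyMeasurable
  · refine (ae_restrict_iff' measurableSet_Ioi).2 (ae_of_all _ fun v hv => ?_)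
    have hv : 0 < v := hv
    have := wt_le (x := v+1) (s := s) (by linarith) (by linarith [hs.1])
    rw [norm_eq_abs, abs_mul, abs_mul]
    rw [abs_one, abs_of_pos (show 0 < (v+1)^(-s-1) by positivity)]
    gcongr
    refine this.trans ?_
    rw [div_le_one (by linarith)]; linarith
  · refine (ae_restrict_iff' measurableSet_Ioi).2 (ae_of_all _ fun v hv => ?_)
    have hv : 0 < v := hv
    exact continuousOn_const.mul (ContinuousOn.rpow continuousOn_const (by fun_prop) fun s _ => Or.inl (by linarith))

/-- splitting J -/
theorem Jsplit {s : ℝ} (hs : 0 ≤ s) (hs' : s ≤ 1) : -(cc * ((1-s) * (1 + log 2) + s * (log 2 + 1/2))) - 0.066 ≤ J ξ s ∧ J ξ s ≤ -(cc * (log 2 + 1/2)) + 0.2118 := by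
  obtain ⟨c1, c2⟩ := cc_bd
  have hc : 0 ≤ cc := by norm_num at *; linarith
  have l1 : ∫ v in (0:ℝ)..1, (v+2)/(v+1) = 1 + log 2 := by
    rw [integral_eq_sub_of_hasDerivAt (f := fun v => v + log (v+1))]
    · norm_num
    · intro v hv
      rw [uIcc_of_le zero_le_one] at hv
      have h := hv.1
      refine ((hasDerivAt_id v).add (((hasDerivAt_id v).add_const 1).log (show v + 1 ≠ 0 by linarith))).congr_deriv ?_
      simp; field_simp; ring
    · refine ContinuousOn.intervalIntegrable (ContinuousOn.div (by fun_prop) (by fun_prop) fun v hv => ?_)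
      rw [uIcc_of_le zero_le_one] at hv; linarith [hv.1]
  have l2 : ∫ v in (0:ℝ)..1, (v+2)/(v+1)^2 = log 2 + 1/2 := by
    rw [integral_eq_sub_of_hasDerivAt (f := fun v => log (v+1) - (v+1)⁻¹)]
    · norm_num; ring
    · intro v hv
      rw [uIcc_of_le zero_le_one] at hv
      have h := hv.1
      have h' : v + 1 ≠ 0 := by linarith
      refine ((((hasDerivAt_id v).add_const 1).log h').sub (((hasDerivAt_id v).add_const 1).inv h')).congr_deriv ?_
      simp; field_simp; ring
    · refine ContinuousOn.intervalIntegrable (ContinuousOn.div (by fun_prop) (by fun_prop) fun v hv => ?_)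
      rw [uIcc_of_le zero_le_one] at hv; have := hv.1; positivity
  have n1 : IntervalIntegrable (fun v : ℝ => (v+2)/(v+1)) volume 0 1 := by
    refine ContinuousOn.intervalIntegrable (ContinuousOn.div (by fun_prop) (by fun_prop) fun v hv => ?_)
    rw [uIcc_of_le zero_le_one] at hv; linarith [hv.1]
  have n2 : IntervalIntegrable (fun v : ℝ => (v+2)/(v+1)^2) volume 0 1 := by
    refine ContinuousOn.intervalIntegrable (ContinuousOn.div (by fun_prop) (by fun_prop) fun v hv => ?_)
    rw [uIcc_of_le zero_le_one] at hv; have := hv.1; positivity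
  have hJ := H.Jint hs
  have hii : ∀ {a b : ℝ}, 0 ≤ a → a ≤ b → IntervalIntegrable (fun v => rho ξ v * (v+1) ^ (-s-1)) volume a b := fun h0 h => iiI h0 h hJ
  have hio : ∀ {a : ℝ}, 0 ≤ a → IntegrableOn (fun v => rho ξ v * (v+1) ^ (-s-1)) (Ioi a) := fun h0 => hJ.mono_set (Ioi_subset_Ioi h0)
  have ub : ∀ {a : ℝ}, 0 ≤ a → |∫ v in Ioi a, rho ξ v * (v+1) ^ (-s-1)| ≤ ∫ v in Ioi a, rz ξ v := fun {a} ha => by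
    rw [← norm_eq_abs]
    refine MeasureTheory.norm_integral_le_of_norm_le (H.rzint' ha) ((ae_restrict_iff' measurableSet_Ioi).2 (ae_of_all _ fun v hv => ?_))
    have hv : a < v := hv
    have := wt_le (x := v+1) (by linarith) hs
    rw [norm_eq_abs, abs_mul, rz, div_eq_mul_one_div]
    gcongr
    rwa [abs_of_pos (rpow_pos_of_pos (by linarith) _)]
  have e1 : J ξ s = (∫ v in (0:ℝ)..1, rho ξ v * (v+1) ^ (-s-1)) + ((∫ v in (1:ℝ)..(5/3), rho ξ v * (v+1) ^ (-s-1)) + ∫ v in Ioi (5/3), rho ξ v * (v+1) ^ (-s-1)) := by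
    rw [J, splitI zero_le_one hJ, splitI (a := 1) (b := 5/3) (by norm_num) (hio zero_le_one)]
  have e2 : J ξ s = (∫ v in (0:ℝ)..1, rho ξ v * (v+1) ^ (-s-1)) + ∫ v in Ioi 1, rho ξ v * (v+1) ^ (-s-1) := by
    rw [J, splitI zero_le_one hJ]
  obtain ⟨t1, t2⟩ := H.T53a
  have u1 := ub (a := 5/3) (by norm_num)
  have u2 := ub (a := 1) (by norm_num)
  have u3 : 0 ≤ ∫ v in (1:ℝ)..(5/3), rho ξ v * (v+1) ^ (-s-1) := by
    refine intervalIntegral.integral_nonneg (by norm_num) fun v hv => mul_nonneg ?_ (rpow_nonneg (by linarith [hv.1]) _)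
    have h1 := hv.1; have h2 := hv.2
    have : 6/5 ≤ 2 / v := by rw [le_div_iff₀ (by linarith)]; linarith
    rw [H.rho12 hv.1 (by linarith)]
    norm_num at *; nlinarith
  constructor
  · have : -(cc * ((1-s) * (1 + log 2) + s * (log 2 + 1/2))) ≤ ∫ v in (0:ℝ)..1, rho ξ v * (v+1) ^ (-s-1) := by
      rw [← l1, ← l2, ← intervalIntegral.integral_const_mul, ← intervalIntegral.integral_const_mul, ← intervalIntegral.integral_add (n1.const_mul _) (n2.const_mul _), ← intervalIntegral.integral_const_mul, ← intervalIntegral.integral_neg]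
      refine integral_mono_on_of_le_Ioo zero_le_one (((n1.const_mul _).add (n2.const_mul _)).const_mul _).neg (hii le_rfl zero_le_one) fun v hv => ?_
      have := wt_am (x := v+1) (by linarith [hv.1]) hs hs'
      rw [H.rho01 hv.2]
      have h3 : 0 ≤ cc * (v+2) := mul_nonneg hc (by linarith [hv.1])
      have := mul_le_mul_of_nonneg_left this h3
      have e : cc * ((1 - s) * ((v + 2) / (v + 1)) + s * ((v + 2) / (v + 1) ^ 2)) = cc * (v + 2) * ((1 - s) * (1 / (v + 1)) + s * (1 / (v + 1) ^ 2)) := by ring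
      rw [e]; linarith
    have := (abs_le.1 u1).1
    linarith
  · have : (∫ v in (0:ℝ)..1, rho ξ v * (v+1) ^ (-s-1)) ≤ -(cc * (log 2 + 1/2)) := by
      rw [← l2, ← intervalIntegral.integral_const_mul, ← intervalIntegral.integral_neg]
      refine integral_mono_on_of_le_Ioo zero_le_one (hii le_rfl zero_le_one) (n2.const_mul _).neg fun v hv => ?_
      have := wt_ge (x := v+1) (by linarith [hv.1]) hs'
      rw [H.rho01 hv.2]
      have h3 : 0 ≤ cc * (v+2) := mul_nonneg hc (by linarith [hv.1])
      have := mul_le_mul_of_nonneg_left this h3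
      have e : cc * ((v + 2) / (v + 1) ^ 2) = cc * (v + 2) * (1 / (v + 1) ^ 2) := by ring
      rw [e]; linarith
    have := (abs_le.1 u2).2
    linarith

theorem exists_delta : ∃ δ : ℝ, 2/3 ≤ δ ∧ δ ≤ 4/5 ∧ 1 + J ξ δ + cc / δ + cc / (δ - 1) = 0 := by
  have hc : ContinuousOn (fun s => 1 + J ξ s + cc / s + cc / (s - 1)) (Icc (2/3) (4/5)) := by
    refine ((continuousOn_const.add H.Jcont).add (continuousOn_const.div continuousOn_id fun s hs => ?_)).add (continuousOn_const.div (by fun_prop) fun s hs => ?_)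
    · simp; linarith [hs.1]
    · linarith [hs.2]
  obtain ⟨c1, c2⟩ := cc_bd
  have l1 := log_two_gt_d9
  have l2 := log_two_lt_d9
  have j1 := (H.Jsplit (s := 2/3) (by norm_num) (by norm_num)).1
  have j2 := (H.Jsplit (s := 4/5) (by norm_num) (by norm_num)).2
  obtain ⟨δ, hd, e⟩ := intermediate_value_Icc' (show (2/3:ℝ) ≤ 4/5 by norm_num) hc (show (0:ℝ) ∈ _ by
    norm_num at *; constructor <;> nlinarith)
  exact ⟨δ, hd.1, hd.2, e⟩
end Xi

namespace Xi
/-- tail integral and preconditioned kernel -/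
noncomputable def YP (ξ : ℝ → ℝ) (s v : ℝ) : ℝ := ∫ w in Ioi v, rho ξ w * (w+1) ^ (-s-1)
noncomputable def kap (ξ : ℝ → ℝ) (s v : ℝ) : ℝ := -rho ξ v + rho ξ (v+1) / (1+s) + -(s*(1-s)/(1+s)) * ((v+1)^s * YP ξ s v)
variable {ξ : ℝ → ℝ} (H : Xi ξ)
include H

theorem Pint {s : ℝ} (hs : 0 ≤ s) : IntegrableOn (fun v => |rho ξ v| * (v+1) ^ (-s-1)) (Ioi 0) := by
  refine (H.Jint hs).abs.congr ((ae_restrict_iff' measurableSet_Ioi).2 (ae_of_all _ fun v hv => ?_))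
  have hv : 0 < v := hv
  simp only [abs_mul]; rw [abs_of_pos (show 0 < (v+1)^(-s-1) by positivity)]

theorem Yabs {s v : ℝ} (hv : 0 ≤ v) : |YP ξ s v| ≤ ∫ w in Ioi v, |rho ξ w| * (w+1) ^ (-s-1) := by
  refine (MeasureTheory.abs_integral_le_integral_abs).trans (le_of_eq (setIntegral_congr_fun measurableSet_Ioi fun w hw => ?_))
  have hw : v < w := hw
  simp only [abs_mul]; rw [abs_of_pos (rpow_pos_of_pos (by linarith) _)]

theorem Dbd {s : ℝ} (hs : 0 ≤ s) (hs1 : s ≤ 1) : (∫ v in Ioi (0:ℝ), rz ξ v) - (∫ v in Ioi (0:ℝ), |rho ξ v| * (v+1) ^ (-s-1)) ≤ 0.3149 := by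
  rw [← integral_sub H.rzint (H.Pint hs)]
  have hi := H.rzint.sub (H.Pint hs)
  have hi : IntegrableOn (fun v => rz ξ v - |rho ξ v| * (v+1) ^ (-s-1)) (Ioi 0) := hi
  rw [splitI zero_le_one hi, splitI (a := 1) (b := 5/3) (by norm_num) (hi.mono_set (Ioi_subset_Ioi zero_le_one))]
  obtain ⟨c1, c2⟩ := cc_bd
  have hc : 0 ≤ cc := by norm_num at *; linarith
  have kd : ∀ v, 0 < v → rz ξ v - |rho ξ v| * (v+1) ^ (-s-1) ≤ rz ξ v * (1 - 1/(v+1)) := fun v hv => by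
    have := wt_ge (x := v+1) (by linarith) hs1
    have := mul_le_mul_of_nonneg_left this (abs_nonneg (rho ξ v))
    have e : rz ξ v * (1 - 1/(v+1)) = rz ξ v - |rho ξ v| * (1/(v+1)^2) := by rw [rz]; field_simp
    rw [e]; linarith
  have rzn : ∀ v, 0 < v → 0 ≤ rz ξ v := fun v hv => by rw [rz]; positivity
  have a1 : ∫ v in (0:ℝ)..1, (rz ξ v - |rho ξ v| * (v+1) ^ (-s-1)) ≤ cc / 2 := by
    have n1 : IntervalIntegrable (fun v : ℝ => cc * (1 - 1/(v+1)^2)) volume 0 1 := by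
      refine ContinuousOn.intervalIntegrable (continuousOn_const.mul (continuousOn_const.sub (ContinuousOn.div (by fun_prop) (by fun_prop) fun v hv => ?_)))
      rw [uIcc_of_le zero_le_one] at hv; have := hv.1; positivity
    have l1 : ∫ v in (0:ℝ)..1, cc * (1 - 1/(v+1)^2) = cc / 2 := by
      rw [integral_eq_sub_of_hasDerivAt (f := fun v => cc * (v + (v+1)⁻¹)) _ n1]
      · norm_num; ring
      · intro v hv
        rw [uIcc_of_le zero_le_one] at hv
        have h := hv.1
        have h' : v + 1 ≠ 0 := by linarith
        refine (((hasDerivAt_id v).add (((hasDerivAt_id v).add_const 1).inv h')).const_mul cc).congr_deriv ?_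
        simp; left; ring
    rw [← l1]
    refine integral_mono_on_of_le_Ioo zero_le_one (iiI le_rfl zero_le_one hi) n1 fun v hv => ?_
    have := hv.1
    refine (kd v hv.1).trans (le_of_eq ?_)
    rw [rz, H.rho01 hv.2, abs_neg, abs_of_nonneg (by positivity)]
    field_simp; ring
  have a2 : ∫ v in (1:ℝ)..(5/3), (rz ξ v - |rho ξ v| * (v+1) ^ (-s-1)) ≤ ∫ v in (1:ℝ)..(5/3), (5/8) * rz ξ v := by
    refine integral_mono_on_of_le_Ioo (by norm_num) (iiI zero_le_one (by norm_num) hi) ((H.rzii zero_le_one (by norm_num)).const_mul _) fun v hv => ?_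
    have h1 := hv.1; have h2 := hv.2
    refine (kd v (by linarith)).trans ?_
    rw [mul_comm]
    refine mul_le_mul_of_nonneg_right ?_ (rzn v (by linarith))
    have : 3/8 ≤ 1/(v+1) := by rw [div_le_div_iff₀ (by norm_num) (by linarith)]; linarith
    linarith
  have a3 : ∫ v in Ioi (5/3:ℝ), (rz ξ v - |rho ξ v| * (v+1) ^ (-s-1)) ≤ ∫ v in Ioi (5/3:ℝ), rz ξ v := by
    refine setIntegral_mono_on (hi.mono_set (Ioi_subset_Ioi (by norm_num))) (H.rzint' (by norm_num)) measurableSet_Ioi fun v hv => ?_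
    have hv : 5/3 < v := hv
    have : 0 ≤ |rho ξ v| * (v+1) ^ (-s-1) := mul_nonneg (abs_nonneg _) (rpow_nonneg (by linarith) _)
    linarith
  rw [intervalIntegral.integral_const_mul] at a2
  obtain ⟨t1, t2⟩ := H.T53a
  rw [splitI (a := 1) (b := 5/3) (by norm_num) (H.rzint' zero_le_one)] at t2
  norm_num at *; linarith

theorem Ybd {s V : ℝ} (hs : 0 < s) (hs1 : s ≤ 1) (hV : 0 ≤ V) :
    ∫ v in (0:ℝ)..V, (v+1)^(s-1) * (∫ w in Ioi v, |rho ξ w| * (w+1) ^ (-s-1)) ≤ 0.3149 / s := by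
  set P : ℝ → ℝ := fun v => ∫ w in Ioi v, |rho ξ w| * (w+1) ^ (-s-1) with hP
  have hi := H.Pint hs.le
  have iv : ∀ v, 0 ≤ v → IntervalIntegrable (fun w => |rho ξ w| * (w+1) ^ (-s-1)) volume 0 v := fun v hv => iiI le_rfl hv hi
  have Pe : ∀ v ∈ Ici (0:ℝ), P v = P 0 - ∫ w in (0:ℝ)..v, |rho ξ w| * (w+1) ^ (-s-1) := fun v hv => by
    simp only [hP]; rw [splitI (show (0:ℝ) ≤ v from hv) hi]; ring
  have Pc : ContinuousOn P (Icc 0 V) := by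
    refine ContinuousOn.congr (f := fun v => P 0 - ∫ w in (0:ℝ)..v, |rho ξ w| * (w+1) ^ (-s-1)) ?_ fun v hv => Pe v hv.1
    refine continuousOn_const.sub ?_
    have := continuousOn_primitive_interval' (iv V hV) left_mem_uIcc
    rwa [uIcc_of_le hV] at this
  have wc : ∀ p : ℝ, ContinuousOn (fun v : ℝ => (v+1)^p) (Icc 0 V) := fun p =>
    ContinuousOn.rpow_const (by fun_prop) fun v hv => Or.inl (by linarith [hv.1])
  have i1 : IntervalIntegrable (fun v => (v+1)^(s-1) * P v) volume 0 V := by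
    refine ContinuousOn.intervalIntegrable ?_
    rw [uIcc_of_le hV]; exact (wc _).mul Pc
  have ft := integral_eq_of_hasDerivAt_off_countable_of_le (f := fun v => (v+1)^s / s * P v) (f' := fun v => (v+1)^(s-1) * P v - rz ξ v / s) (s := {1}) hV (countable_singleton 1)
    (((wc s).div_const s).mul Pc) (fun v hv => by
      have hv0 : 0 < v := hv.1.1
      have d1 : HasDerivAt P (-(|rho ξ v| * (v+1) ^ (-s-1))) v := by
        have c1 : ContinuousAt (fun w => |rho ξ w| * (w+1) ^ (-s-1)) v := by
          refine ContinuousAt.mul ?_ ((continuousAt_id.add continuousAt_const).rpow_const (Or.inl (by simp; linarith)))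
          exact (((H.contAt (by simpa using hv.2)).sub (by fun_prop))).abs
        have c2 := integral_hasDerivAt_right (iv v hv0.le) (Measurable.stronglyMeasurable (by have := H.rho_meas; fun_prop)).stronglyMeasurableAtFilter c1
        refine ((c2.const_sub (P 0))).congr_of_eventuallyEq ?_
        filter_upwards [Ici_mem_nhds hv0] with x hx using Pe x hx
      have d2 : HasDerivAt (fun v : ℝ => (v+1)^s / s) ((v+1)^(s-1)) v := by
        refine ((((hasDerivAt_id v).add_const 1).rpow_const (p := s) (Or.inl (by simp; linarith))).div_const s).congr_deriv ?_
        simp; field_simp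
      refine (d2.mul d1).congr_deriv ?_
      have : (v+1)^s * (v+1)^(-s-1) = 1/(v+1) := by
        rw [← rpow_add (by linarith), show s + (-s-1) = -1 by ring, rpow_neg_one, one_div]
      rw [rz, show |rho ξ v| / (v+1) = |rho ξ v| * ((v+1)^s * (v+1)^(-s-1)) by rw [this]; ring]; ring)
    (i1.sub ((H.rzii le_rfl hV).div_const s))
  rw [intervalIntegral.integral_sub i1 ((H.rzii le_rfl hV).div_const s), intervalIntegral.integral_div] at ft
  have tl : (V+1)^s * P V ≤ ∫ w in Ioi V, rz ξ w := by
    simp only [hP]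
    rw [← MeasureTheory.integral_const_mul]
    refine setIntegral_mono_on ((hi.mono_set (Ioi_subset_Ioi hV)).const_mul _) (H.rzint' hV) measurableSet_Ioi fun w hw => ?_
    have hw : V < w := hw
    have : (w+1)^s * (w+1)^(-s-1) = 1/(w+1) := by
        rw [← rpow_add (by linarith), show s + (-s-1) = -1 by ring, rpow_neg_one, one_div]
    rw [rz, div_eq_mul_one_div, ← this]
    have h2 : (V+1)^s ≤ (w+1)^s := rpow_le_rpow (by linarith) (by linarith) hs.le
    have h3 : 0 ≤ |rho ξ w| * (w+1)^(-s-1) := mul_nonneg (abs_nonneg _) (rpow_nonneg (by linarith) _)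
    nlinarith
  have hD := H.Dbd hs.le hs1
  rw [splitI hV H.rzint] at hD
  have e0 : P 0 = ∫ w in Ioi (0:ℝ), |rho ξ w| * (w+1) ^ (-s-1) := rfl
  rw [← e0] at hD
  simp only [zero_add, one_rpow] at ft
  rw [le_div_iff₀ hs]
  have : (∫ v in (0:ℝ)..V, (v+1)^(s-1) * P v) * s = (V+1)^s * P V - P 0 + ∫ v in (0:ℝ)..V, rz ξ v := by
    field_simp at ft; linarith
  rw [this]; linarith
theorem YPc {s V : ℝ} (hs : 0 ≤ s) (hV : 0 ≤ V) : ContinuousOn (YP ξ s) (Icc 0 V) := by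
  have hi := H.Jint hs
  refine ContinuousOn.congr (f := fun v => YP ξ s 0 - ∫ w in (0:ℝ)..v, rho ξ w * (w+1) ^ (-s-1)) ?_ fun v hv => ?_
  · refine continuousOn_const.sub ?_
    have := continuousOn_primitive_interval' (iiI le_rfl hV hi) left_mem_uIcc
    rwa [uIcc_of_le hV] at this
  · simp only [YP]; rw [splitI (show (0:ℝ) ≤ v from hv.1) hi]; ring

theorem kap_int {s V : ℝ} (hs : 0 ≤ s) (hV : 0 ≤ V) : IntervalIntegrable (kap ξ s) volume 0 V := by
  have wc : ContinuousOn (fun v : ℝ => (v+1)^s) (Icc 0 V) :=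
    ContinuousOn.rpow_const (by fun_prop) fun v hv => Or.inl (by linarith [hv.1])
  have := (H.rho_ii 1 (V+1)).comp_add_right 1
  simp only [sub_self, add_sub_cancel_right] at this
  refine ((H.rho_ii 0 V).neg.add (this.div_const _)).add (IntervalIntegrable.const_mul (ContinuousOn.intervalIntegrable ?_) _)
  rw [uIcc_of_le hV]; exact wc.mul (H.YPc hs hV)

theorem N1bd {q : ℝ} (q0 : 1/2 ≤ q) (q1 : q ≤ 3/5) : IntegrableOn (fun v => |(-rho ξ v + rho ξ (v+1) * q) / (v+1)|) (Ioi 0) ∧ ∫ v in Ioi (0:ℝ), |(-rho ξ v + rho ξ (v+1) * q) / (v+1)| ≤ 0.93 := by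
  obtain ⟨c1, c2⟩ := cc_bd
  have hc : 0 ≤ cc := by norm_num at *; linarith
  have hb : ∀ v, 0 < v → |(-rho ξ v + rho ξ (v+1) * q) / (v+1)| ≤ rz ξ v + q * (|rho ξ (v+1)| / (v+1)) := fun v hv => by
    rw [abs_div, abs_of_pos (show 0 < v+1 by linarith), rz, ← mul_div_assoc, ← add_div]
    gcongr
    refine (abs_add_le _ _).trans ?_
    rw [abs_neg, abs_mul, abs_of_nonneg (show 0 ≤ q by linarith)]; linarith
  have gi : IntegrableOn (fun v => rz ξ v + q * (|rho ξ (v+1)| / (v+1))) (Ioi 0) := H.rzint.add (H.shint.const_mul q)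
  have hi : IntegrableOn (fun v => |(-rho ξ v + rho ξ (v+1) * q) / (v+1)|) (Ioi 0) := by
    refine gi.mono' (Measurable.aestronglyMeasurable (by have := H.rho_meas; fun_prop)) ((ae_restrict_iff' measurableSet_Ioi).2 (ae_of_all _ fun v hv => ?_))
    rw [norm_eq_abs, abs_abs]; exact hb v hv
  refine ⟨hi, ?_⟩
  rw [splitI zero_le_one hi]
  have a2 : ∫ v in Ioi (1:ℝ), |(-rho ξ v + rho ξ (v+1) * q) / (v+1)| ≤ 0.2118 + q * 0.0593 := by
    have s2 := H.shint.mono_set (Ioi_subset_Ioi zero_le_one)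
    refine (setIntegral_mono_on (hi.mono_set (Ioi_subset_Ioi zero_le_one)) (gi.mono_set (Ioi_subset_Ioi zero_le_one)) measurableSet_Ioi fun v hv => hb v (lt_trans one_pos hv)).trans ?_
    rw [integral_add (H.rzint' zero_le_one) (s2.const_mul q), MeasureTheory.integral_const_mul]
    have := H.T53a.2; have := mul_le_mul_of_nonneg_left H.QQ (show 0 ≤ q by linarith)
    linarith
  have a1 : ∫ v in (0:ℝ)..1, |(-rho ξ v + rho ξ (v+1) * q) / (v+1)| = cc * (1 + log 2) + q * (1 - cc * (1 + 2 * log 2)) := by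
    have n1 : IntervalIntegrable (fun v : ℝ => cc * (1 + 1/(v+1)) + q * (2/(v+1)^2 - cc * (1 + 2/(v+1)))) volume 0 1 := by
      refine ContinuousOn.intervalIntegrable ?_
      have h0 : ∀ v ∈ uIcc (0:ℝ) 1, v + 1 ≠ 0 := fun v hv => by rw [uIcc_of_le zero_le_one] at hv; linarith [hv.1]
      have k : ∀ d : ℝ, ContinuousOn (fun v : ℝ => d/(v+1)) (uIcc 0 1) := fun d => continuousOn_const.div (by fun_prop) h0
      exact (continuousOn_const.mul (continuousOn_const.add (k 1))).add (continuousOn_const.mul ((continuousOn_const.div (by fun_prop) fun v hv => pow_ne_zero 2 (h0 v hv)).sub (continuousOn_const.mul (continuousOn_const.add (k 2)))))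
    have l1 : ∫ v in (0:ℝ)..1, (cc * (1 + 1/(v+1)) + q * (2/(v+1)^2 - cc * (1 + 2/(v+1)))) = cc * (1 + log 2) + q * (1 - cc * (1 + 2 * log 2)) := by
      rw [integral_eq_sub_of_hasDerivAt (f := fun v => cc * (v + log (v+1)) + q * (-2*(v+1)⁻¹ - cc * (v + 2 * log (v+1)))) _ n1]
      · norm_num; ring
      · intro v hv
        rw [uIcc_of_le zero_le_one] at hv
        have h := hv.1
        have h' : v + 1 ≠ 0 := by linarith
        have L := ((hasDerivAt_id v).add_const 1).log h'
        refine ((((hasDerivAt_id v).add L).const_mul cc).add ((((((hasDerivAt_id v).add_const 1).inv h').const_mul (-2)).sub (((hasDerivAt_id v).add (L.const_mul 2)).const_mul cc)).const_mul q)).congr_deriv ?_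
        simp; ring_nf; simp
    rw [← l1, integral_of_le zero_le_one, integral_of_le zero_le_one, integral_Ioc_eq_integral_Ioo, integral_Ioc_eq_integral_Ioo]
    refine setIntegral_congr_fun measurableSet_Ioo fun v hv => ?_
    have h1 := hv.1; have h2 := hv.2
    rw [H.rho01 hv.2, H.rho12 (by linarith) (by linarith), abs_of_nonneg]
    · field_simp; ring
    · refine div_nonneg ?_ (by linarith)
      have : 0 ≤ 2/(v+1) * q := by positivity
      have : cc * (v+3) * q ≤ cc * (v+3) * (3/5) := by gcongr
      nlinarith [mul_nonneg hc h1.le]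
  have l1 := log_two_gt_d9
  have l2 := log_two_lt_d9
  rw [a1]
  have : 0 ≤ 1 - cc * (1 + 2 * log 2) := by norm_num at *; nlinarith
  have : q * (1 - cc * (1 + 2 * log 2)) ≤ 3/5 * (1 - cc * (1 + 2 * log 2)) := by gcongr
  have : cc * (1 + log 2 - 3/5 * (1 + 2 * log 2)) ≤ 0.3154 * (1 + 0.6931471808 - 3/5 * (1 + 2 * 0.6931471803)) := by
    refine mul_le_mul c2 (by norm_num at *; linarith) (by norm_num at *; nlinarith) (by norm_num)
  norm_num at *; nlinarith

theorem kap_bd {s V : ℝ} (hs : 2/3 ≤ s) (hs1 : s ≤ 4/5) (hV : 0 ≤ V) : ∫ v in (0:ℝ)..V, |kap ξ s v| / (v+1) ≤ 0.993 := by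
  have q0 : 1/2 ≤ 1/(1+s) := by rw [div_le_div_iff₀ (by norm_num) (by linarith)]; linarith
  have q1 : 1/(1+s) ≤ 3/5 := by rw [div_le_div_iff₀ (by linarith) (by norm_num)]; linarith
  obtain ⟨i1, b1⟩ := H.N1bd q0 q1
  have b2 := H.Ybd (s := s) (by linarith) (by linarith) hV
  have wc : ∀ p : ℝ, ContinuousOn (fun v : ℝ => (v+1)^p) (Icc 0 V) := fun p =>
    ContinuousOn.rpow_const (by fun_prop) fun v hv => Or.inl (by linarith [hv.1])
  have hi := H.Pint (s := s) (by linarith)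
  have i2 : IntervalIntegrable (fun v => (v+1)^(s-1) * (∫ w in Ioi v, |rho ξ w| * (w+1) ^ (-s-1))) volume 0 V := by
    refine ContinuousOn.intervalIntegrable ?_
    rw [uIcc_of_le hV]; refine (wc _).mul ?_
    refine ContinuousOn.congr (f := fun v => (∫ w in Ioi 0, |rho ξ w| * (w+1) ^ (-s-1)) - ∫ w in (0:ℝ)..v, |rho ξ w| * (w+1) ^ (-s-1)) ?_ fun v hv => ?_
    · refine continuousOn_const.sub ?_
      have := continuousOn_primitive_interval' (iiI le_rfl hV hi) left_mem_uIcc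
      rwa [uIcc_of_le hV] at this
    · simp only; rw [splitI (show (0:ℝ) ≤ v from hv.1) hi]; ring
  have i1' := iiI le_rfl hV i1
  have ki : IntervalIntegrable (fun v => |kap ξ s v| / (v+1)) volume 0 V := by
    have := (H.kap_int (s := s) (by linarith) hV).abs.mul_continuousOn (g := fun v => (v+1)⁻¹) (by
      rw [uIcc_of_le hV]; exact ContinuousOn.inv₀ (by fun_prop) fun v hv => by linarith [hv.1])
    simpa only [div_eq_mul_inv] using this
  have al : 0 ≤ s*(1-s)/(1+s) := div_nonneg (mul_nonneg (by linarith) (by linarith)) (by linarith)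
  refine (integral_mono_on hV ki (i1'.add (i2.const_mul (s*(1-s)/(1+s)))) fun v hv => ?_).trans ?_
  · have h1 := hv.1
    have y := H.Yabs (s := s) h1
    rw [abs_div, abs_of_pos (show 0 < v+1 by linarith), div_le_iff₀ (by linarith), add_mul, div_mul_cancel₀ _ (by linarith), kap]
    refine (abs_add_le _ _).trans (add_le_add (le_of_eq (by rw [mul_one_div])) ?_)
    have : (v+1)^s = (v+1)^(s-1) * (v+1) := by rw [rpow_sub_one (by linarith)]; field_simp
    rw [abs_mul, abs_neg, abs_of_nonneg al, abs_mul, abs_of_pos (show 0 < (v+1)^s by positivity), this]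
    have := mul_le_mul_of_nonneg_left y (show 0 ≤ s*(1-s)/(1+s) * ((v+1)^(s-1) * (v+1)) by positivity)
    linarith
  · rw [intervalIntegral.integral_add i1' (i2.const_mul _), intervalIntegral.integral_const_mul]
    have b3 : ∫ v in (0:ℝ)..V, |(-rho ξ v + rho ξ (v+1) * (1/(1+s))) / (v+1)| ≤ 0.93 := by
      rw [splitI hV i1] at b1
      have : 0 ≤ ∫ v in Ioi V, |(-rho ξ v + rho ξ (v+1) * (1/(1+s))) / (v+1)| := MeasureTheory.integral_nonneg fun v => abs_nonneg _
      linarith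
    have b4 := mul_le_mul_of_nonneg_left b2 al
    have : s*(1-s)/(1+s) * (0.3149 / s) ≤ 0.063 := by
      rw [div_mul_div_comm, div_le_iff₀ (by nlinarith)]; nlinarith
    norm_num at *; linarith
end Xi

theorem tri_swap {G : ℝ → ℝ → ℝ} (hG : Measurable (Function.uncurry G)) {a b M : ℝ} (hab : a ≤ b) (hM : ∀ r s, a ≤ r → r ≤ s → s ≤ b → |G r s| ≤ M) :
    IntervalIntegrable (fun s => ∫ r in a..s, G r s) volume a b ∧ (∫ s in a..b, ∫ r in a..s, G r s) = ∫ r in a..b, ∫ s in r..b, G r s := by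
  set T : Set (ℝ × ℝ) := {p | p.1 ≤ p.2}
  have hT : MeasurableSet T := measurableSet_le measurable_fst measurable_snd
  set I := volume.restrict (Ioc a b)
  set g : ℝ × ℝ → ℝ := T.indicator (Function.uncurry G)
  have gi : Integrable g (I.prod I) := by
    refine Integrable.mono' (g := fun _ => |M|) (integrable_const _) (hG.indicator hT).aestronglyMeasurable ?_
    rw [Measure.prod_restrict]
    refine (ae_restrict_iff' (measurableSet_Ioc.prod measurableSet_Ioc)).2 (ae_of_all _ fun p hp => ?_)
    by_cases h : p ∈ T
    · simp only [g, indicator_of_mem h]; exact (hM p.1 p.2 hp.1.1.le h hp.2.2).trans (le_abs_self _)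
    · simp [g, indicator_of_notMem h]
  have e1 : ∀ s ∈ Ioc a b, ∫ r, g (r, s) ∂I = ∫ r in a..s, G r s := fun s hs => by
    have : ∀ r, g (r, s) = (Iic s).indicator (fun r => G r s) r := fun r => by
      by_cases h : r ≤ s
      · rw [indicator_of_mem (by exact h)]; exact indicator_of_mem (s := T) (by exact h) _
      · rw [indicator_of_notMem (by exact h)]; exact indicator_of_notMem (s := T) (by exact h) _
    simp_rw [this]
    rw [MeasureTheory.integral_indicator measurableSet_Iic, Measure.restrict_restrict measurableSet_Iic, integral_of_le hs.1.le, inter_comm, Ioc_inter_Iic, min_eq_right hs.2]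
  have e2 : ∀ r ∈ Ioc a b, ∫ s, g (r, s) ∂I = ∫ s in r..b, G r s := fun r hr => by
    have : ∀ s, g (r, s) = (Ici r).indicator (fun s => G r s) s := fun s => by
      by_cases h : r ≤ s
      · rw [indicator_of_mem (by exact h)]; exact indicator_of_mem (s := T) (by exact h) _
      · rw [indicator_of_notMem (by exact h)]; exact indicator_of_notMem (s := T) (by exact h) _
    simp_rw [this]
    rw [MeasureTheory.integral_indicator measurableSet_Ici, Measure.restrict_restrict measurableSet_Ici, integral_of_le hr.2, ← integral_Icc_eq_integral_Ioc]
    congr 2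
    ext s; simp only [mem_inter_iff, mem_Ici, mem_Ioc, mem_Icc]; have := hr.1; constructor
    · rintro ⟨h1, h2, h3⟩; exact ⟨h1, h3⟩
    · rintro ⟨h1, h2⟩; exact ⟨h1, by linarith, h2⟩
  constructor
  · rw [intervalIntegrable_iff_integrableOn_Ioc_of_le hab]
    exact gi.integral_prod_right.congr ((ae_restrict_iff' measurableSet_Ioc).2 (ae_of_all _ e1))
  · rw [integral_of_le hab, integral_of_le hab, ← setIntegral_congr_fun measurableSet_Ioc e1, ← setIntegral_congr_fun measurableSet_Ioc e2]
    exact (integral_integral_swap (f := fun r s => g (r, s)) gi).symm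

noncomputable def mc (F k : ℝ → ℝ) (x : ℝ) : ℝ := ∫ w in (1:ℝ)..x, F w * k (x / w) / w
def LB (F : ℝ → ℝ) : Prop := Measurable F ∧ ∀ X, ∃ M, 0 ≤ M ∧ ∀ x, 1 ≤ x → x ≤ X → |F x| ≤ M

theorem mc_comm (F k : ℝ → ℝ) {x : ℝ} (hx : 1 ≤ x) : mc F k x = mc k F x := by
  have h := integral_image_eq_integral_abs_deriv_smul (s := Icc 1 x) (f := fun w => x / w) (f' := fun w => -x / w^2) measurableSet_Icc (fun w hw => by
    have : w ≠ 0 := by linarith [hw.1]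
    have := ((hasDerivAt_id w).inv this).const_mul x
    refine (this.congr_deriv ?_).hasDerivWithinAt
    simp; ring) (fun w hw v hv h => by
      have := hw.1; have := hv.1
      simp only at h
      rw [div_eq_div_iff (by linarith) (by linarith)] at h
      exact (mul_left_cancel₀ (show x ≠ 0 by linarith) h).symm) (fun w => F w * k (x / w) / w)
  have im : (fun w => x / w) '' Icc 1 x = Icc 1 x := by
    ext r; constructor
    · rintro ⟨w, hw, rfl⟩
      have := hw.1; have := hw.2
      exact ⟨by simp only; rw [le_div_iff₀ (by linarith)]; linarith, div_le_self (by linarith) hw.1⟩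
    · intro hr
      have := hr.1; have := hr.2
      exact ⟨x / r, ⟨by rw [le_div_iff₀ (by linarith)]; linarith, div_le_self (by linarith) hr.1⟩, by field_simp⟩
  rw [im] at h
  rw [mc, mc, integral_of_le hx, integral_of_le hx, ← integral_Icc_eq_integral_Ioc, ← integral_Icc_eq_integral_Ioc, h]
  refine setIntegral_congr_fun measurableSet_Icc fun w hw => ?_
  have := hw.1
  have e : x / (x / w) = w := by field_simp
  have x0 : 0 < x := by linarith
  simp only [smul_eq_mul, e]
  rw [neg_div, abs_neg, abs_of_pos (by positivity)]
  field_simp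

theorem mc_int {F k : ℝ → ℝ} (hF : LB F) (hk : LB k) {x : ℝ} (hx : 1 ≤ x) : IntervalIntegrable (fun w => F w * k (x / w) / w) volume 1 x := by
  obtain ⟨M, m0, hM⟩ := hF.2 x
  obtain ⟨N, n0, hN⟩ := hk.2 x
  have := hF.1; have := hk.1
  rw [intervalIntegrable_iff_integrableOn_Ioc_of_le hx]
  refine Integrable.mono' (g := fun _ => M * N) (integrable_const _) (Measurable.aestronglyMeasurable (by fun_prop)) ((ae_restrict_iff' measurableSet_Ioc).2 (ae_of_all _ fun w hw => ?_))
  have h1 : 1 < w := hw.1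
  have a := hM w hw.1.le hw.2
  have b := hN (x / w) (by rw [le_div_iff₀ (by linarith)]; linarith [hw.2]) (div_le_self (by linarith) hw.1.le)
  rw [norm_eq_abs, abs_div, abs_mul, abs_of_pos (show 0 < w by linarith)]
  exact (div_le_self (by positivity) hw.1.le).trans (mul_le_mul a b (abs_nonneg _) m0)

theorem mc_assoc {F k e : ℝ → ℝ} (hF : LB F) (hk : LB k) (he : LB e) {x : ℝ} (hx : 1 ≤ x) :
    IntervalIntegrable (fun s => mc F k s * e (x / s) / s) volume 1 x ∧ mc (mc F k) e x = mc F (mc k e) x := by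
  obtain ⟨M, m0, hM⟩ := hF.2 x
  obtain ⟨N, n0, hN⟩ := hk.2 x
  obtain ⟨P, p0, hP⟩ := he.2 x
  have := hF.1; have := hk.1; have := he.1
  have T := tri_swap (G := fun r s => F r * k (s / r) / r * (e (x / s) / s)) (by unfold Function.uncurry; fun_prop) hx (M := M * N * P) (fun r s h1 h2 h3 => by
    have a := hM r h1 (by linarith)
    have b := hN (s / r) (by rw [le_div_iff₀ (by linarith)]; linarith) ((div_le_self (by linarith) h1).trans h3)
    have c := hP (x / s) (by rw [le_div_iff₀ (by linarith)]; linarith) (div_le_self (by linarith) (by linarith))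
    rw [abs_mul, abs_div, abs_mul, abs_div, abs_of_pos (show 0 < r by linarith), abs_of_pos (show 0 < s by linarith)]
    have s0 : 0 < s := by linarith
    exact mul_le_mul ((div_le_self (by positivity) h1).trans (mul_le_mul a b (abs_nonneg _) m0)) ((div_le_self (by positivity) (by linarith)).trans c) (by positivity) (by positivity))
  simp only [intervalIntegral.integral_mul_const] at T
  have e1 : ∀ s, mc F k s * (e (x / s) / s) = mc F k s * e (x / s) / s := fun s => by ring
  refine ⟨?_, ?_⟩
  · exact T.1.congr fun s _ => e1 s
  · rw [mc, mc]
    refine (integral_congr fun s _ => (e1 s).symm).trans (T.2.trans (integral_congr fun r hr => ?_))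
    rw [uIcc_of_le hx] at hr
    have r0 : 0 < r := by linarith [hr.1]
    have e2 : ∀ s, F r * k (s / r) / r * (e (x / s) / s) = F r / r ^ 2 * ((fun w => k w * e (x / r / w) / w) (s / r)) := fun s => by
      have : x / r / (s / r) = x / s := by field_simp
      simp only [this]; field_simp
    simp_rw [e2]
    rw [intervalIntegral.integral_const_mul, intervalIntegral.integral_comp_div (fun w => k w * e (x / r / w) / w) r0.ne', div_self r0.ne', mc, smul_eq_mul]
    field_simp

noncomputable def ee (s x : ℝ) : ℝ := -(s*(1-s)/(1+s)) * x ^ s + (-2/(1+s)) * x⁻¹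
def kk (ξ : ℝ → ℝ) (x : ℝ) : ℝ := ξ (x - 1)

theorem LB_rpow {s : ℝ} (hs : 0 ≤ s) : LB (fun x => x ^ s) := ⟨by fun_prop, fun X => ⟨|X|^s, by positivity, fun x h1 h2 => by
  rw [abs_of_nonneg (rpow_nonneg (by linarith) _)]; exact rpow_le_rpow (by linarith) (h2.trans (le_abs_self _)) hs⟩⟩
theorem LB_inv : LB (fun x => x⁻¹) := ⟨by fun_prop, fun X => ⟨1, zero_le_one, fun x h1 h2 => by
  rw [abs_of_nonneg (inv_nonneg.2 (by linarith))]; exact inv_le_one_of_one_le₀ h1⟩⟩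
theorem LB_add {F G : ℝ → ℝ} (hF : LB F) (hG : LB G) : LB (fun x => F x + G x) := ⟨hF.1.add hG.1, fun X => by
  obtain ⟨M, m0, hM⟩ := hF.2 X
  obtain ⟨N, n0, hN⟩ := hG.2 X
  exact ⟨M + N, by positivity, fun x h1 h2 => (abs_add_le _ _).trans (add_le_add (hM x h1 h2) (hN x h1 h2))⟩⟩
theorem LB_smul {F : ℝ → ℝ} (c : ℝ) (hF : LB F) : LB (fun x => c * F x) := ⟨hF.1.const_mul c, fun X => by
  obtain ⟨M, m0, hM⟩ := hF.2 X
  exact ⟨|c| * M, by positivity, fun x h1 h2 => by rw [abs_mul]; gcongr; exact hM x h1 h2⟩⟩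
theorem LB_ee {s : ℝ} (hs : 0 ≤ s) : LB (ee s) := LB_add (LB_smul _ (LB_rpow hs)) (LB_smul _ LB_inv)

theorem mc_id {s x : ℝ} (hs : 0 < s) (hs1 : s < 1) (hx : 1 ≤ x) : x + mc (fun x => x) (ee s) x = s/(1+s) * x^s + 1/(1+s) * x⁻¹ := by
  have x0 : 0 < x := by linarith
  have e : mc (fun x => x) (ee s) x = ∫ w in (1:ℝ)..x, ((-(s*(1-s)/(1+s)) * x^s) * w^(-s) + (-2/(1+s) * x⁻¹) * w) := by
    refine integral_congr fun w hw => ?_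
    rw [uIcc_of_le hx] at hw
    have w0 : 0 < w := by linarith [hw.1]
    simp only [ee]
    rw [div_rpow x0.le w0.le, rpow_neg w0.le, inv_div]
    field_simp
  have ne : (0:ℝ) ∉ uIcc 1 x := by rw [uIcc_of_le hx]; intro h; linarith [h.1]
  rw [e, intervalIntegral.integral_add ((intervalIntegrable_rpow (Or.inr ne)).const_mul _) (intervalIntegrable_id.const_mul _), intervalIntegral.integral_const_mul, intervalIntegral.integral_const_mul, integral_rpow (Or.inl (by linarith)), integral_id, one_rpow, show -s+1 = 1 - s by ring, rpow_sub x0, rpow_one]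
  have : x^s ≠ 0 := by positivity
  have : 1 - s ≠ 0 := by linarith
  field_simp; ring

namespace Xi
variable {ξ : ℝ → ℝ} (H : Xi ξ)
include H

theorem LB_kk : LB (kk ξ) := ⟨H.meas.comp (by fun_prop), fun X => by
  obtain ⟨K, k0, hK⟩ := H.grow
  refine ⟨K * (1 + |X|), by positivity, fun x h1 h2 => (hK (x-1) (by linarith)).trans ?_⟩
  gcongr; linarith [le_abs_self X]⟩

theorem ker_id {s x : ℝ} (hs : 0 < s) (hs1 : s < 1) (hd : 1 + J ξ s + cc / s + cc / (s - 1) = 0) (hx : 1 ≤ x) :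
    kk ξ x + ee s x + mc (kk ξ) (ee s) x = -kap ξ s (x-1) := by
  have x0 : 0 < x := by linarith
  have X : 0 ≤ x - 1 := by linarith
  have wc : ∀ p : ℝ, ContinuousOn (fun v : ℝ => (v+1)^p) (uIcc 0 (x-1)) := fun p => by
    rw [uIcc_of_le X]
    exact ContinuousOn.rpow_const (by fun_prop) fun v hv => Or.inl (by linarith [hv.1])
  have e : mc (kk ξ) (ee s) x = ∫ v in (0:ℝ)..(x-1), ((-(s*(1-s)/(1+s)) * x^s) * (rho ξ v * (v+1)^(-s-1) + cc * ((v+2) * (v+1)^(-s-1))) + (-2/(1+s) * x⁻¹) * ξ v) := by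
    rw [show (0:ℝ) = 1 - 1 by norm_num, ← intervalIntegral.integral_comp_sub_right _ 1]
    refine integral_congr fun w hw => ?_
    rw [uIcc_of_le hx] at hw
    have w0 : 0 < w := by linarith [hw.1]
    simp only [ee, kk, rho]
    rw [div_rpow x0.le w0.le, sub_add_cancel, rpow_sub w0, rpow_neg w0.le, inv_div, rpow_one]
    field_simp; ring
  have i1 := iiI le_rfl X (H.Jint hs.le)
  have i2 : IntervalIntegrable (fun v : ℝ => (v+2) * (v+1)^(-s-1)) volume 0 (x-1) := ContinuousOn.intervalIntegrable (ContinuousOn.mul (by fun_prop) (wc _))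
  have v2 : ∫ v in (0:ℝ)..(x-1), (v+2) * (v+1)^(-s-1) = x^(1-s)/(1-s) - x^(-s)/s - 1/(1-s) + 1/s := by
    rw [integral_eq_sub_of_hasDerivAt (f := fun v => (v+1)^(1-s)/(1-s) - (v+1)^(-s)/s) _ i2]
    · simp; ring
    · intro v hv
      rw [uIcc_of_le X] at hv
      have v0 : 0 < v + 1 := by linarith [hv.1]
      have D := (hasDerivAt_id v).add_const 1
      refine (((D.rpow_const (p := 1-s) (Or.inl v0.ne')).div_const (1-s)).sub ((D.rpow_const (p := -s) (Or.inl v0.ne')).div_const s)).congr_deriv ?_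
      have : 1 - s ≠ 0 := by linarith
      simp only [id]
      rw [show (1:ℝ) - s - 1 = (-s-1) + 1 by ring, rpow_add_one v0.ne']
      field_simp; ring
  have v3 : 2 * ∫ v in (0:ℝ)..(x-1), ξ v = x * ξ x - 2 := by
    rw [← integral_add_adjacent_intervals (H.ii 0 1) (H.ii 1 (x-1)), H.int0 zero_le_one le_rfl, H.h1 x hx]; ring
  have v1 : J ξ s = (∫ v in (0:ℝ)..(x-1), rho ξ v * (v+1)^(-s-1)) + YP ξ s (x-1) := splitI X (H.Jint hs.le)
  rw [e, intervalIntegral.integral_add ((i1.add (i2.const_mul _)).const_mul _) ((H.ii _ _).const_mul _), intervalIntegral.integral_const_mul, intervalIntegral.integral_const_mul, intervalIntegral.integral_add i1 (i2.const_mul _), intervalIntegral.integral_const_mul, v2, kap, kk, ee]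
  have hi : ∫ v in (0:ℝ)..(x-1), ξ v = (x * ξ x - 2)/2 := by linarith
  have hj : (∫ v in (0:ℝ)..(x-1), rho ξ v * (v+1)^(-s-1)) = -1 - cc/s - cc/(s-1) - YP ξ s (x-1) := by linarith
  rw [hi, hj, sub_add_cancel, rho, rho, rpow_sub x0, rpow_neg x0.le, rpow_one]
  have : x^s ≠ 0 := by positivity
  have : 1 - s ≠ 0 := by linarith
  have : s - 1 ≠ 0 := by linarith
  rw [show cc / (s-1) = -(cc/(1-s)) by rw [← div_neg]; ring_nf]
  field_simp; ring

/-- the kernel in multiplicative variable -/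
theorem kap_i {s x : ℝ} (hs : 0 ≤ s) (hx : 1 ≤ x) : IntervalIntegrable (fun w => kap ξ s (w-1) / w) volume 1 x := by
  have := (H.kap_int hs (show 0 ≤ x - 1 by linarith)).comp_sub_right 1
  simp only [zero_add, sub_add_cancel] at this
  have := this.mul_continuousOn (g := fun v => v⁻¹) (by
      rw [uIcc_of_le hx]; exact ContinuousOn.inv₀ (by fun_prop) fun v hv => by linarith [hv.1])
  simpa only [div_eq_mul_inv] using this

theorem kap_b {s x : ℝ} (hs : 2/3 ≤ s) (hs1 : s ≤ 4/5) (hx : 1 ≤ x) : ∫ w in (1:ℝ)..x, |kap ξ s (w-1) / w| ≤ 0.993 := by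
  have := H.kap_bd hs hs1 (show 0 ≤ x - 1 by linarith)
  rw [show (0:ℝ) = 1 - 1 by norm_num, ← intervalIntegral.integral_comp_sub_right _ 1] at this
  refine le_trans (le_of_eq (integral_congr fun w hw => ?_)) this
  rw [uIcc_of_le hx] at hw
  simp only [sub_add_cancel, abs_div, abs_of_pos (show 0 < w by linarith [hw.1])]

theorem mck_i {s x : ℝ} (hs : 0 ≤ s) {F : ℝ → ℝ} (hF : LB F) (hx : 1 ≤ x) : IntervalIntegrable (fun w => kap ξ s (w-1) * F (x/w) / w) volume 1 x := by
  obtain ⟨M, m0, hM⟩ := hF.2 x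
  have := hF.1
  have i := H.kap_i hs hx
  rw [intervalIntegrable_iff_integrableOn_Ioc_of_le hx] at i ⊢
  refine (Integrable.bdd_mul (c := M) (f := fun w => F (x / w)) i (Measurable.aestronglyMeasurable (by fun_prop)) ((ae_restrict_iff' measurableSet_Ioc).2 (ae_of_all _ fun w hw => ?_))).congr (ae_of_all _ fun w => by simp only; ring)
  exact hM (x / w) (by rw [le_div_iff₀ (by linarith [hw.1])]; linarith [hw.2]) (div_le_self (by linarith) hw.1.le)

theorem mck_b {s x M : ℝ} (hs : 2/3 ≤ s) (hs1 : s ≤ 4/5) {F : ℝ → ℝ} (hx : 1 ≤ x) (m0 : 0 ≤ M) (hM : ∀ y, 1 ≤ y → y ≤ x → |F y| ≤ M) :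
    |mc (fun w => kap ξ s (w-1)) F x| ≤ 0.993 * M := by
  rw [mc, ← norm_eq_abs]
  refine (intervalIntegral.norm_integral_le_of_norm_le (g := fun w => |kap ξ s (w-1) / w| * M) hx (ae_of_all _ fun w hw => ?_) ((H.kap_i (by linarith) hx).abs.mul_const _)).trans ?_
  · rw [norm_eq_abs, mul_div_right_comm, abs_mul]
    gcongr
    exact hM (x / w) (by rw [le_div_iff₀ (by linarith [hw.1])]; linarith [hw.2]) (div_le_self (by linarith) hw.1.le)
  · rw [intervalIntegral.integral_mul_const]
    exact mul_le_mul_of_nonneg_right (H.kap_b hs hs1 hx) m0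

theorem sup_arg {s X B : ℝ} (hs : 2/3 ≤ s) (hs1 : s ≤ 4/5) {F : ℝ → ℝ} (hF : LB F) (hX : 1 ≤ X)
    (h : ∀ x, 1 ≤ x → x ≤ X → |F x - mc (fun w => kap ξ s (w-1)) F x| ≤ B) : |F X| ≤ B / 0.007 := by
  obtain ⟨M, m0, hM⟩ := hF.2 X
  set S := sSup ((fun x => |F x|) '' Icc 1 X)
  have bd : BddAbove ((fun x => |F x|) '' Icc 1 X) := ⟨M, by rintro _ ⟨x, hx, rfl⟩; exact hM x hx.1 hx.2⟩
  have le : ∀ x, 1 ≤ x → x ≤ X → |F x| ≤ S := fun x h1 h2 => le_csSup bd ⟨x, ⟨h1, h2⟩, rfl⟩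
  have S0 : 0 ≤ S := (abs_nonneg _).trans (le X hX le_rfl)
  have : S ≤ 0.993 * S + B := by
    refine csSup_le ⟨_, X, ⟨hX, le_rfl⟩, rfl⟩ ?_
    rintro _ ⟨x, hx, rfl⟩
    have h1 := h x hx.1 hx.2
    have h2 := H.mck_b hs hs1 hx.1 S0 (F := F) fun y y1 y2 => le y y1 (y2.trans hx.2)
    have := abs_sub_abs_le_abs_sub (F x) (mc (fun w => kap ξ s (w-1)) F x)
    simp only; linarith
  have := le X hX le_rfl
  rw [le_div_iff₀ (by norm_num)]; norm_num at *; linarith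
end Xi

namespace Xi
noncomputable def EE (ξ F : ℝ → ℝ) (C x : ℝ) : ℝ := F x + mc F (kk ξ) x - C * x
variable {ξ : ℝ → ℝ} (H : Xi ξ)
theorem Iw {p : ℝ} (hp : 0 < p) {x : ℝ} (hx : 1 ≤ x) : ∫ w in (1:ℝ)..x, w^(-p-1) ≤ 1/p := by
  have ne : (0:ℝ) ∉ uIcc 1 x := by rw [uIcc_of_le hx]; intro h; linarith [h.1]
  rw [integral_rpow (Or.inr ⟨by linarith, ne⟩), sub_add_cancel, one_rpow, div_neg, ← neg_div]
  gcongr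
  have : 0 < x^(-p) := rpow_pos_of_pos (by linarith) _
  linarith

include H

theorem precond {s C : ℝ} (hs : 0 < s) (hs1 : s < 1) (hd : 1 + J ξ s + cc / s + cc / (s - 1) = 0) {F : ℝ → ℝ} (hF : LB F) {x : ℝ} (hx : 1 ≤ x) :
    F x - mc (fun w => kap ξ s (w-1)) F x = C * (s/(1+s) * x^s + 1/(1+s) * x⁻¹) + EE ξ F C x + mc (EE ξ F C) (ee s) x := by
  have hk := H.LB_kk
  have he := LB_ee hs.le
  have hid : LB (fun x => x) := by simpa using LB_rpow zero_le_one
  obtain ⟨i3, a⟩ := mc_assoc hF hk he hx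
  have i1 := mc_int hF he hx
  have i2 := (mc_int hid he hx).const_mul C
  have e1 : mc (EE ξ F C) (ee s) x = mc F (ee s) x + mc (mc F (kk ξ)) (ee s) x - C * mc (fun x => x) (ee s) x := by
    simp only [mc] at i1 i2 i3 ⊢
    rw [← intervalIntegral.integral_const_mul, ← intervalIntegral.integral_add i1 i3, ← intervalIntegral.integral_sub (i1.add i3) i2]
    refine integral_congr fun w _ => ?_
    simp only [EE, mc]; ring
  have e2 : mc F (mc (kk ξ) (ee s)) x = -mc (fun w => kap ξ s (w-1)) F x - mc (kk ξ) F x - mc (ee s) F x := by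
    rw [mc_comm _ _ hx]
    have j1 := H.mck_i hs.le hF hx
    have j2 := mc_int hk hF hx
    have j3 := mc_int he hF hx
    rw [mc, mc, mc, mc, ← neg_add', ← neg_add', ← intervalIntegral.integral_add j1 j2, ← intervalIntegral.integral_add (j1.add j2) j3, ← intervalIntegral.integral_neg]
    refine integral_congr fun w hw => ?_
    rw [uIcc_of_le hx] at hw
    have := H.ker_id hs hs1 hd hw.1
    have : mc (kk ξ) (ee s) w = -kap ξ s (w-1) - kk ξ w - ee s w := by linarith
    simp only [this]; ring
  have e3 := mc_id hs hs1 hx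
  rw [e1, a, e2, mc_comm _ _ hx, mc_comm F _ hx, EE, mc_comm F _ hx, ← e3, mc_comm F _ hx]; ring

theorem EE_i {C : ℝ} {F : ℝ → ℝ} (hF : LB F) {x : ℝ} (hx : 1 ≤ x) : IntervalIntegrable (EE ξ F C) volume 1 x := by
  have i1 : IntervalIntegrable F volume 1 x := by
    refine ((mc_int hF LB_inv hx).const_mul x).congr fun w hw => ?_
    rw [uIoc_of_le hx] at hw
    have := hw.1
    have : w ≠ 0 := by linarith
    have : x ≠ 0 := by linarith
    field_simp
  have i2 : IntervalIntegrable (mc F (kk ξ)) volume 1 x := by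
    refine ((mc_assoc hF H.LB_kk LB_inv hx).1.const_mul x).congr fun w hw => ?_
    rw [uIoc_of_le hx] at hw
    have := hw.1
    have : w ≠ 0 := by linarith
    have : x ≠ 0 := by linarith
    field_simp
  exact (i1.add i2).sub (intervalIntegrable_id.const_mul C)

/-- crude bound -/
theorem solveA {s C K : ℝ} (hs : 2/3 ≤ s) (hs1 : s ≤ 4/5) (hd : 1 + J ξ s + cc / s + cc / (s - 1) = 0) {F : ℝ → ℝ} (hF : LB F)
    (hE : ∀ x, 1 ≤ x → |EE ξ F C x| ≤ K * x^(1/2:ℝ)) : ∃ K', ∀ x, 1 ≤ x → |F x| ≤ K' * x ^ s := by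
  have k0 : 0 ≤ K := by simpa using (abs_nonneg _).trans (hE 1 le_rfl)
  refine ⟨(2 * |C| + K + 1 * (K * 6 + 2 * K)) / 0.007, fun X hX => ?_⟩
  rw [div_mul_eq_mul_div]
  refine H.sup_arg hs hs1 hF hX fun x hx hxX => ?_
  rw [H.precond (C := C) (by linarith) (by linarith) hd hF hx]
  have x0 : 0 < x := by linarith
  have xX : x^s ≤ X^s := rpow_le_rpow x0.le hxX (by linarith)
  have x1 : 1 ≤ x^s := one_le_rpow hx (by linarith)
  have xh : x^(1/2:ℝ) ≤ x^s := rpow_le_rpow_of_exponent_le hx (by linarith)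
  have al : |-(s*(1-s)/(1+s))| ≤ 1 := by rw [abs_neg, abs_of_nonneg (div_nonneg (by nlinarith) (by linarith)), div_le_one (by linarith)]; nlinarith
  have be : |-2/(1+s)| ≤ 2 := by rw [abs_div, abs_of_pos (show 0 < 1 + s by linarith), div_le_iff₀ (by linarith)]; norm_num; linarith
  have ne : (0:ℝ) ∉ uIcc 1 x := by rw [uIcc_of_le hx]; intro h; linarith [h.1]
  have m : |mc (EE ξ F C) (ee s) x| ≤ ∫ w in (1:ℝ)..x, (K * x^s * w^(-(1/6:ℝ)-1) + 2 * K * x^(1/2:ℝ) * x⁻¹) := by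
    rw [mc, ← norm_eq_abs]
    refine intervalIntegral.norm_integral_le_of_norm_le hx (ae_of_all _ fun w hw => ?_) (((intervalIntegrable_rpow (Or.inr ne)).const_mul _).add (intervalIntegrable_const))
    have w0 : 0 < w := by linarith [hw.1]
    have h1 := hE w hw.1.le
    have h2 : |ee s (x/w)| ≤ x^s * w^(-s) + 2 * (w * x⁻¹) := by
      rw [ee]; refine (abs_add_le _ _).trans ?_
      rw [abs_mul, abs_mul, div_rpow x0.le w0.le, inv_div, rpow_neg w0.le, abs_of_pos (show 0 < x^s / w^s by positivity), abs_of_pos (show 0 < w/x by positivity)]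
      have := mul_le_mul_of_nonneg_right al (show 0 ≤ x^s / w^s by positivity)
      have := mul_le_mul_of_nonneg_right be (show 0 ≤ w/x by positivity)
      simp only [div_eq_mul_inv] at *; linarith
    rw [norm_eq_abs, abs_div, abs_mul, abs_of_pos w0, div_le_iff₀ w0]
    refine (mul_le_mul h1 h2 (abs_nonneg _) (by positivity)).trans ?_
    have h3 : w^(1/2:ℝ) * w^(-s) ≤ w^(-(1/6:ℝ)-1) * w := by
      rw [← rpow_add w0, ← rpow_add_one w0.ne']; exact rpow_le_rpow_of_exponent_le hw.1.le (by linarith)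
    have h4 : w^(1/2:ℝ) ≤ x^(1/2:ℝ) := rpow_le_rpow w0.le hw.2 (by norm_num)
    have h5 := mul_le_mul_of_nonneg_left h3 (show 0 ≤ K * x^s by positivity)
    have h6 := mul_le_mul_of_nonneg_left h4 (show 0 ≤ K * 2 * w * x⁻¹ by positivity)
    nlinarith
  rw [intervalIntegral.integral_add ((intervalIntegrable_rpow (Or.inr ne)).const_mul _) intervalIntegrable_const, intervalIntegral.integral_const_mul, intervalIntegral.integral_const, smul_eq_mul] at m
  have I := Iw (p := 1/6) (by norm_num) hx
  have m2 := mul_le_mul_of_nonneg_left I (show 0 ≤ K * x^s by positivity)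
  have m3 : (x - 1) * (2 * K * x^(1/2:ℝ) * x⁻¹) ≤ 2 * K * x^s := by
    have : (x - 1) * x⁻¹ ≤ 1 := by rw [← div_eq_mul_inv, div_le_one x0]; linarith
    calc _ = 2 * K * x^(1/2:ℝ) * ((x - 1) * x⁻¹) := by ring
      _ ≤ 2 * K * x^s * 1 := by gcongr
      _ = _ := by ring
  have c1 : |C * (s/(1+s) * x^s + 1/(1+s) * x⁻¹)| ≤ |C| * (2 * x^s) := by
    rw [abs_mul]; gcongr
    have : x⁻¹ ≤ 1 := inv_le_one_of_one_le₀ hx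
    have : s/(1+s) ≤ 1 := by rw [div_le_one (by linarith)]; linarith
    have : 1/(1+s) ≤ 1 := by rw [div_le_one (by linarith)]; linarith
    rw [abs_of_nonneg (by positivity)]
    have := mul_le_mul_of_nonneg_right ‹s/(1+s) ≤ 1› (show 0 ≤ x^s by positivity)
    have := mul_le_mul ‹1/(1+s) ≤ 1› ‹x⁻¹ ≤ 1› (by positivity) (by positivity)
    linarith
  have t := (abs_add_le (C * (s/(1+s) * x^s + 1/(1+s) * x⁻¹) + EE ξ F C x) (mc (EE ξ F C) (ee s) x)).trans (add_le_add_left (abs_add_le _ _) _)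
  have h1 := hE x hx
  have h7 := mul_le_mul_of_nonneg_left xh k0
  have h8 := mul_le_mul_of_nonneg_left xX (show 0 ≤ 2 * |C| + K + 1 * (K * 6 + 2 * K) by positivity)
  linarith
theorem solveB {s C K : ℝ} (hs : 2/3 ≤ s) (hs1 : s ≤ 4/5) (hd : 1 + J ξ s + cc / s + cc / (s - 1) = 0) {F : ℝ → ℝ} (hF : LB F)
    (hE : ∀ x, 1 ≤ x → |EE ξ F C x| ≤ K) : ∃ ν K', ∀ x, 1 ≤ x → |F x - ν * x ^ s| ≤ K' := by
  have k0 : 0 ≤ K := (abs_nonneg _).trans (hE 1 le_rfl)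
  set κ : ℝ → ℝ := fun w => kap ξ s (w-1) with hκ
  have s0 : 0 < s := by linarith
  have wc : ∀ (p x : ℝ), 1 ≤ x → ContinuousOn (fun v : ℝ => v^p) (uIcc 1 x) := fun p x hx =>
    ContinuousOn.rpow_const (by fun_prop) fun v hv => Or.inl (by rw [uIcc_of_le hx] at hv; linarith [hv.1])
  have Ei : ∀ x, 1 ≤ x → IntervalIntegrable (fun w => EE ξ F C w * w^(-s-1)) volume 1 x := fun x hx => (H.EE_i hF hx).mul_continuousOn (wc _ x hx)
  have pos : ∀ w p : ℝ, 1 ≤ w → 0 < w^p := fun w p hw => rpow_pos_of_pos (by linarith) _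
  have EI : IntegrableOn (fun w => EE ξ F C w * w^(-s-1)) (Ioi 1) := by
    refine integrableOn_Ioi_of_intervalIntegral_norm_bounded (l := atTop) (b := fun t : ℝ => max 1 t) (K * (1/s)) 1 (fun t => ?_) (tendsto_atTop_mono (fun t => le_max_right 1 t) tendsto_id) (Eventually.of_forall fun t => ?_)
    · exact (intervalIntegrable_iff_integrableOn_Ioc_of_le (le_max_left _ _)).1 (Ei _ (le_max_left _ _))
    · have hx : 1 ≤ max 1 t := le_max_left 1 t
      refine (integral_mono_on hx (Ei _ hx).norm ((wc (-s-1) _ hx).intervalIntegrable.const_mul K) fun w hw => ?_).trans ?_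
      · rw [norm_eq_abs, abs_mul, abs_of_pos (pos w _ hw.1)]
        exact mul_le_mul_of_nonneg_right (hE w hw.1) (pos w _ hw.1).le
      · rw [intervalIntegral.integral_const_mul]; gcongr; exact Iw s0 hx
  have κI : IntegrableOn (fun w => κ w / w) (Ioi 1) := by
    refine integrableOn_Ioi_of_intervalIntegral_norm_bounded (l := atTop) (b := fun t : ℝ => max 1 t) 0.993 1 (fun t => ?_) (tendsto_atTop_mono (fun t => le_max_right 1 t) tendsto_id) (Eventually.of_forall fun t => ?_)
    · exact (intervalIntegrable_iff_integrableOn_Ioc_of_le (le_max_left _ _)).1 (H.kap_i s0.le (le_max_left _ _))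
    · exact H.kap_b hs hs1 (le_max_left _ _)
  have κ1 : ∫ w in Ioi 1, |κ w / w| ≤ 0.993 := by
    have T := intervalIntegral_tendsto_integral_Ioi (μ := volume) (l := atTop) (b := fun t : ℝ => t) 1 κI.abs tendsto_id
    exact le_of_tendsto T (by filter_upwards [eventually_ge_atTop 1] with t ht using H.kap_b hs hs1 ht)
  have le1 : ∀ w : ℝ, 1 ≤ w → w^(-s) ≤ 1 := fun w hw => rpow_le_one_of_one_le_of_nonpos hw (by linarith)
  have κJ : IntegrableOn (fun w => w^(-s) * (κ w / w)) (Ioi 1) := by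
    refine Integrable.bdd_mul (c := 1) κI (Measurable.aestronglyMeasurable (by fun_prop)) ((ae_restrict_iff' measurableSet_Ioi).2 (ae_of_all _ fun w hw => ?_))
    have hw : 1 < w := hw
    rw [norm_eq_abs, abs_of_pos (pos w _ hw.le)]; exact le1 w hw.le
  have tl : ∀ x, 1 ≤ x → |∫ w in Ioi x, w^(-s) * (κ w / w)| ≤ x^(-s) * 0.993 := fun x hx => by
    have a : IntegrableOn (fun w => |κ w / w|) (Ioi x) := IntegrableOn.mono_set κI.abs (Ioi_subset_Ioi hx)
    rw [← norm_eq_abs]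
    refine (MeasureTheory.norm_integral_le_of_norm_le (a.const_mul (x^(-s))) ((ae_restrict_iff' measurableSet_Ioi).2 (ae_of_all _ fun w hw => ?_))).trans ?_
    · have hw : x < w := hw
      rw [norm_eq_abs, abs_mul, abs_of_pos (pos w _ (by linarith))]
      gcongr ?_ * _
      exact rpow_le_rpow_of_nonpos (by linarith) hw.le (by linarith)
    · rw [MeasureTheory.integral_const_mul]
      gcongr
      refine le_trans (setIntegral_mono_set κI.abs (ae_of_all _ fun w => abs_nonneg _) (Ioi_subset_Ioi hx).eventuallyLE) κ1
  set κh := ∫ w in Ioi 1, w^(-s) * (κ w / w) with hκh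
  set Ih := ∫ w in Ioi 1, EE ξ F C w * w^(-s-1) with hIh
  have κh1 : |κh| ≤ 0.993 := by simpa using tl 1 le_rfl
  have κ2 : 0 < 1 - κh := by have := (abs_le.1 κh1).2; norm_num at *; linarith
  set α := -(s*(1-s)/(1+s)) with hα
  set β := -2/(1+s) with hβ
  set ν' := C * (s/(1+s)) + α * Ih
  set ν := ν' / (1 - κh) with hν
  have nn : ν * (1 - κh) = ν' := by rw [hν]; field_simp
  set B := |C| + K + |α| * (K * (1/s)) + |β| * K + |ν| * 0.993 with hB
  refine ⟨ν, B / 0.007, fun X hX => ?_⟩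
  have LBG : LB (fun x => F x - ν * x^s) := by
    have := LB_add hF (LB_smul (-ν) (LB_rpow s0.le))
    simpa [sub_eq_add_neg] using this
  refine H.sup_arg (F := fun x => F x - ν * x^s) hs hs1 LBG hX fun x hx _ => ?_
  have x0 : 0 < x := by linarith
  have e1 : mc κ (fun x => F x - ν * x^s) x = mc κ F x - ν * (x^s * (κh - ∫ w in Ioi x, w^(-s) * (κ w / w))) := by
    have i1 := H.mck_i s0.le hF hx
    have i2 := iiI le_rfl hx κJ
    have : κh - (∫ w in Ioi x, w^(-s) * (κ w / w)) = ∫ w in (1:ℝ)..x, w^(-s) * (κ w / w) := by rw [hκh, splitI hx κJ]; ring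
    rw [this, mc, mc, ← intervalIntegral.integral_const_mul, ← intervalIntegral.integral_const_mul, ← intervalIntegral.integral_sub i1 ((i2.const_mul _).const_mul _)]
    refine integral_congr fun w hw => ?_
    rw [uIcc_of_le hx] at hw
    have w0 : 0 < w := by linarith [hw.1]
    rw [div_rpow x0.le w0.le, rpow_neg w0.le]; field_simp; simp only [hκ]; ring
  have e2 : mc (EE ξ F C) (ee s) x = α * (x^s * (Ih - ∫ w in Ioi x, EE ξ F C w * w^(-s-1))) + β * x⁻¹ * ∫ w in (1:ℝ)..x, EE ξ F C w := by
    have : Ih - (∫ w in Ioi x, EE ξ F C w * w^(-s-1)) = ∫ w in (1:ℝ)..x, EE ξ F C w * w^(-s-1) := by rw [hIh, splitI hx EI]; ring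
    rw [this, mc, ← intervalIntegral.integral_const_mul, ← intervalIntegral.integral_const_mul, ← intervalIntegral.integral_const_mul, ← intervalIntegral.integral_add (((Ei x hx).const_mul _).const_mul _) ((H.EE_i hF hx).const_mul _)]
    refine integral_congr fun w hw => ?_
    rw [uIcc_of_le hx] at hw
    have w0 : 0 < w := by linarith [hw.1]
    simp only [ee]
    rw [div_rpow x0.le w0.le, rpow_sub w0, rpow_neg w0.le, rpow_one, inv_div, hα, hβ]; field_simp; try ring
  have t2 : |∫ w in Ioi x, EE ξ F C w * w^(-s-1)| ≤ K * (x^(-s) * (1/s)) := by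
    rw [← norm_eq_abs]
    refine (MeasureTheory.norm_integral_le_of_norm_le ((integrableOn_Ioi_rpow_of_lt (show -s-1 < -1 by linarith) x0).const_mul K) ((ae_restrict_iff' measurableSet_Ioi).2 (ae_of_all _ fun w hw => ?_))).trans (le_of_eq ?_)
    · have hw : x < w := hw
      rw [norm_eq_abs, abs_mul, abs_of_pos (pos w _ (by linarith))]
      exact mul_le_mul_of_nonneg_right (hE w (by linarith)) (pos w _ (by linarith)).le
    · rw [MeasureTheory.integral_const_mul, integral_Ioi_rpow_of_lt (by linarith) x0, sub_add_cancel]; field_simp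
  have t3 : |∫ w in (1:ℝ)..x, EE ξ F C w| ≤ K * x := by
    have := norm_integral_le_of_norm_le_const (a := 1) (b := x) (f := EE ξ F C) (C := K) fun w hw => by rw [uIoc_of_le hx] at hw; exact hE w hw.1.le
    rw [abs_of_nonneg (by linarith)] at this
    exact this.trans (by nlinarith)
  have pre := H.precond (C := C) s0 (by linarith) hd hF hx
  rw [e2] at pre
  have key : F x - ν * x^s - mc κ (fun x => F x - ν * x^s) x = C * (1/(1+s) * x⁻¹) + EE ξ F C x + -(α * (x^s * ∫ w in Ioi x, EE ξ F C w * w^(-s-1))) + β * x⁻¹ * (∫ w in (1:ℝ)..x, EE ξ F C w) + -(ν * (x^s * ∫ w in Ioi x, w^(-s) * (κ w / w))) := by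
    rw [e1]
    linear_combination pre - x^s * nn
  have xs : x^s * x^(-s) = 1 := by rw [← rpow_add x0]; simp
  have b1 : |C * (1/(1+s) * x⁻¹)| ≤ |C| := by
    rw [abs_mul]
    refine mul_le_of_le_one_right (abs_nonneg _) ?_
    have : x⁻¹ ≤ 1 := inv_le_one_of_one_le₀ hx
    have h2 : 1/(1+s) ≤ 1 := by rw [div_le_one (by linarith)]; linarith
    rw [abs_of_nonneg (by positivity)]
    exact mul_le_one₀ h2 (by positivity) this
  have b3 : |-(α * (x^s * ∫ w in Ioi x, EE ξ F C w * w^(-s-1)))| ≤ |α| * (K * (1/s)) := by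
    rw [abs_neg, abs_mul, abs_mul, abs_of_pos (pos x s hx)]
    refine mul_le_mul_of_nonneg_left ?_ (abs_nonneg _)
    refine (mul_le_mul_of_nonneg_left t2 (pos x s hx).le).trans (le_of_eq ?_)
    linear_combination (K * (1/s)) * xs
  have b4 : |β * x⁻¹ * (∫ w in (1:ℝ)..x, EE ξ F C w)| ≤ |β| * K := by
    rw [mul_assoc, abs_mul, abs_mul, abs_of_pos (inv_pos.2 x0)]
    gcongr
    rw [inv_mul_le_iff₀ x0]; linarith
  have b5 : |-(ν * (x^s * ∫ w in Ioi x, w^(-s) * (κ w / w)))| ≤ |ν| * 0.993 := by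
    rw [abs_neg, abs_mul, abs_mul, abs_of_pos (pos x s hx)]
    gcongr
    refine (mul_le_mul_of_nonneg_left (tl x hx) (pos x s hx).le).trans (le_of_eq ?_)
    rw [← mul_assoc, xs, one_mul]
  rw [key]
  refine (abs_add_le _ _).trans (add_le_add ((abs_add_le _ _).trans (add_le_add ((abs_add_le _ _).trans (add_le_add ((abs_add_le _ _).trans (add_le_add b1 (hE x hx))) b3)) b4)) b5)
end Xi

def sg (n : ℕ) : ℕ := ∑ d ∈ n.divisors, d
def PP (n : ℕ) : Prop := 0 < n ∧ ∀ j ≤ sg n, ∃ s ⊆ n.divisors, ∑ d ∈ s, d = j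
def RR (y r : ℕ) : Prop := ∀ p, p.Prime → p ∣ r → y < p
theorem le_sg {n : ℕ} (h : 0 < n) : n ≤ sg n := Finset.single_le_sum (f := fun d => d) (fun _ _ => Nat.zero_le _) (Nat.mem_divisors_self n h.ne')
theorem PP.prac {n : ℕ} (h : PP n) : IsPractical n := ⟨h.1, fun m _ hm => h.2 m (hm.trans (le_sg h.1))⟩
theorem div_succ {m p k : ℕ} (hm : 0 < m) (hp : p.Prime) (hc : ¬ p ∣ m) :
    (m*p^(k+1)).divisors = (m*p^k).divisors ∪ m.divisors.image (· * p^(k+1)) ∧ Disjoint (m*p^k).divisors (m.divisors.image (· * p^(k+1))) := by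
  have p0 := hp.pos
  constructor
  · ext d
    simp only [Finset.mem_union, Finset.mem_image, Nat.mem_divisors]
    constructor
    · rintro ⟨h, -⟩
      by_cases hd : p^(k+1) ∣ d
      · obtain ⟨e, rfl⟩ := hd
        refine Or.inr ⟨e, ⟨?_, hm.ne'⟩, by ring⟩
        rw [mul_comm m] at h; exact Nat.dvd_of_mul_dvd_mul_left (by positivity) h
      · refine Or.inl ⟨?_, by positivity⟩
        obtain ⟨a, b, ha, hb, rfl⟩ := (Nat.dvd_mul).1 h
        obtain ⟨i, hi, rfl⟩ := (Nat.dvd_prime_pow hp).1 hb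
        refine mul_dvd_mul ha (pow_dvd_pow p ?_)
        by_contra hik
        have : i = k+1 := by omega
        subst this; exact hd (dvd_mul_left _ _)
    · rintro (⟨h, -⟩ | ⟨e, ⟨h, -⟩, rfl⟩)
      · exact ⟨h.trans (mul_dvd_mul_left _ (pow_dvd_pow _ (by omega))), by positivity⟩
      · exact ⟨mul_dvd_mul_right h _, by positivity⟩
  · rw [Finset.disjoint_left]
    intro d hd h
    obtain ⟨e, he, rfl⟩ := Finset.mem_image.1 h
    have := (dvd_mul_left _ e).trans (Nat.dvd_of_mem_divisors hd)
    rw [pow_succ, mul_comm m] at this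
    exact hc (Nat.dvd_of_mul_dvd_mul_left (by positivity) this)
theorem PP.ext {m p : ℕ} (h : PP m) (hp : p.Prime) (hc : ¬ p ∣ m) (hl : p ≤ sg m + 1) (k : ℕ) : PP (m*p^k) ∧ p^(k+1) ≤ sg (m*p^k) + 1 := by
  have p0 := hp.pos
  induction k with
  | zero => simpa using ⟨h, hl⟩
  | succ k ih =>
    obtain ⟨⟨i0, i1⟩, i2⟩ := ih
    obtain ⟨e, dj⟩ := div_succ (k := k) h.1 hp hc
    have inj : ∀ s : Finset ℕ, ∑ d ∈ s.image (· * p^(k+1)), d = (∑ d ∈ s, d) * p^(k+1) := fun s => by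
      rw [Finset.sum_image (fun a _ b _ hab => Nat.eq_of_mul_eq_mul_right (by positivity) hab), Finset.sum_mul]
    have sge : sg (m*p^(k+1)) = sg (m*p^k) + sg m * p^(k+1) := by rw [sg, e, Finset.sum_union dj, inj]; rfl
    refine ⟨⟨by have := h.1; positivity, fun j hj => ?_⟩, ?_⟩
    · set q := min (sg m) (j / p^(k+1)) with hq
      have a1 : q * p^(k+1) ≤ j := (Nat.mul_le_mul_right _ (min_le_right _ _)).trans (Nat.div_mul_le_self _ _)
      have a2 : j - q * p^(k+1) ≤ sg (m*p^k) := by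
        rcases min_choice (sg m) (j / p^(k+1)) with c | c
        · rw [hq, c]; omega
        · rw [hq, c]; have := Nat.lt_div_mul_add (a := j) (b := p^(k+1)) (by positivity); omega
      obtain ⟨s, hs, es⟩ := i1 _ a2
      obtain ⟨t, ht, et⟩ := h.2 q (min_le_left _ _)
      refine ⟨s ∪ t.image (· * p^(k+1)), e ▸ Finset.union_subset_union hs (Finset.image_subset_image ht), ?_⟩
      rw [Finset.sum_union (Finset.disjoint_of_subset_left hs (Finset.disjoint_of_subset_right (Finset.image_subset_image ht) dj)), inj, es, et]; omega
    · rw [sge]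
      have : (p-1) * p^(k+1) ≤ sg m * p^(k+1) := Nat.mul_le_mul_right _ (by omega)
      have h3 : p^(k+1+1) = (p-1) * p^(k+1) + p^(k+1) := by
        obtain ⟨a, rfl⟩ : ∃ a, p = a+1 := ⟨p-1, by omega⟩
        rw [Nat.add_sub_cancel]; ring
      omega
theorem dec_ex (n : ℕ) (hn : 0 < n) : ∃ m r, n = m*r ∧ PP m ∧ RR (sg m + 1) r ∧ ∀ q, q.Prime → q ∣ r → q ∣ n := by
  induction n using Nat.strong_induction_on with
  | _ n ih =>
  rcases Nat.lt_or_ge n 2 with h | h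
  · obtain rfl : n = 1 := by omega
    refine ⟨1, 1, rfl, ⟨one_pos, fun j hj => ?_⟩, fun p hp h => absurd (Nat.dvd_one.1 h) hp.ne_one, fun q _ h => h⟩
    have : j = 0 ∨ j = 1 := by simp [sg] at hj; omega
    rcases this with rfl | rfl
    · exact ⟨∅, by simp, by simp⟩
    · exact ⟨{1}, by simp, by simp⟩
  · have ne : n.primeFactors.Nonempty := Nat.nonempty_primeFactors.2 h
    obtain ⟨p, hpm, hpx⟩ := Finset.exists_max_image n.primeFactors id ne
    have hp := Nat.prime_of_mem_primeFactors hpm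
    obtain ⟨k, n', hc, rfl⟩ := Nat.exists_eq_pow_mul_and_not_dvd hn.ne' p hp.ne_one
    have n0 : 0 < n' := Nat.pos_of_ne_zero fun h => by simp [h] at hc
    have k0 : k ≠ 0 := by rintro rfl; simp at hpm; exact hc hpm.2.1
    have lt : n' < p^k*n' := by
      have : 1 < p^k := Nat.one_lt_pow k0 hp.one_lt
      nlinarith
    obtain ⟨m, r, rfl, hm, hr, hd⟩ := ih n' lt n0
    have dp : ∀ q, q.Prime → q ∣ r*p^k → q ∣ p^k*(m*r) := fun q _ h => by
      rw [show p^k*(m*r) = r*p^k*m by ring]; exact h.mul_right _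
    by_cases r1 : r = 1
    · subst r1
      rw [mul_one] at *
      by_cases hl : p ≤ sg m + 1
      · exact ⟨m*p^k, 1, by ring, (hm.ext hp hc hl k).1, fun q hq h => absurd (Nat.dvd_one.1 h) hq.ne_one, fun q hq h => h.trans (one_dvd _)⟩
      · refine ⟨m, p^k, by ring, hm, fun q hq h => ?_, fun q hq h => h.mul_right _⟩
        rw [(Nat.prime_dvd_prime_iff_eq hq hp).1 (hq.dvd_of_dvd_pow h)]; omega
    · refine ⟨m, r*p^k, by ring, hm, fun q hq h => ?_, dp⟩
      rcases (Nat.Prime.dvd_mul hq).1 h with h | h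
      · exact hr q hq h
      · rw [(Nat.prime_dvd_prime_iff_eq hq hp).1 (hq.dvd_of_dvd_pow h)]
        have hq' := Nat.minFac_prime r1
        refine (hr _ hq' (Nat.minFac_dvd r)).trans_le (hpx _ (Nat.mem_primeFactors.2 ⟨hq', ?_, hn.ne'⟩))
        exact ((Nat.minFac_dvd r).mul_left _).mul_left _
theorem dec_B {d e : ℕ} (h : IsPractical (d*e)) (he : RR (sg d + 1) e) : e = 1 := by
  by_contra e1
  have d0 : 0 < d := Nat.pos_of_ne_zero fun h0 => by have := h.1; simp [h0] at this
  have e0 : 0 < e := Nat.pos_of_ne_zero fun h0 => by have := h.1; simp [h0] at this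
  have hq' := Nat.minFac_prime e1
  have : sg d + 1 ≤ d*e := by
    have := he _ hq' (Nat.minFac_dvd e)
    have := Nat.minFac_le e0
    nlinarith
  obtain ⟨s, hs, es⟩ := h.2 _ (by omega) this
  have hs2 : s ⊆ d.divisors := fun t ht => by
    have hle : t ≤ sg d + 1 := es ▸ Finset.single_le_sum (f := fun d => d) (fun _ _ => Nat.zero_le _) ht
    have hd := Nat.dvd_of_mem_divisors (hs ht)
    refine Nat.mem_divisors.2 ⟨(Nat.Coprime.dvd_of_dvd_mul_right (Nat.coprime_of_dvd fun p hp h1 h2 => ?_) hd), d0.ne'⟩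
    have := he p hp h2
    have := Nat.le_of_dvd (Nat.pos_of_mem_divisors (hs ht)) h1
    omega
  have := Finset.sum_le_sum_of_subset (f := fun d => d) hs2
  rw [es] at this
  have : sg d + 1 ≤ sg d := this
  omega
theorem prac_PP {n : ℕ} (h : IsPractical n) : PP n := by
  obtain ⟨m, r, rfl, hm, hr, -⟩ := dec_ex n h.1
  rw [dec_B h hr, mul_one]; exact hm
theorem RR.cop {m r y : ℕ} (hm : 0 < m) (hy : sg m ≤ y) (h : RR y r) : Nat.Coprime m r :=
  Nat.coprime_of_dvd fun p hp h1 h2 => by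
    have := h p hp h2
    have := (Nat.le_of_dvd hm h1).trans (le_sg hm)
    omega
theorem dec_un {m r m' r' : ℕ} (hm : IsPractical m) (hm' : IsPractical m') (hr : RR (sg m + 1) r) (hr' : RR (sg m' + 1) r')
    (e : m*r = m'*r') (hs : sg m ≤ sg m') : m = m' := by
  have := (hr'.cop hm.1 (by omega)).dvd_of_dvd_mul_right (Dvd.intro _ e)
  obtain ⟨t, rfl⟩ := this
  have : r = t*r' := Nat.eq_of_mul_eq_mul_left hm.1 (by rw [e]; ring)
  rw [dec_B hm' fun p hp h => hr p hp (this ▸ h.mul_right _), mul_one]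
open Classical in
noncomputable def Phi (X : ℝ) (y : ℕ) : ℝ := ∑ r ∈ (Finset.Icc 1 ⌊X⌋₊).filter (RR y), (r.divisors.card : ℝ)
noncomputable def DD (X : ℝ) : ℝ := ∑ r ∈ Finset.Icc 1 ⌊X⌋₊, (r.divisors.card : ℝ)
noncomputable def aa (m : ℕ) : ℝ := open Classical in if IsPractical m then (m.divisors.card : ℝ) else 0
theorem main_id (X : ℝ) : DD X = ∑ m ∈ Finset.Icc 1 ⌊X⌋₊, aa m * Phi (X/m) (sg m + 1) := by
  classical
  have h1 : ∀ m ∈ Finset.Icc 1 ⌊X⌋₊, aa m * Phi (X/m) (sg m + 1) = if IsPractical m then ∑ r ∈ (Finset.Icc 1 ⌊X/m⌋₊).filter (RR (sg m + 1)), ((m*r).divisors.card : ℝ) else 0 := fun m _ => by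
    by_cases hm : IsPractical m
    · simp only [aa, hm, if_true, Phi, Finset.mul_sum]
      refine Finset.sum_congr rfl fun r hr => ?_
      rw [Nat.Coprime.card_divisors_mul (RR.cop hm.1 (by omega) (Finset.mem_filter.1 hr).2)]; push_cast; rfl
    · simp [aa, hm]
  rw [Finset.sum_congr rfl h1, ← Finset.sum_filter, Finset.sum_sigma', DD]
  symm
  refine Finset.sum_bij (fun x _ => x.1*x.2) ?_ ?_ ?_ ?_
  · rintro ⟨m, r⟩ h
    simp only [Finset.mem_sigma, Finset.mem_filter, Finset.mem_Icc, Nat.floor_div_natCast] at h ⊢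
    exact ⟨Nat.mul_pos h.1.1.1 h.2.1.1, by rw [mul_comm]; exact (Nat.le_div_iff_mul_le h.1.1.1).1 h.2.1.2⟩
  · rintro ⟨m, r⟩ h ⟨m', r'⟩ h' e
    simp only [Finset.mem_sigma, Finset.mem_filter, Finset.mem_Icc] at h h' e
    have : m = m' := (le_total (sg m) (sg m')).elim (dec_un h.1.2 h'.1.2 h.2.2 h'.2.2 e) fun hh => (dec_un h'.1.2 h.1.2 h'.2.2 h.2.2 e.symm hh).symm
    subst this
    have : r = r' := Nat.eq_of_mul_eq_mul_left h.1.1.1 e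
    rw [this]
  · intro n hn
    rw [Finset.mem_Icc] at hn
    obtain ⟨m, r, rfl, hm, hr, -⟩ := dec_ex n hn.1
    have r0 : 0 < r := Nat.pos_of_ne_zero fun h0 => by simp [h0] at hn
    have m0 := hm.1
    refine ⟨⟨m, r⟩, ?_, rfl⟩
    simp only [Finset.mem_sigma, Finset.mem_filter, Finset.mem_Icc, Nat.floor_div_natCast]
    exact ⟨⟨⟨m0, by nlinarith⟩, hm.prac⟩, ⟨r0, (Nat.le_div_iff_mul_le m0).2 (by linarith)⟩, hr⟩
  · intro _ _; rfl
theorem Tprac_eq (X : ℝ) : Tprac X = ∑ m ∈ Finset.Icc 1 ⌊X⌋₊, aa m := by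
  rw [Tprac, Finset.sum_filter]; rfl

noncomputable def Hn (n : ℕ) (s : ℂ) : ℂ := (s-1)*((n+2:ℕ):ℂ)^(-s) + ((n+2:ℕ):ℂ)^(1-s) - ((n+1:ℕ):ℂ)^(1-s)
noncomputable def ZZ (s : ℂ) : ℂ := s + ∑' n, Hn n s
theorem cpd (c : ℂ) {x : ℝ} (hx : 0 < x) : HasDerivAt (fun y : ℝ => (y:ℂ)^c) (c * (x:ℂ)^(c-1)) x := by
  simpa using ((hasDerivAt_id (x:ℂ)).cpow_const (c := c) (Or.inl (by simpa using hx))).comp_ofReal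
theorem Hn_le (n : ℕ) {s : ℂ} (hs : 0 ≤ s.re) : ‖Hn n s‖ ≤ ‖s-1‖ * ‖s‖ * ((n+1:ℕ):ℝ)^(-s.re-1) := by
  set a : ℝ := ((n+1:ℕ):ℝ) with ha
  have a0 : 0 < a := by positivity
  have cv := convex_Icc (𝕜 := ℝ) a (a+1)
  have m1 : a ∈ Icc a (a+1) := ⟨le_rfl, by linarith⟩
  have m2 : a+1 ∈ Icc a (a+1) := ⟨by linarith, le_rfl⟩
  have h1 : ∀ x ∈ Icc a (a+1), ‖(x:ℂ)^(-s) - ((a+1:ℝ):ℂ)^(-s)‖ ≤ ‖s‖ * a^(-s.re-1) := fun x hx => by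
    have x0 : 0 < x := by linarith [hx.1]
    have := cv.norm_image_sub_le_of_norm_hasDerivWithin_le (f := fun y : ℝ => (y:ℂ)^(-s)) (f' := fun x => -s * (x:ℂ)^(-s-1)) (C := ‖s‖ * a^(-s.re-1)) (fun y hy => (cpd (-s) (by linarith [hy.1])).hasDerivWithinAt) (fun y hy => ?_) m2 hx
    · refine this.trans (mul_le_of_le_one_right (by positivity) ?_)
      rw [norm_eq_abs, abs_le]; constructor <;> linarith [hx.1, hx.2]
    · have y0 : 0 < y := by linarith [hy.1]
      rw [norm_mul, norm_neg, Complex.norm_cpow_eq_rpow_re_of_pos y0]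
      gcongr
      simp only [Complex.sub_re, Complex.neg_re, Complex.one_re]
      exact rpow_le_rpow_of_nonpos a0 hy.1 (by linarith)
  have := cv.norm_image_sub_le_of_norm_hasDerivWithin_le (f := fun y : ℝ => (y:ℂ)^(1-s) + (s-1)*((a+1:ℝ):ℂ)^(-s)*(y:ℂ)) (f' := fun x => (1-s) * (x:ℂ)^(-s) + (s-1)*((a+1:ℝ):ℂ)^(-s)) (C := ‖s-1‖ * (‖s‖ * a^(-s.re-1))) (fun y hy => ?_) (fun y hy => ?_) m1 m2
  · refine le_trans (le_of_eq ?_) (this.trans (le_of_eq ?_))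
    · rw [Hn]; congr 1; rw [ha]; push_cast; ring_nf
    · simp; ring
  · have := (cpd (1-s) (x := y) (by linarith [hy.1])).add (((hasDerivAt_id (y:ℂ)).comp_ofReal).const_mul ((s-1)*((a+1:ℝ):ℂ)^(-s)))
    simp only [id, mul_one, sub_sub_cancel_left, show 1 - s - 1 = -s by ring] at this
    exact this.hasDerivWithinAt
  · rw [show (1-s) * (y:ℂ)^(-s) + (s-1)*((a+1:ℝ):ℂ)^(-s) = -((s-1) * ((y:ℂ)^(-s) - ((a+1:ℝ):ℂ)^(-s))) by ring, norm_neg, norm_mul]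
    gcongr; exact h1 y hy
theorem smn {p : ℝ} (hp : p < -1) : Summable (fun n : ℕ => ((n+1:ℕ):ℝ)^p) := (summable_nat_add_iff 1).2 (Real.summable_nat_rpow.2 hp)
theorem Hn_sum {s : ℂ} (hs : 0 < s.re) : Summable (fun n => Hn n s) :=
  Summable.of_norm_bounded ((smn (by linarith)).mul_left (‖s-1‖ * ‖s‖)) fun n => Hn_le n hs.le
theorem ZZ_fin (s : ℂ) (N : ℕ) : s + ∑ n ∈ Finset.range N, Hn n s = (s-1) * ∑ n ∈ Finset.range (N+1), ((n+1:ℕ):ℂ)^(-s) + ((N+1:ℕ):ℂ)^(1-s) := by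
  induction N with
  | zero => simp
  | succ N ih => rw [Finset.sum_range_succ, ← add_assoc, ih, Finset.sum_range_succ _ (N+1), Hn]; push_cast; ring_nf
theorem ZZ_zeta {s : ℂ} (hs : 1 < s.re) : ZZ s = (s-1) * riemannZeta s := by
  have t1 : Tendsto (fun N => s + ∑ n ∈ Finset.range N, Hn n s) atTop (𝓝 (ZZ s)) := ((Hn_sum (by linarith)).hasSum.tendsto_sum_nat).const_add s
  have hz : HasSum (fun n : ℕ => ((n+1:ℕ):ℂ)^(-s)) (riemannZeta s) := by
    rw [zeta_eq_tsum_one_div_nat_add_one_cpow hs]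
    have : Summable (fun n : ℕ => ((n+1:ℕ):ℂ)^(-s)) := (summable_nat_add_iff (f := fun n : ℕ => (n:ℂ)^(-s)) 1).2 (by simpa [Complex.cpow_neg] using Complex.summable_one_div_nat_cpow.2 hs)
    convert this.hasSum using 4 with n
    rw [Complex.cpow_neg, one_div]; push_cast; rfl
  have t2 : Tendsto (fun N : ℕ => (s-1) * ∑ n ∈ Finset.range (N+1), ((n+1:ℕ):ℂ)^(-s) + ((N+1:ℕ):ℂ)^(1-s)) atTop (𝓝 ((s-1) * riemannZeta s + 0)) := by
    refine ((hz.tendsto_sum_nat.comp (tendsto_add_atTop_nat 1)).const_mul _).add ?_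
    rw [tendsto_zero_iff_norm_tendsto_zero]
    have : ∀ N : ℕ, ‖((N+1:ℕ):ℂ)^(1-s)‖ = ((N+1:ℕ):ℝ)^(-(s.re-1)) := fun N => by
      rw [Complex.norm_natCast_cpow_of_pos (by omega)]; simp
    simp only [this]
    exact (tendsto_rpow_neg_atTop (by linarith)).comp (tendsto_natCast_atTop_atTop.comp (tendsto_add_atTop_nat 1))
  rw [add_zero] at t2
  exact tendsto_nhds_unique t1 (by simpa only [ZZ_fin] using t2)
theorem ZZ_diff {s : ℂ} (hs : 1/2 < s.re) : DifferentiableAt ℂ ZZ s := by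
  have hU : IsOpen ({z : ℂ | 1/2 < z.re} ∩ Metric.ball 0 (‖s‖+1)) := (isOpen_lt continuous_const Complex.continuous_re).inter Metric.isOpen_ball
  have := Complex.differentiableOn_tsum_of_summable_norm (F := Hn) ((smn (p := -(3/2)) (by norm_num)).mul_left ((‖s‖+1+1) * (‖s‖+1))) (fun n z hz => DifferentiableAt.differentiableWithinAt ?_) hU (fun n z hz => ?_)
  · exact differentiableAt_id.add ((this s ⟨hs, by simp⟩).differentiableAt (hU.mem_nhds ⟨hs, by simp⟩))
  · unfold Hn
    have h1 : ((n+2:ℕ):ℂ) ≠ 0 := by exact_mod_cast (by omega : n+2 ≠ 0)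
    have h2 : ((n+1:ℕ):ℂ) ≠ 0 := by exact_mod_cast (by omega : n+1 ≠ 0)
    refine DifferentiableAt.sub (DifferentiableAt.add (DifferentiableAt.mul (by fun_prop) ?_) ?_) ?_
    all_goals exact DifferentiableAt.const_cpow (by fun_prop) (Or.inl (by assumption))
  · have z1 : 1/2 < z.re := hz.1
    have z2 : ‖z‖ < ‖s‖+1 := by simpa using hz.2
    refine (Hn_le n (by linarith)).trans ?_
    gcongr
    · exact (norm_sub_le _ _).trans (by simp; linarith)
    · push_cast; linarith
    · linarith
theorem ZZ_ub : ∃ K, 0 < K ∧ ∀ s : ℂ, 79/80 ≤ s.re → s.re ≤ 4 → 1 ≤ |s.im| → ‖ZZ s‖ ≤ K * (|s.im| * |s.im|^(1/40:ℝ)) := by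
  set S := ∑' n : ℕ, ((n+1:ℕ):ℝ)^(-81/80:ℝ) with hS
  have sS : Summable (fun n : ℕ => ((n+1:ℕ):ℝ)^(-81/80:ℝ)) := smn (by norm_num)
  have S0 : 0 ≤ S := tsum_nonneg fun n => by positivity
  refine ⟨4*(3*S)+3+20*(3*S), by positivity, fun s h1 h2 ht => ?_⟩
  set t := |s.im| with htt
  set N := ⌈t⌉₊ with hN
  set M : ℝ := ((N+1:ℕ):ℝ) with hM
  have n1 : t ≤ N := Nat.le_ceil t
  have n2 : (N:ℝ) < t + 1 := Nat.ceil_lt_add_one (by linarith)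
  have M1 : t ≤ M := by rw [hM]; push_cast; linarith
  have M2 : M ≤ 3*t := by rw [hM]; push_cast; linarith
  have M0 : 0 < M := by linarith
  have m1 : 1 ≤ M := by linarith
  have s1 : ‖s‖ ≤ 5*t := (Complex.norm_le_abs_re_add_abs_im s).trans (by rw [abs_of_nonneg (by linarith)]; linarith)
  have s2 : ‖s-1‖ ≤ 4*t := (Complex.norm_le_abs_re_add_abs_im _).trans (by
    have : |(s-1).re| ≤ 3 := by simp; rw [abs_le]; constructor <;> linarith
    have : |(s-1).im| = t := by simp [htt]
    linarith)
  have Mp : M^(1/40:ℝ) ≤ 3 * t^(1/40:ℝ) := by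
    refine (rpow_le_rpow M0.le M2 (by norm_num)).trans ?_
    rw [mul_rpow (by norm_num) (by linarith)]
    gcongr
    calc (3:ℝ)^(1/40:ℝ) ≤ 3^(1:ℝ) := rpow_le_rpow_of_exponent_le (by norm_num) (by norm_num)
      _ = 3 := by simp
  have e1 : ZZ s = (s-1) * ∑ n ∈ Finset.range (N+1), ((n+1:ℕ):ℂ)^(-s) + ((N+1:ℕ):ℂ)^(1-s) + ∑' n, Hn (n+N) s := by
    rw [← ZZ_fin, ZZ, add_assoc, (Hn_sum (by linarith)).sum_add_tsum_nat_add]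
  have b1 : ‖∑ n ∈ Finset.range (N+1), ((n+1:ℕ):ℂ)^(-s)‖ ≤ M^(1/40:ℝ) * S := by
    refine (norm_sum_le _ _).trans ((Finset.sum_le_sum fun n hn => ?_).trans ((Finset.mul_sum _ (fun n : ℕ => ((n+1:ℕ):ℝ)^(-81/80:ℝ)) _).symm.le.trans (mul_le_mul_of_nonneg_left (sS.sum_le_tsum (Finset.range (N+1)) fun _ _ => by positivity) (by positivity))))
    have hn' : n ≤ N := Nat.lt_succ_iff.1 (Finset.mem_range.1 hn)
    have p1 : (1:ℝ) ≤ ((n+1:ℕ):ℝ) := by push_cast; linarith [(Nat.cast_nonneg n : (0:ℝ) ≤ n)]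
    rw [Complex.norm_natCast_cpow_of_pos (by omega), Complex.neg_re]
    calc ((n+1:ℕ):ℝ)^(-s.re) ≤ ((n+1:ℕ):ℝ)^((1/40:ℝ)+(-81/80)) := rpow_le_rpow_of_exponent_le p1 (by linarith)
      _ = ((n+1:ℕ):ℝ)^(1/40:ℝ) * ((n+1:ℕ):ℝ)^(-81/80:ℝ) := rpow_add (by linarith) _ _
      _ ≤ _ := by gcongr; rw [hM]; exact_mod_cast (by omega)
  have b2 : ‖((N+1:ℕ):ℂ)^(1-s)‖ ≤ M^(1/40:ℝ) := by
    rw [Complex.norm_natCast_cpow_of_pos (by omega)]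
    exact rpow_le_rpow_of_exponent_le m1 (by simp; linarith)
  have b3 : ‖∑' n, Hn (n+N) s‖ ≤ ‖s-1‖*‖s‖*(M^(-1:ℝ) * M^(1/40:ℝ)) * S := by
    have : Summable fun n : ℕ => ((n+N+1:ℕ):ℝ)^(-81/80:ℝ) := (summable_nat_add_iff (f := fun n : ℕ => ((n+1:ℕ):ℝ)^(-81/80:ℝ)) N).2 sS
    refine (tsum_of_norm_bounded (g := fun n : ℕ => ‖s-1‖*‖s‖*(M^(-1:ℝ) * M^(1/40:ℝ)) * ((n+N+1:ℕ):ℝ)^(-81/80:ℝ)) (this.mul_left _).hasSum fun n => ?_).trans ?_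
    · refine (Hn_le _ (by linarith)).trans ?_
      rw [mul_assoc _ (M^(-1:ℝ) * _)]
      gcongr
      have p1 : M ≤ ((n+N+1:ℕ):ℝ) := by rw [hM]; exact_mod_cast (by omega)
      rw [← rpow_add M0]
      calc ((n+N+1:ℕ):ℝ)^(-s.re-1) ≤ ((n+N+1:ℕ):ℝ)^((-1+1/40:ℝ)+(-81/80)) := rpow_le_rpow_of_exponent_le (m1.trans p1) (by linarith)
        _ = ((n+N+1:ℕ):ℝ)^(-1+1/40:ℝ) * ((n+N+1:ℕ):ℝ)^(-81/80:ℝ) := rpow_add (by linarith) _ _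
        _ ≤ _ := mul_le_mul_of_nonneg_right (rpow_le_rpow_of_nonpos M0 p1 (by norm_num)) (by positivity)
    · rw [tsum_mul_left]
      gcongr
      rw [hS, ← sS.sum_add_tsum_nat_add N]
      exact le_add_of_nonneg_left (Finset.sum_nonneg fun n _ => by positivity)
  have tp : 0 ≤ t^(1/40:ℝ) := by positivity
  have b4 : t * M^(-1:ℝ) ≤ 1 := by rw [rpow_neg_one, ← div_eq_mul_inv, div_le_one M0]; exact M1
  rw [e1]
  refine (norm_add₃_le ..).trans ?_
  rw [norm_mul]
  have c1 : ‖s-1‖ * ‖∑ n ∈ Finset.range (N+1), ((n+1:ℕ):ℂ)^(-s)‖ ≤ (4*t) * ((3 * t^(1/40:ℝ)) * S) := by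
    gcongr; exact b1.trans (by gcongr)
  have c2 : ‖((N+1:ℕ):ℂ)^(1-s)‖ ≤ 3 * (t * t^(1/40:ℝ)) := by nlinarith [b2, Mp]
  have c3 : ‖s-1‖*‖s‖*(M^(-1:ℝ) * M^(1/40:ℝ)) * S ≤ 20*(3*S) * (t * t^(1/40:ℝ)) := by
    calc ‖s-1‖*‖s‖*(M^(-1:ℝ) * M^(1/40:ℝ)) * S ≤ (4*t)*(5*t)*(M^(-1:ℝ) * (3 * t^(1/40:ℝ))) * S := by gcongr
      _ = 20*(3*S) * (t * t^(1/40:ℝ)) * (t * M^(-1:ℝ)) := by ring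
      _ ≤ _ := mul_le_of_le_one_right (by positivity) b4
  calc _ ≤ (4*t) * ((3 * t^(1/40:ℝ)) * S) + 3 * (t * t^(1/40:ℝ)) + 20*(3*S) * (t * t^(1/40:ℝ)) := add_le_add (add_le_add c1 c2) (b3.trans c3)
    _ = _ := by ring

theorem shc {f : ℂ → ℂ} {s : ℂ} (h : ContinuousAt f s) : Tendsto (fun x : ℝ => f (s + x)) (𝓝[>] 0) (𝓝 (f s)) := by
  have c : Continuous (fun x : ℝ => s + (x:ℂ)) := by fun_prop
  have := (c.tendsto 0).mono_left (nhdsWithin_le_nhds (s := Ioi 0))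
  simp only [Complex.ofReal_zero, add_zero] at this
  exact h.tendsto.comp this
theorem ZZ_zeta' {s : ℂ} (hs : 1 ≤ s.re) (h1 : s ≠ 1) : ZZ s = (s-1) * riemannZeta s :=
  tendsto_nhds_unique_of_eventuallyEq (shc (ZZ_diff (by linarith)).continuousAt) (shc (f := fun s => (s-1) * riemannZeta s) (ContinuousAt.mul (by fun_prop) (differentiableAt_riemannZeta h1).continuousAt))
    (eventually_nhdsWithin_of_forall fun x hx => ZZ_zeta (by have : 0 < x := hx; simp; linarith))
theorem ZZ_one : ZZ 1 = 1 := by simp [ZZ, Hn]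
theorem ZZ_ne {s : ℂ} (hs : 1 ≤ s.re) : ZZ s ≠ 0 := by
  by_cases h : s = 1
  · simp [h, ZZ_one]
  · rw [ZZ_zeta' hs h]; exact mul_ne_zero (sub_ne_zero.2 h) (riemannZeta_ne_zero_of_one_le_re hs)
theorem cau {f : ℂ → ℂ} {c : ℂ} {R C : ℝ} (n : ℕ) (hR : 0 < R) (hf : ∀ z ∈ Metric.closedBall c R, DifferentiableAt ℂ f z) (hC : ∀ z ∈ Metric.closedBall c R, ‖f z‖ ≤ C) :
    ‖iteratedDeriv n f c‖ ≤ n.factorial * C / R ^ n :=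
  Complex.norm_iteratedDeriv_le_of_forall_mem_sphere_norm_le n hR
    ⟨fun z hz => (hf z (Metric.ball_subset_closedBall hz)).differentiableWithinAt, fun z hz => (hf z (Metric.closure_ball_subset_closedBall hz)).continuousAt.continuousWithinAt⟩
    fun z hz => hC z (Metric.sphere_subset_closedBall hz)
theorem ball_b {z c : ℂ} {R : ℝ} (h : z ∈ Metric.closedBall c R) : c.re - R ≤ z.re ∧ z.re ≤ c.re + R ∧ |c.im| - R ≤ |z.im| ∧ |z.im| ≤ |c.im| + R := by
  rw [mem_closedBall_iff_norm] at h
  have a := abs_le.1 ((Complex.abs_re_le_norm _).trans h)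
  have b := abs_le.1 ((abs_abs_sub_abs_le _ _).trans ((Complex.abs_im_le_norm (z-c)).trans h))
  simp at a
  exact ⟨by linarith, by linarith, by linarith, by linarith⟩
theorem Y_le {a b : ℝ} (ha : 0 < a) (h : b ≤ 2*a) (hb : 0 ≤ b) : b^(1/40:ℝ) ≤ 2 * a^(1/40:ℝ) := by
  refine (rpow_le_rpow hb h (by norm_num)).trans ?_
  rw [mul_rpow (by norm_num) ha.le]
  gcongr
  calc (2:ℝ)^(1/40:ℝ) ≤ 2^(1:ℝ) := rpow_le_rpow_of_exponent_le (by norm_num) (by norm_num)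
    _ = 2 := by simp
theorem ZZ_der : ∃ K, 0 < K ∧ ∀ s : ℂ, 159/160 ≤ s.re → s.re ≤ 3 → 2 ≤ |s.im| → ‖deriv ZZ s‖ ≤ K * (|s.im| * |s.im|^(1/40:ℝ)) := by
  obtain ⟨K, K0, hK⟩ := ZZ_ub
  refine ⟨640*K, by positivity, fun s h1 h2 ht => ?_⟩
  have := cau (f := ZZ) (c := s) (R := 1/160) (C := K * ((2*|s.im|) * (2*|s.im|^(1/40:ℝ)))) 1 (by norm_num) (fun z hz => ZZ_diff (by have := ball_b hz; linarith)) (fun z hz => ?_)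
  · simp at this ⊢; linarith
  · obtain ⟨a, b, c, d⟩ := ball_b hz
    refine (hK z (by linarith) (by linarith) (by linarith)).trans ?_
    have := Y_le (b := |z.im|) (a := |s.im|) (by linarith) (by linarith) (abs_nonneg _)
    gcongr; linarith
theorem ZZ_lb0 : ∃ c, 0 < c ∧ ∀ x y : ℝ, 0 < x → x ≤ 2 → 2 ≤ |y| → c^4 * x^3 * |y|^4 ≤ ‖ZZ (1+x+Complex.I*y)‖^4 * |y|^(1/40:ℝ) := by
  obtain ⟨K, K0, hK⟩ := ZZ_ub
  obtain ⟨K1, hK1⟩ := (isCompact_Icc (a := (0:ℝ)) (b := 2)).exists_bound_of_continuousOn (f := fun x : ℝ => ZZ (1+x)) (fun x hx => ContinuousAt.continuousWithinAt (ContinuousAt.comp (f := fun x : ℝ => 1+(x:ℂ)) (ZZ_diff (by simp; linarith [hx.1])).continuousAt (by fun_prop)))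
  have k1 : 0 < K1 := lt_of_lt_of_le (by simp [ZZ_one]) (hK1 0 (by simp))
  have cc0 : 0 < 1/(K1^3 * (K*2)) := by positivity
  obtain ⟨c, c0, hc⟩ : ∃ c : ℝ, 0 < c ∧ c^4 = 1/(K1^3 * (K*2)) := ⟨(1/(K1^3 * (K*2)))^(1/4:ℝ), by positivity, by rw [← rpow_natCast, ← rpow_mul cc0.le]; norm_num⟩
  refine ⟨c, c0, fun x y x0 x2 hy => ?_⟩
  have h := DirichletCharacter.norm_LFunction_product_ge_one (1 : DirichletCharacter ℂ 1) x0 y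
  rw [DirichletCharacter.LFunctionTrivChar, DirichletCharacter.LFunction_modOne_eq, DirichletCharacter.LFunction_modOne_eq, norm_mul, norm_mul, norm_pow, norm_pow] at h
  have z : ∀ w : ℂ, 1 < (1+w).re → ‖ZZ (1+w)‖ = ‖w‖ * ‖riemannZeta (1+w)‖ := fun w hw => by rw [ZZ_zeta hw, add_sub_cancel_left, norm_mul]
  have z0 := z x (by simpa using x0)
  have z1 := z (x+Complex.I*y) (by simpa using x0)
  have z2 := z (x+2*Complex.I*y) (by simpa using x0)
  rw [← add_assoc] at z1 z2
  have n1 : |y| ≤ ‖(x:ℂ)+Complex.I*y‖ := by simpa using Complex.abs_im_le_norm ((x:ℂ)+Complex.I*y)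
  have n2 : 2*|y| ≤ ‖(x:ℂ)+2*Complex.I*y‖ := by simpa [abs_mul] using Complex.abs_im_le_norm ((x:ℂ)+2*Complex.I*y)
  have n0 : ‖(x:ℂ)‖ = x := by simp [abs_of_pos x0]
  have u2 := hK (1+x+2*Complex.I*y) (by simp; linarith) (by simp; linarith) (by simp [abs_mul]; linarith)
  have u0 := hK1 x ⟨x0.le, x2⟩
  have im2 : |(1+x+2*Complex.I*y : ℂ).im| = 2*|y| := by simp [abs_mul]
  rw [im2] at u2
  set A := ‖riemannZeta (1+x)‖
  set B := ‖riemannZeta (1+x+Complex.I*y)‖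
  set D := ‖riemannZeta (1+x+2*Complex.I*y)‖
  set Y := |y|^(1/40:ℝ)
  have y0 : 0 < |y| := by linarith
  have A1 : x * A ≤ K1 := by rw [← n0, ← z0]; exact u0
  have B1 : |y| * B ≤ ‖ZZ (1+x+Complex.I*y)‖ := by rw [z1]; gcongr
  have D1 : D ≤ K*2*Y := by
    have : (2 * |y|) * D ≤ (2 * |y|) * (K*2*Y) := by
      calc (2 * |y|) * D ≤ _ := mul_le_mul_of_nonneg_right n2 (norm_nonneg _)
        _ ≤ K * (2*|y| * (2*|y|)^(1/40:ℝ)) := z2 ▸ u2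
        _ ≤ K * (2*|y| * (2*Y)) := by gcongr; exact Y_le y0 le_rfl (by positivity)
        _ = _ := by ring
    exact le_of_mul_le_mul_left this (by positivity)
  have A0 : 0 ≤ A := norm_nonneg _
  have B0 : 0 ≤ B := norm_nonneg _
  have Y0 : 0 ≤ Y := by positivity
  rw [hc]
  calc 1/(K1^3 * (K*2)) * x^3 * |y|^4 ≤ 1/(K1^3 * (K*2)) * x^3 * |y|^4 * (A^3*B^4*D) := le_mul_of_one_le_right (by positivity) h
    _ = 1/(K1^3 * (K*2)) * (x*A)^3 * (|y| * B)^4 * D := by ring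
    _ ≤ 1/(K1^3 * (K*2)) * K1^3 * ‖ZZ (1+x+Complex.I*y)‖^4 * (K*2*Y) := by gcongr
    _ = _ := by field_simp
theorem ZZ_lb : ∃ q c, 0 < q ∧ q ≤ 1/160 ∧ 0 < c ∧ ∀ s : ℂ, 2 ≤ |s.im| → 1 - q/(|s.im|^(1/40:ℝ))^5 ≤ s.re → s.re ≤ 3 → c * (|s.im| / (|s.im|^(1/40:ℝ))^4) ≤ ‖ZZ s‖ := by
  obtain ⟨K, K0, hK⟩ := ZZ_der
  obtain ⟨c, c0, hc⟩ := ZZ_lb0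
  set p := min (1/160) (c/(4*K)) with hp
  have p0 : 0 < p := lt_min (by norm_num) (by positivity)
  have p1 : p ≤ 1/160 := min_le_left _ _
  have p2 : 4*K*p ≤ c := by have := min_le_right (1/160) (c/(4*K)); rw [le_div_iff₀ (by positivity)] at this; linarith
  refine ⟨p^4, c*p^3/2, by positivity, (pow_le_of_le_one p0.le (by linarith) (by norm_num)).trans p1, by positivity, fun s ht h1 h2 => ?_⟩
  set t := |s.im| with htt
  set Y := t^(1/40:ℝ) with hY
  have t0 : 0 < t := by linarith
  have Y1 : 1 ≤ Y := one_le_rpow (by linarith) (by norm_num)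
  set R := p^4/Y^5 with hR
  have R0 : 0 < R := by positivity
  have R1 : R ≤ 1/160 := by
    refine (div_le_self (by positivity) (one_le_pow₀ Y1)).trans ((pow_le_of_le_one p0.le (by linarith) (by norm_num)).trans p1)
  have big : ∀ x : ℝ, R ≤ x → x ≤ 2 → c*p^3*(t/Y^4) ≤ ‖ZZ (1+x+Complex.I*s.im)‖ := fun x hx hx2 => by
    have := hc x s.im (by linarith) hx2 ht
    rw [← htt, ← hY] at this
    refine le_of_pow_le_pow_left₀ (n := 4) (by norm_num) (norm_nonneg _) (le_of_mul_le_mul_right (a := Y) (le_trans ?_ this) (by linarith))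
    calc (c*p^3*(t/Y^4))^4*Y = c^4 * R^3 * t^4 := by rw [hR]; field_simp
      _ ≤ _ := by gcongr
  have es : ∀ σ : ℝ, (1:ℂ) + ((σ-1:ℝ):ℂ) + Complex.I*s.im = (σ:ℂ) + s.im * Complex.I := fun σ => by push_cast; ring
  have q0 : 0 ≤ t/Y^4 := by positivity
  rcases le_or_gt (1+R) s.re with h | h
  · have := big (s.re - 1) (by linarith) (by linarith)
    rw [es, Complex.re_add_im] at this
    refine le_trans ?_ this
    nlinarith [mul_nonneg (mul_nonneg c0.le (pow_pos p0 3).le) q0]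
  · have b := big R le_rfl (by linarith)
    have e1 : (1:ℂ) + R + Complex.I*s.im = ((1+R:ℝ):ℂ) + s.im * Complex.I := by push_cast; ring
    rw [e1] at b
    have mv := (convex_Icc (𝕜 := ℝ) (1-R) (1+R)).norm_image_sub_le_of_norm_hasDerivWithin_le (f := fun σ : ℝ => ZZ ((σ:ℂ) + s.im * Complex.I)) (f' := fun σ : ℝ => deriv ZZ ((σ:ℂ) + s.im * Complex.I)) (C := K * (t*Y)) (x := s.re) (y := 1+R)
      (fun σ hσ => ?_) (fun σ hσ => ?_) ⟨h1, h.le⟩ ⟨by linarith, le_rfl⟩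
    · have n1 : ‖1+R-s.re‖ ≤ 2*R := by rw [norm_eq_abs, abs_of_pos (by linarith)]; linarith
      have m2 := mv.trans (mul_le_mul_of_nonneg_left n1 (by positivity))
      simp only [Complex.re_add_im] at m2
      have tri := norm_sub_norm_le (ZZ (((1+R:ℝ):ℂ) + s.im * Complex.I)) (ZZ s)
      have : K*(t*Y)*(2*R) = 2*K*p*(p^3*(t/Y^4)) := by rw [hR]; field_simp
      have : 4*K*p*(p^3*(t/Y^4)) ≤ c*(p^3*(t/Y^4)) := mul_le_mul_of_nonneg_right p2 (by positivity)
      linarith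
    · have := (ZZ_diff (s := (σ:ℂ) + s.im * Complex.I) (by simp; linarith [hσ.1])).hasDerivAt
      have h2 := (this.comp (σ:ℂ) ((hasDerivAt_id (σ:ℂ)).add_const (s.im * Complex.I))).comp_ofReal
      simpa using h2.hasDerivWithinAt
    · have := hK ((σ:ℂ) + s.im * Complex.I) (by simp; linarith [hσ.1]) (by simp; linarith [hσ.2]) (by simpa using ht)
      have e : |((σ:ℂ)+s.im*Complex.I).im| = t := by simp [htt]
      rw [e] at this; exact this
noncomputable def WW (s : ℂ) : ℂ := (-(deriv ZZ s / ZZ s) - 1)/(s*(s+1))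
theorem WW_diff {s : ℂ} (hs : 1/2 < s.re) (hz : ZZ s ≠ 0) : DifferentiableAt ℂ WW s := by
  have hU : IsOpen {z : ℂ | 1/2 < z.re} := isOpen_lt continuous_const Complex.continuous_re
  have d : DifferentiableOn ℂ ZZ {z : ℂ | 1/2 < z.re} := fun z hz => (ZZ_diff hz).differentiableWithinAt
  have d2 := (d.deriv hU).differentiableAt (hU.mem_nhds hs)
  have s0 : s*(s+1) ≠ 0 := mul_ne_zero (fun h => by simp [h] at hs; linarith) (fun h => by have := congrArg Complex.re h; simp at this; linarith)
  exact (((d2.div (ZZ_diff hs) hz).neg).sub_const 1).div (by fun_prop) s0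
theorem WW_big : ∃ K, 0 ≤ K ∧ ∀ n ≤ 2, ∀ s : ℂ, 1 ≤ s.re → s.re ≤ 2 → 3 ≤ |s.im| → ‖iteratedDeriv n WW s‖ ≤ K * |s.im|^(-3/2:ℝ) := by
  obtain ⟨K, K0, hK⟩ := ZZ_der
  obtain ⟨q, c, q0, q1, c0, hc⟩ := ZZ_lb
  have W0 : ∀ s : ℂ, 2 ≤ |s.im| → 1 - q/(|s.im|^(1/40:ℝ))^5 ≤ s.re → s.re ≤ 3 → 1/2 < s.re ∧ ZZ s ≠ 0 ∧ ‖WW s‖ ≤ (K/c+1) * (|s.im|^(1/40:ℝ))^5 / |s.im|^2 := fun s ht h1 h2 => by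
    have a := hc s ht h1 h2
    set t := |s.im|
    set Y := t^(1/40:ℝ)
    have t0 : 0 < t := by linarith
    have Y1 : 1 ≤ Y := one_le_rpow (by linarith) (by norm_num)
    have r1 : q/Y^5 ≤ q := div_le_self q0.le (one_le_pow₀ Y1)
    have z0 : 0 < ‖ZZ s‖ := lt_of_lt_of_le (by positivity) a
    refine ⟨by linarith, norm_pos_iff.1 z0, ?_⟩
    have b := hK s (by linarith) h2 ht
    have d1 : ‖deriv ZZ s / ZZ s‖ ≤ K/c*Y^5 := by
      rw [norm_div, div_le_iff₀ z0]
      calc _ ≤ K*(t*Y) := b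
        _ = K/c*Y^5*(c*(t/Y^4)) := by field_simp
        _ ≤ _ := by gcongr
    rw [WW, norm_div, norm_mul]
    have d2 : ‖-(deriv ZZ s / ZZ s) - 1‖ ≤ (K/c+1)*Y^5 := by
      refine (norm_sub_le _ _).trans ?_
      rw [norm_neg, norm_one]; nlinarith [one_le_pow₀ Y1 (n := 5)]
    have n1 : t ≤ ‖s‖ := Complex.abs_im_le_norm s
    have n2 : t ≤ ‖s+1‖ := by simpa using Complex.abs_im_le_norm (s+1)
    rw [pow_two t]; gcongr
  refine ⟨2*((K/c+1)*128)*(32/q)^2, by positivity, fun n hn s h1 h2 ht => ?_⟩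
  set t := |s.im|
  set Y := t^(1/40:ℝ) with hY
  have t0 : 0 < t := by linarith
  have Y1 : 1 ≤ Y := one_le_rpow (by linarith) (by norm_num)
  have Yq : 1 ≤ 32*Y^5/q := by rw [le_div_iff₀ q0]; nlinarith [one_le_pow₀ Y1 (n := 5)]
  have Rq : q/(32*Y^5) ≤ 1 := by rw [div_le_one (by positivity)]; nlinarith [one_le_pow₀ Y1 (n := 5)]
  have inn : ∀ z ∈ Metric.closedBall s (q/(32*Y^5)), 1/2 < z.re ∧ ZZ z ≠ 0 ∧ ‖WW z‖ ≤ (K/c+1)*128*Y^5/t^2 := fun z hz => by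
    obtain ⟨a, b, c', d⟩ := ball_b hz
    have y2 : |z.im|^(1/40:ℝ) ≤ 2*Y := Y_le t0 (by linarith) (abs_nonneg _)
    have zi : 0 < |z.im| := by linarith
    have y0 : 0 < |z.im|^(1/40:ℝ) := by positivity
    have : q/(32*Y^5) ≤ q/(|z.im|^(1/40:ℝ))^5 := by
      gcongr; calc _ ≤ (2*Y)^5 := by gcongr
        _ = _ := by ring
    obtain ⟨p1, p2, p3⟩ := W0 z (by linarith) (by linarith) (by linarith)
    refine ⟨p1, p2, p3.trans ?_⟩
    calc _ ≤ (K/c+1)*(2*Y)^5/(t/2)^2 := by gcongr; linarith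
      _ = _ := by field_simp; ring
  have := cau n (by positivity) (fun z hz => WW_diff (inn z hz).1 (inn z hz).2.1) (fun z hz => (inn z hz).2.2)
  refine this.trans ?_
  have f2 : (n.factorial : ℝ) ≤ 2 := by interval_cases n <;> norm_num
  rw [div_eq_mul_inv _ ((q/(32*Y^5))^n), ← inv_pow, inv_div]
  have pn : (32*Y^5/q)^n ≤ (32*Y^5/q)^2 := pow_le_pow_right₀ Yq hn
  calc _ ≤ 2*((K/c+1)*128*Y^5/t^2)*(32*Y^5/q)^2 := by gcongr
    _ = 2*((K/c+1)*128)*(32/q)^2*(Y^15/t^2) := by ring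
    _ ≤ _ := by
      gcongr
      rw [hY, ← rpow_natCast, ← rpow_mul t0.le, ← rpow_natCast t 2, ← rpow_sub t0]
      exact rpow_le_rpow_of_exponent_le (by linarith) (by norm_num)
theorem WW_bd : ∃ K, 0 ≤ K ∧ ∀ n ≤ 2, ∀ s : ℂ, 1 ≤ s.re → s.re ≤ 2 → ‖iteratedDeriv n WW s‖ ≤ K * (1+|s.im|)^(-3/2:ℝ) := by
  obtain ⟨K, K0, hK⟩ := WW_big
  have cp : IsCompact (Icc (1:ℝ) 2 ×ℂ Icc (-3) 3) := isCompact_Icc.reProdIm isCompact_Icc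
  have han : ∀ n, ContinuousOn (iteratedDeriv n WW) (Icc (1:ℝ) 2 ×ℂ Icc (-3) 3) := fun n z hz => by
    have h1 : 1 ≤ z.re := hz.1.1
    have hz0 := ZZ_ne h1
    have ev : ∀ᶠ w in 𝓝 z, DifferentiableAt ℂ WW w := by
      filter_upwards [(isOpen_lt continuous_const Complex.continuous_re).mem_nhds (show (1/2:ℝ) < z.re by linarith), (ZZ_diff (by linarith)).continuousAt.eventually_ne hz0] with w a b using WW_diff a b
    have an : AnalyticAt ℂ WW z := Complex.analyticAt_iff_eventually_differentiableAt.2 ev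
    rw [iteratedDeriv_eq_iterate]
    exact (AnalyticAt.iterated_deriv an n).continuousAt.continuousWithinAt
  choose C hC using fun n => cp.exists_bound_of_continuousOn (han n)
  have C0 : ∀ n, 0 ≤ C n := fun n => (norm_nonneg _).trans (hC n 1 ⟨by simp, by simp⟩)
  refine ⟨8*(C 0 + C 1 + C 2) + 8*K, by have := C0 0; have := C0 1; have := C0 2; positivity, fun n hn s h1 h2 => ?_⟩
  have c0 := C0 0
  have c1 := C0 1
  have c2 := C0 2
  rcases le_total |s.im| 3 with h | h
  · have a := hC n s ⟨⟨h1, h2⟩, abs_le.1 h⟩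
    have b : C n ≤ C 0 + C 1 + C 2 := by interval_cases n <;> linarith
    have : (1/8:ℝ) ≤ (1+|s.im|)^(-3/2:ℝ) := by
      calc (1/8:ℝ) = (4:ℝ)^(-3/2:ℝ) := by rw [show (4:ℝ) = 2^(2:ℝ) by norm_num, ← rpow_mul (by norm_num)]; norm_num
        _ ≤ _ := rpow_le_rpow_of_nonpos (by positivity) (by linarith) (by norm_num)
    nlinarith
  · have a := hK n hn s h1 h2 h
    have : |s.im|^(-3/2:ℝ) ≤ 8*(1+|s.im|)^(-3/2:ℝ) := by
      have p : 0 < |s.im| := by linarith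
      have e : (8:ℝ) = (1/4:ℝ)^(-3/2:ℝ) := by rw [show (1/4:ℝ) = 2^(-2:ℝ) by norm_num, ← rpow_mul (by norm_num)]; norm_num
      rw [e, ← mul_rpow (by norm_num) (by positivity)]
      exact rpow_le_rpow_of_nonpos (by positivity) (by linarith) (by norm_num)
    have : 0 ≤ (1+|s.im|)^(-3/2:ℝ) := by positivity
    nlinarith

open scoped FourierTransform Convolution
noncomputable def pq (u : ℝ) : ℝ := Chebyshev.psi (exp u) - exp u
theorem pq_meas : Measurable pq := (Chebyshev.psi_mono.measurable.comp measurable_exp).sub measurable_exp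
theorem pq_bd (u : ℝ) : |pq u| ≤ 8 * exp u := by
  have h1 := Chebyshev.psi_le_const_mul_self (exp_pos u).le
  have h2 := Chebyshev.psi_nonneg (exp u)
  have h3 : log 4 ≤ 2 := by
    rw [show (4:ℝ) = 2^2 by norm_num, log_pow]; have := log_two_lt_d9; push_cast; linarith
  have := exp_pos u
  rw [pq, abs_le]; constructor <;> nlinarith
theorem expI {a : ℂ} (ha : a.re < 0) : ∫ u in Ioi (0:ℝ), Complex.exp (a*u) = -1/a := by
  rw [integral_exp_mul_complex_Ioi ha]; simp
theorem psi_int {s : ℂ} (hs : 1 < s.re) : IntegrableOn (fun u : ℝ => (pq u : ℂ) * Complex.exp (-s*u)) (Ioi 0) := by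
  have h := (integrableOn_exp_mul_Ioi (a := 1-s.re) (by linarith) 0).const_mul 8
  refine Integrable.mono' h (by have := pq_meas; exact Measurable.aestronglyMeasurable (by fun_prop)) (ae_of_all _ fun u => ?_)
  rw [norm_mul, Complex.norm_real, Complex.norm_exp, norm_eq_abs]
  have e : (-s*u).re = -s.re*u := by simp
  rw [e]
  calc _ ≤ 8 * exp u * exp (-s.re*u) := by gcongr; exact pq_bd u
    _ = _ := by rw [mul_assoc, ← Real.exp_add]; ring_nf
theorem psi_LT {s : ℂ} (hs : 1 < s.re) : ∫ u in Ioi (0:ℝ), (pq u : ℂ) * Complex.exp (-s*u) = (s+1) * WW s := by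
  have hO : (fun n : ℕ => ∑ k ∈ Finset.Icc 1 n, ArithmeticFunction.vonMangoldt k) =O[atTop] fun n : ℕ => (n:ℝ)^(1:ℝ) := by
    refine Asymptotics.IsBigO.of_bound (log 4 + 4) (Eventually.of_forall fun n => ?_)
    have := Chebyshev.psi_le_const_mul_self (x := n) (by positivity)
    have h2 := Chebyshev.psi_nonneg n
    have e : ∑ k ∈ Finset.Icc 1 n, ArithmeticFunction.vonMangoldt k = Chebyshev.psi n := by
      rw [Chebyshev.psi, Nat.floor_natCast]; rfl
    rw [e, rpow_one, norm_eq_abs, abs_of_nonneg h2, norm_natCast]; exact this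
  have L := LSeries_eq_mul_integral_of_nonneg ArithmeticFunction.vonMangoldt (s := s) zero_le_one hs hO (fun _ => ArithmeticFunction.vonMangoldt_nonneg)
  rw [ArithmeticFunction.LSeries_vonMangoldt_eq_deriv_riemannZeta_div hs] at L
  have cv : ∫ t in Ioi (1:ℝ), (∑ k ∈ Finset.Icc 1 ⌊t⌋₊, (ArithmeticFunction.vonMangoldt k : ℂ)) * (t:ℂ)^(-(s+1)) = ∫ u in Ioi (0:ℝ), (Chebyshev.psi (exp u) : ℂ) * Complex.exp (-s*u) := by
    have im : Real.exp '' Ioi 0 = Ioi 1 := by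
      ext x; constructor
      · rintro ⟨y, hy, rfl⟩; exact one_lt_exp_iff.2 hy
      · intro h; exact ⟨log x, log_pos h, exp_log (lt_trans one_pos h)⟩
    rw [← im, integral_image_eq_integral_abs_deriv_smul measurableSet_Ioi (fun x _ => (Real.hasDerivAt_exp x).hasDerivWithinAt) Real.exp_injective.injOn]
    refine setIntegral_congr_fun measurableSet_Ioi fun u _ => ?_
    have e : ∑ k ∈ Finset.Icc 1 ⌊exp u⌋₊, (ArithmeticFunction.vonMangoldt k : ℂ) = (Chebyshev.psi (exp u) : ℂ) := by
      rw [Chebyshev.psi]; push_cast; rfl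
    have e2 : ((exp u : ℝ):ℂ)^(-(s+1)) = Complex.exp (-(s+1)*u) := by
      rw [Complex.cpow_def_of_ne_zero (by exact_mod_cast (exp_pos u).ne'), ← Complex.ofReal_log (exp_pos u).le, Real.log_exp]; ring_nf
    simp only [e, e2, abs_of_pos (exp_pos u)]
    rw [Complex.real_smul, mul_left_comm, Complex.ofReal_exp, ← Complex.exp_add]; ring_nf
  rw [cv] at L
  have i1 : IntegrableOn (fun u : ℝ => Complex.exp ((1-s)*u)) (Ioi 0) := integrableOn_exp_mul_complex_Ioi (by simpa using hs) 0
  have e3 : ∫ u in Ioi (0:ℝ), (Chebyshev.psi (exp u) : ℂ) * Complex.exp (-s*u) = (∫ u in Ioi (0:ℝ), (pq u : ℂ) * Complex.exp (-s*u)) + ∫ u in Ioi (0:ℝ), Complex.exp ((1-s)*u) := by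
    rw [← integral_add (psi_int hs) i1]
    refine setIntegral_congr_fun measurableSet_Ioi fun u _ => ?_
    have : Complex.exp ((1-s)*u) = Complex.exp u * Complex.exp (-s*u) := by rw [← Complex.exp_add]; ring_nf
    simp only [this, pq]; push_cast; ring
  rw [e3, expI (by simpa using hs)] at L
  have s1 : s - 1 ≠ 0 := fun h => by have := congrArg Complex.re h; simp at this; linarith
  have s2 : 1 - s ≠ 0 := fun h => s1 (by linear_combination -h)
  have s0 : s ≠ 0 := fun h => by simp [h] at hs; linarith
  have s3 : s + 1 ≠ 0 := fun h => by have := congrArg Complex.re h; simp at this; linarith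
  have hU : IsOpen {z : ℂ | 1 < z.re} := isOpen_lt continuous_const Complex.continuous_re
  have z0 : riemannZeta s ≠ 0 := riemannZeta_ne_zero_of_one_lt_re hs
  have dZ : deriv ZZ s = riemannZeta s + (s-1) * deriv riemannZeta s := by
    have : ZZ =ᶠ[𝓝 s] fun z => (z-1)*riemannZeta z := by filter_upwards [hU.mem_nhds hs] with z hz using ZZ_zeta hz
    rw [this.deriv_eq]
    have dz := (differentiableAt_riemannZeta (s := s) (fun h => s1 (by simp [h]))).hasDerivAt
    have := (((hasDerivAt_id s).sub_const 1).mul dz).deriv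
    simp only [id, one_mul] at this; exact this
  set I := ∫ u in Ioi (0:ℝ), (pq u : ℂ) * Complex.exp (-s*u)
  rw [WW, dZ, ZZ_zeta hs]
  have : s * I = -deriv riemannZeta s/riemannZeta s - s * (-1/(1-s)) := by rw [L]; ring
  have : I = (-deriv riemannZeta s/riemannZeta s - s * (-1/(1-s)))/s := by rw [← this]; field_simp
  rw [this, show 1 - s = -(s-1) by ring]; field_simp; ring
theorem four_b : ∃ A, 0 ≤ A ∧ ∀ (B x : ℝ) (g w1 w2 : ℝ → ℂ), Integrable g → (∀ t, HasDerivAt (𝓕 g) (w1 t) t) → (∀ t, HasDerivAt w1 (w2 t) t) →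
    (∀ t, ‖𝓕 g t‖ ≤ B*(1+|t|)^(-3/2:ℝ)) → (∀ t, ‖w1 t‖ ≤ B*(1+|t|)^(-3/2:ℝ)) → (∀ t, ‖w2 t‖ ≤ B*(1+|t|)^(-3/2:ℝ)) → ContinuousAt g x → x^2*‖g x‖ ≤ A*B := by
  have hi : Integrable (fun t : ℝ => (1+|t|)^(-3/2:ℝ)) := by
    have := integrable_one_add_norm (E := ℝ) (μ := volume) (r := 3/2) (by simp; norm_num)
    simpa [neg_div] using this
  refine ⟨∫ t : ℝ, (1+|t|)^(-3/2:ℝ), integral_nonneg fun t => by positivity, fun B x g w1 w2 hg d1 d2 b0 b1 b2 hc => ?_⟩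
  have hB : 0 ≤ B := by simpa using (norm_nonneg _).trans (b0 0)
  have D0 : deriv (𝓕 g) = w1 := funext fun t => (d1 t).deriv
  have D1 : deriv w1 = w2 := funext fun t => (d2 t).deriv
  have m : ∀ w : ℝ → ℂ, AEStronglyMeasurable w → (∀ t, ‖w t‖ ≤ B*(1+|t|)^(-3/2:ℝ)) → Integrable w := fun w hm hb =>
    Integrable.mono' (hi.const_mul B) hm (ae_of_all _ hb)
  have c0 : Differentiable ℝ (𝓕 g) := fun t => (d1 t).differentiableAt
  have c1 : Differentiable ℝ w1 := fun t => (d2 t).differentiableAt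
  have i0 := m _ c0.continuous.aestronglyMeasurable b0
  have i1 := m _ c1.continuous.aestronglyMeasurable b1
  have i2 := m w2 (D1 ▸ (stronglyMeasurable_deriv w1).aestronglyMeasurable) b2
  have f1 := Real.fourier_deriv i0 c0 (D0 ▸ i1)
  have f2 := Real.fourier_deriv i1 c1 (D1 ▸ i2)
  rw [D0] at f1
  rw [D1, f1] at f2
  have inv := hg.fourierInv_fourier_eq i0 hc
  rw [Real.fourierInv_eq_fourier_neg] at inv
  have h := congrFun f2 (-x)
  simp only [inv] at h
  have n : ‖𝓕 w2 (-x)‖ ≤ (∫ t : ℝ, (1+|t|)^(-3/2:ℝ)) * B := by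
    rw [Real.fourier_real_eq_integral_exp_smul]
    calc _ ≤ ∫ t, B*(1+|t|)^(-3/2:ℝ) := norm_integral_le_of_norm_le (hi.const_mul B) (ae_of_all _ fun t => by
            rw [norm_smul, Complex.norm_exp_ofReal_mul_I, one_mul]; exact b2 t)
      _ = _ := by rw [MeasureTheory.integral_const_mul, mul_comm]
  rw [h] at n
  simp only [norm_mul, Complex.norm_real, norm_neg, Complex.norm_I, Complex.norm_ofNat, norm_eq_abs, abs_of_pos pi_pos, Complex.ofReal_neg, smul_eq_mul] at n
  refine le_trans ?_ n
  have : (1:ℝ) ≤ 2*π := by linarith [pi_gt_three]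
  have h2 : x^2 = |x| * |x| := by rw [abs_mul_abs_self]; ring
  rw [h2]
  have q : 0 ≤ |x| * |x| * ‖g x‖ := by positivity
  nlinarith [mul_le_mul this this zero_le_one (by linarith)]
noncomputable def pG (x : ℝ) : ℝ := ∫ t in (0:ℝ)..x, pq t * exp t
theorem pG_ii (a b : ℝ) : IntervalIntegrable (fun t => pq t * exp t) volume a b := by
  have c : IntervalIntegrable (fun t => 8*exp t*exp t) volume a b := (by fun_prop : Continuous (fun t : ℝ => 8*exp t*exp t)).intervalIntegrable a b
  refine c.mono_fun' (by have := pq_meas; exact Measurable.aestronglyMeasurable (by fun_prop)) (ae_of_all _ fun t => ?_)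
  simp only [norm_mul, norm_eq_abs, abs_of_pos (exp_pos t)]
  exact mul_le_mul_of_nonneg_right (pq_bd t) (exp_pos t).le
theorem WW_an {s : ℂ} (hs : 1 ≤ s.re) : AnalyticAt ℂ WW s := by
  refine Complex.analyticAt_iff_eventually_differentiableAt.2 ?_
  filter_upwards [(isOpen_lt continuous_const Complex.continuous_re).mem_nhds (show (1/2:ℝ) < s.re by linarith), (ZZ_diff (by linarith)).continuousAt.eventually_ne (ZZ_ne hs)] with w a b using WW_diff a b
theorem pG_eps : ∃ K, 0 ≤ K ∧ ∀ ε > 0, ε ≤ 1 → ∀ x > 0, x^2 * (exp (-(2+ε)*x) * |pG x|) ≤ K := by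
  obtain ⟨K, K0, hK⟩ := WW_bd
  obtain ⟨A, A0, hA⟩ := four_b
  refine ⟨A*(64*K), by positivity, fun ε e0 e1 x x0 => ?_⟩
  set f1 : ℝ → ℂ := (Ioi (0:ℝ)).indicator fun u => (pq u : ℂ) * Complex.exp (-(1+ε:ℝ)*u) with hf1
  set f2 : ℝ → ℂ := (Ioi (0:ℝ)).indicator fun u => Complex.exp (-(2+ε:ℝ)*u) with hf2
  have I1 : Integrable f1 := (psi_int (s := ((1+ε:ℝ):ℂ)) (by simpa using e0)).integrable_indicator measurableSet_Ioi
  have I2 : Integrable f2 := (integrableOn_exp_mul_complex_Ioi (a := -((2+ε:ℝ):ℂ)) (by simp; linarith) 0).integrable_indicator measurableSet_Ioi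
  set g := f1 ⋆[ContinuousLinearMap.mul ℂ ℂ] f2 with hg
  have Ig : Integrable g := I1.integrable_convolution (ContinuousLinearMap.mul ℂ ℂ) I2
  set σ : ℝ → ℂ := fun t => ((1+ε:ℝ):ℂ) + 2*π*Complex.I*t with hσ
  have σre : ∀ t, (σ t).re = 1+ε := fun t => by simp [hσ]
  have σim : ∀ t, (σ t).im = 2*π*t := fun t => by simp [hσ]
  have F1 : ∀ t, 𝓕 f1 t = (σ t + 1) * WW (σ t) := fun t => by
    rw [← psi_LT (by rw [σre]; linarith), Real.fourier_real_eq_integral_exp_smul, ← MeasureTheory.integral_indicator measurableSet_Ioi]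
    congr 1; ext u; rw [hf1]; by_cases h : u ∈ Ioi (0:ℝ)
    · simp only [indicator_of_mem h, smul_eq_mul]
      rw [mul_left_comm, ← Complex.exp_add]; congr 2; simp [hσ]; ring
    · simp [indicator_of_notMem h]
  have F2 : ∀ t, 𝓕 f2 t = 1/(σ t + 1) := fun t => by
    have : ∫ u in Ioi (0:ℝ), Complex.exp (-(σ t+1)*u) = 1/(σ t + 1) := by
      rw [expI (by simp [σre]; linarith), neg_div_neg_eq]
    rw [← this, Real.fourier_real_eq_integral_exp_smul, ← MeasureTheory.integral_indicator measurableSet_Ioi]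
    congr 1; ext u; rw [hf2]; by_cases h : u ∈ Ioi (0:ℝ)
    · simp only [indicator_of_mem h, smul_eq_mul]
      rw [← Complex.exp_add]; congr 1; simp [hσ]; ring
    · simp [indicator_of_notMem h]
  have Fg : 𝓕 g = fun t => WW (σ t) := by
    ext t
    have s0 : σ t + 1 ≠ 0 := fun h => by have := congrArg Complex.re h; simp [σre] at this; linarith
    rw [hg, Real.fourier_mul_convolution_eq I1 I2, F1, F2]; field_simp
  have gx : ∀ y > 0, g y = ((exp (-(2+ε)*y) * pG y : ℝ):ℂ) := fun y hy => by
    rw [hg, convolution_def, pG, ← intervalIntegral.integral_const_mul, intervalIntegral.integral_of_le hy.le, ← integral_Ioc_eq_integral_Ioo.symm, ← integral_complex_ofReal, ← MeasureTheory.integral_indicator measurableSet_Ioo]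
    congr 1; ext t
    simp only [ContinuousLinearMap.mul_apply', hf1, hf2]
    by_cases h : t ∈ Ioo 0 y
    · rw [indicator_of_mem h, indicator_of_mem (show t ∈ Ioi (0:ℝ) from h.1), indicator_of_mem (show y - t ∈ Ioi (0:ℝ) from sub_pos.2 h.2)]
      push_cast
      rw [mul_assoc, ← Complex.exp_add, mul_left_comm, ← Complex.exp_add]; ring_nf
    · rw [indicator_of_notMem h]
      by_cases h0 : 0 < t
      · rw [indicator_of_notMem (s := Ioi (0:ℝ)) (a := y - t) (fun h' => h ⟨h0, sub_pos.1 h'⟩), mul_zero]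
      · rw [indicator_of_notMem (s := Ioi (0:ℝ)) (a := t) h0, zero_mul]
  have cg : ContinuousAt g x := by
    have c : Continuous fun y => ((exp (-(2+ε)*y) * pG y : ℝ):ℂ) := by
      have : Continuous pG := intervalIntegral.continuous_primitive pG_ii 0
      fun_prop
    refine c.continuousAt.congr ?_
    filter_upwards [Ioi_mem_nhds x0] with y hy using (gx y hy).symm
  have dσ : ∀ t, HasDerivAt σ (2*π*Complex.I) t := fun t => by
    have := ((Complex.ofRealCLM.hasDerivAt (x := t)).const_mul (2*π*Complex.I)).const_add ((1+ε:ℝ):ℂ)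
    simp only [Complex.ofRealCLM_apply, Complex.ofReal_one, mul_one] at this; exact this
  have n2 : ‖(2*π*Complex.I : ℂ)‖ ≤ 8 := by
    simp [abs_of_pos pi_pos]; linarith [pi_lt_d2]
  have b : ∀ n ≤ 2, ∀ t, ‖iteratedDeriv n WW (σ t)‖ ≤ K*(1+|t|)^(-3/2:ℝ) := fun n hn t => by
    refine (hK n hn (σ t) (by rw [σre]; linarith) (by rw [σre]; linarith)).trans (mul_le_mul_of_nonneg_left (rpow_le_rpow_of_nonpos (by positivity) ?_ (by norm_num)) K0)
    rw [σim, abs_mul, abs_of_pos (by positivity : 0 < 2*π)]; nlinarith [abs_nonneg t, pi_gt_three]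
  have pw : ∀ t : ℝ, 0 ≤ K*(1+|t|)^(-3/2:ℝ) := fun t => by positivity
  have := hA (64*K) x g (fun t => deriv WW (σ t) * (2*π*Complex.I)) (fun t => deriv (deriv WW) (σ t) * (2*π*Complex.I) * (2*π*Complex.I)) Ig
    (fun t => by rw [Fg]; exact (WW_an (by rw [σre]; linarith)).differentiableAt.hasDerivAt.comp t (dσ t))
    (fun t => ((WW_an (by rw [σre]; linarith)).deriv.differentiableAt.hasDerivAt.comp t (dσ t)).mul_const _)
    (fun t => by have := b 0 (by norm_num) t; rw [Fg]; simp only [iteratedDeriv_zero] at this; nlinarith [pw t])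
    (fun t => by
      have := b 1 (by norm_num) t; rw [iteratedDeriv_one] at this
      rw [norm_mul]; nlinarith [pw t, mul_le_mul this n2 (norm_nonneg _) (pw t)])
    (fun t => by
      have := b 2 le_rfl t; rw [iteratedDeriv_succ, iteratedDeriv_one] at this
      rw [norm_mul, norm_mul]
      have h1 := mul_le_mul this n2 (norm_nonneg _) (pw t)
      have h2 := mul_le_mul h1 n2 (norm_nonneg _) (by nlinarith [pw t])
      linarith) cg
  rw [gx x x0, Complex.norm_real, norm_mul, norm_of_nonneg (exp_pos _).le] at this
  exact this
theorem pG_bd : ∃ K, 0 ≤ K ∧ ∀ x > 0, x^2 * |pG x| ≤ K * exp (2*x) := by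
  obtain ⟨K, K0, hK⟩ := pG_eps
  refine ⟨K, K0, fun x x0 => ?_⟩
  have t : Tendsto (fun ε => x^2 * (exp (-(2+ε)*x) * |pG x|)) (𝓝[>] 0) (𝓝 (x^2 * (exp (-(2+0)*x) * |pG x|))) :=
    (Continuous.tendsto (by fun_prop) 0).mono_left nhdsWithin_le_nhds
  have := le_of_tendsto t (by filter_upwards [Ioc_mem_nhdsGT one_pos] with ε h using hK ε h.1 h.2 x x0)
  have e : exp (-(2+0)*x) * exp (2*x) = 1 := by rw [← Real.exp_add]; simp
  have p := exp_pos (2*x)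
  calc x^2 * |pG x| = x^2 * (exp (-(2+0)*x) * |pG x|) * exp (2*x) := by rw [← mul_one (x^2 * |pG x|), ← e]; ring
    _ ≤ _ := by gcongr
theorem pnt0 : ∃ K, 0 ≤ K ∧ ∀ x, 2 ≤ x → |pq x| ≤ K * exp x / x := by
  obtain ⟨K, K0, hK⟩ := pG_bd
  refine ⟨200*K+200, by positivity, fun x hx => ?_⟩
  have x0 : 0 < x := by linarith
  set h := 1/x with hh
  have h0 : 0 < h := by positivity
  have hxh : x*h = 1 := by rw [hh]; field_simp
  have h1 : h ≤ 1/2 := by rw [hh]; exact one_div_le_one_div_of_le (by norm_num) hx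
  set E := exp x with hE
  have E0 : 0 < E := exp_pos x
  have g0 : ∀ y, x - h ≤ y → y ≤ x + h → |pG y| ≤ 12*K*E^2*h^2 := fun y h2 h3 => by
    have y0 : x*(3/4) ≤ y := by nlinarith
    have := hK y (by nlinarith)
    have e : exp (2*y) ≤ E^2*exp 1 := by rw [hE, ← Real.exp_nat_mul, ← Real.exp_add]; exact exp_le_exp.2 (by push_cast; linarith)
    have e1 := exp_one_lt_d9
    have : (x*(3/4))^2*|pG y| ≤ y^2*|pG y| := by gcongr
    have : (x*(3/4))^2*|pG y| ≤ K*(E^2*3) := by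
      calc _ ≤ K*exp (2*y) := by linarith
        _ ≤ _ := by gcongr; nlinarith [sq_nonneg E]
    calc |pG y| = ((x*(3/4))^2*|pG y|)*h^2*(16/9) := by
            have : (x*(3/4))^2*|pG y| * h^2*(16/9) = (x*h)^2*|pG y| := by ring
            rw [this, hxh]; ring
      _ ≤ K*(E^2*3)*h^2*(16/9) := by gcongr
      _ ≤ _ := by nlinarith [show 0 ≤ K*E^2*h^2 by positivity]
  have eh : exp h ≤ 1 + 2*h := by
    have := Real.exp_bound' h0.le (by linarith) (n := 1) (by norm_num)
    norm_num [Finset.sum_range_one] at this; linarith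
  have eh2 : 1 - h ≤ exp (-h) := by have := add_one_le_exp (-h); linarith
  have r1 := Chebyshev.psi_mono
  have I1 : ∀ a b, pG b - pG a = ∫ t in a..b, pq t * exp t := fun a b => by
    rw [pG, pG, intervalIntegral.integral_interval_sub_left (pG_ii _ _) (pG_ii _ _)]
  have g1 := abs_le.1 (g0 x (by linarith) (by linarith))
  have g2 := abs_le.1 (g0 (x+h) (by linarith) le_rfl)
  have g3 := abs_le.1 (g0 (x-h) le_rfl (by linarith))
  have goal : (200*K+200)*E/x = (200*K+200)*E*h := by rw [hh]; ring
  rw [goal, abs_le]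
  have KE : 0 ≤ K*E*h := by positivity
  have Eh : 0 < E*h := by positivity
  constructor
  · by_contra hc; push Not at hc
    have : pG x - pG (x-h) ≤ ∫ t in (x-h)..x, (-(100*K+50)*E*h)*E := by
      rw [I1]
      refine intervalIntegral.integral_mono_on (by linarith) (pG_ii _ _) (by simp) fun t ht => ?_
      have m := r1 (exp_le_exp.2 ht.2)
      have e1 : E*(1-h) ≤ exp t := by
        calc E*(1-h) ≤ E*exp (-h) := by gcongr
          _ ≤ exp t := by rw [hE, ← Real.exp_add]; exact exp_le_exp.2 (by linarith [ht.1])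
      have e2 : E/2 ≤ exp t := by nlinarith
      have : pq t ≤ -(200*K+100)*E*h := by
        simp only [pq] at hc ⊢; nlinarith
      nlinarith [show 0 ≤ (200*K+100)*E*h by positivity]
    rw [intervalIntegral.integral_const, smul_eq_mul] at this
    nlinarith [show 0 ≤ K*E^2*h^2 by positivity, show 0 < E^2*h^2 by positivity]
  · by_contra hc; push Not at hc
    have : ∫ t in x..(x+h), ((100*K+50)*E*h)*E ≤ pG (x+h) - pG x := by
      rw [I1]
      refine intervalIntegral.integral_mono_on (by linarith) (by simp) (pG_ii _ _) fun t ht => ?_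
      have m := r1 (exp_le_exp.2 ht.1)
      have e1 : exp t ≤ E*(1+2*h) := by
        calc exp t ≤ E*exp h := by rw [hE, ← Real.exp_add]; exact exp_le_exp.2 (by linarith [ht.2])
          _ ≤ _ := by gcongr
      have e2 : E ≤ exp t := exp_le_exp.2 ht.1
      have : (100*K+50)*E*h ≤ pq t := by
        simp only [pq] at hc ⊢; nlinarith
      nlinarith [show 0 ≤ (100*K+50)*E*h by positivity]
    rw [intervalIntegral.integral_const, smul_eq_mul] at this
    nlinarith [show 0 ≤ K*E^2*h^2 by positivity, show 0 < E^2*h^2 by positivity]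
theorem pnt : ∃ K, 0 < K ∧ ∀ x, 2 ≤ x → |Chebyshev.psi x - x| ≤ K * x / log x := by
  obtain ⟨K, K0, hK⟩ := pnt0
  refine ⟨K+16, by positivity, fun x hx => ?_⟩
  have l0 : 0 < log x := log_pos (by linarith)
  have ex : exp (log x) = x := exp_log (by linarith)
  rcases le_total 2 (log x) with h | h
  · have := hK _ h; rw [pq, ex] at this
    refine this.trans ?_
    gcongr; linarith
  · have := pq_bd (log x); rw [pq, ex] at this
    rw [le_div_iff₀ l0]
    calc _ ≤ (8*x)*2 := by gcongr
      _ ≤ _ := by nlinarith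

theorem RR.mul {y a b : ℕ} : RR y (a*b) ↔ RR y a ∧ RR y b := by
  refine ⟨fun h => ⟨fun p hp d => h p hp (d.mul_right _), fun p hp d => h p hp (d.mul_left _)⟩, fun h p hp d => ?_⟩
  rcases hp.dvd_mul.1 d with d | d
  exacts [h.1 p hp d, h.2 p hp d]
open Classical in
noncomputable def rst (y : ℕ) (f : ArithmeticFunction ℝ) : ArithmeticFunction ℝ := ⟨fun r => if RR y r then f r else 0, by simp⟩
theorem rst_ap (y : ℕ) (f : ArithmeticFunction ℝ) (r : ℕ) : rst y f r = open Classical in if RR y r then f r else 0 := rfl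
theorem rst_mul (y : ℕ) (f g : ArithmeticFunction ℝ) : rst y (f*g) = rst y f * rst y g := by
  ext n
  simp only [rst_ap, ArithmeticFunction.mul_apply]
  split_ifs with h
  · refine Finset.sum_congr rfl fun x hx => ?_
    rw [← (Nat.mem_divisorsAntidiagonal.1 hx).1, RR.mul] at h
    simp [h.1, h.2]
  · refine (Finset.sum_eq_zero fun x hx => ?_).symm
    rw [← (Nat.mem_divisorsAntidiagonal.1 hx).1, RR.mul] at h
    by_cases h1 : RR y x.1
    · have h2 : ¬ RR y x.2 := fun h2 => h ⟨h1, h2⟩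
      simp [h2]
    · simp [h1]
noncomputable def tau : ArithmeticFunction ℝ := (ArithmeticFunction.zeta : ArithmeticFunction ℝ) * (ArithmeticFunction.zeta : ArithmeticFunction ℝ)
theorem tau_ap (n : ℕ) : tau n = n.divisors.card := by
  rw [tau, ArithmeticFunction.coe_mul_zeta_apply, Finset.sum_congr rfl (g := fun _ => (1:ℝ))]
  · simp
  · intro i hi; simp [ArithmeticFunction.natCoe_apply, ArithmeticFunction.zeta_apply, (Nat.pos_of_mem_divisors hi).ne']
noncomputable def tt (y : ℕ) : ArithmeticFunction ℝ := rst y tau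
theorem tt_nn (y n : ℕ) : 0 ≤ tt y n := by rw [tt, rst_ap]; split_ifs; rw [tau_ap]; positivity; rfl
theorem Phi_eq (X : ℝ) (y : ℕ) : Phi X y = ∑ r ∈ Finset.Ioc 0 ⌊X⌋₊, tt y r := by
  rw [Phi, Finset.sum_filter]; exact Finset.sum_congr rfl fun r _ => by simp only [tt, rst_ap, tau_ap]
theorem rough_h {y : ℕ} (hy : 2 ≤ y) {X : ℝ} (hX : 1 ≤ X) : ∑ r ∈ Finset.Ioc 0 ⌊X⌋₊, rst y ArithmeticFunction.zeta r / r ≤ log X / log y + 3 := by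
  classical
  have hN : 1 ≤ ⌊X⌋₊ := (Nat.one_le_floor_iff X).2 hX
  have L0 : log 2 ≤ log y := log_le_log (by norm_num) (by exact_mod_cast hy)
  have l2 := log_two_gt_d9
  have e : ∑ r ∈ Finset.Ioc 0 ⌊X⌋₊, rst y ArithmeticFunction.zeta r / r = ∑ r ∈ (Finset.Ioc 0 ⌊X⌋₊).filter (RR y), (r:ℝ)⁻¹ := by
    rw [Finset.sum_filter]; refine Finset.sum_congr rfl fun r hr => ?_
    have := (Finset.mem_Ioc.1 hr).1.ne'
    simp [rst_ap, ArithmeticFunction.natCoe_apply, ArithmeticFunction.zeta_apply, this]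
    split_ifs <;> simp
  have key : (∑ d ∈ Finset.Icc 1 y, (d:ℝ)⁻¹) * ∑ r ∈ (Finset.Ioc 0 ⌊X⌋₊).filter (RR y), (r:ℝ)⁻¹ ≤ ∑ n ∈ Finset.Icc 1 (⌊X⌋₊*y), (n:ℝ)⁻¹ := by
    rw [Finset.sum_mul_sum, ← Finset.sum_product']
    have co : ∀ d r, 1 ≤ d → d ≤ y → RR y r → Nat.Coprime d r := fun d r h1 h2 h3 => Nat.Coprime.symm <| Nat.coprime_of_dvd fun p hp a b =>
      absurd (h3 p hp a) (not_lt.2 ((Nat.le_of_dvd h1 b).trans h2))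
    have inj : Set.InjOn (fun x : ℕ × ℕ => x.1*x.2) ↑(Finset.Icc 1 y ×ˢ (Finset.Ioc 0 ⌊X⌋₊).filter (RR y)) := by
      rintro ⟨a, b⟩ h ⟨c, d⟩ h' (hh : a*b = c*d)
      simp only [Finset.coe_product, Set.mem_prod, Finset.mem_coe, Finset.mem_Icc, Finset.mem_filter, Finset.mem_Ioc] at h h'
      have e1 : a = c := Nat.dvd_antisymm ((co a d h.1.1 h.1.2 h'.2.2).dvd_of_dvd_mul_right (hh ▸ Dvd.intro _ rfl)) ((co c b h'.1.1 h'.1.2 h.2.2).dvd_of_dvd_mul_right (hh ▸ Dvd.intro _ rfl))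
      subst e1
      rw [Nat.eq_of_mul_eq_mul_left h.1.1 hh]
    calc _ = ∑ n ∈ (Finset.Icc 1 y ×ˢ (Finset.Ioc 0 ⌊X⌋₊).filter (RR y)).image (fun x : ℕ × ℕ => x.1*x.2), (n:ℝ)⁻¹ := by
          rw [Finset.sum_image inj]; refine Finset.sum_congr rfl fun x _ => by push_cast; rw [mul_inv]
      _ ≤ _ := by
          refine Finset.sum_le_sum_of_subset_of_nonneg (fun n hn => ?_) (fun _ _ _ => by positivity)
          obtain ⟨⟨a, b⟩, h, rfl⟩ := Finset.mem_image.1 hn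
          simp only [Finset.mem_product, Finset.mem_Icc, Finset.mem_filter, Finset.mem_Ioc] at h ⊢
          exact ⟨Nat.mul_pos h.1.1 h.2.1.1, by rw [mul_comm]; exact Nat.mul_le_mul h.2.1.2 h.1.2⟩
  have hh : ∀ n : ℕ, ∑ d ∈ Finset.Icc 1 n, (d:ℝ)⁻¹ = (harmonic n : ℝ) := fun n => by rw [harmonic_eq_sum_Icc]; push_cast; rfl
  rw [hh, hh] at key
  rw [e]
  set R := ∑ r ∈ (Finset.Ioc 0 ⌊X⌋₊).filter (RR y), (r:ℝ)⁻¹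
  have R0 : 0 ≤ R := Finset.sum_nonneg fun _ _ => by positivity
  have h1 : log y ≤ (harmonic y : ℝ) := (log_le_log (by positivity) (by push_cast; linarith)).trans (log_add_one_le_harmonic y)
  have h2 := harmonic_le_one_add_log (⌊X⌋₊*y)
  have h3 : log (⌊X⌋₊:ℝ) ≤ log X := log_le_log (by exact_mod_cast hN) (Nat.floor_le (by linarith))
  push_cast at h2
  rw [log_mul (by positivity) (by positivity)] at h2
  have h4 : log y * R ≤ 1 + log X + log y := by nlinarith
  have L1 : 0 < log y := by linarith
  rw [div_add' _ _ _ L1.ne', le_div_iff₀ L1]; linarith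
noncomputable def SS (y : ℕ) (X : ℝ) : ℝ := ∑ r ∈ Finset.Ioc 0 ⌊X⌋₊, tt y r / r
theorem SS_le {y : ℕ} (hy : 2 ≤ y) {X : ℝ} (hX : 1 ≤ X) : SS y X ≤ (log X / log y + 3)^2 := by
  let zz : ArithmeticFunction ℝ := ⟨fun r => rst y ArithmeticFunction.zeta r / r, by simp⟩
  have zn : ∀ r, 0 ≤ zz r := fun r => by
    change 0 ≤ rst y ArithmeticFunction.zeta r / r
    refine div_nonneg ?_ (by positivity)
    rw [rst_ap]; split_ifs; rw [ArithmeticFunction.natCoe_apply]; positivity; rfl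
  have e : ∀ n, tt y n / n = (zz*zz) n := fun n => by
    rw [tt, tau, rst_mul, ArithmeticFunction.mul_apply, ArithmeticFunction.mul_apply, Finset.sum_div]
    refine Finset.sum_congr rfl fun x hx => ?_
    rw [← (Nat.mem_divisorsAntidiagonal.1 hx).1]; push_cast; rw [mul_div_mul_comm]; rfl
  have h := rough_h hy hX
  rw [SS, Finset.sum_congr rfl (fun n _ => e n), ArithmeticFunction.sum_Ioc_mul_eq_sum_sum, pow_two]
  have h0 : 0 ≤ ∑ r ∈ Finset.Ioc 0 ⌊X⌋₊, zz r := Finset.sum_nonneg fun r _ => zn r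
  calc _ ≤ ∑ n ∈ Finset.Ioc 0 ⌊X⌋₊, zz n * ∑ r ∈ Finset.Ioc 0 ⌊X⌋₊, zz r := Finset.sum_le_sum fun n _ => mul_le_mul_of_nonneg_left
          (Finset.sum_le_sum_of_subset_of_nonneg (Finset.Ioc_subset_Ioc_right (Nat.div_le_self _ _)) fun r _ _ => zn r) (zn n)
    _ ≤ _ := by rw [← Finset.sum_mul]; exact mul_le_mul h h h0 (h0.trans h)
noncomputable def psy (y : ℕ) (T : ℝ) : ℝ := ∑ n ∈ Finset.Ioc 0 ⌊T⌋₊, rst y ArithmeticFunction.vonMangoldt n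
theorem log_id (y : ℕ) (X : ℝ) : ∑ r ∈ Finset.Ioc 0 ⌊X⌋₊, tt y r * log r = 2 * ∑ r ∈ Finset.Ioc 0 ⌊X⌋₊, tt y r * psy y (X/r) := by
  have e : ∀ n, tt y n * log n = 2 * (tt y * rst y ArithmeticFunction.vonMangoldt) n := fun n => by
    rw [tt, ← rst_mul, rst_ap, rst_ap]
    split_ifs
    · rw [tau, mul_assoc, mul_comm _ ArithmeticFunction.vonMangoldt, ArithmeticFunction.vonMangoldt_mul_zeta, ArithmeticFunction.mul_apply, ArithmeticFunction.mul_apply, Finset.sum_mul, two_mul]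
      nth_rw 2 [← Nat.map_swap_divisorsAntidiagonal]
      rw [Finset.sum_map, ← Finset.sum_add_distrib]
      refine Finset.sum_congr rfl fun x hx => ?_
      obtain ⟨h1, h2⟩ := Nat.mem_divisorsAntidiagonal.1 hx
      have a0 : x.1 ≠ 0 := fun h => h2 (by rw [← h1, h, zero_mul])
      have b0 : x.2 ≠ 0 := fun h => h2 (by rw [← h1, h, mul_zero])
      rw [← h1]; push_cast
      rw [log_mul (by exact_mod_cast a0) (by exact_mod_cast b0)]
      simp [ArithmeticFunction.natCoe_apply, ArithmeticFunction.zeta_apply, a0, b0, ArithmeticFunction.log_apply, add_comm]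
    · simp
  rw [Finset.sum_congr rfl (fun n _ => e n), ← Finset.mul_sum, ArithmeticFunction.sum_Ioc_mul_eq_sum_sum]
  simp only [psy, Nat.floor_div_natCast]

theorem psy_bd : ∃ K, 0 < K ∧ ∀ y : ℕ, 2 ≤ y → ∀ T, 0 ≤ T → |psy y T - max (T - y) 0| ≤ K * T / log y := by
  classical
  obtain ⟨K, K0, hK⟩ := pnt
  refine ⟨2*K+32, by positivity, fun y hy T hT => ?_⟩
  have hy' : (2:ℝ) ≤ y := by exact_mod_cast hy
  have L0 : 0 < log y := log_pos (by linarith)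
  have rough : ∀ n, rst y ArithmeticFunction.vonMangoldt n ≠ 0 → y < n := fun n hn => by
    rw [rst_ap] at hn
    split_ifs at hn with h
    · have pp := ArithmeticFunction.vonMangoldt_ne_zero_iff.1 hn
      have := Nat.minFac_prime pp.ne_one
      exact (h _ this (Nat.minFac_dvd n)).trans_le (Nat.minFac_le pp.pos)
    · exact absurd rfl hn
  rcases lt_or_ge T y with h | h
  · have : psy y T = 0 := Finset.sum_eq_zero fun n hn => by
      by_contra hc
      have := rough n hc
      exact absurd ((Nat.le_floor_iff hT).1 (Finset.mem_Ioc.1 hn).2) (not_le.2 (h.trans (by exact_mod_cast this)))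
    rw [this, max_eq_right (by linarith)]; simp; positivity
  rw [max_eq_left (by linarith)]
  have T2 : 2 ≤ T := by linarith
  have ly : log y ≤ log T := log_le_log (by linarith) h
  have sub : Finset.Ioc 0 y ⊆ Finset.Ioc 0 ⌊T⌋₊ := Finset.Ioc_subset_Ioc_right (Nat.le_floor h)
  have up : psy y T + Chebyshev.psi y ≤ Chebyshev.psi T := by
    rw [psy, Chebyshev.psi, Chebyshev.psi, Nat.floor_natCast, ← Finset.sum_sdiff sub]
    rw [Finset.sum_eq_zero (s := Finset.Ioc 0 y), add_zero, ← Finset.sum_sdiff sub (f := fun n => ArithmeticFunction.vonMangoldt n)]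
    · gcongr with n hn
      rw [rst_ap]; split_ifs; exact le_rfl; exact ArithmeticFunction.vonMangoldt_nonneg
    · intro n hn; by_contra hc; exact absurd (rough n hc) (not_lt.2 (Finset.mem_Ioc.1 hn).2)
  have lo : Chebyshev.theta T ≤ psy y T + Chebyshev.theta y := by
    rw [Chebyshev.theta, Chebyshev.theta, psy, Nat.floor_natCast, Finset.sum_filter, Finset.sum_filter, ← Finset.sum_sdiff sub, ← Finset.sum_sdiff sub (f := fun n => rst y ArithmeticFunction.vonMangoldt n)]
    have : 0 ≤ ∑ n ∈ Finset.Ioc 0 y, rst y ArithmeticFunction.vonMangoldt n := Finset.sum_nonneg fun n _ => by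
      rw [rst_ap]; split_ifs; exact ArithmeticFunction.vonMangoldt_nonneg; rfl
    have : ∑ n ∈ Finset.Ioc 0 ⌊T⌋₊ \ Finset.Ioc 0 y, (if n.Prime then log n else 0) ≤ ∑ n ∈ Finset.Ioc 0 ⌊T⌋₊ \ Finset.Ioc 0 y, rst y ArithmeticFunction.vonMangoldt n := by
      refine Finset.sum_le_sum fun n hn => ?_
      simp only [Finset.mem_sdiff, Finset.mem_Ioc] at hn
      rw [rst_ap]
      split_ifs with h1 h2 h2
      · rw [ArithmeticFunction.vonMangoldt_apply_prime h1]
      · exact absurd (fun p hp hd => by rw [(Nat.prime_dvd_prime_iff_eq hp h1).1 hd]; omega) h2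
      · exact ArithmeticFunction.vonMangoldt_nonneg
      · rfl
    linarith
  have a1 := hK T T2
  have a2 := hK y hy'
  have a3 := Chebyshev.psi_sub_theta_le (x := T) (by linarith)
  have a4 := Chebyshev.theta_le_psi y
  have b1 : K*T/log T ≤ K*T/log y := by gcongr
  have b2 : K*y/log y ≤ K*T/log y := by gcongr
  have b3 : 2*√T*log T ≤ 32*T/log y := by
    have := log_le_rpow_div hT (show (0:ℝ) < 1/4 by norm_num)
    have e : (T^(1/4:ℝ))^2 = √T := by rw [sqrt_eq_rpow, ← rpow_natCast, ← rpow_mul hT]; norm_num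
    have l0 : 0 ≤ log T := by linarith
    have : (log T)^2 ≤ 16*√T := by rw [← e]; nlinarith
    rw [le_div_iff₀ L0]
    calc _ ≤ 2*√T*log T*log T := by gcongr
      _ = 2*√T*(log T)^2 := by ring
      _ ≤ 2*√T*(16*√T) := by gcongr
      _ = _ := by rw [show 2*√T*(16*√T) = 32*(√T*√T) by ring, mul_self_sqrt hT]
  have : (2*K+32)*T/log y = K*T/log y + K*T/log y + 32*T/log y := by ring
  rw [this, abs_le]
  rw [abs_le] at a1 a2
  constructor <;> linarith
/-- Abel summation. -/
theorem abel (w : ℕ → ℝ) {X : ℝ} (hX : 1 ≤ X) {g : ℝ → ℝ} (hg : IntervalIntegrable g volume 1 X) :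
    IntervalIntegrable (fun t => (∑ n ∈ Finset.Ioc 0 ⌊t⌋₊, w n) * g t) volume 1 X ∧
    ∫ t in (1:ℝ)..X, (∑ n ∈ Finset.Ioc 0 ⌊t⌋₊, w n) * g t = ∑ n ∈ Finset.Ioc 0 ⌊X⌋₊, w n * ∫ t in (n:ℝ)..X, g t := by
  have e : ∀ t ∈ Ioc 1 X, (∑ n ∈ Finset.Ioc 0 ⌊t⌋₊, w n) * g t = ∑ n ∈ Finset.Ioc 0 ⌊X⌋₊, w n * (Ici (n:ℝ)).indicator g t := fun t ht => by
    rw [Finset.sum_mul, ← Finset.sum_subset (Finset.Ioc_subset_Ioc_right (Nat.floor_mono ht.2))]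
    · refine Finset.sum_congr rfl fun n hn => ?_
      rw [indicator_of_mem (show t ∈ Ici (n:ℝ) from (Nat.le_floor_iff (by linarith [ht.1])).1 (Finset.mem_Ioc.1 hn).2)]
    · intro n h1 h2
      rw [indicator_of_notMem, mul_zero]
      intro h; exact h2 (Finset.mem_Ioc.2 ⟨(Finset.mem_Ioc.1 h1).1, Nat.le_floor h⟩)
  have hi := (intervalIntegrable_iff_integrableOn_Ioc_of_le hX).1 hg
  have ii : ∀ n ∈ Finset.Ioc 0 ⌊X⌋₊, IntegrableOn (fun t => w n * (Ici (n:ℝ)).indicator g t) (Ioc 1 X) := fun n _ =>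
    (hi.indicator measurableSet_Ici).const_mul _
  constructor
  · rw [intervalIntegrable_iff_integrableOn_Ioc_of_le hX]
    exact (integrableOn_congr_fun e measurableSet_Ioc).2 (integrable_finsetSum _ ii)
  · rw [intervalIntegral.integral_of_le hX, setIntegral_congr_fun measurableSet_Ioc e, MeasureTheory.integral_finsetSum _ ii]
    refine Finset.sum_congr rfl fun n hn => ?_
    obtain ⟨h1, h2⟩ := Finset.mem_Ioc.1 hn
    have h3 : (n:ℝ) ≤ X := (Nat.le_floor_iff (by linarith)).1 h2
    have h4 : (1:ℝ) ≤ n := by exact_mod_cast h1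
    rw [MeasureTheory.integral_const_mul, setIntegral_indicator measurableSet_Ici, intervalIntegral.integral_of_le h3, ← MeasureTheory.integral_Icc_eq_integral_Ioc (x := (n:ℝ))]
    congr 1
    have : Icc 1 X ∩ Ici (n:ℝ) = Icc (n:ℝ) X := by ext t; exact ⟨fun h => ⟨h.2, h.1.2⟩, fun h => ⟨⟨h4.trans h.1, h.2⟩, h.1⟩⟩
    exact setIntegral_congr_set (this ▸ Ioc_ae_eq_Icc.inter (ae_eq_refl _))

theorem exp_sub (G : ℝ → ℝ) {X : ℝ} (hX : 1 ≤ X) : (IntervalIntegrable (fun t => G (log t) / t) volume 1 X ↔ IntervalIntegrable G volume 0 (log X)) ∧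
    ∫ t in (1:ℝ)..X, G (log t) / t = ∫ s in (0:ℝ)..(log X), G s := by
  have l0 := log_nonneg hX
  have im : rexp '' Ioc 0 (log X) = Ioc 1 X := by
    ext t; constructor
    · rintro ⟨s, h, rfl⟩; exact ⟨one_lt_exp_iff.2 h.1, (le_log_iff_exp_le (by linarith)).1 h.2⟩
    · intro h; exact ⟨log t, ⟨log_pos h.1, log_le_log (by linarith [h.1]) h.2⟩, exp_log (by linarith [h.1])⟩
  have e : (fun x => |rexp x| • (fun t => G (log t) / t) (rexp x)) = G := by
    funext x; simp only [log_exp, smul_eq_mul, abs_of_pos (exp_pos x)]; field_simp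
  rw [intervalIntegrable_iff_integrableOn_Ioc_of_le hX, intervalIntegrable_iff_integrableOn_Ioc_of_le l0, intervalIntegral.integral_of_le hX, intervalIntegral.integral_of_le l0, ← im,
    integral_image_eq_integral_abs_deriv_smul measurableSet_Ioc (fun x _ => (Real.hasDerivAt_exp x).hasDerivWithinAt) Real.exp_injective.injOn,
    integrableOn_image_iff_integrableOn_abs_deriv_smul measurableSet_Ioc (fun x _ => (Real.hasDerivAt_exp x).hasDerivWithinAt) Real.exp_injective.injOn, e]
  exact ⟨Iff.rfl, rfl⟩
theorem Phi_one {y : ℕ} {X : ℝ} (hX : 1 ≤ X) (h : X < y + 1) : Phi X y = 1 := by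
  rw [Phi_eq, Finset.sum_eq_single_of_mem 1 (Finset.mem_Ioc.2 ⟨one_pos, (Nat.one_le_floor_iff X).2 hX⟩)]
  · rw [tt, rst_ap, tau_ap, if_pos]; simp
    intro p hp hd; exact absurd (Nat.dvd_one.1 hd) hp.ne_one
  · intro r hr h1
    rw [tt, rst_ap, if_neg]
    intro hR
    have a := hR _ (Nat.minFac_prime h1) (Nat.minFac_dvd r)
    have b := Nat.minFac_le (Finset.mem_Ioc.1 hr).1
    have c : r < y + 1 := by exact_mod_cast ((Nat.le_floor_iff (by linarith)).1 (Finset.mem_Ioc.1 hr).2).trans_lt h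
    omega
theorem u_facts {y : ℕ} (hy : 2 ≤ y) {X : ℝ} (hX : (y:ℝ) ≤ X) : 0.69 < log y ∧ 1 ≤ log X / log y ∧ 1 ≤ X ∧ (log X / log y + 3)^2 ≤ 16 * (log X / log y)^2 := by
  have hy' : (2:ℝ) ≤ y := by exact_mod_cast hy
  have L0 : log 2 ≤ log y := log_le_log (by norm_num) hy'
  have l2 := log_two_gt_d9
  have h1 : 1 ≤ log X / log y := (one_le_div (by linarith)).2 (log_le_log (by linarith) hX)
  exact ⟨by linarith, h1, by linarith, by nlinarith⟩
theorem Phi_split {y : ℕ} {X : ℝ} (hX : 1 ≤ X) : Phi X y * log X = (∫ t in (1:ℝ)..X, Phi t y * t⁻¹) + 2 * ∑ r ∈ Finset.Ioc 0 ⌊X⌋₊, tt y r * psy y (X/r) := by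
  have h := abel (tt y) hX (g := fun t => t⁻¹) (intervalIntegral.intervalIntegrable_inv (fun t ht => by rw [uIcc_of_le hX] at ht; linarith [ht.1]) continuousOn_id)
  rw [← log_id]
  simp only [Phi_eq]
  rw [h.2, Finset.sum_mul, ← Finset.sum_add_distrib]
  refine Finset.sum_congr rfl fun r hr => ?_
  have : (0:ℝ) < r := by exact_mod_cast (Finset.mem_Ioc.1 hr).1
  rw [integral_inv_of_pos this (by linarith), log_div (by linarith) this.ne']; ring
theorem Phi_up : ∃ K, 0 < K ∧ ∀ y : ℕ, 2 ≤ y → ∀ X : ℝ, (y:ℝ) ≤ X → Phi X y ≤ K * X * (log X / log y) / log y ∧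
    |Phi X y * log X - 2 * X * ∫ t in (1:ℝ)..(X/y), Phi t y * (t^2)⁻¹| ≤ K * (log y + X * (log X / log y)^2 / log y) := by
  obtain ⟨K, K0, hK⟩ := psy_bd
  set K1 := 16 * (3 + 4*K) with hK1
  have A : ∀ y : ℕ, 2 ≤ y → ∀ X : ℝ, (y:ℝ) ≤ X → Phi X y ≤ K1 * X * (log X / log y) / log y := fun y hy X hX => by
    obtain ⟨L0, u1, X1, u2⟩ := u_facts hy hX
    set L := log (y:ℝ)
    set u := log X / L
    have S := (SS_le hy X1).trans u2
    have lX : log X = u * L := by simp only [u]; field_simp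
    have e1 : Phi X y * log X ≤ X * SS y X + 2 * ((1+2*K) * (X * SS y X)) := by
      have : Phi X y * log X = ∑ r ∈ Finset.Ioc 0 ⌊X⌋₊, tt y r * log (X/r) + 2 * ∑ r ∈ Finset.Ioc 0 ⌊X⌋₊, tt y r * psy y (X/r) := by
        rw [← log_id, Phi_eq, Finset.sum_mul, ← Finset.sum_add_distrib]
        refine Finset.sum_congr rfl fun r hr => ?_
        have : (0:ℝ) < r := by exact_mod_cast (Finset.mem_Ioc.1 hr).1
        rw [log_div (by linarith) this.ne']; ring
      simp only [this, SS, Finset.mul_sum]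
      refine add_le_add (Finset.sum_le_sum fun r hr => ?_) (Finset.sum_le_sum fun r hr => mul_le_mul_of_nonneg_left ?_ (by norm_num))
      · rw [show X * (tt y r / r) = tt y r * (X/r) by ring]
        exact mul_le_mul_of_nonneg_left (log_le_self (by positivity)) (tt_nn _ _)
      · rw [show (1+2*K)*(X * (tt y r / r)) = tt y r * ((1+2*K)*(X/r)) by ring]
        refine mul_le_mul_of_nonneg_left ?_ (tt_nn _ _)
        have h0 : 0 ≤ X/r := by positivity
        have h := (abs_le.1 (hK y hy (X/r) h0)).2
        have h2 : max (X/r - y) 0 ≤ X/r := max_le (by linarith [(Nat.cast_nonneg y : (0:ℝ) ≤ y)]) h0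
        have h3 : K*(X/r)/L ≤ 2*K*(X/r) := by rw [div_le_iff₀ (by linarith)]; nlinarith [mul_nonneg K0.le h0]
        linarith
    rw [le_div_iff₀ (by linarith)]
    have : u * (Phi X y * L) ≤ u * (K1 * X * u) := by
      calc _ = Phi X y * log X := by rw [lX]; ring
        _ ≤ (3+4*K) * (X * SS y X) := by linarith
        _ ≤ (3+4*K) * (X * (16*u^2)) := by gcongr
        _ = _ := by rw [hK1]; ring
    exact le_of_mul_le_mul_left this (by linarith)
  refine ⟨1 + K1 + 32*K, by positivity, fun y hy X hX => ⟨(A y hy X hX).trans ?_, ?_⟩⟩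
  · obtain ⟨L0, u1, X1, u2⟩ := u_facts hy hX
    gcongr; linarith
  obtain ⟨L0, u1, X1, u2⟩ := u_facts hy hX
  have y0 : (0:ℝ) < y := by positivity
  have y1 : (1:ℝ) ≤ y := by exact_mod_cast (by omega : 1 ≤ y)
  have B := Phi_split (y := y) X1
  have Xy : 1 ≤ X/y := (one_le_div y0).2 hX
  have C := (abel (tt y) Xy (g := fun t => (t^2)⁻¹) (ContinuousOn.intervalIntegrable (ContinuousOn.inv₀ (by fun_prop) fun t ht => by
    rw [uIcc_of_le Xy] at ht; nlinarith [ht.1]))).2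
  simp only [← Phi_eq] at C
  have C2 : X * ∑ n ∈ Finset.Ioc 0 ⌊X/y⌋₊, tt y n * ∫ t in (n:ℝ)..(X/y), (t^2)⁻¹ = ∑ r ∈ Finset.Ioc 0 ⌊X⌋₊, tt y r * max (X/r - y) 0 := by
    rw [Finset.mul_sum]
    refine (Finset.sum_congr rfl (g := fun r : ℕ => tt y r * max (X/r - y) 0) fun r hr => ?_).trans (Finset.sum_subset (Finset.Ioc_subset_Ioc_right (Nat.floor_mono (div_le_self (by linarith) y1))) ?_)
    · have r0 : (0:ℝ) < r := by exact_mod_cast (Finset.mem_Ioc.1 hr).1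
      have r1 : (r:ℝ) ≤ X/y := (Nat.le_floor_iff (by linarith)).1 (Finset.mem_Ioc.1 hr).2
      have h2 : (y:ℝ) ≤ X/r := by rw [le_div_iff₀ r0]; rw [le_div_iff₀ y0] at r1; linarith
      have : ∫ t in (r:ℝ)..(X/y), (t^2)⁻¹ = 1/r - y/X := by
        have := integral_zpow (a := (r:ℝ)) (b := X/y) (n := -2) (Or.inr ⟨by norm_num, fun h => by rw [uIcc_of_le r1] at h; linarith [h.1]⟩)
        norm_num [zpow_neg] at this
        refine Eq.trans (by norm_cast) (this.trans ?_); field_simp; ring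
      rw [this, max_eq_left (by linarith)]; field_simp
    · intro r h1 h2
      have r0 : (0:ℝ) < r := by exact_mod_cast (Finset.mem_Ioc.1 h1).1
      rw [max_eq_right, mul_zero]
      by_contra hc
      push Not at hc
      refine h2 (Finset.mem_Ioc.2 ⟨(Finset.mem_Ioc.1 h1).1, Nat.le_floor ?_⟩)
      rw [le_div_iff₀ y0]; rw [sub_pos, lt_div_iff₀ r0] at hc; linarith
  have E : |∑ r ∈ Finset.Ioc 0 ⌊X⌋₊, tt y r * psy y (X/r) - ∑ r ∈ Finset.Ioc 0 ⌊X⌋₊, tt y r * max (X/r - y) 0| ≤ K * (16 * (log X / log y)^2) * X / log y := by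
    rw [← Finset.sum_sub_distrib]
    refine (Finset.abs_sum_le_sum_abs _ _).trans ?_
    calc _ ≤ ∑ r ∈ Finset.Ioc 0 ⌊X⌋₊, K * X / log y * (tt y r / r) := Finset.sum_le_sum fun r hr => by
          rw [← mul_sub, abs_mul, abs_of_nonneg (tt_nn _ _)]
          refine (mul_le_mul_of_nonneg_left (hK y hy (X/r) (by positivity)) (tt_nn _ _)).trans_eq ?_
          ring
      _ = K * X / log y * SS y X := by rw [SS, Finset.mul_sum]
      _ ≤ K * X / log y * (16 * (log X / log y)^2) := by gcongr; exact (SS_le hy X1).trans u2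
      _ = _ := by ring
  have F : |∫ t in (1:ℝ)..X, Phi t y * t⁻¹| ≤ log y + K1 * X * (log X / log y) / log y := by
    have ii := fun {X : ℝ} (hX : 1 ≤ X) => (abel (tt y) hX (g := fun t => t⁻¹) (intervalIntegral.intervalIntegrable_inv (fun t ht => by rw [uIcc_of_le hX] at ht; linarith [ht.1]) continuousOn_id)).1
    simp only [← Phi_eq] at ii
    have i2 : IntervalIntegrable (fun t => Phi t y * t⁻¹) volume y X := (ii y1).symm.trans (ii X1)
    have nn : ∀ t, 0 ≤ Phi t y := fun t => by rw [Phi_eq]; exact Finset.sum_nonneg fun _ _ => tt_nn _ _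
    rw [← intervalIntegral.integral_add_adjacent_intervals (ii y1) i2]
    refine (abs_add_le _ _).trans (add_le_add ?_ ?_)
    · rw [intervalIntegral.integral_congr (g := fun t => t⁻¹), integral_inv_of_pos one_pos y0, div_one, abs_of_nonneg (by linarith)]
      intro t ht; rw [uIcc_of_le y1] at ht
      simp only; rw [Phi_one ht.1 (by linarith [ht.2]), one_mul]
    · have := intervalIntegral.norm_integral_le_of_norm_le_const (f := fun t => Phi t y * t⁻¹) (a := y) (b := X) (C := K1 * (log X / log y) / log y) (fun t ht => by
        rw [uIoc_of_le hX] at ht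
        have t0 : 0 < t := by linarith [ht.1]
        rw [norm_mul, norm_inv, Real.norm_of_nonneg (nn t), Real.norm_of_nonneg t0.le, ← div_eq_mul_inv, div_le_iff₀ t0]
        refine (A y hy t ht.1.le).trans ?_
        rw [show K1 * (log X / log y) / log y * t = K1 * t * (log X / log y) / log y by ring]
        have := log_le_log t0 ht.2
        gcongr)
      refine this.trans ?_
      rw [abs_of_nonneg (by linarith), show K1 * X * (log X / log y) / log y = K1 * (log X / log y) / log y * X by ring]
      gcongr; linarith
  rw [B, C, show ∀ a b c : ℝ, a + 2*b - 2*X*c = a + 2*(b - X*c) by intros; ring, C2]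
  refine (abs_add_le _ _).trans ?_
  rw [abs_mul, abs_two]
  have q : K1 * X * (log X / log y) / log y ≤ K1 * (X * (log X / log y)^2 / log y) := by
    rw [show K1 * (X * (log X / log y)^2 / log y) = K1 * X * ((log X / log y)^2) / log y by ring]; gcongr; nlinarith
  have q2 : 0 ≤ X * (log X / log y)^2 / log y := by positivity
  have q3 : K * (16 * (log X / log y)^2) * X / log y = 16*K*(X * (log X / log y)^2 / log y) := by ring
  nlinarith [mul_nonneg (by positivity : 0 ≤ K1) (by linarith : 0 ≤ log (y:ℝ)), mul_nonneg K0.le (by linarith : 0 ≤ log (y:ℝ))]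

theorem log_sq_le {y : ℝ} (hy : 1 ≤ y) : (log y)^2 ≤ 4*y := by
  have h := log_le_rpow_div (by linarith : 0 ≤ y) (show (0:ℝ) < 1/2 by norm_num)
  rw [← sqrt_eq_rpow] at h
  nlinarith [sq_sqrt (by linarith : 0 ≤ y), log_nonneg hy, sqrt_nonneg y]
set_option maxHeartbeats 1000000 in
theorem Xi.Phi_D {ξ : ℝ → ℝ} (H : Xi ξ) : ∃ A, 0 < A ∧ ∀ y : ℕ, 2 ≤ y → ∀ X : ℝ, 1 ≤ X →
    |Phi X y - (1 + X / log y * ξ (log X / log y))| ≤ A * (X * (log X / log y)^2 / (log y)^2 + y / log y) := by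
  obtain ⟨K', K0, hK⟩ := Phi_up
  set K := K' + 6 with hKK
  have Kp : 0 < K := by positivity
  suffices h : ∀ y : ℕ, 2 ≤ y → ∀ k : ℕ, ∀ X : ℝ, 1 ≤ X → X ≤ (y:ℝ)^k →
      |Phi X y - (1 + X / log y * ξ (log X / log y))| ≤ 27*K * (X * (log X / log y)^2 / (log y)^2) + K * (y / log y) by
    refine ⟨27*K, by positivity, fun y hy X hX => ?_⟩
    have y1 : (1:ℝ) < y := by exact_mod_cast hy
    obtain ⟨k, hk⟩ := pow_unbounded_of_one_lt X y1
    refine (h y hy k X hX hk.le).trans ?_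
    have : 0 ≤ K * (y / log y) := by have := log_pos y1; positivity
    linarith
  intro y hy k
  have y1 : (1:ℝ) < y := by exact_mod_cast hy
  have L0 := log_pos y1
  set L := log (y:ℝ) with hL
  have rhs0 : ∀ X : ℝ, 0 ≤ X → 0 ≤ 27*K * (X * (log X / L)^2 / L^2) + K * (y / L) := fun X hX => by positivity
  have small : ∀ X : ℝ, 1 ≤ X → X < y → |Phi X y - (1 + X / L * ξ (log X / L))| = 0 := fun X h1 h2 => by
    rw [Phi_one h1 (by linarith), H.h0 _ ((div_lt_one L0).2 (log_lt_log (by linarith) h2))]; simp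
  induction k with
  | zero => intro X h1 h2; rw [pow_zero] at h2; rw [small X h1 (by linarith)]; exact rhs0 X (by linarith)
  | succ k ih =>
    intro X h1 h2
    rcases lt_or_ge X y with h | hX
    · rw [small X h1 h]; exact rhs0 X (by linarith)
    obtain ⟨-, u1, -, -⟩ := u_facts hy hX
    set u := log X / L with hu
    have lX : log X = u * L := by simp only [u]; field_simp
    have b1 : 1 ≤ X/y := (one_le_div (by linarith)).2 hX
    have lb : log (X/y) = (u-1)*L := by rw [log_div (by linarith) (by linarith), lX]; ring
    have i2 : IntervalIntegrable (fun t : ℝ => (t^2)⁻¹) volume 1 (X/y) := ContinuousOn.intervalIntegrable (ContinuousOn.inv₀ (by fun_prop) fun t ht => by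
      rw [uIcc_of_le b1] at ht; nlinarith [ht.1])
    have iP := (abel (tt y) b1 i2).1
    simp only [← Phi_eq] at iP
    have sub := exp_sub (fun s => ξ (s/L)) b1
    have iX : IntervalIntegrable (fun t => ξ (log t/L)/t) volume 1 (X/y) := sub.1.2 (by
      have := IntervalIntegrable.comp_mul_left (c := L⁻¹) (H.ii 0 (log (X/y)/L))
      simpa [div_eq_mul_inv, mul_comm, L0.ne'] using this)
    have vX : ∫ t in (1:ℝ)..(X/y), ξ (log t/L)/t = L * ∫ v in (1:ℝ)..(u-1), ξ v := by
      rw [sub.2, intervalIntegral.integral_comp_div _ L0.ne', lb, smul_eq_mul, zero_div, mul_div_cancel_right₀ _ L0.ne',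
        ← intervalIntegral.integral_add_adjacent_intervals (H.ii 0 1) (H.ii 1 _), H.int0 zero_le_one le_rfl, zero_add]
    have v2 : ∫ t in (1:ℝ)..(X/y), (t^2)⁻¹ = 1 - y/X := by
      have := integral_zpow (a := (1:ℝ)) (b := X/y) (n := -2) (Or.inr ⟨by norm_num, fun h => by rw [uIcc_of_le b1] at h; linarith [h.1]⟩)
      norm_num [zpow_neg] at this
      refine Eq.trans (by norm_cast) (this.trans ?_); field_simp; ring
    have eD : ∀ t ∈ uIcc 1 (X/y), (Phi t y - (1 + t / L * ξ (log t / L))) * (t^2)⁻¹ = Phi t y * (t^2)⁻¹ - ((t^2)⁻¹ + L⁻¹ * (ξ (log t/L)/t)) := fun t ht => by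
      rw [uIcc_of_le b1] at ht
      have : t ≠ 0 := by linarith [ht.1]
      field_simp
    have vD : ∫ t in (1:ℝ)..(X/y), (Phi t y - (1 + t / L * ξ (log t / L))) * (t^2)⁻¹ = (∫ t in (1:ℝ)..(X/y), Phi t y * (t^2)⁻¹) - (1 - y/X + ∫ v in (1:ℝ)..(u-1), ξ v) := by
      rw [intervalIntegral.integral_congr eD, intervalIntegral.integral_sub iP (i2.add (iX.const_mul _)), intervalIntegral.integral_add i2 (iX.const_mul _), intervalIntegral.integral_const_mul, v2, vX]
      field_simp
    have q1 : IntervalIntegrable (fun t : ℝ => (log t)^2 / t) volume 1 (X/y) := ContinuousOn.intervalIntegrable (by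
      rw [uIcc_of_le b1]; refine ContinuousOn.div (ContinuousOn.pow (continuousOn_log.mono fun t ht => ?_) 2) continuousOn_id fun t ht => ?_
      · exact (zero_lt_one.trans_le ht.1).ne'
      · exact (zero_lt_one.trans_le ht.1).ne')
    have q2 : IntervalIntegrable (fun t : ℝ => 4*((t+y)^2)⁻¹) volume 1 (X/y) := ContinuousOn.intervalIntegrable (by
      rw [uIcc_of_le b1]; refine continuousOn_const.mul (ContinuousOn.inv₀ (by fun_prop) fun t ht => by have := ht.1; positivity))
    have w1 : ∫ t in (1:ℝ)..(X/y), (log t)^2 / t = ((u-1)*L)^3/3 := by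
      rw [(exp_sub (fun s => s^2) b1).2, integral_pow, lb]; norm_num
    have w2 : ∫ t in (1:ℝ)..(X/y), 4*((t+y)^2)⁻¹ ≤ 4/y := by
      rw [intervalIntegral.integral_eq_sub_of_hasDerivAt (f := fun t => -4*(t+y)⁻¹) (fun t ht => ?_) q2]
      · have a1 : (1+(y:ℝ))⁻¹ ≤ (y:ℝ)⁻¹ := by gcongr; linarith
        have a2 : 0 ≤ (X/y+y)⁻¹ := by positivity
        rw [div_eq_mul_inv (4:ℝ)]; linarith
      · rw [uIcc_of_le b1] at ht
        have t0 : 0 < t + y := by linarith [ht.1]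
        convert! (((hasDerivAt_id t).add_const (y:ℝ)).inv t0.ne').const_mul (-4) using 1
        simp only [id]; field_simp
    have bd : |∫ t in (1:ℝ)..(X/y), (Phi t y - (1 + t / L * ξ (log t / L))) * (t^2)⁻¹| ≤ 27*K/L^4 * (((u-1)*L)^3/3) + K*y/L*(4/y) := by
      refine (intervalIntegral.abs_integral_le_integral_abs b1).trans ?_
      refine (intervalIntegral.integral_mono_on b1 (g := fun t => 27*K/L^4 * ((log t)^2/t) + K*y/L*(4*((t+y)^2)⁻¹)) ?_ ((q1.const_mul _).add (q2.const_mul _)) fun t ht => ?_).trans ?_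
      · exact ((iP.sub (i2.add (iX.const_mul L⁻¹))).congr fun t ht => (eD t (uIoc_subset_uIcc ht)).symm).abs
      · have t0 : 0 < t := by linarith [ht.1]
        rcases lt_or_ge t y with h | h
        · rw [abs_mul, small t ht.1 h, zero_mul]; positivity
        have c := ih t ht.1 (ht.2.trans ((div_le_iff₀ (by linarith)).2 (by rwa [pow_succ] at h2)))
        rw [abs_mul, abs_of_pos (by positivity : 0 < (t^2)⁻¹)]
        have c2 : (t^2)⁻¹ ≤ 4*((t+y)^2)⁻¹ := by
          rw [← div_eq_mul_inv, inv_eq_one_div, div_le_div_iff₀ (by positivity) (by positivity)]; nlinarith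
        calc _ ≤ (27*K * (t * (log t / L)^2 / L^2) + K * (y / L)) * (t^2)⁻¹ := by gcongr
          _ = 27*K/L^4 * ((log t)^2/t) + K*y/L*(t^2)⁻¹ := by field_simp
          _ ≤ _ := by gcongr
      · rw [intervalIntegral.integral_add (q1.const_mul _) (q2.const_mul _), intervalIntegral.integral_const_mul, intervalIntegral.integral_const_mul, w1]
        gcongr
    have e1 := (hK y hy X hX).2
    set I := ∫ t in (1:ℝ)..(X/y), Phi t y * (t^2)⁻¹
    set I' := ∫ v in (1:ℝ)..(u-1), ξ v
    rw [vD] at bd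
    have hx := H.h1 u u1
    have main : (Phi X y - (1 + X / L * ξ u)) * (u*L) = 2*X*(I - (1 - y/X + I')) + (Phi X y * log X - 2*X*I) - u*L - 2*y := by
      rw [lX, show (Phi X y - (1 + X / L * ξ u)) * (u*L) = Phi X y * (u*L) - u*L - X*(u * ξ u) by field_simp; ring, hx]
      have : X ≠ 0 := by linarith
      field_simp; ring
    have X0 : 0 < X := by linarith
    have Ly : L ≤ y := (log_le_sub_one_of_pos (by linarith)).trans (by linarith)
    have g1 : u*L ≤ 4*(X*u^2/L) := by
      rw [← mul_div_assoc, le_div_iff₀ L0]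
      have := log_sq_le y1.le
      calc u*L*L = u*L^2 := by ring
        _ ≤ u*(4*y) := by gcongr
        _ ≤ u^2*(4*X) := by gcongr; nlinarith
        _ = _ := by ring
    have g2 : |(Phi X y - (1 + X / L * ξ u)) * (u*L)| ≤ 2*X*(27*K/L^4 * (((u-1)*L)^3/3) + K*y/L*(4/y)) + K*(y + X*u^2/L) := by
      rw [main]
      have this : |2*X*(I - (1 - y/X + I'))| ≤ 2*X*(27*K/L^4 * (((u-1)*L)^3/3) + K*y/L*(4/y)) := by
        rw [abs_mul, abs_of_pos (by positivity : 0 < 2*X)]; gcongr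
      rw [abs_le] at this e1 ⊢
      have p0 : 0 ≤ X*u^2/L := by positivity
      have u0 : 0 ≤ u*L := by positivity
      have l := mul_le_mul_of_nonneg_left Ly K0.le
      have k : K*(y + X*u^2/L) = K'*y + K'*(X*u^2/L) + 6*y + 6*(X*u^2/L) := by rw [hKK]; ring
      rw [mul_add] at e1
      rw [k]
      generalize 2*X*(27*K/L^4 * (((u-1)*L)^3/3) + K*y/L*(4/y)) = T at *
      constructor <;> linarith
    rw [abs_mul, abs_of_pos (by positivity : 0 < u*L)] at g2
    refine le_of_mul_le_mul_right (g2.trans ?_) (by positivity : 0 < u*L)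
    have : 2*X*(27*K/L^4 * (((u-1)*L)^3/3) + K*y/L*(4/y)) + K*(y + X*u^2/L) = K*(X/L)*(18*(u-1)^3+8+u^2) + K*y := by field_simp; ring
    rw [this, show (27*K * (X * u^2 / L^2) + K * (y / L)) * (u*L) = K*(X/L)*(27*u^3) + K*y*u by field_simp]
    have : 18*(u-1)^3+8+u^2 ≤ 27*u^3 := by 
      have v0 : 0 ≤ u-1 := by linarith
      linarith [show 27*u^3 - (18*(u-1)^3+8+u^2) = 9*(u-1)^3+80*(u-1)^2+79*(u-1)+18 by ring, (by positivity : 0 ≤ 9*(u-1)^3+80*(u-1)^2+79*(u-1)+18)]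
    have : K*y ≤ K*y*u := by nlinarith [mul_pos Kp (by linarith : (0:ℝ) < y)]
    gcongr

theorem hyp_nat : ∃ K, ∀ N : ℕ, 1 ≤ N → |∑ n ∈ Finset.Ioc 0 N, tau n - (N * log N + (2*eulerMascheroniConstant-1)*N)| ≤ K * √N := by
  refine ⟨20, fun N hN => ?_⟩
  set r := N.sqrt with hr
  have r1 : 1 ≤ r := Nat.le_sqrt'.2 (by simpa using hN)
  have rN : r*r ≤ N := Nat.sqrt_le N
  have rN2 : N < (r+1)*(r+1) := Nat.lt_succ_sqrt N
  have rleN : r ≤ N := Nat.sqrt_le_self N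
  have e : ∑ n ∈ Finset.Ioc 0 N, tau n = 2 * ∑ a ∈ Finset.Ioc 0 r, ((N/a : ℕ) : ℝ) - r^2 := by
    rw [tau, ArithmeticFunction.sum_Ioc_mul_eq_sum_prod_filter]
    have h1 : ∀ x ∈ (Finset.Ioc 0 N ×ˢ Finset.Ioc 0 N).filter (fun x => x.1*x.2 ≤ N), (ArithmeticFunction.zeta : ArithmeticFunction ℝ) x.1 * (ArithmeticFunction.zeta : ArithmeticFunction ℝ) x.2 =
        (if x.1 ≤ r then (1:ℝ) else 0) + (if x.2 ≤ r then 1 else 0) - if x.1 ≤ r ∧ x.2 ≤ r then 1 else 0 := fun x hx => by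
      simp only [Finset.mem_filter, Finset.mem_product, Finset.mem_Ioc] at hx
      simp only [ArithmeticFunction.natCoe_apply, ArithmeticFunction.zeta_apply, hx.1.1.1.ne', hx.1.2.1.ne', if_false]
      have : x.1 ≤ r ∨ x.2 ≤ r := by
        by_contra! hc
        have := Nat.mul_le_mul (Nat.succ_le_of_lt hc.1) (Nat.succ_le_of_lt hc.2)
        simp only [Nat.succ_eq_add_one] at this; omega
      by_cases c1 : x.1 ≤ r <;> by_cases c2 : x.2 ≤ r <;> simp [c1, c2]; tauto
    rw [Finset.sum_congr rfl h1, Finset.sum_sub_distrib, Finset.sum_add_distrib]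
    have h2 : ∀ a, 0 < a → (((Finset.Ioc 0 N).filter fun b => a*b ≤ N).card) = N/a := fun a ha => by
      rw [show (Finset.Ioc 0 N).filter (fun b => a*b ≤ N) = Finset.Ioc 0 (N/a) from ?_]; simp
      ext b
      simp only [Finset.mem_filter, Finset.mem_Ioc, Nat.le_div_iff_mul_le ha, mul_comm b a]
      exact ⟨fun h => ⟨h.1.1, h.2⟩, fun h => ⟨⟨h.1, (Nat.le_mul_of_pos_left b ha).trans h.2⟩, h.2⟩⟩
    have h3 : ∑ x ∈ (Finset.Ioc 0 N ×ˢ Finset.Ioc 0 N).filter (fun x => x.1*x.2 ≤ N), (if x.1 ≤ r then (1:ℝ) else 0) = ∑ a ∈ Finset.Ioc 0 r, ((N/a : ℕ) : ℝ) := by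
      rw [Finset.sum_filter, Finset.sum_product]
      rw [← Finset.sum_subset (Finset.Ioc_subset_Ioc_right rleN)]
      · refine Finset.sum_congr rfl fun a ha => ?_
        obtain ⟨ha, ha'⟩ := Finset.mem_Ioc.1 ha
        simp only [ha', if_true]
        rw [← h2 a ha, Finset.card_filter]; push_cast; rfl
      · intro a h1 h2
        have : ¬ a ≤ r := fun h => h2 (Finset.mem_Ioc.2 ⟨(Finset.mem_Ioc.1 h1).1, h⟩)
        simp [this]
    have h4 : ∑ x ∈ (Finset.Ioc 0 N ×ˢ Finset.Ioc 0 N).filter (fun x => x.1*x.2 ≤ N), (if x.2 ≤ r then (1:ℝ) else 0) = ∑ a ∈ Finset.Ioc 0 r, ((N/a : ℕ) : ℝ) := by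
      rw [← h3, Finset.sum_filter, Finset.sum_filter, Finset.sum_product, Finset.sum_comm, Finset.sum_product]
      simp only [mul_comm]
    have h5 : ∑ x ∈ (Finset.Ioc 0 N ×ˢ Finset.Ioc 0 N).filter (fun x => x.1*x.2 ≤ N), (if x.1 ≤ r ∧ x.2 ≤ r then (1:ℝ) else 0) = r^2 := by
      rw [← Finset.sum_filter, Finset.filter_filter, show (Finset.Ioc 0 N ×ˢ Finset.Ioc 0 N).filter (fun x => x.1*x.2 ≤ N ∧ x.1 ≤ r ∧ x.2 ≤ r) = Finset.Ioc 0 r ×ˢ Finset.Ioc 0 r from ?_]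
      · simp [pow_two]
      · ext x
        simp only [Finset.mem_filter, Finset.mem_product, Finset.mem_Ioc]
        exact ⟨fun h => ⟨⟨h.1.1.1, h.2.2.1⟩, ⟨h.1.2.1, h.2.2.2⟩⟩, fun h => ⟨⟨⟨h.1.1, h.1.2.trans rleN⟩, ⟨h.2.1, h.2.2.trans rleN⟩⟩, (Nat.mul_le_mul h.1.2 h.2.2).trans rN, h.1.2, h.2.2⟩⟩
    rw [h3, h4, h5]; ring
  have r0 : (1:ℝ) ≤ r := by exact_mod_cast r1
  have s1 : (r:ℝ) ≤ √N := le_sqrt_of_sq_le (by exact_mod_cast (by rwa [pow_two] : r^2 ≤ N))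
  have s2 : √N < r + 1 := (sqrt_lt' (by positivity)).2 (by exact_mod_cast (by rwa [pow_two] : N < (r+1)^2))
  have fl : |∑ a ∈ Finset.Ioc 0 r, ((N/a : ℕ) : ℝ) - N * (harmonic r : ℝ)| ≤ r := by
    rw [harmonic_eq_sum_Icc]; push_cast
    rw [Finset.mul_sum, show Finset.Icc 1 r = Finset.Ioc 0 r from rfl, ← Finset.sum_sub_distrib]
    refine (Finset.abs_sum_le_sum_abs _ _).trans ((Finset.sum_le_card_nsmul _ _ 1 fun a ha => ?_).trans (by simp))
    have a0 : (0:ℝ) < a := by exact_mod_cast (Finset.mem_Ioc.1 ha).1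
    have b1 : ((N/a:ℕ):ℝ) ≤ N/a := Nat.cast_div_le
    have b2 : (N:ℝ)/a < (N/a:ℕ) + 1 := by rw [div_lt_iff₀ a0]; exact_mod_cast Nat.lt_div_mul_add (Finset.mem_Ioc.1 ha).1 |>.trans_eq (by ring)
    rw [abs_le, ← div_eq_mul_inv]; constructor <;> linarith
  have g1 := Real.eulerMascheroniSeq_lt_eulerMascheroniConstant r
  have g2 := Real.eulerMascheroniConstant_lt_eulerMascheroniSeq' r
  rw [Real.eulerMascheroniSeq] at g1
  rw [Real.eulerMascheroniSeq', if_neg (by omega)] at g2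
  set S := √(N:ℝ)
  have SS : S*S = N := mul_self_sqrt (by positivity)
  have S1 : 1 ≤ S := r0.trans s1
  have lN : log N = 2 * log S := by rw [← SS, log_mul (by positivity) (by positivity)]; ring
  have l1 : log r ≤ log S := log_le_log (by positivity) s1
  have l2 : log S ≤ log (r+1) := log_le_log (by positivity) s2.le
  have l3 : log (r+1) - log r ≤ 1/r := by
    rw [← log_div (by positivity) (by positivity)]
    refine (log_le_sub_one_of_pos (by positivity)).trans_eq (by field_simp; ring)
  have l4 : 1/(r:ℝ) ≤ 2/S := by rw [div_le_div_iff₀ (by positivity) (by positivity)]; linarith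
  have h : |(harmonic r:ℝ) - log S - eulerMascheroniConstant| ≤ 2/S := by rw [abs_le]; constructor <;> linarith
  have hh : |N*((harmonic r:ℝ) - log S - eulerMascheroniConstant)| ≤ 2*S := by
    rw [abs_mul, abs_of_nonneg (by positivity : (0:ℝ) ≤ N)]
    calc _ ≤ (N:ℝ) * (2/S) := by gcongr
      _ = _ := by rw [← SS]; field_simp
  rw [e, lN]
  have hS : (S-1)^2 ≤ (r:ℝ)^2 := by apply pow_le_pow_left₀ <;> linarith
  have hS2 : (r:ℝ)^2 ≤ N := by exact_mod_cast (by rwa [pow_two] : r^2 ≤ N)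
  rw [abs_le] at hh fl ⊢
  constructor <;> nlinarith
theorem hyp_real : ∃ K, 0 < K ∧ ∃ c0 : ℝ, ∀ η : ℝ, 0 < η → η ≤ 1/2 → ∀ X : ℝ, 0 < X → |∑ n ∈ Finset.Ioc 0 ⌊X⌋₊, tau n - X * (log X + c0)| ≤ K/η * X^(1-η) := by
  obtain ⟨K, hK⟩ := hyp_nat
  set c0 := 2*eulerMascheroniConstant-1
  refine ⟨2*|K| + |c0| + 10, by positivity, c0, fun η h0 h1 X hX => ?_⟩
  have P0 : 0 < X^(1-η) := by positivity
  have e1 : 1 ≤ 1/η := by rw [le_div_iff₀ h0]; linarith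
  rcases lt_or_ge X 1 with hX1 | hX1
  · have l := log_le_rpow_div (x := X⁻¹) (by positivity) h0
    rw [log_inv, inv_rpow hX.le, ← rpow_neg hX.le] at l
    have l2 : X * (-log X) ≤ X^(1-η)/η := by
      refine (mul_le_mul_of_nonneg_left l hX.le).trans_eq ?_
      rw [sub_eq_add_neg, rpow_add hX, rpow_one]; ring
    have l3 : X ≤ X^(1-η) := by
      nth_rw 1 [← rpow_one X]; exact rpow_le_rpow_of_exponent_ge hX hX1.le (by linarith)
    rw [Nat.floor_eq_zero.2 hX1]
    simp only [Finset.Ioc_self, Finset.sum_empty, zero_sub, abs_neg]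
    rw [mul_add]
    refine (abs_add_le _ _).trans ?_
    rw [abs_mul, abs_mul, abs_of_pos hX, abs_of_neg (log_neg hX hX1)]
    have l4 : X*|c0| ≤ |c0| * (X^(1-η)/η) := by
      rw [mul_comm]; gcongr; refine l3.trans ?_; rw [div_eq_mul_one_div]; nlinarith
    have : 0 ≤ 2*|K| * (X^(1-η)/η) := by positivity
    have : 0 ≤ X^(1-η)/η := by positivity
    rw [div_mul_eq_mul_div, mul_div_assoc]; nlinarith
  · have N1 : 1 ≤ ⌊X⌋₊ := (Nat.one_le_floor_iff X).2 hX1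
    have h := hK _ N1
    set N := ((⌊X⌋₊ : ℕ) : ℝ)
    have n1 : (1:ℝ) ≤ N := Nat.one_le_cast.2 N1
    have n2 : N ≤ X := Nat.floor_le hX.le
    have n3 : X < N + 1 := Nat.lt_floor_add_one X
    have sq : √X ≤ X^(1-η) := by rw [sqrt_eq_rpow]; exact rpow_le_rpow_of_exponent_le hX1 (by linarith)
    have sq1 : 1 ≤ √X := one_le_sqrt.2 hX1
    have lX : log X ≤ 2*√X := by have := log_le_rpow_div hX.le (show (0:ℝ) < 1/2 by norm_num); rw [← sqrt_eq_rpow] at this; linarith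
    have d1 : log X - log N ≤ 1/N := by
      rw [← log_div (by positivity) (by positivity)]
      refine (log_le_sub_one_of_pos (by positivity)).trans ?_
      rw [div_sub_one (by positivity)]; gcongr; linarith
    have d2 : 0 ≤ log X - log N := sub_nonneg.2 (log_le_log (by positivity) n2)
    have d3 : N*(log X - log N) ≤ 1 := by calc _ ≤ N*(1/N) := by gcongr
                                         _ = 1 := by field_simp
    have d4 : 0 ≤ N*(log X - log N) := by positivity
    have d5 := log_nonneg hX1
    have d6 : |(N*log N + c0*N) - X*(log X + c0)| ≤ (3 + |c0|)*√X := by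
      have : (N*log N + c0*N) - X*(log X + c0) = -(N*(log X - log N)) - (X-N)*log X - (X-N)*c0 := by ring
      rw [this]
      have a1 : (X-N)*log X ≤ 2*√X := by nlinarith
      have a2 : |(X-N)*c0| ≤ |c0| * √X := by rw [abs_mul, abs_of_nonneg (by linarith)]; nlinarith [abs_nonneg c0]
      have a3 : 0 ≤ (X-N)*log X := mul_nonneg (by linarith) d5
      rw [abs_le] at a2 ⊢; constructor <;> nlinarith [abs_nonneg c0]
    have d7 : K*√N ≤ |K| * √X := mul_le_mul (le_abs_self K) (sqrt_le_sqrt n2) (by positivity) (by positivity)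
    have : |∑ n ∈ Finset.Ioc 0 ⌊X⌋₊, tau n - X * (log X + c0)| ≤ (|K| + 3 + |c0|)*√X := by
      refine (abs_sub_le _ (N*log N + c0*N) _).trans ?_
      linarith
    refine this.trans ?_
    rw [div_eq_mul_one_div, mul_assoc]
    have : √X ≤ 1/η*X^(1-η) := sq.trans (by nlinarith)
    exact mul_le_mul (by linarith [abs_nonneg K]) this (by positivity) (by positivity)

noncomputable def dd (p : ℕ) : ArithmeticFunction ℝ := ⟨fun n => if n ≠ 0 ∧ n = p then 1 else 0, by simp⟩
theorem dd_ap (p n : ℕ) : dd p n = if n ≠ 0 ∧ n = p then 1 else 0 := rfl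
theorem af_sub (f g : ArithmeticFunction ℝ) (n : ℕ) : (f-g) n = f n - g n := by
  rw [sub_eq_add_neg, ArithmeticFunction.add_apply]; rfl
theorem dd_mul {p : ℕ} (hp : 0 < p) (f : ArithmeticFunction ℝ) (n : ℕ) : (dd p * f) n = if p ∣ n then f (n/p) else 0 := by
  rw [ArithmeticFunction.mul_apply]
  rcases Nat.eq_zero_or_pos n with rfl | hn
  · simp
  split_ifs with h
  · obtain ⟨k, rfl⟩ := h
    rw [Nat.mul_div_cancel_left _ hp, Finset.sum_eq_single (p, k)]
    · simp [dd_ap, hp.ne']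
    · rintro ⟨a, b⟩ h1 h2
      have h1 := (Nat.mem_divisorsAntidiagonal.1 h1).1
      have : ¬ (a ≠ 0 ∧ a = p) := by
        rintro ⟨-, rfl⟩; exact h2 (Prod.ext rfl (Nat.eq_of_mul_eq_mul_left hp h1))
      rw [dd_ap, if_neg this, zero_mul]
    · intro h; exact absurd (Nat.mem_divisorsAntidiagonal.2 ⟨rfl, hn.ne'⟩) h
  · refine Finset.sum_eq_zero fun x hx => ?_
    have h1 := (Nat.mem_divisorsAntidiagonal.1 hx).1
    have : ¬ (x.1 ≠ 0 ∧ x.1 = p) := by rintro ⟨-, rfl⟩; exact h ⟨_, h1.symm⟩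
    rw [dd_ap, if_neg this, zero_mul]
theorem dd_sum {p : ℕ} (hp : 0 < p) (f : ArithmeticFunction ℝ) (N : ℕ) : ∑ n ∈ Finset.Ioc 0 N, (dd p * f) n = ∑ n ∈ Finset.Ioc 0 (N/p), f n := by
  rw [ArithmeticFunction.sum_Ioc_mul_eq_sum_sum, Finset.sum_eq_single p]
  · simp [dd_ap, hp.ne']
  · intro b _ h; simp [dd_ap, h]
  · intro h
    have : N/p = 0 := Nat.div_eq_of_lt (by simp at h; omega)
    simp [this]
theorem RR_succ {y r : ℕ} : RR (y+1) r ↔ RR y r ∧ ((y+1).Prime → ¬ (y+1) ∣ r) :=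
  ⟨fun h => ⟨fun p hp d => (Nat.lt_succ_self y).trans (h p hp d), fun hp d => lt_irrefl _ (h _ hp d)⟩, fun h p hp d => lt_of_le_of_ne (h.1 p hp d) (by
    rintro (e : y + 1 = p); exact h.2 (by rwa [e]) (by rwa [e]))⟩
theorem rst_np {y : ℕ} (hp : ¬ (y+1).Prime) (f) : rst (y+1) f = rst y f := by
  ext n; rw [rst_ap, rst_ap]; have : RR (y+1) n ↔ RR y n := RR_succ.trans (by simp [hp])
  by_cases h3 : RR y n <;> simp [this, h3]
theorem rst_p {y : ℕ} (hp : (y+1).Prime) : rst (y+1) ArithmeticFunction.zeta = (1 - dd (y+1)) * rst y ArithmeticFunction.zeta := by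
  ext n
  rw [sub_mul, one_mul, af_sub, dd_mul (by omega)]
  simp only [rst_ap]
  by_cases d : (y+1) ∣ n
  · obtain ⟨k, rfl⟩ := d
    have : RR y (y+1) := fun q hq d => by rw [(Nat.prime_dvd_prime_iff_eq hq hp).1 d]; omega
    rw [Nat.mul_div_cancel_left _ (by omega)]
    rcases Nat.eq_zero_or_pos k with rfl | hk
    · simp
    have h1 : ¬ RR (y+1) ((y+1)*k) := fun h => (RR_succ.1 h).2 hp (dvd_mul_right _ _)
    have h2 : RR y ((y+1)*k) ↔ RR y k := by rw [RR.mul]; simp [this]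
    by_cases h3 : RR y k <;> simp [h1, h2, h3, ArithmeticFunction.natCoe_apply, ArithmeticFunction.zeta_apply, hk.ne']
  · have : RR (y+1) n ↔ RR y n := RR_succ.trans (by simp [d])
    by_cases h3 : RR y n <;> simp [d, this, h3]
theorem tt_p {y : ℕ} (hp : (y+1).Prime) : tt (y+1) = (1 - dd (y+1)) * ((1 - dd (y+1)) * tt y) := by
  rw [tt, tt, tau, rst_mul, rst_mul, rst_p hp]; ring
theorem tt_one : tt 1 = tau := by
  ext n; rw [tt, rst_ap, if_pos (show RR 1 n from fun p hp _ => hp.one_lt)]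
noncomputable def pr (g : ℕ → ℝ) (y : ℕ) : ℝ := ∏ p ∈ (Finset.Icc 1 y).filter Nat.Prime, g p
theorem pr_one (g) : pr g 1 = 1 := by rw [pr]; simp [Finset.prod_filter, Nat.not_prime_one]
theorem pr_succ (g y) : pr g (y+1) = pr g y * if (y+1).Prime then g (y+1) else 1 := by
  simp only [pr, Finset.prod_filter]; rw [Finset.prod_Icc_succ_top (by omega)]
noncomputable def c1 (y : ℕ) : ℝ := pr (fun p => (1-1/(p:ℝ))^2) y
theorem rk_step {p : ℕ} (hp : 0 < p) {f : ArithmeticFunction ℝ} {c b K η : ℝ}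
    (h : ∀ X : ℝ, 0 < X → |∑ n ∈ Finset.Ioc 0 ⌊X⌋₊, f n - X*(c*log X+b)| ≤ K*X^(1-η)) :
    ∃ b', ∀ X : ℝ, 0 < X → |∑ n ∈ Finset.Ioc 0 ⌊X⌋₊, ((1-dd p)*f) n - X*(c*(1-1/(p:ℝ))*log X+b')| ≤ K*(1+(p:ℝ)^(η-1))*X^(1-η) := by
  refine ⟨b*(1-1/p)+c*log p/p, fun X hX => ?_⟩
  have p0 : (0:ℝ) < p := by exact_mod_cast hp
  have e : ∑ n ∈ Finset.Ioc 0 ⌊X⌋₊, ((1-dd p)*f) n = ∑ n ∈ Finset.Ioc 0 ⌊X⌋₊, f n - ∑ n ∈ Finset.Ioc 0 ⌊X/p⌋₊, f n := by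
    rw [Nat.floor_div_natCast, ← dd_sum hp, ← Finset.sum_sub_distrib]
    simp only [sub_mul, one_mul, af_sub]
  have h1 := h X hX
  have h2 := h (X/p) (by positivity)
  rw [log_div hX.ne' p0.ne'] at h2
  have e2 : (X/p)^(1-η) = (p:ℝ)^(η-1)*X^(1-η) := by
    rw [div_rpow hX.le p0.le, div_eq_mul_inv, ← rpow_neg p0.le, mul_comm]; congr 2; ring
  rw [e2] at h2
  have e3 : ∑ n ∈ Finset.Ioc 0 ⌊X⌋₊, ((1-dd p)*f) n - X*(c*(1-1/(p:ℝ))*log X+(b*(1-1/p)+c*log p/p)) =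
    (∑ n ∈ Finset.Ioc 0 ⌊X⌋₊, f n - X*(c*log X+b)) - (∑ n ∈ Finset.Ioc 0 ⌊X/p⌋₊, f n - X/p*(c*(log X-log p)+b)) := by
    rw [e]; field_simp; ring
  rw [e3]; refine (abs_sub _ _).trans ?_; nlinarith
theorem rankin : ∃ K, 0 < K ∧ ∀ η : ℝ, 0 < η → η ≤ 1/2 → ∀ y : ℕ, 1 ≤ y → ∃ b, ∀ X : ℝ, 0 < X →
    |Phi X y - X*(c1 y*log X+b)| ≤ K/η * pr (fun p => (1+(p:ℝ)^(η-1))^2) y * X^(1-η) := by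
  obtain ⟨K, K0, c0, hK⟩ := hyp_real
  refine ⟨K, K0, fun η h0 h1 y hy => ?_⟩
  simp only [Phi_eq]
  induction y, hy using Nat.le_induction with
  | base => exact ⟨c0, fun X hX => by simpa [tt_one, c1, pr_one] using hK η h0 h1 X hX⟩
  | succ y hy ih =>
    obtain ⟨b, ih⟩ := ih
    by_cases hp : (y+1).Prime
    · obtain ⟨b1, k1⟩ := rk_step (p := y+1) (by omega) ih
      obtain ⟨b2, k2⟩ := rk_step (p := y+1) (by omega) k1
      refine ⟨b2, fun X hX => ?_⟩
      rw [tt_p hp]; convert k2 X hX using 1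
      · simp only [c1, pr_succ, hp, if_true]; ring_nf
      · simp only [pr_succ, hp, if_true]; ring
    · refine ⟨b, fun X hX => ?_⟩
      simpa only [c1, pr_succ, hp, if_false, mul_one, tt, rst_np hp] using ih X hX

theorem pinv_pow (k : ℕ) : ∑ p ∈ (Finset.Icc 1 (2^(k+1))).filter Nat.Prime, 1/(p:ℝ) ≤ 1 + 4*(harmonic k : ℝ) := by
  induction k with
  | zero =>
    rw [Finset.sum_filter]; norm_num [Finset.sum_Icc_succ_top, Nat.prime_two, Nat.not_prime_one]
  | succ k ih =>
    have e : (Finset.Icc 1 (2^(k+2))).filter Nat.Prime = (Finset.Icc 1 (2^(k+1))).filter Nat.Prime ∪ (Finset.Ioc (2^(k+1)) (2^(k+2))).filter Nat.Prime := by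
      have h : 2^(k+1) ≤ 2^(k+2) := Nat.pow_le_pow_right (by norm_num) (by omega)
      have h' : 1 ≤ 2^(k+1) := Nat.one_le_two_pow
      ext p; simp only [Finset.mem_union, Finset.mem_filter, Finset.mem_Icc, Finset.mem_Ioc]; constructor
      · rintro ⟨a, b⟩; by_cases c : p ≤ 2^(k+1)
        · exact Or.inl ⟨⟨a.1, c⟩, b⟩
        · exact Or.inr ⟨⟨by omega, a.2⟩, b⟩
      · rintro (⟨a, b⟩ | ⟨a, b⟩)
        · exact ⟨⟨a.1, a.2.trans h⟩, b⟩
        · exact ⟨⟨by omega, a.2⟩, b⟩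
    have lt : 0 < log 2 := log_pos (by norm_num)
    have l4 : log 4 = 2*log 2 := by rw [show (4:ℝ) = 2^2 by norm_num, log_pow]; norm_num
    have q : (0:ℝ) < 2^(k+1)*((k+1)*log 2) := by positivity
    have b : ∑ p ∈ (Finset.Ioc (2^(k+1)) (2^(k+2))).filter Nat.Prime, 1/(p:ℝ) ≤ 4/((k:ℝ)+1) := by
      calc _ ≤ ∑ p ∈ (Finset.Ioc (2^(k+1)) (2^(k+2))).filter Nat.Prime, log p / (2^(k+1)*((k+1)*log 2)) := by
            refine Finset.sum_le_sum fun p hp => ?_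
            have hp := (Finset.mem_Ioc.1 (Finset.mem_filter.1 hp).1).1
            have h1 : (2:ℝ)^(k+1) ≤ p := by exact_mod_cast hp.le
            have h0 : (0:ℝ) < p := lt_of_lt_of_le (by positivity) h1
            have h2 : ((k:ℝ)+1)*log 2 ≤ log p := by
              have := log_le_log (by positivity) h1
              rw [log_pow] at this; push_cast at this; exact this
            rw [div_le_div_iff₀ h0 q]
            have := mul_le_mul h1 h2 (by positivity) h0.le; linarith
        _ ≤ (∑ p ∈ (Finset.Ioc 0 (2^(k+2))).filter Nat.Prime, log p) / (2^(k+1)*((k+1)*log 2)) := by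
            rw [← Finset.sum_div]; refine div_le_div_of_nonneg_right ?_ q.le
            refine Finset.sum_le_sum_of_subset_of_nonneg (Finset.filter_subset_filter _ (Finset.Ioc_subset_Ioc_left (Nat.zero_le _))) fun p _ _ => log_natCast_nonneg p
        _ ≤ (log 4 * 2^(k+2)) / (2^(k+1)*((k+1)*log 2)) := by
            gcongr
            have := Chebyshev.theta_le_log4_mul_x (x := ((2^(k+2) : ℕ):ℝ)) (by positivity)
            rw [Chebyshev.theta, Nat.floor_natCast] at this; push_cast at this; exact this
        _ = _ := by rw [l4]; field_simp; ring
    rw [e, harmonic_succ]; push_cast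
    rw [Finset.sum_union (Finset.disjoint_left.2 fun p h1 h2 => by
      simp only [Finset.mem_filter, Finset.mem_Icc, Finset.mem_Ioc] at h1 h2; omega)]
    rw [← one_div, mul_add, mul_one_div]; linarith
theorem pinv : ∀ y : ℕ, 2 ≤ y → ∑ p ∈ (Finset.Icc 1 y).filter Nat.Prime, 1/(p:ℝ) ≤ 8 + 4*log (1+log y) := fun y hy => by
  have lt : 0 < log 2 := log_pos (by norm_num)
  have hy0 : (2:ℝ) ≤ y := by exact_mod_cast hy
  set k := Nat.log 2 y
  have k1 : 1 ≤ k := Nat.log_pos (by norm_num) hy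
  have k0 : (1:ℝ) ≤ k := by exact_mod_cast k1
  have h1 : (2:ℝ)^k ≤ y := by exact_mod_cast Nat.pow_log_le_self 2 (by omega)
  have h2 := log_le_log (by positivity) h1
  rw [log_pow] at h2
  have h3 : (k:ℝ) ≤ 2*(1+log y) := by nlinarith [log_two_gt_d9]
  have h4 := log_le_log (by positivity) h3
  have L0 : 0 ≤ log y := log_nonneg (by linarith)
  rw [log_mul (by norm_num) (by linarith)] at h4
  have h5 := harmonic_le_one_add_log k
  have h6 := pinv_pow k
  have h7 : ∑ p ∈ (Finset.Icc 1 y).filter Nat.Prime, 1/(p:ℝ) ≤ ∑ p ∈ (Finset.Icc 1 (2^(k+1))).filter Nat.Prime, 1/(p:ℝ) :=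
    Finset.sum_le_sum_of_subset_of_nonneg (Finset.filter_subset_filter _ (Finset.Icc_subset_Icc_right (Nat.lt_pow_succ_log_self (by norm_num) y).le)) fun p _ _ => by positivity
  linarith [log_two_lt_d9]
theorem pr_up : ∀ y : ℕ, 2 ≤ y → ∀ η : ℝ, 0 ≤ η → η*log y ≤ 1/4 → pr (fun p => (1+(p:ℝ)^(η-1))^2) y ≤ exp 32*(1+log y)^16 := fun y hy η h0 h1 => by
  have hy0 : (2:ℝ) ≤ y := by exact_mod_cast hy
  have L0 : 0 ≤ log y := log_nonneg (by linarith)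
  calc _ ≤ ∏ p ∈ (Finset.Icc 1 y).filter Nat.Prime, exp (4*(1/(p:ℝ))) := by
        refine Finset.prod_le_prod (fun _ _ => by positivity) fun p hp => ?_
        have hp := Finset.mem_Icc.1 (Finset.mem_filter.1 hp).1
        have p0 : (1:ℝ) ≤ p := by exact_mod_cast hp.1
        have lp : log p ≤ log y := log_le_log (by linarith) (by exact_mod_cast hp.2)
        have a : (p:ℝ)^(η-1) ≤ 2*(1/p) := by
          rw [sub_eq_add_neg, rpow_add (by linarith), rpow_neg_one, one_div]; gcongr
          rw [rpow_def_of_pos (by linarith)]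
          have : exp (log p * η) ≤ exp (1/4) := exp_le_exp.2 (by nlinarith [log_nonneg p0])
          refine this.trans ?_
          have := exp_bound_div_one_sub_of_interval (x := 1/4) (by norm_num) (by norm_num)
          exact this.trans (by norm_num)
        have b : 1+(p:ℝ)^(η-1) ≤ exp (2*(1/p)) := by linarith [add_one_le_exp (2*(1/(p:ℝ)))]
        calc _ ≤ (exp (2*(1/(p:ℝ))))^2 := by gcongr
          _ = _ := by rw [← exp_nat_mul]; congr 1; push_cast; ring
    _ = exp (4*∑ p ∈ (Finset.Icc 1 y).filter Nat.Prime, 1/(p:ℝ)) := by rw [← exp_sum, Finset.mul_sum]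
    _ ≤ exp (32 + (16:ℕ)*log (1+log y)) := by rw [exp_le_exp]; push_cast; linarith [pinv y hy]
    _ = _ := by rw [exp_add, exp_nat_mul, exp_log (by linarith)]
theorem theta_low (N : ℕ) (hN : 1 ≤ N) : log N - 1 ≤ ∑ p ∈ (Finset.Icc 1 N).filter Nat.Prime, log p / ((p:ℝ)-1) := by
  have n0 : (0:ℝ) < N := by exact_mod_cast hN
  have h1 : (N:ℝ)*(log N - 1) ≤ log (N.factorial : ℝ) := by
    have := Real.pow_div_factorial_le_exp (N:ℝ) n0.le N
    have := log_le_log (by positivity) this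
    rw [log_exp, log_div (by positivity) (by positivity), log_pow] at this; linarith
  have h2 : log (N.factorial : ℝ) ≤ N * ∑ p ∈ (Finset.Icc 1 N).filter Nat.Prime, log p / ((p:ℝ)-1) := by
    have e := Nat.factorization_prod_pow_eq_self N.factorial_ne_zero
    rw [← e, Finsupp.prod, Nat.cast_prod, log_prod (fun p hp => by have := (Nat.prime_of_mem_primeFactors hp).pos; positivity), Finset.mul_sum]
    calc _ ≤ ∑ p ∈ N.factorial.factorization.support, (N:ℝ)*(log p/((p:ℝ)-1)) := by
          refine Finset.sum_le_sum fun p hp => ?_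
          have hp := Nat.prime_of_mem_primeFactors hp
          haveI := Fact.mk hp
          have := sub_one_mul_padicValNat_factorial (p := p) N
          have h3 : (p-1) * N.factorial.factorization p ≤ N := by rw [Nat.factorization_def _ hp]; omega
          have p1 : (1:ℝ) < p := by exact_mod_cast hp.one_lt
          have h4 : ((p:ℝ)-1) * N.factorial.factorization p ≤ N := by
            rw [← Nat.cast_one, ← Nat.cast_sub hp.pos]; exact_mod_cast h3
          push_cast; rw [log_pow, ← mul_div_assoc, le_div_iff₀ (by linarith)]
          nlinarith [log_pos p1]
      _ ≤ _ := by
          refine Finset.sum_le_sum_of_subset_of_nonneg (fun p hp => ?_) fun p hp _ => ?_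
          · have h := Nat.prime_of_mem_primeFactors hp
            simp only [Finset.mem_filter, Finset.mem_Icc]
            exact ⟨⟨h.pos, (h.dvd_factorial).1 (Nat.dvd_of_mem_primeFactors hp)⟩, h⟩
          · have p1 : (1:ℝ) ≤ p := by exact_mod_cast (Finset.mem_Icc.1 (Finset.mem_filter.1 hp).1).1
            have := log_nonneg p1
            exact mul_nonneg n0.le (div_nonneg this (by linarith))
  nlinarith

theorem Xi.match {ξ : ℝ → ℝ} (H : Xi ξ) : ∃ K, 0 < K ∧ ∀ y : ℕ, 2 ≤ y → ∃ b, ∀ u : ℝ, 80*(1+log (1+log y)) ≤ u →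
    |cc*(u+2)/log y - (c1 y*log y*u+b)| ≤ K*u^2/(log y)^2 ∧ |Phi (exp (u*log y)) y - exp (u*log y)*(c1 y*log y*u+b)| ≤ K*exp (u*log y)/(log y)^2 := by
  obtain ⟨A, A0, hA⟩ := H.Phi_D
  obtain ⟨Kr, Kr0, hr, -⟩ := H.rho_bd
  obtain ⟨K1, K10, h1⟩ := rankin
  refine ⟨1+Kr+2*A+4*K1*exp 32, by positivity, fun y hy => ?_⟩
  have hy0 : (2:ℝ) ≤ y := by exact_mod_cast hy
  have ly : log 2 ≤ log y := log_le_log (by norm_num) hy0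
  have l2 := log_two_gt_d9
  set L := log (y:ℝ) with hL
  have L0 : 0 < L := by linarith
  have yL : (y:ℝ) = exp L := by rw [hL, exp_log (by linarith)]
  obtain ⟨b, hb⟩ := h1 (1/(4*L)) (by positivity) (by rw [div_le_div_iff₀ (by positivity) (by norm_num)]; linarith) y (by omega)
  refine ⟨b, fun u hu => ?_⟩
  set q := 1 + L with hq
  have q1 : 1 ≤ q := by linarith
  have lq := log_nonneg q1
  have u1 : 80 ≤ u := by linarith
  have qq : exp (-(u/4)) ≤ (q^20)⁻¹ := by
    rw [exp_neg]; gcongr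
    calc q^20 = exp ((20:ℕ)*log q) := by rw [exp_nat_mul, exp_log (by linarith)]
      _ ≤ _ := exp_le_exp.2 (by push_cast; linarith)
  set X := exp (u*L) with hX
  have X0 : 0 < X := exp_pos _
  have lX : log X = u*L := log_exp _
  have X1 : 1 ≤ X := one_le_exp (by positivity)
  have Lq : 1/(q^3) ≤ 1/L^2 := by
    gcongr; calc L^2 ≤ q^2 := by gcongr; linarith
              _ ≤ q^3 := pow_le_pow_right₀ q1 (by norm_num)
  have rk : |Phi X y - X*(c1 y*L*u+b)| ≤ 4*K1*exp 32*(X/L^2) := by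
    refine ((show c1 y*L*u = c1 y*log X by rw [lX]; ring) ▸ hb X X0).trans ?_
    have p := pr_up y hy (1/(4*L)) (by positivity) (by rw [← hL]; field_simp; norm_num)
    have e : X^(1-1/(4*L)) = X*exp (-(u/4)) := by
      rw [hX, ← exp_mul, ← exp_add]; congr 1; field_simp; ring
    rw [e, ← hL] at *
    calc _ ≤ K1/(1/(4*L))*(exp 32*q^16)*(X*(q^20)⁻¹) := by gcongr
      _ = 4*K1*exp 32*X*(L*(1/q)*(1/q^3)) := by field_simp
      _ ≤ 4*K1*exp 32*X*(1*(1/L^2)) := by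
          gcongr; rw [mul_one_div, div_le_one (by linarith)]; linarith
      _ = _ := by ring
  have eL : L ≤ exp L := by linarith [add_one_le_exp L]
  have yX : y/L ≤ X/L^2 := by
    rw [div_le_div_iff₀ L0 (by positivity), yL]
    have : exp L*exp L ≤ X := by rw [← exp_add]; exact exp_le_exp.2 (by nlinarith)
    have := mul_le_mul_of_nonneg_right ((mul_le_mul_of_nonneg_left eL (exp_pos L).le).trans this) L0.le
    linarith
  have oX : 1 ≤ X/L^2 := by
    rw [le_div_iff₀ (by positivity)]
    have : exp L*exp L ≤ X := by rw [← exp_add]; exact exp_le_exp.2 (by nlinarith)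
    nlinarith [exp_pos L]
  have D := hA y hy X X1
  rw [lX, ← hL, mul_div_cancel_right₀ _ L0.ne'] at D
  have R := hr u (by linarith)
  rw [Xi.rho] at R
  have R2 : |X/L*(ξ u - cc*(u+2))| ≤ Kr*(X/L^2) := by
    rw [abs_mul, abs_of_pos (by positivity)]
    have : exp (-u) ≤ 1/L := by
      refine (exp_le_exp.2 (by linarith : -u ≤ -(u/4))).trans (qq.trans ?_)
      rw [← one_div]; gcongr
      calc L ≤ q^1 := by linarith
        _ ≤ q^20 := pow_le_pow_right₀ q1 (by norm_num)
    calc _ ≤ X/L*(Kr*(1/L)) := by gcongr; exact R.trans (by gcongr)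
      _ = _ := by ring
  have XL : 0 < X/L^2 := by positivity
  refine ⟨?_, rk.trans ?_⟩
  · have : |X*(cc*(u+2)/L - (c1 y*L*u+b))| ≤ X*((1+Kr+2*A+4*K1*exp 32)*u^2/L^2) := by
      have e : X*(cc*(u+2)/L - (c1 y*L*u+b)) = (Phi X y - X*(c1 y*L*u+b)) - (Phi X y - (1+X/L*ξ u)) - X/L*(ξ u - cc*(u+2)) - 1 := by ring
      have u2 : 1 ≤ u^2 := by nlinarith
      have : X*((1+Kr+2*A+4*K1*exp 32)*u^2/L^2) = (1+Kr+2*A+4*K1*exp 32)*((X/L^2)*u^2) := by ring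
      rw [e, this]
      have v : X/L^2 ≤ X/L^2*u^2 := le_mul_of_one_le_right XL.le u2
      have e2 : A*(X*u^2/L^2+y/L) ≤ A*(X/L^2*u^2) + A*(X/L^2*u^2) := by
        rw [show X*u^2/L^2 = X/L^2*u^2 by ring, mul_add]; linarith [mul_le_mul_of_nonneg_left (yX.trans v) A0.le]
      have w1 := mul_le_mul_of_nonneg_left v Kr0
      have w2 := mul_le_mul_of_nonneg_left v (by positivity : 0 ≤ 4*K1*exp 32)
      rw [abs_le] at rk D R2 ⊢
      constructor <;> linarith
    rw [abs_mul, abs_of_pos X0] at this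
    exact le_of_mul_le_mul_left this X0
  · rw [mul_div_assoc]; gcongr; linarith
set_option maxHeartbeats 1000000 in
theorem Xi.Phi_fin {ξ : ℝ → ℝ} (H : Xi ξ) : ∃ K, 0 < K ∧ ∀ y : ℕ, 2 ≤ y → |c1 y - cc/(log y)^2| ≤ K*(log y)^(-29/10:ℝ) ∧
    ∀ X : ℝ, (y:ℝ) ≤ X → |Phi X y - 1 - X/log y*ξ (log X/log y) - X*log X*(c1 y - cc/(log y)^2)| ≤ K*(X*(log y)^(-19/10:ℝ) + y/log y) := by
  obtain ⟨A, A0, hA⟩ := H.Phi_D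
  obtain ⟨Kr, Kr0, hr, -⟩ := H.rho_bd
  obtain ⟨K, K0, hK⟩ := H.match
  refine ⟨(6400*A+100*80^2*K+Kr+1)*4000, by positivity, fun y hy => ?_⟩
  obtain ⟨b, hb⟩ := hK y hy
  have hy0 : (2:ℝ) ≤ y := by exact_mod_cast hy
  have ly : log 2 ≤ log y := log_le_log (by norm_num) hy0
  have l2 := log_two_gt_d9
  set L := log (y:ℝ) with hL
  have L0 : 0 < L := by linarith
  have yL : (y:ℝ) = exp L := by rw [hL, exp_log (by linarith)]
  set lam := 1 + log (1+L) with hlam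
  have lq := log_nonneg (show 1 ≤ 1+L by linarith)
  have lam1 : 1 ≤ lam := by linarith
  have lam2 : lam ≤ 63*L^(1/20:ℝ) := by
    have h := log_le_rpow_div (x := 1+L) (by linarith) (show (0:ℝ) < 1/20 by norm_num)
    have h2 : 1 ≤ (1+L)^(1/20:ℝ) := one_le_rpow (by linarith) (by norm_num)
    have h3 : (1+L)^(1/20:ℝ) ≤ 3*L^(1/20:ℝ) := by
      calc _ ≤ (3*L)^(1/20:ℝ) := by gcongr; linarith
        _ = 3^(1/20:ℝ)*L^(1/20:ℝ) := mul_rpow (by norm_num) L0.le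
        _ ≤ _ := by gcongr; nth_rw 2 [← rpow_one 3]; exact rpow_le_rpow_of_exponent_le (by norm_num) (by norm_num)
    linarith
  have lam3 : lam^2/L^2 ≤ 4000*L^(-19/10:ℝ) := by
    calc lam^2/L^2 ≤ (63*L^(1/20:ℝ))^2/L^2 := by gcongr
      _ = 63^2*(L^(1/20:ℝ)*L^(1/20:ℝ)/L^(2:ℝ)) := by rw [rpow_two]; ring
      _ = 63^2*L^(-19/10:ℝ) := by rw [← rpow_add L0, ← rpow_sub L0]; norm_num
      _ ≤ _ := by gcongr; norm_num
  set u0 := 80*lam with hu0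
  obtain ⟨m1, -⟩ := hb u0 le_rfl
  obtain ⟨m2, -⟩ := hb (2*u0) (by linarith)
  set e1 := c1 y - cc/L^2 with he1
  have Q : u0^2/L^2 = 6400*(lam^2/L^2) := by rw [hu0]; ring
  have Q0 : 0 < lam^2/L^2 := by positivity
  have f1 : cc*(u0+2)/L - (c1 y*L*u0+b) = -(u0*(L*e1)) - (b - 2*cc/L) := by rw [he1]; field_simp; ring
  have f2 : cc*(2*u0+2)/L - (c1 y*L*(2*u0)+b) = -(2*u0*(L*e1)) - (b - 2*cc/L) := by rw [he1]; field_simp; ring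
  rw [f1, mul_div_assoc K, Q] at m1
  rw [f2, mul_pow, mul_div_assoc K, mul_div_assoc (2^2), Q] at m2
  have g1 : |u0*(L*e1)| ≤ 5*6400*K*(lam^2/L^2) := by rw [abs_le] at *; constructor <;> linarith
  have g2 : |b-2*cc/L| ≤ 6*6400*K*(lam^2/L^2) := by rw [abs_le] at *; constructor <;> linarith
  constructor
  · rw [abs_mul u0 (L*e1), abs_mul L e1, abs_of_pos (by positivity : 0 < u0), abs_of_pos L0] at g1
    have : |e1| ≤ 400*K*(lam/L^3) := by
      have : |e1| * (u0*L) ≤ 400*K*(lam/L^3)*(u0*L) := by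
        calc _ ≤ 5*6400*K*(lam^2/L^2) := by linarith [g1]
          _ = _ := by rw [hu0]; field_simp; try norm_num
      exact le_of_mul_le_mul_right this (by positivity)
    refine this.trans ?_
    calc _ ≤ 400*K*((63*L^(1/20:ℝ))/L^3) := by gcongr
      _ = 400*63*K*(L^(1/20:ℝ)/L^(3:ℝ)) := by rw [show (3:ℝ) = ((3:ℕ):ℝ) by norm_num, rpow_natCast]; ring
      _ = 400*63*K*L^(-59/20:ℝ) := by rw [← rpow_sub L0]; norm_num
      _ ≤ 400*63*K*(2*L^(-29/10:ℝ)) := by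
        gcongr
        rw [show (-59/20:ℝ) = -1/20+(-29/10) by norm_num, rpow_add L0]; gcongr
        calc L^(-1/20:ℝ) ≤ (1/2)^(-1/20:ℝ) := rpow_le_rpow_of_nonpos (by norm_num) (by linarith) (by norm_num)
          _ = 2^(1/20:ℝ) := by rw [one_div, inv_rpow (by norm_num), ← rpow_neg (by norm_num)]; norm_num
          _ ≤ 2^(1:ℝ) := rpow_le_rpow_of_exponent_le (by norm_num) (by norm_num)
          _ = 2 := rpow_one 2
      _ ≤ _ := by
        have T0 : 0 < L^(-29/10:ℝ) := by positivity
        linarith [T0, mul_pos A0 T0, mul_pos K0 T0, mul_nonneg Kr0 T0.le]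
  · intro X hX
    have X0 : 0 < X := by linarith
    set u := log X/L with hu
    have lX : log X = u*L := by rw [hu]; field_simp
    have XX : X = exp (u*L) := by rw [← lX, exp_log X0]
    have u1 : 1 ≤ u := by rw [hu, le_div_iff₀ L0, one_mul]; exact log_le_log (by linarith) hX
    have P : X*(lam^2/L^2) ≤ 4000*(X*L^(-19/10:ℝ)) := by linarith [mul_le_mul_of_nonneg_left lam3 X0.le]
    have yL0 : 0 < y/L := by positivity
    have P0 : 0 < X*L^(-19/10:ℝ) := by positivity
    rcases le_total u u0 with h | h
    · have D := hA y hy X (by linarith)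
      rw [← hL, ← hu] at D
      have a1 : X*u^2/L^2 ≤ 6400*(X*(lam^2/L^2)) := by
        calc _ ≤ X*u0^2/L^2 := by gcongr
          _ = _ := by rw [hu0]; ring
      have a2 : |X*log X*e1| ≤ X*(5*6400*K*(lam^2/L^2)) := by
        rw [lX, show X*(u*L)*e1 = X*(u*(L*e1)) by ring, abs_mul, abs_of_pos X0]; gcongr
        refine le_trans ?_ g1
        rw [abs_mul, abs_mul u0]; gcongr
      have a3 := mul_le_mul_of_nonneg_left P (by positivity : 0 ≤ 6400*A+5*6400*K)
      have a4 := mul_le_mul_of_nonneg_left a1 A0.le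
      have e : Phi X y - 1 - X/L*ξ u - X*log X*e1 = (Phi X y - (1+X/L*ξ u)) - X*log X*e1 := by ring
      rw [e]; refine (abs_sub _ _).trans ((add_le_add D a2).trans ?_)
      linarith [P0, yL0, mul_pos A0 yL0, mul_pos K0 yL0, mul_nonneg Kr0 yL0.le, mul_pos A0 P0, mul_pos K0 P0, mul_nonneg Kr0 P0.le]
    · obtain ⟨-, m3⟩ := hb u h
      rw [← XX] at m3
      have R := hr u (by linarith)
      rw [Xi.rho] at R
      have eu : exp (-u) ≤ 1/L := by
        have : log (1+L) ≤ u := by linarith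
        rw [← log_le_log_iff (exp_pos _) (by positivity), log_exp, one_div, log_inv]
        linarith [log_le_log L0 (by linarith : L ≤ 1+L)]
      have eL : L ≤ exp L := by linarith [add_one_le_exp L]
      have oX : 1 ≤ X/L^2 := by
        rw [le_div_iff₀ (by positivity)]
        have : exp L*exp L ≤ X := by rw [← exp_add, XX]; exact exp_le_exp.2 (by nlinarith)
        nlinarith [exp_pos L]
      have R2 : |X/L*(ξ u - cc*(u+2))| ≤ Kr*(X/L^2) := by
        rw [abs_mul, abs_of_pos (by positivity)]
        calc _ ≤ X/L*(Kr*(1/L)) := by gcongr; exact R.trans (by gcongr)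
          _ = _ := by ring
      have g3 : |X*(b-2*cc/L)| ≤ X*(6*6400*K*(lam^2/L^2)) := by rw [abs_mul, abs_of_pos X0]; gcongr
      have v : X/L^2 ≤ X*(lam^2/L^2) := by rw [← mul_div_assoc]; gcongr; exact le_mul_of_one_le_right X0.le (one_le_pow₀ lam1)
      have e : Phi X y - 1 - X/L*ξ u - X*log X*e1 = (Phi X y - X*(c1 y*L*u+b)) - X/L*(ξ u - cc*(u+2)) + X*(b-2*cc/L) - 1 := by
        rw [lX, he1]; field_simp; ring
      rw [e]
      have v1 := mul_le_mul_of_nonneg_left (v.trans P) (by positivity : 0 ≤ K+Kr+1)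
      have v2 := mul_le_mul_of_nonneg_left P (by positivity : 0 ≤ 6*6400*K)
      have : |(Phi X y - X*(c1 y*L*u+b)) - X/L*(ξ u - cc*(u+2)) + X*(b-2*cc/L) - 1| ≤ (K+Kr+1+6*6400*K)*(4000*(X*L^(-19/10:ℝ))) := by
        rw [mul_div_assoc] at m3
        rw [abs_le] at m3 R2 g3 ⊢; constructor <;> linarith
      refine this.trans ?_
      linarith [P0, yL0, mul_pos A0 yL0, mul_pos K0 yL0, mul_nonneg Kr0 yL0.le, mul_pos A0 P0, mul_pos K0 P0, mul_nonneg Kr0 P0.le]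

theorem Xi.lip {ξ : ℝ → ℝ} (H : Xi ξ) : ∃ K, 0 < K ∧ (∀ u, 0 ≤ u → |Xi.rho ξ u| ≤ K) ∧ ∀ u v D : ℝ, 0 ≤ u → 0 ≤ v → ((u < 1 ∧ v < 1) ∨ (1 ≤ u ∧ 1 ≤ v)) → |u-v| ≤ (1+u)*D → |u-v| ≤ (1+v)*D →
    |Xi.rho ξ u - Xi.rho ξ v| ≤ K*D := by
  obtain ⟨K, K0, hK, -⟩ := H.rho_bd
  have c0 : 0 < cc := exp_pos _
  have key : ∀ u v D : ℝ, 0 ≤ u → u ≤ v → ((u < 1 ∧ v < 1) ∨ (1 ≤ u ∧ 1 ≤ v)) → v-u ≤ (1+u)*D → |Xi.rho ξ u - Xi.rho ξ v| ≤ (9*K+2*cc+1)*D := fun u v D u0 uv h hD => by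
    have D0 : 0 ≤ D := by by_contra h; nlinarith
    rcases h with ⟨h1, h2⟩ | ⟨h1, h2⟩
    · rw [H.rho01 h1, H.rho01 h2, show -(cc*(u+2)) - -(cc*(v+2)) = cc*(v-u) by ring, abs_of_nonneg (mul_nonneg c0.le (by linarith))]
      nlinarith [mul_nonneg K0 D0, mul_nonneg c0.le D0]
    · have e := H.rhoI h1 h2
      have b := intervalIntegral.norm_integral_le_of_norm_le_const (f := Xi.rho ξ) (a := u-1) (b := v-1) (C := K*exp (1-u)) (fun x hx => by
        rw [uIoc_of_le (by linarith)] at hx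
        refine (hK x (by linarith [hx.1])).trans ?_
        gcongr; linarith [hx.1])
      rw [norm_eq_abs, show v-1-(u-1) = v-u by ring, abs_of_nonneg (show 0 ≤ v-u by linarith)] at b
      have a1 := hK u u0
      have e3 : exp 1 < 2.7182818286 := exp_one_lt_d9
      have e2 : exp (1-u) ≤ 3*exp (-u) := by
        rw [sub_eq_add_neg, exp_add]; nlinarith [exp_pos (-u)]
      have e4 : (1+u)*exp (-u) ≤ 1 := by
        rw [exp_neg, ← div_eq_mul_inv, div_le_one (exp_pos _)]; linarith [add_one_le_exp u]
      have X0 := exp_pos (-u)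
      have w : v*|Xi.rho ξ u - Xi.rho ξ v| ≤ 7*K*((v-u)*exp (-u)) := by
        rw [← abs_of_pos (by linarith : 0 < v), ← abs_mul, abs_of_pos (by linarith : 0 < v)]
        have : v*(Xi.rho ξ u - Xi.rho ξ v) = (v-u)*Xi.rho ξ u - 2*∫ t in (u-1)..(v-1), Xi.rho ξ t := by linarith
        rw [this]
        refine (abs_sub _ _).trans ?_
        rw [abs_mul, abs_mul, abs_of_nonneg (by linarith : 0 ≤ v-u), abs_two]
        have t1 := mul_le_mul_of_nonneg_left a1 (by linarith : 0 ≤ v-u)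
        have t2 : K*exp (1-u)*(v-u) ≤ K*(3*exp (-u))*(v-u) := mul_le_mul_of_nonneg_right (mul_le_mul_of_nonneg_left e2 K0) (by linarith)
        linarith
      have w2 : (v-u)*exp (-u) ≤ D := by
        calc _ ≤ (1+u)*D*exp (-u) := by gcongr
          _ = D*((1+u)*exp (-u)) := by ring
          _ ≤ D*1 := by gcongr
          _ = D := mul_one D
      have w3 := mul_le_mul_of_nonneg_left w2 (by linarith : 0 ≤ 7*K)
      have w4 : |Xi.rho ξ u - Xi.rho ξ v| ≤ v*|Xi.rho ξ u - Xi.rho ξ v| := le_mul_of_one_le_left (abs_nonneg _) h2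
      linarith [mul_nonneg K0 D0, mul_nonneg c0.le D0]
  refine ⟨9*K+2*cc+1, by positivity, fun u hu => (hK u hu).trans ?_, fun u v D u0 v0 h h1 h2 => ?_⟩
  · have : exp (-u) ≤ 1 := exp_le_one_iff.2 (by linarith)
    nlinarith
  · rcases le_total u v with huv | huv
    · rw [abs_sub_comm, abs_of_nonneg (by linarith)] at h1
      exact key u v D u0 huv h h1
    · rw [abs_of_nonneg (by linarith)] at h2
      rw [abs_sub_comm]
      exact key v u D v0 huv (by tauto) h2
set_option maxHeartbeats 1000000 in
theorem Xi.ptw {ξ : ℝ → ℝ} (H : Xi ξ) : ∃ K, 0 < K ∧ ∀ l L z t r : ℝ, 0 ≤ l → l ≤ z → 0 ≤ t → (1+l)/3 ≤ L → l ≤ L → L-l ≤ 20*r → exp ((L-l)/10) ≤ 2*r → 1 ≤ r →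
    |ξ ((z-l)/L)/L - z*cc/L^2 + z*cc/(1+l+t)^2 - ξ ((z-(l+t))/(1+l+t))/(1+l+t)| ≤ K*exp (t/2)*(r/(1+l)^2 + r/(1+l)*(exp (-|z-2*l|/10)+exp (-(z-l)/10))) := by
  obtain ⟨K, K0, hK, hl⟩ := H.lip
  have c0 : 0 < cc := exp_pos _
  have c1 : cc < 1 := by rw [cc, exp_lt_one_iff]; linarith [one_half_lt_eulerMascheroniConstant]
  refine ⟨1000*(K+1), by positivity, fun l L z t r l0 lz t0 hL lL hr hr2 r1 => ?_⟩
  have N0 : 0 < 1+l := by linarith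
  have S0 : 0 < 1+l+t := by linarith
  set N := 1+l with hN
  set S := N+t with hS
  have L0 : 0 < L := by linarith
  have u0 : 0 ≤ (z-l)/L := div_nonneg (by linarith) L0.le
  set u := (z-l)/L with hu
  have hxi : ξ u = Xi.rho ξ u + cc*(u+2) := by rw [Xi.rho]; ring
  have zl : z - l = u*L := by rw [hu]; field_simp
  have lz2 : z = l + u*L := by linarith
  have E1 : 1 + t/2 ≤ exp (t/2) := by linarith [add_one_le_exp (t/2)]
  have A0 : 0 < r/N^2 := by positivity
  have A1 : 0 < r/N*exp (-|z-2*l|/10) := by positivity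
  have A2 : 0 < r/N*exp (-(z-l)/10) := by positivity
  have Li : 1/L ≤ 3/N := by rw [div_le_div_iff₀ L0 N0]; linarith
  have Si : 1/S ≤ 1/N := one_div_le_one_div_of_le N0 (by linarith)
  have Li0 : 0 < 1/L := by positivity
  have Si0 : 0 < 1/S := by positivity
  have rN : 1/N ≤ r/N := by gcongr
  set D := (1+t+(L-l))/N with hD
  clear_value D u S N
  have D0 : 0 ≤ D := by rw [hD]; exact div_nonneg (by linarith) N0.le
  have DN : D/N ≤ 42*(exp (t/2)*(r/N^2)) := by
    calc D/N = (1+t+(L-l))*(1/N^2) := by rw [hD]; field_simp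
      _ ≤ (42*exp (t/2)*r)*(1/N^2) := by
          gcongr
          have w1 := mul_le_mul E1 hr (by linarith) (exp_pos (t/2)).le
          have w2 := mul_le_mul E1 r1 zero_le_one (exp_pos (t/2)).le
          have w3 : 0 ≤ t/2*(L-l) := mul_nonneg (by linarith) (by linarith)
          linarith only [w1, w2, w3, t0]
      _ = _ := by ring
  rcases lt_or_ge (z-l) t with h | h
  · have hz : ξ ((z-(l+t))/S) = 0 := H.h0 _ ((div_neg_of_neg_of_pos (by linarith) S0).trans zero_lt_one)
    have zS : z/S^2 ≤ 1/N := by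
      rw [div_le_div_iff₀ (by positivity) N0, one_mul, sq]
      exact mul_le_mul (by linarith) (by linarith) N0.le S0.le
    have e : ξ u/L - z*cc/L^2 + z*cc/S^2 - 0/S = (Xi.rho ξ u + 2*cc - cc*(l/L))*(1/L) + cc*(z/S^2) := by
      rw [hxi, lz2]; field_simp; ring
    have lL1 : l/L ≤ 1 := (div_le_one L0).2 lL
    have lL0 : 0 ≤ l/L := by positivity
    have zS0 : 0 ≤ z/S^2 := div_nonneg (by linarith) (by positivity)
    rw [hz, e]
    have b1 : |(Xi.rho ξ u + 2*cc - cc*(l/L))*(1/L)| ≤ (K+2)*(3/N) := by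
      rw [abs_mul, abs_of_pos Li0]; gcongr
      have := abs_le.1 (hK u u0)
      have m1 := mul_le_mul_of_nonneg_left lL1 c0.le
      have m2 := mul_nonneg c0.le lL0
      rw [abs_le]; constructor <;> linarith only [m1, m2, this.1, this.2, c0, c1]
    have b2 : |cc*(z/S^2)| ≤ 1/N := by rw [abs_of_nonneg (by positivity)]; exact (mul_le_of_le_one_left zS0 c1.le).trans zS
    have b3 : 1/N ≤ exp (t/2)*(r/N*exp (-(z-l)/10)) := by
      have : 1 ≤ exp (t/2)*exp (-(z-l)/10) := by rw [← exp_add]; exact one_le_exp (by linarith)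
      calc 1/N ≤ r/N*1 := by linarith
        _ ≤ r/N*(exp (t/2)*exp (-(z-l)/10)) := by gcongr
        _ = _ := by ring
    refine (abs_add_le _ _).trans ((add_le_add b1 b2).trans ?_)
    have b4 : (K+2)*(3/N) + 1/N = (3*K+7)*(1/N) := by ring
    rw [b4]
    have e0 := exp_pos (t/2)
    have p1 := mul_pos e0 A0
    have p2 := mul_pos e0 A1
    have p3 := mul_pos e0 A2
    have q1 := mul_pos K0 p1
    have q2 := mul_pos K0 p2
    have q3 := mul_pos K0 p3
    have := mul_le_mul_of_nonneg_left b3 (by positivity : 0 ≤ 3*K+7)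
    linarith only [this, p1, p2, p3, q1, q2, q3]
  · have v0 : 0 ≤ (z-(l+t))/S := div_nonneg (by linarith) S0.le
    set v := (z-(l+t))/S with hv
    clear_value v
    have hxv : ξ v = Xi.rho ξ v + cc*(v+2) := by rw [Xi.rho]; ring
    have zv : z - (l+t) = v*S := by rw [hv]; field_simp
    have e : ξ u/L - z*cc/L^2 + z*cc/S^2 - ξ v/S = cc*((S-L)*(1/L)*(1/S)) + cc*((L-l)*(1/L)*(1/L)) - cc*(1/S*(1/S)) + Xi.rho ξ u*((S-L)*(1/L)*(1/S)) + (Xi.rho ξ u - Xi.rho ξ v)*(1/S) := by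
      have e1 : z*cc/L^2 = cc*(u/L) + cc*(l/L^2) := by rw [lz2]; field_simp; ring
      have e2 : z*cc/S^2 = cc*(v/S) + cc*((S-1)/S^2) := by rw [show z = v*S+(S-1) by linarith]; field_simp
      rw [hxi, hxv, e1, e2]; field_simp; ring
    rw [e]
    have SL : |S-L| ≤ N*D := by
      rw [hD, mul_div_cancel₀ _ N0.ne', abs_le]; constructor <;> linarith
    have b1 : |(S-L)*(1/L)*(1/S)| ≤ 3*(D/N) := by
      rw [abs_mul, abs_mul, abs_of_pos Li0, abs_of_pos Si0]
      calc _ ≤ (N*D)*(3/N)*(1/N) := by gcongr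
        _ = _ := by field_simp
    have b2 : |(L-l)*(1/L)*(1/L)| ≤ 9*(D/N) := by
      rw [abs_mul, abs_mul, abs_of_pos Li0, abs_of_nonneg (by linarith : 0 ≤ L-l)]
      calc _ ≤ (N*D)*(3/N)*(3/N) := by gcongr; rw [hD, mul_div_cancel₀ _ N0.ne']; linarith
        _ = _ := by field_simp; norm_num
    have b3 : |1/S*(1/S)| ≤ D/N := by
      rw [abs_of_pos (by positivity)]
      calc _ ≤ 1/N*(1/N) := by gcongr
        _ ≤ D*(1/N) := by gcongr; rw [hD]; gcongr; linarith
        _ = _ := by ring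
    have b4 : |Xi.rho ξ u - Xi.rho ξ v| * (1/S) ≤ 3*K*(D/N) + 2*K*(2*exp 1)*(exp (t/2)*(r/N*exp (-|z-2*l|/10))) := by
      by_cases hs : (u < 1 ∧ v < 1) ∨ (1 ≤ u ∧ 1 ≤ v)
      · have d1 : u - v = (u*(S-L)+t)/S := by rw [eq_div_iff S0.ne']; linear_combination zv - zl
        have d2 : u - v = (v*(S-L)+t)/L := by rw [eq_div_iff L0.ne']; linear_combination zv - zl
        have tD : t ≤ N*D := by rw [hD, mul_div_cancel₀ _ N0.ne']; linarith
        have k : ∀ w, 0 ≤ w → |w*(S-L)+t| ≤ (1+w)*(N*D) := fun w hw => by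
          refine (abs_add_le _ _).trans ?_
          rw [abs_mul, abs_of_nonneg hw, abs_of_nonneg t0]; linarith only [mul_le_mul_of_nonneg_left SL hw, tD]
        have := hl u v (3*D) u0 v0 hs (by
            rw [d1, abs_div, abs_of_pos S0, div_eq_mul_one_div]
            calc _ ≤ (1+u)*(N*D)*(1/N) := by gcongr; exact k u u0
              _ = (1+u)*D := by field_simp
              _ ≤ _ := by gcongr; linarith) (by
            rw [d2, abs_div, abs_of_pos L0, div_eq_mul_one_div]
            calc _ ≤ (1+v)*(N*D)*(3/N) := by gcongr; exact k v v0
              _ = _ := by field_simp)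
        calc _ ≤ K*(3*D)*(1/N) := by gcongr
          _ = 3*K*(D/N) := by ring
          _ ≤ _ := le_add_of_nonneg_right (by positivity)
      · have st : |z-2*l| ≤ (L-l)+1+2*t := by
          have hu1 : u < 1 ↔ z-l < L := by rw [hu, div_lt_one L0]
          have hv1 : v < 1 ↔ z-(l+t) < S := by rw [hv, div_lt_one S0]
          rw [← not_lt, ← not_lt (a := v), hu1, hv1] at hs
          push Not at hs
          rw [abs_le]
          rcases lt_or_ge (z-l) L with h1 | h1
          · have := hs.1 h1; constructor <;> linarith
          · have := hs.2 h1; constructor <;> linarith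
        have g : 1 ≤ exp ((L-l)/10)*(exp 1*(exp (t/2)*exp (-|z-2*l|/10))) := by
          rw [← exp_add, ← exp_add, ← exp_add]; exact one_le_exp (by linarith)
        have g2 : 1/N ≤ 2*exp 1*(exp (t/2)*(r/N*exp (-|z-2*l|/10))) := by
          have : 1 ≤ 2*r*(exp 1*(exp (t/2)*exp (-|z-2*l|/10))) := g.trans (by gcongr)
          calc 1/N ≤ 2*r*(exp 1*(exp (t/2)*exp (-|z-2*l|/10)))/N := by gcongr
            _ = _ := by ring
        have g3 : |Xi.rho ξ u - Xi.rho ξ v| ≤ 2*K := (abs_sub _ _).trans (by linarith [hK u u0, hK v v0])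
        calc _ ≤ 2*K*(2*exp 1*(exp (t/2)*(r/N*exp (-|z-2*l|/10)))) := by gcongr; exact Si.trans g2
          _ = 2*K*(2*exp 1)*(exp (t/2)*(r/N*exp (-|z-2*l|/10))) := by ring
          _ ≤ _ := le_add_of_nonneg_left (by positivity)
    have e3 : exp 1 < 2.7182818286 := exp_one_lt_d9
    have c' : ∀ x B : ℝ, |x| ≤ B → |cc*x| ≤ B := fun x B h => by
      rw [abs_mul, abs_of_pos c0]; exact (mul_le_of_le_one_left (abs_nonneg x) c1.le).trans h
    have k1 := c' _ _ b1
    have k2 := c' _ _ b2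
    have k3 := c' _ _ b3
    have k4 : |Xi.rho ξ u*((S-L)*(1/L)*(1/S))| ≤ K*(3*(D/N)) := by rw [abs_mul]; exact mul_le_mul (hK u u0) b1 (abs_nonneg _) K0.le
    have k5 := b4
    rw [← abs_of_pos Si0, ← abs_mul] at k5
    have e0 := exp_pos (t/2)
    have p1 := mul_pos e0 A0
    have p2 := mul_pos e0 A1
    have p3 := mul_pos e0 A2
    have q1 := mul_pos K0 p1
    have q2 := mul_pos K0 p2
    have q3 := mul_pos K0 p3
    have q4 := mul_le_mul_of_nonneg_right e3.le q2.le
    have q5 := mul_le_mul_of_nonneg_left DN (by positivity : 0 ≤ 13+6*K)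
    refine (abs_add_le _ _).trans (le_trans (add_le_add ((abs_add_le _ _).trans (add_le_add ((abs_sub _ _).trans (add_le_add ((abs_add_le _ _).trans (add_le_add k1 k2)) k3)) k4)) k5) ?_)
    linarith only [p1, p2, p3, q1, q2, q3, q4, q5]

theorem pint {m A B : ℝ} {g : ℝ → ℝ} (hm : 0 < m) (hg : Measurable g) (h : ∀ t, m < t → |A - g t| ≤ B*(t/m)^(1/2:ℝ)) :
    IntegrableOn (fun t => g t*t^(-2:ℝ)) (Ioi m) ∧ |A - m*∫ t in Ioi m, g t*t^(-2:ℝ)| ≤ 2*B := by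
  have i2 := integrableOn_Ioi_rpow_of_lt (show (-2:ℝ) < -1 by norm_num) hm
  have i3 := integrableOn_Ioi_rpow_of_lt (show (-3/2:ℝ) < -1 by norm_num) hm
  have v2 := integral_Ioi_rpow_of_lt (show (-2:ℝ) < -1 by norm_num) hm
  have v3 := integral_Ioi_rpow_of_lt (show (-3/2:ℝ) < -1 by norm_num) hm
  have bd : ∀ᵐ t ∂volume.restrict (Ioi m), ‖(A - g t)*t^(-2:ℝ)‖ ≤ B*m^(-1/2:ℝ)*t^(-3/2:ℝ) := by
    refine (ae_restrict_mem measurableSet_Ioi).mono fun t ht => ?_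
    have t0 : 0 < t := hm.trans ht
    rw [norm_mul, norm_eq_abs, norm_of_nonneg (rpow_nonneg t0.le _)]
    calc _ ≤ B*(t/m)^(1/2:ℝ)*t^(-2:ℝ) := by gcongr; exact h t ht
      _ = B*m^(-1/2:ℝ)*(t^(1/2:ℝ)*t^(-2:ℝ)) := by
          rw [div_rpow t0.le hm.le, show (-1/2:ℝ) = -(1/2) by norm_num, rpow_neg hm.le]; ring
      _ = _ := by rw [← rpow_add t0]; norm_num
  have iA : IntegrableOn (fun t => (A - g t)*t^(-2:ℝ)) (Ioi m) :=
    (i3.const_mul (B*m^(-1/2:ℝ))).mono' ((measurable_const.sub hg).mul (measurable_id.pow_const _)).aestronglyMeasurable bd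
  have ig : IntegrableOn (fun t => g t*t^(-2:ℝ)) (Ioi m) := by
    refine ((i2.const_mul A).sub iA).congr (Eventually.of_forall fun t => ?_)
    simp only [Pi.sub_apply]; ring
  refine ⟨ig, ?_⟩
  have e := MeasureTheory.integral_sub (i2.const_mul A) ig
  rw [MeasureTheory.integral_const_mul, v2] at e
  have n := norm_integral_le_of_norm_le (i3.const_mul (B*m^(-1/2:ℝ))) bd
  rw [MeasureTheory.integral_const_mul, v3, norm_eq_abs] at n
  have e' : A - m*∫ t in Ioi m, g t*t^(-2:ℝ) = m*∫ t in Ioi m, (A - g t)*t^(-2:ℝ) := by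
    have : ∫ t in Ioi m, (A - g t)*t^(-2:ℝ) = ∫ t in Ioi m, (A*t^(-2:ℝ) - g t*t^(-2:ℝ)) := by congr 1; ext t; ring
    rw [this, e, mul_sub, show (-2:ℝ)+1 = -1 by norm_num, rpow_neg_one]
    field_simp
  rw [e', abs_mul, abs_of_pos hm]
  calc _ ≤ m*(B*m^(-1/2:ℝ)*(-m^(-3/2+1:ℝ)/(-3/2+1))) := by gcongr
    _ = 2*B*(m^(1:ℝ)*(m^(-1/2:ℝ)*m^(-1/2:ℝ))) := by rw [rpow_one, show (-3/2+1:ℝ) = -1/2 by norm_num]; ring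
    _ = 2*B := by rw [← rpow_add hm, ← rpow_add hm]; norm_num

theorem sg_up {m : ℕ} (hm : 1 ≤ m) : (sg m:ℝ) ≤ m*(1+log m) := by
  have h1 : sg m = ∑ d ∈ m.divisors, m/d := (Nat.sum_div_divisors m id).symm
  rw [h1, Nat.cast_sum]
  have h2 := harmonic_le_one_add_log m
  rw [harmonic_eq_sum_Icc, Rat.cast_sum] at h2
  calc _ ≤ ∑ d ∈ m.divisors, (m:ℝ)*((((d:ℚ)⁻¹:ℚ)):ℝ) := Finset.sum_le_sum fun d _ => by
        push_cast; rw [← div_eq_mul_inv]; exact Nat.cast_div_le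
    _ ≤ ∑ d ∈ Finset.Icc 1 m, (m:ℝ)*((((d:ℚ)⁻¹:ℚ)):ℝ) := Finset.sum_le_sum_of_subset_of_nonneg (fun d hd => by
        rw [Finset.mem_Icc]; exact ⟨Nat.pos_of_mem_divisors hd, Nat.divisor_le hd⟩) fun d _ _ => by push_cast; positivity
    _ ≤ _ := by rw [← Finset.mul_sum]; gcongr

/-- basic facts about `L = log (sg m + 1)` -/
theorem L_facts {m : ℕ} (hm : 1 ≤ m) : 0 ≤ log m ∧ (1+log m)/3 ≤ log ((sg m+1:ℕ):ℝ) ∧ log m ≤ log ((sg m+1:ℕ):ℝ) ∧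
    exp ((log ((sg m+1:ℕ):ℝ)-log m)/10) ≤ 2*(1+log m)^(1/10:ℝ) ∧ log ((sg m+1:ℕ):ℝ) - log m ≤ 20*(1+log m)^(1/10:ℝ) ∧ 1 ≤ (1+log m)^(1/10:ℝ) ∧ 2 ≤ sg m + 1 := by
  have m1 : (1:ℝ) ≤ m := by exact_mod_cast hm
  have l0 := log_nonneg m1
  have s1 := le_sg hm
  have y1 : (m:ℝ) + 1 ≤ ((sg m+1:ℕ):ℝ) := by exact_mod_cast Nat.succ_le_succ s1
  have a1 : log m ≤ log ((sg m+1:ℕ):ℝ) := log_le_log (by linarith) (by linarith)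
  have a2 : log 2 ≤ log ((sg m+1:ℕ):ℝ) := log_le_log (by norm_num) (by linarith)
  have a3 := log_two_gt_d9
  have b : log ((sg m+1:ℕ):ℝ) ≤ log (m*(2*(1+log m))) := by
    apply log_le_log (by linarith)
    have := sg_up hm
    push_cast; nlinarith
  rw [log_mul (by linarith) (by linarith)] at b
  have c : exp ((log ((sg m+1:ℕ):ℝ)-log m)/10) ≤ 2*(1+log m)^(1/10:ℝ) := by
    calc _ ≤ exp (log (2*(1+log m))*(1/10)) := exp_le_exp.2 (by linarith)
      _ = (2*(1+log m))^(1/10:ℝ) := (rpow_def_of_pos (by linarith) _).symm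
      _ = 2^(1/10:ℝ)*(1+log m)^(1/10:ℝ) := mul_rpow (by norm_num) (by linarith)
      _ ≤ _ := by
        gcongr
        calc (2:ℝ)^(1/10:ℝ) ≤ 2^(1:ℝ) := rpow_le_rpow_of_exponent_le (by norm_num) (by norm_num)
          _ = 2 := rpow_one 2
  refine ⟨l0, by linarith, a1, c, ?_, one_le_rpow (by linarith) (by norm_num), by omega⟩
  linarith [add_one_le_exp ((log ((sg m+1:ℕ):ℝ)-log m)/10)]

theorem inv2 {N L t r : ℝ} (N0 : 1 ≤ N) (t0 : 0 ≤ t) (hL : N/3 ≤ L) (hl : N-1 ≤ L) (hr : L-(N-1) ≤ 20*r) (r1 : 1 ≤ r) :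
    |1/L^2 - 1/(N+t)^2| ≤ 504*(r/N^3)*exp (t/2) := by
  have L0 : 0 < L := by linarith
  have S0 : 0 < N+t := by linarith
  have E1 : 1 + t/2 ≤ exp (t/2) := by linarith [add_one_le_exp (t/2)]
  have e : 1/L^2 - 1/(N+t)^2 = (N+t-L)*(1/L*(1/L)*(1/(N+t)) + 1/L*(1/(N+t))*(1/(N+t))) := by field_simp; ring
  have Li : 1/L ≤ 3/N := by rw [div_le_div_iff₀ L0 (by linarith)]; linarith
  have Si : 1/(N+t) ≤ 1/N := one_div_le_one_div_of_le (by linarith) (by linarith)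
  have a : |N+t-L| ≤ 42*exp (t/2)*r := by
    have w1 := mul_le_mul E1 hr (by linarith) (exp_pos (t/2)).le
    have w2 := mul_le_mul E1 r1 zero_le_one (exp_pos (t/2)).le
    have w3 : 0 ≤ t/2*(L-(N-1)) := mul_nonneg (by linarith) (by linarith)
    have w4 : 0 ≤ exp (t/2)*r := by positivity
    rw [abs_le]; constructor <;> linarith only [w1, w2, w3, w4, t0, hl, hr]
  rw [e, abs_mul, abs_of_nonneg (a := 1/L*(1/L)*(1/(N+t)) + 1/L*(1/(N+t))*(1/(N+t))) (by positivity)]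
  calc _ ≤ 42*exp (t/2)*r*(3/N*(3/N)*(1/N) + 3/N*(1/N)*(1/N)) := by gcongr
    _ = _ := by field_simp; norm_num

noncomputable def kz (ξ : ℝ → ℝ) (z s : ℝ) : ℝ := ξ ((z-s)/(1+s))/(1+s)
noncomputable def Im (ξ : ℝ → ℝ) (z : ℝ) (m : ℕ) : ℝ := m*∫ t in Ioi (m:ℝ), kz ξ z (log t)*t^(-2:ℝ)
noncomputable def kp (m : ℕ) : ℝ := c1 (sg m+1) - cc*(m*∫ t in Ioi (m:ℝ), 1/(1+log t)^2*t^(-2:ℝ))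

set_option maxHeartbeats 1000000 in
theorem Xi.term {ξ : ℝ → ℝ} (H : Xi ξ) : ∃ K, 0 < K ∧ ∀ m : ℕ, 1 ≤ m → |kp m| ≤ K*(1+log m)^(-29/10:ℝ) ∧ ∀ z, log m ≤ z →
    IntegrableOn (fun t => kz ξ z (log t)*t^(-2:ℝ)) (Ioi (m:ℝ)) ∧
    |Phi (exp z/m) (sg m+1)*(m/exp z) - m/exp z - Im ξ z m - z*kp m| ≤
      K*((1+log m)^(-19/10:ℝ) + (1+log m)^(-9/10:ℝ)*(exp (-|z/2-log m|/10) + exp (-|z-log m|/10))) := by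
  obtain ⟨K, K0, hK⟩ := H.ptw
  obtain ⟨K2, K20, hP⟩ := H.Phi_fin
  have c0 : 0 < cc := exp_pos _
  have c1' : cc < 1 := by rw [cc, exp_lt_one_iff]; linarith [one_half_lt_eulerMascheroniConstant]
  refine ⟨2*K+200*K2+2000, by positivity, fun m hm => ?_⟩
  obtain ⟨l0, f1, f2, f3, f4, f5, f6⟩ := L_facts hm
  have m0 : (0:ℝ) < m := by exact_mod_cast hm
  obtain ⟨P1, P2⟩ := hP _ f6
  have hc : (((sg m+1:ℕ):ℝ)) ≠ 0 := by positivity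
  have yy : exp (log ((sg m+1:ℕ):ℝ)) = ((sg m+1:ℕ):ℝ) := exp_log (by positivity)
  set y : ℕ := sg m+1 with hy
  set L := log (y:ℝ) with hL
  set l := log (m:ℝ) with hl
  set r := (1+l)^(1/10:ℝ) with hr
  have ml : (m:ℝ) = exp l := (exp_log m0).symm
  have N0 : 0 < 1+l := by linarith
  have L0 : 0 < L := by linarith
  have r19 : r/(1+l)^2 = (1+l)^(-19/10:ℝ) := by
    rw [hr, ← rpow_natCast, ← rpow_sub N0]; norm_num
  have r9 : r/(1+l) = (1+l)^(-9/10:ℝ) := by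
    have := rpow_sub N0 (1/10) 1
    rw [rpow_one] at this
    rw [hr, ← this]; norm_num
  have r29 : r/(1+l)^3 = (1+l)^(-29/10:ℝ) := by
    rw [hr, ← rpow_natCast, ← rpow_sub N0]; norm_num
  have q19 : L^(-19/10:ℝ) ≤ 9*(1+l)^(-19/10:ℝ) := by
    calc _ ≤ ((1+l)/3)^(-19/10:ℝ) := rpow_le_rpow_of_nonpos (by linarith) f1 (by norm_num)
      _ = (1+l)^(-19/10:ℝ)*3^(19/10:ℝ) := by rw [div_rpow N0.le (by norm_num), div_eq_mul_inv, ← rpow_neg (by norm_num)]; norm_num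
      _ ≤ (1+l)^(-19/10:ℝ)*3^(2:ℝ) := by gcongr <;> norm_num
      _ = _ := by norm_num; ring
  have q29 : L^(-29/10:ℝ) ≤ 27*(1+l)^(-29/10:ℝ) := by
    calc _ ≤ ((1+l)/3)^(-29/10:ℝ) := rpow_le_rpow_of_nonpos (by linarith) f1 (by norm_num)
      _ = (1+l)^(-29/10:ℝ)*3^(29/10:ℝ) := by rw [div_rpow N0.le (by norm_num), div_eq_mul_inv, ← rpow_neg (by norm_num)]; norm_num
      _ ≤ (1+l)^(-29/10:ℝ)*3^(3:ℝ) := by gcongr <;> norm_num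
      _ = _ := by norm_num; ring
  have ht : ∀ t, (m:ℝ) < t → exp ((log t-l)/2) = (t/m)^(1/2:ℝ) := fun t h => by
    rw [rpow_def_of_pos (by positivity [m0.trans h]), log_div (m0.trans h).ne' m0.ne']; congr 1; ring
  have hlt : ∀ t, (m:ℝ) < t → 0 ≤ log t - l := fun t h => sub_nonneg.2 (log_le_log m0 h.le)
  have p29 : 0 ≤ (1+l)^(-29/10:ℝ) := by positivity
  obtain ⟨I1, I2⟩ := pint (A := 1/L^2) (B := 504*(r/(1+l)^3)) (g := fun t => 1/(1+log t)^2) m0 (by fun_prop) (fun t h => by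
    have := inv2 (N := 1+l) (L := L) (t := log t - l) (r := r) (by linarith) (hlt t h) f1 (by linarith) (by linarith) f5
    rwa [ht t h, show 1+l+(log t-l) = 1+log t by ring] at this)
  rw [r29] at I2
  refine ⟨?_, fun z hz => ?_⟩
  · have : kp m = (c1 y - cc/L^2) + cc*(1/L^2 - m*∫ t in Ioi (m:ℝ), 1/(1+log t)^2*t^(-2:ℝ)) := by rw [kp]; ring
    rw [this]
    refine (abs_add_le _ _).trans ?_
    rw [abs_mul cc, abs_of_pos c0]
    have w := (mul_le_of_le_one_left (abs_nonneg _) c1'.le).trans I2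
    have w2 := mul_le_mul_of_nonneg_left q29 K20.le
    have w3 := mul_nonneg K20.le p29
    have w4 := mul_nonneg K0.le p29
    linarith only [P1, w, w2, w3, w4, p29]
  set x := exp z with hx
  have x0 : 0 < x := exp_pos z
  set Bd := r/(1+l)^2 + r/(1+l)*(exp (-|z/2-l|/10) + exp (-|z-l|/10)) with hB
  obtain ⟨J1, J2⟩ := pint (A := ξ ((z-l)/L)/L - z*cc/L^2) (B := K*Bd) (g := fun t => kz ξ z (log t) - z*cc*(1/(1+log t)^2)) m0 (by
      have := H.meas; unfold kz; fun_prop) (fun t h => by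
    have := hK l L z (log t - l) r l0 hz (hlt t h) f1 f2 f4 f3 f5
    rw [ht t h] at this
    rw [show 1+l+(log t-l) = 1+log t by ring, show l+(log t-l) = log t by ring] at this
    have e : ξ ((z-l)/L)/L - z*cc/L^2 - (kz ξ z (log t) - z*cc*(1/(1+log t)^2)) = ξ ((z-l)/L)/L - z*cc/L^2 + z*cc/(1+log t)^2 - ξ ((z-log t)/(1+log t))/(1+log t) := by
      rw [kz]; ring
    rw [e]
    refine this.trans ?_
    have z0 : 0 ≤ z-l := by linarith
    have e1 : exp (-|z-2*l|/10) ≤ exp (-|z/2-l|/10) := exp_le_exp.2 (by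
      rw [show z-2*l = 2*(z/2-l) by ring, abs_mul, abs_two]; linarith [abs_nonneg (z/2-l)])
    have e2 : -(z-l) = -|z-l| := by rw [abs_of_nonneg z0]
    rw [e2]
    calc _ ≤ K*(t/m)^(1/2:ℝ)*Bd := by
          rw [hB]; have := m0.trans h; gcongr
      _ = _ := by ring)
  have J3 : IntegrableOn (fun t => kz ξ z (log t)*t^(-2:ℝ)) (Ioi (m:ℝ)) := by
    refine (J1.add (I1.const_mul (z*cc))).congr (Eventually.of_forall fun t => ?_)
    simp only [Pi.add_apply]; ring
  refine ⟨J3, ?_⟩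
  have J4 : m*∫ t in Ioi (m:ℝ), (kz ξ z (log t) - z*cc*(1/(1+log t)^2))*t^(-2:ℝ) = Im ξ z m - z*(c1 y - kp m) := by
    have : ∀ t, (kz ξ z (log t) - z*cc*(1/(1+log t)^2))*t^(-2:ℝ) = kz ξ z (log t)*t^(-2:ℝ) - z*cc*(1/(1+log t)^2*t^(-2:ℝ)) := fun t => by ring
    simp_rw [this]
    rw [MeasureTheory.integral_sub J3 (I1.const_mul (z*cc)), MeasureTheory.integral_const_mul, Im, kp]; ring
  rw [J4] at J2
  have B0 : r/(1+l)^2 ≤ Bd := by rw [hB]; exact le_add_of_nonneg_right (by positivity)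
  have B00 : 0 ≤ Bd := (by positivity : 0 ≤ r/(1+l)^2).trans B0
  rw [← r19, ← r9, ← hB]
  rw [← r19] at q19
  have q : L*|c1 y - cc/L^2| ≤ 9*K2*Bd := by
    calc _ ≤ L*(K2*L^(-29/10:ℝ)) := by gcongr
      _ = K2*(L^(1:ℝ)*L^(-29/10:ℝ)) := by rw [rpow_one]; ring
      _ = K2*L^(-19/10:ℝ) := by rw [← rpow_add L0]; norm_num
      _ ≤ K2*(9*(r/(1+l)^2)) := by gcongr
      _ ≤ K2*(9*Bd) := by gcongr
      _ = _ := by ring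
  have xm : x/m = exp (z-l) := by rw [Real.exp_sub, ← ml]
  have lX : log (x/m) = z-l := by rw [xm, log_exp]
  have k1 : x/m*(m/x) = 1 := by field_simp
  have KB := mul_nonneg K0.le B00
  have K2B := mul_nonneg K20.le B00
  rcases lt_or_ge (x/m) y with h | h
  · rw [Phi_one (by rw [xm]; exact one_le_exp (by linarith)) (by linarith)]
    have lt : z-l < L := by rw [← lX]; exact log_lt_log (by positivity) h
    have x0 : ξ ((z-l)/L) = 0 := H.h0 _ ((div_lt_one L0).2 lt)
    rw [x0] at J2
    have e : 1*(m/x) - m/x - Im ξ z m - z*kp m = (0/L - z*cc/L^2 - (Im ξ z m - z*(c1 y - kp m))) - z*(c1 y - cc/L^2) := by ring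
    rw [e]
    refine (abs_sub _ _).trans ?_
    have : |z*(c1 y - cc/L^2)| ≤ 2*(9*K2*Bd) := by
      rw [abs_mul, abs_of_nonneg (by linarith : 0 ≤ z)]
      calc _ ≤ (2*L)*|c1 y - cc/L^2| := by gcongr; linarith
        _ ≤ _ := by linarith only [q]
    linarith only [this, J2, K2B, KB, B00]
  · have P := P2 _ h
    rw [lX] at P
    have lt : L ≤ z-l := by rw [← lX]; exact log_le_log (by positivity) h
    have e : Phi (x/m) y*(m/x) - m/x - Im ξ z m - z*kp m = (ξ ((z-l)/L)/L - z*cc/L^2 - (Im ξ z m - z*(c1 y - kp m))) - l*(c1 y - cc/L^2)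
        + (Phi (x/m) y - 1 - x/m/L*ξ ((z-l)/L) - x/m*(z-l)*(c1 y - cc/L^2))*(m/x) := by
      linear_combination (ξ ((z-l)/L)/L + (z-l)*(c1 y - cc/L^2))*k1
    rw [e]
    have a1 : |l*(c1 y - cc/L^2)| ≤ 9*K2*Bd := by
      rw [abs_mul, abs_of_nonneg l0]
      exact le_trans (by gcongr) q
    have a2 : |(Phi (x/m) y - 1 - x/m/L*ξ ((z-l)/L) - x/m*(z-l)*(c1 y - cc/L^2))*(m/x)| ≤ 15*K2*Bd := by
      rw [abs_mul, abs_of_pos (by positivity : 0 < m/x)]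
      have w : (y:ℝ)/L*(m/x) ≤ 6*(r/(1+l)*exp (-|z/2-l|/10)) := by
        have ym : (y:ℝ)*(m/x) = exp (-(z-l-L)) := by rw [show m/x = (x/m)⁻¹ by rw [inv_div], xm, ← yy, ← exp_neg, ← exp_add]; congr 1; ring
        have : exp (-(z-l-L)) ≤ 2*r*exp (-|z/2-l|/10) := by
          calc _ ≤ exp ((L-l)/10 + -|z/2-l|/10) := exp_le_exp.2 (by rw [abs_of_nonneg (by linarith)]; linarith)
            _ = exp ((L-l)/10)*exp (-|z/2-l|/10) := exp_add _ _
            _ ≤ _ := by gcongr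
        have Li : 1/L ≤ 3/(1+l) := by rw [div_le_div_iff₀ L0 N0]; linarith
        calc (y:ℝ)/L*(m/x) = (y:ℝ)*(m/x)*(1/L) := by ring
          _ ≤ 2*r*exp (-|z/2-l|/10)*(3/(1+l)) := by rw [ym]; gcongr
          _ = _ := by ring
      have w2 : r/(1+l)*exp (-|z/2-l|/10) + r/(1+l)^2 ≤ Bd := by
        rw [hB]; have : 0 ≤ r/(1+l)*exp (-|z-l|/10) := by positivity
        linarith
      calc _ ≤ K2*(x/m*L^(-19/10:ℝ) + y/L)*(m/x) := by gcongr
        _ = K2*(L^(-19/10:ℝ)*(x/m*(m/x)) + y/L*(m/x)) := by ring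
        _ ≤ K2*(9*(r/(1+l)^2) + 6*(r/(1+l)*exp (-|z/2-l|/10))) := by rw [k1, mul_one]; gcongr
        _ ≤ K2*(15*Bd) := by
          gcongr
          have s1 : 0 ≤ r/(1+l)*exp (-|z/2-l|/10) := by positivity
          have s2 : 0 ≤ r/(1+l)^2 := by positivity
          linarith only [s1, s2, w2]
        _ = _ := by ring
    refine (abs_add_le _ _).trans ((add_le_add ((abs_sub _ _).trans (add_le_add J2 a1)) a2).trans ?_)
    linarith only [K2B, KB, B00]

theorem Sexp : ∃ S, 0 < S ∧ ∀ (w : ℝ) (J : ℕ), ∑ j ∈ Finset.range J, exp (-|w-j|/10) ≤ S := by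
  have h0 : Summable fun n : ℕ => exp (-(n:ℝ)/10) := by
    have := summable_geometric_of_lt_one (exp_pos (-1/10)).le (exp_lt_one_iff.2 (by norm_num))
    refine this.congr fun n => ?_
    rw [← exp_nat_mul]; congr 1; ring
  have h1 : Summable fun k : ℤ => exp (-|(k:ℝ)|/10) := by
    apply Summable.of_nat_of_neg
    · simpa using h0
    · simpa using h0
  refine ⟨exp (1/10)*∑' k : ℤ, exp (-|(k:ℝ)|/10), mul_pos (exp_pos _) (h1.tsum_pos (fun _ => (exp_pos _).le) 0 (exp_pos _)), fun w J => ?_⟩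
  have inj : Function.Injective fun j : ℕ => ⌊w⌋ - (j:ℤ) := fun a b h => by simpa using h
  calc _ ≤ ∑ j ∈ Finset.range J, exp (1/10)*exp (-|((⌊w⌋ - (j:ℤ) : ℤ):ℝ)|/10) := Finset.sum_le_sum fun j _ => by
        rw [← exp_add, exp_le_exp]; push_cast
        have : |(⌊w⌋:ℝ) - j| ≤ |w-j| + 1 := by
          rw [show (⌊w⌋:ℝ)-j = (w-j) - (w-⌊w⌋) by ring]
          refine (abs_sub _ _).trans ?_
          rw [abs_of_nonneg (sub_nonneg.2 (Int.floor_le w))]; linarith [Int.lt_floor_add_one w]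
        linarith
    _ = exp (1/10)*∑ k ∈ (Finset.range J).map ⟨_, inj⟩, exp (-|(k:ℝ)|/10) := by rw [← Finset.mul_sum, Finset.sum_map]; rfl
    _ ≤ _ := mul_le_mul_of_nonneg_left (h1.sum_le_tsum _ fun _ _ => (exp_pos _).le) (exp_pos _).le

theorem blk {s : Finset ℕ} {b g : ℕ → ℝ} {β C : ℕ → ℝ} {J : ℕ} (b0 : ∀ m, 0 ≤ b m) (hJ : ∀ m ∈ s, ⌊log m⌋₊ < J)
    (hβ : ∀ j, ∑ m ∈ s with ⌊log ((m:ℕ):ℝ)⌋₊ = j, b m ≤ β j) (hC : ∀ m ∈ s, g m ≤ C ⌊log m⌋₊) (C0 : ∀ j, 0 ≤ C j) :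
    ∑ m ∈ s, b m*g m ≤ ∑ j ∈ Finset.range J, β j*C j := by
  rw [← Finset.sum_fiberwise_of_maps_to (t := Finset.range J) (g := fun m : ℕ => ⌊log m⌋₊) (fun m hm => Finset.mem_range.2 (hJ m hm))]
  refine Finset.sum_le_sum fun j _ => ?_
  refine le_trans ?_ (mul_le_mul_of_nonneg_right (hβ j) (C0 j))
  rw [Finset.sum_mul]
  refine Finset.sum_le_sum fun m hm => ?_
  rw [Finset.mem_filter] at hm
  rw [← hm.2]
  exact mul_le_mul_of_nonneg_left (hC m hm.1) (b0 m)

theorem aa_nn (m : ℕ) : 0 ≤ aa m := by unfold aa; split_ifs <;> positivity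

noncomputable def fz (z : ℝ) : ℝ := Tprac (exp z)*exp (-z)

theorem beta {s : Finset ℕ} (hs : ∀ m ∈ s, 1 ≤ m) (j : ℕ) : ∑ m ∈ s with ⌊log ((m:ℕ):ℝ)⌋₊ = j, aa m/m ≤ exp 1*fz (j+1) := by
  have h : ∑ m ∈ s with ⌊log ((m:ℕ):ℝ)⌋₊ = j, aa m ≤ Tprac (exp (j+1)) := by
    rw [Tprac_eq]
    refine Finset.sum_le_sum_of_subset_of_nonneg (fun m hm => ?_) fun m _ _ => aa_nn m
    rw [Finset.mem_filter] at hm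
    have m0 : (0:ℝ) < m := by exact_mod_cast hs m hm.1
    refine Finset.mem_Icc.2 ⟨hs m hm.1, Nat.le_floor ?_⟩
    rw [← log_le_iff_le_exp m0, ← hm.2]
    exact (Nat.lt_floor_add_one _).le
  calc _ ≤ ∑ m ∈ s with ⌊log ((m:ℕ):ℝ)⌋₊ = j, aa m*exp (-(j:ℝ)) := Finset.sum_le_sum fun m hm => by
        rw [Finset.mem_filter] at hm
        have m1 : (1:ℝ) ≤ m := by exact_mod_cast hs m hm.1
        have : (j:ℝ) ≤ log m := by rw [← hm.2]; exact Nat.floor_le (log_nonneg m1)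
        rw [div_eq_mul_inv, exp_neg]
        have a0 := aa_nn m
        gcongr
        exact (le_log_iff_exp_le (by linarith)).1 this
    _ ≤ Tprac (exp (j+1))*exp (-(j:ℝ)) := by rw [← Finset.sum_mul]; gcongr
    _ = _ := by rw [fz, mul_left_comm, ← exp_add]; ring_nf

theorem S11 : ∃ S, 0 < S ∧ ∀ J : ℕ, ∑ j ∈ Finset.range J, ((j:ℝ)+1)^(-11/10:ℝ) ≤ S := by
  have h : Summable fun j : ℕ => ((j:ℝ)+1)^(-11/10:ℝ) := by
    have := (Real.summable_nat_rpow (p := -11/10)).2 (by norm_num)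
    refine ((summable_nat_add_iff 1).2 this).congr fun j => by push_cast; rfl
  have nn : ∀ j : ℕ, 0 ≤ ((j:ℝ)+1)^(-11/10:ℝ) := fun j => by positivity
  exact ⟨_, h.tsum_pos nn 0 (by norm_num), fun J => h.sum_le_tsum _ fun j _ => nn j⟩

theorem beta2 {K θ : ℝ} (K0 : 0 ≤ K) (h0 : 0 ≤ θ) (h1 : θ ≤ 1/2) (hf : ∀ s, 0 ≤ s → fz s ≤ K*(1+s)^(4/5+θ)) {s : Finset ℕ} (hs : ∀ m ∈ s, 1 ≤ m) (j : ℕ) :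
    ∑ m ∈ s with ⌊log ((m:ℕ):ℝ)⌋₊ = j, aa m/m ≤ 12*K*((j:ℝ)+1)^(4/5+θ) := by
  refine (beta hs j).trans ?_
  have e3 : exp 1 ≤ 3 := by linarith [exp_one_lt_d9]
  calc _ ≤ exp 1*(K*(1+(j+1:ℝ))^(4/5+θ)) := mul_le_mul_of_nonneg_left (hf _ (by positivity)) (exp_pos _).le
    _ ≤ 3*(K*(2*(j+1:ℝ))^(4/5+θ)) := by gcongr; linarith [Nat.cast_nonneg (α := ℝ) j]
    _ = 3*(K*(2^(4/5+θ)*(j+1:ℝ)^(4/5+θ))) := by rw [mul_rpow (by norm_num) (by positivity)]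
    _ ≤ 3*(K*(2^(2:ℝ)*(j+1:ℝ)^(4/5+θ))) := by gcongr <;> linarith
    _ = _ := by norm_num; ring

theorem tail_sum {K θ : ℝ} (K0 : 0 ≤ K) (h0 : 0 ≤ θ) (h1 : θ ≤ 1/2) (hf : ∀ s, 0 ≤ s → fz s ≤ K*(1+s)^(4/5+θ)) :
    ∃ K', 0 ≤ K' ∧ ∀ s : Finset ℕ, (∀ m ∈ s, 1 ≤ m) → ∑ m ∈ s, aa m/m*(1+log m)^(-19/10-θ) ≤ K' := by
  obtain ⟨S, S0, hS⟩ := S11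
  refine ⟨12*K*S, by positivity, fun s hs => ?_⟩
  have hJ : ∀ m ∈ s, ⌊log m⌋₊ < s.sup (fun m : ℕ => ⌊log m⌋₊) + 1 := fun m hm => Nat.lt_succ_of_le (Finset.le_sup (f := fun m : ℕ => ⌊log m⌋₊) hm)
  refine (blk (b := fun m => aa m/m) (C := fun j => ((j:ℝ)+1)^(-19/10-θ)) (fun m => div_nonneg (aa_nn m) (by positivity)) hJ (beta2 K0 h0 h1 hf hs) (fun m hm => ?_) (fun j => by positivity)).trans ?_
  · have m1 : (1:ℝ) ≤ m := by exact_mod_cast hs m hm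
    exact rpow_le_rpow_of_nonpos (by positivity) (by linarith [Nat.floor_le (log_nonneg m1)]) (by linarith)
  · refine le_trans (le_of_eq ?_) (mul_le_mul_of_nonneg_left (hS (s.sup (fun m : ℕ => ⌊log (m:ℝ)⌋₊) + 1)) (by positivity : 0 ≤ 12*K))
    rw [Finset.mul_sum]
    refine Finset.sum_congr rfl fun j _ => ?_
    rw [mul_assoc, ← rpow_add (by positivity)]; ring_nf

theorem main_sum {K θ : ℝ} (K0 : 0 ≤ K) (h0 : 0 ≤ θ) (h1 : θ ≤ 1/2) (hf : ∀ s, 0 ≤ s → fz s ≤ K*(1+s)^(4/5+θ)) :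
    ∃ K', 0 ≤ K' ∧ ∀ z, 0 ≤ z → ∑ m ∈ Finset.Icc 1 ⌊exp z⌋₊, aa m/m*((1+log m)^(-19/10:ℝ) + (1+log m)^(-9/10:ℝ)*(exp (-|z/2-log m|/10) + exp (-|z-log m|/10))) ≤ K'*(1+z)^θ := by
  obtain ⟨S, S0, hS⟩ := S11
  obtain ⟨T, T0, hT⟩ := Sexp
  refine ⟨12*K*(S+4*T), by positivity, fun z z0 => ?_⟩
  have hs : ∀ m ∈ Finset.Icc 1 ⌊exp z⌋₊, 1 ≤ m := fun m hm => (Finset.mem_Icc.1 hm).1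
  have hJ : ∀ m ∈ Finset.Icc 1 ⌊exp z⌋₊, ⌊log (m:ℝ)⌋₊ < ⌊z⌋₊+1 := fun m hm => by
    refine Nat.lt_succ_of_le (Nat.floor_le_floor ?_)
    have m1 : (0:ℝ) < m := by exact_mod_cast hs m hm
    rw [log_le_iff_le_exp m1]
    exact (Nat.le_floor_iff (exp_pos z).le).1 (Finset.mem_Icc.1 hm).2
  refine (blk (b := fun m => aa m/m) (C := fun j => ((j:ℝ)+1)^(-19/10:ℝ) + ((j:ℝ)+1)^(-9/10:ℝ)*(2*(exp (-|z/2-j|/10) + exp (-|z-j|/10)))) (fun m => div_nonneg (aa_nn m) (by positivity)) hJ (beta2 K0 h0 h1 hf hs) (fun m hm => ?_) (fun j => by positivity)).trans ?_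
  · have m1 : (1:ℝ) ≤ m := by exact_mod_cast hs m hm
    have l0 := log_nonneg m1
    have f1 := Nat.floor_le l0
    have f2 := Nat.lt_floor_add_one (log (m:ℝ))
    have e : ∀ w, exp (-|w-log m|/10) ≤ 2*exp (-|w-(⌊log (m:ℝ)⌋₊:ℝ)|/10) := fun w => by
      have : exp (1/10) ≤ 2 := by
        have := exp_bound' (x := 1/10) (by norm_num) (by norm_num) (n := 1) (by norm_num)
        norm_num at this ⊢; linarith
      refine le_trans ?_ (mul_le_mul_of_nonneg_right this (exp_pos _).le)
      rw [← exp_add, exp_le_exp]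
      have : |w-(⌊log (m:ℝ)⌋₊:ℝ)| ≤ |w-log m| + 1 := by
        rw [show w-(⌊log (m:ℝ)⌋₊:ℝ) = (w-log m)+(log m-(⌊log (m:ℝ)⌋₊:ℝ)) by ring]
        refine (abs_add_le _ _).trans ?_
        rw [abs_of_nonneg (sub_nonneg.2 f1)]; linarith
      linarith
    have r1 := rpow_le_rpow_of_nonpos (x := (⌊log (m:ℝ)⌋₊:ℝ)+1) (y := 1+log m) (z := -19/10) (by positivity) (by linarith) (by norm_num)
    have r2 := rpow_le_rpow_of_nonpos (x := (⌊log (m:ℝ)⌋₊:ℝ)+1) (y := 1+log m) (z := -9/10) (by positivity) (by linarith) (by norm_num)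
    refine add_le_add r1 (mul_le_mul r2 ?_ (by positivity) (by positivity))
    linarith only [e (z/2), e z]
  · calc _ ≤ ∑ j ∈ Finset.range (⌊z⌋₊+1), 12*K*(1+z)^θ*(((j:ℝ)+1)^(-11/10:ℝ) + 2*(exp (-|z/2-j|/10) + exp (-|z-j|/10))) := Finset.sum_le_sum fun j hj => by
          have jz : (j:ℝ)+1 ≤ 1+z := by
            have := (Nat.le_floor_iff z0).1 (Nat.lt_succ_iff.1 (Finset.mem_range.1 hj)); linarith
          have j0 : (0:ℝ) < (j:ℝ)+1 := by positivity
          have t1 : ((j:ℝ)+1)^θ ≤ (1+z)^θ := by gcongr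
          have s1 : ((j:ℝ)+1)^(4/5+θ)*((j:ℝ)+1)^(-19/10:ℝ) = ((j:ℝ)+1)^θ*((j:ℝ)+1)^(-11/10:ℝ) := by rw [← rpow_add j0, ← rpow_add j0]; ring_nf
          have s2 : ((j:ℝ)+1)^(4/5+θ)*((j:ℝ)+1)^(-9/10:ℝ) = ((j:ℝ)+1)^θ*((j:ℝ)+1)^(-1/10:ℝ) := by rw [← rpow_add j0, ← rpow_add j0]; ring_nf
          have s3 : ((j:ℝ)+1)^(-1/10:ℝ) ≤ 1 := rpow_le_one_of_one_le_of_nonpos (by linarith [Nat.cast_nonneg (α := ℝ) j]) (by norm_num)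
          calc _ = 12*K*(((j:ℝ)+1)^(4/5+θ)*((j:ℝ)+1)^(-19/10:ℝ) + ((j:ℝ)+1)^(4/5+θ)*((j:ℝ)+1)^(-9/10:ℝ)*(2*(exp (-|z/2-j|/10) + exp (-|z-j|/10)))) := by ring
            _ ≤ 12*K*((1+z)^θ*((j:ℝ)+1)^(-11/10:ℝ) + (1+z)^θ*1*(2*(exp (-|z/2-j|/10) + exp (-|z-j|/10)))) := by rw [s1, s2]; gcongr
            _ = _ := by ring
      _ = 12*K*(1+z)^θ*((∑ j ∈ Finset.range (⌊z⌋₊+1), ((j:ℝ)+1)^(-11/10:ℝ)) + 2*((∑ j ∈ Finset.range (⌊z⌋₊+1), exp (-|z/2-j|/10)) + ∑ j ∈ Finset.range (⌊z⌋₊+1), exp (-|z-j|/10))) := by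
          rw [← Finset.mul_sum, Finset.sum_add_distrib, ← Finset.mul_sum, Finset.sum_add_distrib]
      _ ≤ 12*K*(1+z)^θ*(S + 2*(T+T)) := by gcongr <;> first | exact hS _ | exact hT _ _
      _ = _ := by ring

theorem IccIoc (n : ℕ) : Finset.Icc 1 n = Finset.Ioc 0 n := by ext; simp [Nat.succ_le_iff]

theorem DD_bd : ∃ K, 0 < K ∧ ∀ z, 0 ≤ z → |DD (exp z)*exp (-z) - z| ≤ K := by
  obtain ⟨K, K0, c0, h⟩ := hyp_real
  refine ⟨2*K+|c0|, by positivity, fun z z0 => ?_⟩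
  have := h (1/2) (by norm_num) le_rfl (exp z) (exp_pos z)
  have e : DD (exp z) = ∑ n ∈ Finset.Ioc 0 ⌊exp z⌋₊, tau n := by
    rw [DD, IccIoc]; exact Finset.sum_congr rfl fun n _ => (tau_ap n).symm
  have e0 := exp_pos (-z)
  rw [← e, log_exp] at this
  have p : exp z^(1-1/2:ℝ) ≤ exp z := by
    calc _ ≤ exp z^(1:ℝ) := rpow_le_rpow_of_exponent_le (one_le_exp z0) (by norm_num)
      _ = _ := rpow_one _
  have x1 : exp z*exp (-z) = 1 := by rw [← exp_add]; simp
  have e2 : DD (exp z)*exp (-z) - z = (DD (exp z) - exp z*(z+c0))*exp (-z) + c0 := by linear_combination (z+c0)*x1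
  rw [e2]
  refine (abs_add_le _ _).trans (add_le_add ?_ le_rfl)
  rw [abs_mul, abs_of_pos e0]
  calc _ ≤ K/(1/2)*exp z*exp (-z) := by gcongr; exact this.trans (by gcongr)
    _ = _ := by rw [mul_assoc, x1]; ring

theorem fz_nn (z : ℝ) : 0 ≤ fz z := by
  rw [fz, Tprac_eq]; exact mul_nonneg (Finset.sum_nonneg fun m _ => aa_nn m) (exp_pos _).le

theorem fz_triv : ∃ K, 0 < K ∧ ∀ z, 0 ≤ z → fz z ≤ K*(1+z) := by
  obtain ⟨K, K0, h⟩ := DD_bd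
  refine ⟨K+1, by positivity, fun z z0 => ?_⟩
  have : fz z ≤ DD (exp z)*exp (-z) := by
    rw [fz, Tprac_eq, DD]; gcongr with m
    unfold aa; split_ifs
    · rfl
    · positivity
  have := (abs_le.1 (h z z0)).2
  nlinarith

noncomputable def FF (x : ℝ) : ℝ := fz (x-1)

theorem LB_FF : LB FF := by
  refine ⟨?_, fun X => ?_⟩
  · have : FF = fun x => ((fun n : ℕ => ∑ m ∈ Finset.Icc 1 n, aa m) ∘ Nat.floor) (exp (x-1))*exp (-(x-1)) := by
      ext x; rw [FF, fz, Tprac_eq]; rfl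
    rw [this]
    have h : Measurable ((fun n : ℕ => ∑ m ∈ Finset.Icc 1 n, aa m) ∘ (Nat.floor : ℝ → ℕ)) := measurable_from_nat.comp Nat.measurable_floor
    exact (h.comp (by fun_prop)).mul (by fun_prop)
  · obtain ⟨K, K0, h⟩ := fz_triv
    refine ⟨K*|X|, by positivity, fun x h1 h2 => ?_⟩
    rw [FF, abs_of_nonneg (fz_nn _)]
    refine (h _ (by linarith)).trans ?_
    gcongr; linarith [le_abs_self X]

theorem Xi.mc_eq {ξ : ℝ → ℝ} (H : Xi ξ) {z : ℝ} (z0 : 0 ≤ z) : mc FF (kk ξ) (1+z) = ∑ m ∈ Finset.Icc 1 ⌊exp z⌋₊, aa m/m*Im ξ z m := by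
  obtain ⟨K, K0, hT⟩ := H.term
  have X1 : 1 ≤ exp z := one_le_exp z0
  have a1 : mc FF (kk ξ) (1+z) = ∫ s in (0:ℝ)..z, fz s*kz ξ z s := by
    have := intervalIntegral.integral_comp_add_right (a := 0) (b := z) (fun w => FF w*kk ξ ((1+z)/w)/w) 1
    rw [mc, add_comm 1 z]
    rw [zero_add, add_comm 1 z] at this
    rw [← this]
    refine intervalIntegral.integral_congr fun s hs => ?_
    rw [uIcc_of_le z0] at hs
    have s0 : 1+s ≠ 0 := by linarith [hs.1]
    simp only [FF, kk, kz, add_sub_cancel_right, add_comm s 1]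
    rw [show (z+1)/(1+s) - 1 = (z-s)/(1+s) by field_simp; ring]; ring
  have I := (hT 1 le_rfl).2 z (by simpa using z0)
  have a2 := (exp_sub (fun s => fz s*kz ξ z s) X1).2
  rw [log_exp] at a2
  have a3 := (abel aa X1 (g := fun t => kz ξ z (log t)*t^(-2:ℝ)) (by
    rw [intervalIntegrable_iff_integrableOn_Ioc_of_le X1]
    exact I.1.mono_set (by simpa using Ioc_subset_Ioi_self))).2
  rw [a1, ← a2, IccIoc]
  rw [show ∫ t in (1:ℝ)..exp z, fz (log t)*kz ξ z (log t)/t = ∫ t in (1:ℝ)..exp z, (∑ n ∈ Finset.Ioc 0 ⌊t⌋₊, aa n)*(kz ξ z (log t)*t^(-2:ℝ)) from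
    intervalIntegral.integral_congr fun t ht => by
      rw [uIcc_of_le X1] at ht
      have t0 : 0 < t := by linarith [ht.1]
      have : t^(-2:ℝ) = t⁻¹*t⁻¹ := by rw [show (-2:ℝ) = -1 + -1 by norm_num, rpow_add t0, rpow_neg_one]
      rw [fz, Tprac_eq, IccIoc, exp_neg, exp_log t0, this]; ring, a3]
  refine Finset.sum_congr rfl fun m hm => ?_
  rw [Finset.mem_Ioc] at hm
  have m0 : (0:ℝ) < m := by exact_mod_cast hm.1
  have mx : (m:ℝ) ≤ exp z := (Nat.le_floor_iff (exp_pos z).le).1 hm.2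
  rw [Im, ← mul_assoc, div_mul_cancel₀ _ m0.ne', intervalIntegral.integral_of_le mx]
  congr 1
  symm
  apply setIntegral_eq_of_subset_of_forall_diff_eq_zero measurableSet_Ioi Ioc_subset_Ioi_self
  intro t ht
  have h1 : exp z < t := by
    have h2 := ht.2; rw [mem_Ioc, not_and, not_le] at h2; exact h2 ht.1
  have h3 : z < log t := (lt_log_iff_exp_lt ((exp_pos z).trans h1)).2 h1
  rw [kz, H.h0 _ ((div_neg_of_neg_of_pos (by linarith) (by linarith)).trans zero_lt_one)]; simp

set_option maxHeartbeats 1000000 in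
theorem Xi.eqn {ξ : ℝ → ℝ} (H : Xi ξ) {K θ : ℝ} (K0 : 0 ≤ K) (h0 : 0 ≤ θ) (h1 : θ ≤ 1/2) (hf : ∀ s, 0 ≤ s → fz s ≤ K*(1+s)^(4/5+θ)) :
    ∃ C K', ∀ x, 1 ≤ x → |Xi.EE ξ FF C x| ≤ K'*x^θ := by
  obtain ⟨K1, K10, hT⟩ := H.term
  obtain ⟨K2, K20, hM⟩ := main_sum K0 h0 h1 hf
  obtain ⟨K3, K30, hS⟩ := tail_sum K0 h0 h1 hf
  obtain ⟨K4, K40, hD⟩ := DD_bd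
  set G : ℕ → ℝ := fun m => aa m/m*(1+log m)^(-19/10-θ) with hG
  have b0 : ∀ m : ℕ, 0 ≤ aa m/m := fun m => div_nonneg (aa_nn m) (by positivity)
  have G0 : ∀ m, 0 ≤ G m := fun m => mul_nonneg (b0 m) (rpow_nonneg (by linarith [log_natCast_nonneg m]) _)
  have sG : Summable G := summable_of_sum_le (c := K3) G0 fun u => by
    rw [← Finset.sum_subset (Finset.erase_subset 0 u) fun m h1 h2 => ?_]
    · exact hS _ fun m hm => Nat.one_le_iff_ne_zero.2 (Finset.ne_of_mem_erase hm)
    · have : m = 0 := by by_contra h; exact h2 (Finset.mem_erase.2 ⟨h, h1⟩)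
      simp [hG, this]
  set fk : ℕ → ℝ := fun m => aa m/m*kp m with hfk
  have fb : ∀ (m : ℕ) (Z : ℝ), 1 ≤ Z → Z ≤ 1+log m → |fk m| * Z ≤ K1*Z^θ*G m := fun m Z Z1 hZ => by
    rcases Nat.eq_zero_or_pos m with rfl | hm
    · simp [hfk, hG]
    have k := (hT m hm).1
    rw [hfk]; simp only []
    rw [abs_mul, abs_of_nonneg (b0 m)]
    have N0 : 0 < 1+log (m:ℝ) := by linarith
    have e : Z ≤ Z^θ*(1+log m)^(1-θ) := by
      calc Z = Z^θ*Z^(1-θ) := by rw [← rpow_add (by linarith)]; simp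
        _ ≤ _ := by gcongr; linarith
    calc _ ≤ aa m/m*(K1*(1+log m)^(-29/10:ℝ))*(Z^θ*(1+log m)^(1-θ)) := by
          have := b0 m
          gcongr
      _ = K1*Z^θ*(aa m/m*((1+log m)^(-29/10:ℝ)*(1+log m)^(1-θ))) := by ring
      _ = _ := by rw [← rpow_add N0, hG]; ring_nf
  have sfk : Summable fk := Summable.of_norm_bounded (sG.mul_left K1) fun m => by
    have := fb m 1 le_rfl (by linarith [log_natCast_nonneg m])
    simpa using this
  refine ⟨1 - ∑' m, fk m, K4 + K1*K2 + K1*(∑' m, G m) + |1 - ∑' m, fk m|, fun x hx => ?_⟩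
  set z := x-1 with hz
  have z0 : 0 ≤ z := by linarith
  have xz : x = 1+z := by linarith
  set s := Finset.Icc 1 ⌊exp z⌋₊ with hs
  have x0 := exp_pos z
  have cp : ∑ m ∈ s, fk m + ∑' m : ↥((s:Set ℕ)ᶜ), fk m = ∑' m, fk m := sfk.sum_add_tsum_compl
  have tl : |∑' m : ↥((s:Set ℕ)ᶜ), fk m| * x ≤ K1*x^θ*∑' m, G m := by
    have hb : ∀ m : ↥((s:Set ℕ)ᶜ), ‖fk m*x‖ ≤ K1*x^θ*G m := fun ⟨m, hm⟩ => by
      rw [norm_mul, norm_of_nonneg (by linarith : 0 ≤ x)]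
      rcases Nat.eq_zero_or_pos m with rfl | hm0
      · simp [hfk, hG]
      refine fb m x hx ?_
      have h : ¬ m ≤ ⌊exp z⌋₊ := fun h => hm (by simpa [hs] using ⟨hm0, h⟩)
      rw [Nat.le_floor_iff x0.le, not_le] at h
      have := (lt_log_iff_exp_lt (by exact_mod_cast hm0)).2 h
      linarith
    have := tsum_of_norm_bounded ((sG.subtype ((s:Set ℕ)ᶜ)).hasSum.mul_left (K1*x^θ)) hb
    rw [tsum_mul_right, norm_mul, norm_of_nonneg (by linarith : 0 ≤ x), norm_eq_abs] at this
    refine this.trans (mul_le_mul_of_nonneg_left (sG.tsum_subtype_le _ _ G0) (by positivity))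
  have e1 : DD (exp z)*exp (-z) = ∑ m ∈ s, aa m/m*(Phi (exp z/m) (sg m+1)*(m/exp z)) := by
    rw [main_id, Finset.sum_mul]
    refine Finset.sum_congr rfl fun m hm => ?_
    have m0 : (m:ℝ) ≠ 0 := by have := (Finset.mem_Icc.1 hm).1; positivity
    rw [exp_neg]; field_simp
  have e2 : fz z = ∑ m ∈ s, aa m/m*(m/exp z) := by
    rw [fz, Tprac_eq, Finset.sum_mul]
    refine Finset.sum_congr rfl fun m hm => ?_
    have m0 : (m:ℝ) ≠ 0 := by have := (Finset.mem_Icc.1 hm).1; positivity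
    rw [exp_neg]; field_simp
  have e3 := H.mc_eq z0
  have e4 : ∑ m ∈ s, aa m/m*(Phi (exp z/m) (sg m+1)*(m/exp z) - m/exp z - Im ξ z m - z*kp m) = DD (exp z)*exp (-z) - fz z - mc FF (kk ξ) (1+z) - z*∑ m ∈ s, fk m := by
    rw [e1, e2, e3, Finset.mul_sum, ← Finset.sum_sub_distrib, ← Finset.sum_sub_distrib, ← Finset.sum_sub_distrib]
    refine Finset.sum_congr rfl fun m hm => ?_
    rw [hfk]; ring
  have e5 : |∑ m ∈ s, aa m/m*(Phi (exp z/m) (sg m+1)*(m/exp z) - m/exp z - Im ξ z m - z*kp m)| ≤ K1*(K2*x^θ) := by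
    refine (Finset.abs_sum_le_sum_abs _ _).trans ?_
    rw [xz]
    refine le_trans ?_ (mul_le_mul_of_nonneg_left (hM z z0) K10.le)
    rw [Finset.mul_sum]
    refine Finset.sum_le_sum fun m hm => ?_
    obtain ⟨m1, m2⟩ := Finset.mem_Icc.1 hm
    rw [abs_mul, abs_of_nonneg (b0 m), mul_left_comm]
    refine mul_le_mul_of_nonneg_left ?_ (b0 m)
    exact ((hT m m1).2 z ((log_le_iff_le_exp (by exact_mod_cast m1)).2 ((Nat.le_floor_iff x0.le).1 m2))).2
  have P : 1 ≤ x^θ := one_le_rpow hx h0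
  have e6 : Xi.EE ξ FF (1 - ∑' m, fk m) x = (DD (exp z)*exp (-z) - z) - (∑ m ∈ s, aa m/m*(Phi (exp z/m) (sg m+1)*(m/exp z) - m/exp z - Im ξ z m - z*kp m))
      + z*(∑' m : ↥((s:Set ℕ)ᶜ), fk m) - (1 - ∑' m, fk m) := by
    rw [e4, Xi.EE, FF, ← hz, xz, ← cp]; ring
  rw [e6]
  have t1 := hD z z0
  have t2 : |z*(∑' m : ↥((s:Set ℕ)ᶜ), fk m)| ≤ K1*x^θ*∑' m, G m := by
    rw [abs_mul, abs_of_nonneg z0, mul_comm]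
    exact le_trans (mul_le_mul_of_nonneg_left (by linarith) (abs_nonneg _)) tl
  refine (abs_sub _ _).trans (le_trans (add_le_add ((abs_add_le _ _).trans (add_le_add ((abs_sub _ _).trans (add_le_add t1 e5)) t2)) le_rfl) ?_)
  have w1 := mul_le_mul_of_nonneg_left P K40.le
  have w2 := mul_le_mul_of_nonneg_left P (abs_nonneg (1 - ∑' m, fk m))
  linarith only [w1, w2]

theorem Xi.asymp {ξ : ℝ → ℝ} (H : Xi ξ) {δ : ℝ} (hs : 2/3 ≤ δ) (hs1 : δ ≤ 4/5) (hd : 1 + Xi.J ξ δ + cc/δ + cc/(δ-1) = 0) :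
    ∃ ν K, 0 < K ∧ ∀ z, 0 ≤ z → |fz z - ν*(1+z)^δ| ≤ K := by
  obtain ⟨K, K0, hf⟩ := fz_triv
  obtain ⟨C, K1, hE⟩ := H.eqn K0.le (by norm_num : (0:ℝ) ≤ 1/5) (by norm_num) (fun s h => by
    rw [show (4/5+1/5:ℝ) = 1 by norm_num, rpow_one]; exact hf s h)
  obtain ⟨K2, hA⟩ := H.solveA hs hs1 hd LB_FF (C := C) (K := |K1|) fun x hx => by
    calc _ ≤ K1*x^(1/5:ℝ) := hE x hx
      _ ≤ |K1| * x^(1/2:ℝ) := by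
        have : 0 ≤ x := by linarith
        gcongr
        · exact le_abs_self _
        · norm_num
  obtain ⟨C', K3, hE'⟩ := H.eqn (abs_nonneg K2) le_rfl (by norm_num : (0:ℝ) ≤ 1/2) (fun s h => by
    have := hA (1+s) (by linarith)
    rw [FF, add_sub_cancel_left] at this
    calc fz s ≤ _ := (le_abs_self _).trans this
      _ ≤ |K2| * (1+s)^(4/5+0:ℝ) := by
        gcongr
        · exact le_abs_self _
        · linarith
        · linarith)
  obtain ⟨ν, K4, h⟩ := H.solveB hs hs1 hd LB_FF (C := C') (K := K3) fun x hx => by simpa using hE' x hx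
  refine ⟨ν, |K4|+1, by positivity, fun z hz => ?_⟩
  have := h (1+z) (by linarith)
  rw [FF, add_sub_cancel_left] at this
  linarith [le_abs_self K4]

theorem hs_dd {p : ℕ} (hp : 0 < p) {f : ArithmeticFunction ℝ} {s A : ℝ} (h : HasSum (fun n : ℕ => f n*(n:ℝ)^(-s)) A) :
    HasSum (fun n : ℕ => (dd p*f) n*(n:ℝ)^(-s)) ((p:ℝ)^(-s)*A) := by
  have inj : Function.Injective (fun k : ℕ => p*k) := fun a b e => Nat.eq_of_mul_eq_mul_left hp e
  refine (inj.hasSum_iff (fun n hn => ?_)).1 ((h.mul_left ((p:ℝ)^(-s))).congr_fun (fun k => ?_))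
  · rw [dd_mul hp, if_neg (fun ⟨k, e⟩ => hn ⟨k, e.symm⟩), zero_mul]
  · simp only [Function.comp]
    rw [dd_mul hp, if_pos (dvd_mul_right p k), Nat.mul_div_cancel_left _ hp, Nat.cast_mul, mul_rpow (by positivity) (by positivity)]; ring

theorem hs_1dd {p : ℕ} (hp : 0 < p) {f : ArithmeticFunction ℝ} {s A : ℝ} (h : HasSum (fun n : ℕ => f n*(n:ℝ)^(-s)) A) :
    HasSum (fun n : ℕ => ((1-dd p)*f) n*(n:ℝ)^(-s)) ((1-(p:ℝ)^(-s))*A) := by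
  have := h.sub (hs_dd hp h)
  rw [show (1-(p:ℝ)^(-s))*A = A - (p:ℝ)^(-s)*A by ring]
  refine this.congr_fun fun n => ?_
  rw [sub_mul, one_mul, af_sub]; ring

theorem hs_tau {s : ℝ} (h : 1 < s) : ∃ D, 0 < D ∧ HasSum (fun n : ℕ => tau n*(n:ℝ)^(-s)) D := by
  have h1 : LSeriesSummable (fun n => (ArithmeticFunction.zeta n : ℂ)) (s:ℂ) := ArithmeticFunction.LSeriesSummable_zeta_iff.2 (by simpa using h)
  have h2 := (h1.convolution h1).norm
  have S : Summable (fun n : ℕ => tau n*(n:ℝ)^(-s)) := by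
    refine h2.congr fun n => ?_
    rw [LSeries.norm_term_eq]
    rcases Nat.eq_zero_or_pos n with rfl | hn
    · simp
    · rw [if_neg hn.ne', Complex.ofReal_re, LSeries.convolution_def, rpow_neg (by positivity), div_eq_mul_inv]
      congr 1
      have : (∑ x ∈ n.divisorsAntidiagonal, (ArithmeticFunction.zeta x.1 : ℂ)*(ArithmeticFunction.zeta x.2 : ℂ)) = ((tau n : ℝ) : ℂ) := by
        rw [tau, ArithmeticFunction.mul_apply]; push_cast; rfl
      beta_reduce
      rw [this, Complex.norm_real, Real.norm_of_nonneg (by rw [tau_ap]; positivity)]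
  refine ⟨_, S.tsum_pos (fun n => by rw [tau_ap]; positivity) 1 (by rw [tau_ap]; simp), S.hasSum⟩

theorem hs_tt {s D : ℝ} (h : HasSum (fun n : ℕ => tau n*(n:ℝ)^(-s)) D) (y : ℕ) (hy : 1 ≤ y) :
    HasSum (fun n : ℕ => tt y n*(n:ℝ)^(-s)) (pr (fun p => (1-(p:ℝ)^(-s))^2) y*D) := by
  induction y, hy using Nat.le_induction with
  | base => simpa [tt_one, pr_one] using h
  | succ y hy ih =>
    by_cases hp : (y+1).Prime
    · rw [tt_p hp, pr_succ, if_pos hp]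
      have := hs_1dd hp.pos (hs_1dd hp.pos ih)
      convert this using 1; ring
    · rw [pr_succ, if_neg hp, mul_one, tt, rst_np hp]; exact ih

noncomputable def As (s : ℝ) (m : ℕ) : ℝ := (m:ℝ)^(-s)*pr (fun p => (1-(p:ℝ)^(-s))^2) (sg m+1)

theorem sum_As {s : ℝ} (h : 1 < s) (S : Finset ℕ) (hS : ∀ m ∈ S, 1 ≤ m) : ∑ m ∈ S, aa m*As s m ≤ 1 := by
  classical
  obtain ⟨D, D0, hD⟩ := hs_tau h
  have h1 : HasSum (fun n : ℕ => ∑ m ∈ S, aa m*((dd m*tt (sg m+1)) n*(n:ℝ)^(-s))) (∑ m ∈ S, aa m*((m:ℝ)^(-s)*(pr (fun p => (1-(p:ℝ)^(-s))^2) (sg m+1)*D))) :=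
    hasSum_sum fun m hm => (hs_dd (hS m hm) (hs_tt hD (sg m+1) (by omega))).mul_left _
  have h2 := hasSum_le (fun n => ?_) h1 hD
  · have : ∑ m ∈ S, aa m*((m:ℝ)^(-s)*(pr (fun p => (1-(p:ℝ)^(-s))^2) (sg m+1)*D)) = (∑ m ∈ S, aa m*As s m)*D := by
      rw [Finset.sum_mul]; refine Finset.sum_congr rfl fun m _ => ?_
      rw [As]; ring
    rw [this] at h2
    nlinarith
  · have t0 : 0 ≤ tau n := by rw [tau_ap]; positivity
    have key : ∑ m ∈ S, aa m*(dd m*tt (sg m+1)) n ≤ tau n := by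
      have val : ∀ m ∈ S, aa m*(dd m*tt (sg m+1)) n ≠ 0 → aa m*(dd m*tt (sg m+1)) n = tau n ∧ IsPractical m ∧ ∃ r, n = m*r ∧ RR (sg m+1) r := by
        intro m hm hne
        have m0 : 0 < m := hS m hm
        rw [dd_mul m0] at hne ⊢
        by_cases d : m ∣ n
        swap
        · simp [d] at hne
        obtain ⟨r, rfl⟩ := d
        rw [if_pos (dvd_mul_right _ _), Nat.mul_div_cancel_left _ m0, tt, rst_ap, aa] at hne ⊢
        by_cases hP : IsPractical m
        swap
        · simp [hP] at hne
        by_cases hR : RR (sg m+1) r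
        swap
        · simp [hR] at hne
        refine ⟨?_, hP, r, rfl, hR⟩
        rw [if_pos hP, if_pos hR, tau_ap, tau_ap, Nat.Coprime.card_divisors_mul (RR.cop m0 (by omega) hR)]; push_cast; rfl
      by_cases hz : ∀ m ∈ S, aa m*(dd m*tt (sg m+1)) n = 0
      · rw [Finset.sum_eq_zero hz]; exact t0
      · push Not at hz
        obtain ⟨m, hm, hne⟩ := hz
        obtain ⟨v, P, r, e, R⟩ := val m hm hne
        rw [Finset.sum_eq_single_of_mem m hm, v]
        intro m' hm' hne'
        by_contra hc
        obtain ⟨v', P', r', e', R'⟩ := val m' hm' hc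
        rcases le_total (sg m) (sg m') with c | c
        · exact hne' (dec_un P P' R R' (e.symm.trans e') c).symm
        · exact hne' (dec_un P' P R' R (e'.symm.trans e) c)
    calc _ = (∑ m ∈ S, aa m*(dd m*tt (sg m+1)) n)*(n:ℝ)^(-s) := by rw [Finset.sum_mul]; exact Finset.sum_congr rfl fun m _ => by ring
      _ ≤ _ := mul_le_mul_of_nonneg_right key (by positivity)

theorem sg_2m {m : ℕ} (h : IsPractical m) : 2*m ≤ sg m+1 := by
  have m0 := h.1
  rcases Nat.lt_or_ge m 2 with c | c
  · have : m = 1 := by omega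
    subst this; simp [sg]
  obtain ⟨s, hs, es⟩ := h.2 (m-1) (by omega) (by omega)
  have hm : m ∉ s := fun hm => by
    have := Finset.single_le_sum (f := fun d => d) (fun _ _ => Nat.zero_le _) hm
    omega
  have : ∑ d ∈ insert m s, d ≤ sg m := Finset.sum_le_sum_of_subset (Finset.insert_subset (Nat.mem_divisors_self m m0.ne') hs)
  rw [Finset.sum_insert hm, es] at this
  omega

theorem pr_gain {p t : ℝ} (hp : 2 ≤ p) (t0 : 0 ≤ t) (t1 : t ≤ 1/100) : (1-1/p)*exp (98/100*(t/(p-1))) ≤ 1-exp (-t)/p := by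
  have p1 : 0 < p-1 := by linarith
  have p0 : 0 < p := by linarith
  have e1 : exp (-t) ≤ 1-99/100*t := by
    have h1 := add_one_le_exp t
    have : exp (-t)*exp t = 1 := by rw [← Real.exp_add]; simp
    have h2 := exp_pos (-t)
    by_contra hc
    push Not at hc
    have : (1-99/100*t)*(t+1) < 1 := by
      calc _ < exp (-t)*(t+1) := by gcongr
        _ ≤ exp (-t)*exp t := by gcongr
        _ = 1 := this
    nlinarith
  have e2 : 1-t ≤ exp (-t) := by linarith [add_one_le_exp (-t)]
  set u := (1-exp (-t))/(p-1) with hu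
  have u0 : 0 ≤ u := div_nonneg (by linarith) p1.le
  have u1 : u ≤ 1/100 := by rw [hu, div_le_iff₀ p1]; nlinarith
  have u2 : 99/100*(t/(p-1)) ≤ u := by rw [hu, ← mul_div_assoc]; gcongr; linarith
  have eq : 1-exp (-t)/p = (1-1/p)*(1+u) := by rw [hu]; field_simp; ring
  rw [eq]
  refine mul_le_mul_of_nonneg_left ?_ (by rw [sub_nonneg, div_le_one p0]; linarith)
  rw [← le_log_iff_exp_le (by linarith)]
  have l := one_sub_inv_le_log_of_pos (show 0 < 1+u by linarith)
  have : (1+u)⁻¹ ≤ 1-99/100*u := by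
    rw [inv_le_iff_one_le_mul₀ (by linarith)]; nlinarith
  nlinarith [div_nonneg t0 p1.le]

theorem c1_pos (y : ℕ) : 0 < c1 y := by
  rw [c1, pr]; refine Finset.prod_pos fun p hp => ?_
  have h2 : (2:ℝ) ≤ p := by exact_mod_cast (Finset.mem_filter.1 hp).2.two_le
  have : 1/(p:ℝ) < 1 := by rw [div_lt_one (by linarith)]; linarith
  exact pow_pos (by linarith) 2

theorem pr_gain2 {ε : ℝ} (e0 : 0 < ε) {y : ℕ} (hy : ε*log y ≤ 1/100) :
    c1 y*exp (98/50*ε*∑ p ∈ (Finset.Icc 1 y).filter Nat.Prime, log p/((p:ℝ)-1)) ≤ pr (fun p => (1-(p:ℝ)^(-(1+ε)))^2) y := by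
  rw [Finset.mul_sum, Real.exp_sum, c1, pr, pr, ← Finset.prod_mul_distrib]
  have key : ∀ p ∈ (Finset.Icc 1 y).filter Nat.Prime, 0 ≤ (1-1/(p:ℝ))*exp (98/100*(ε*log p/((p:ℝ)-1))) ∧ (1-1/(p:ℝ))*exp (98/100*(ε*log p/((p:ℝ)-1))) ≤ 1-(p:ℝ)^(-(1+ε)) := fun p hp => by
    rw [Finset.mem_filter, Finset.mem_Icc] at hp
    have h2 : (2:ℝ) ≤ p := by exact_mod_cast hp.2.two_le
    have p0 : (0:ℝ) < p := by linarith
    have py : (p:ℝ) ≤ y := by exact_mod_cast hp.1.2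
    have l0 : 0 ≤ log p := log_nonneg (by linarith)
    constructor
    · have : 1/(p:ℝ) < 1 := by rw [div_lt_one (by linarith)]; linarith
      exact mul_nonneg (by linarith) (exp_pos _).le
    · have := pr_gain h2 (mul_nonneg e0.le l0) ((mul_le_mul_of_nonneg_left (log_le_log p0 py) e0.le).trans hy)
      refine this.trans (le_of_eq ?_)
      rw [neg_add, rpow_add p0, rpow_neg_one, rpow_def_of_pos p0]; ring_nf
  refine Finset.prod_le_prod (fun p hp => by positivity) fun p hp => ?_
  obtain ⟨k0, k1⟩ := key p hp
  calc _ = ((1-1/(p:ℝ))*exp (98/100*(ε*log p/((p:ℝ)-1))))^2 := by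
        rw [mul_pow, ← Real.exp_nat_mul]; congr 2; push_cast; ring
    _ ≤ _ := pow_le_pow_left₀ k0 k1 2

noncomputable def LL (m : ℕ) : ℝ := log ((sg m+1 : ℕ):ℝ)

theorem th_gain {m : ℕ} (h : IsPractical m) : LL m/25 ≤ 98/50*(∑ p ∈ (Finset.Icc 1 (sg m+1)).filter Nat.Prime, log p/((p:ℝ)-1)) - log m := by
  have l2 := log_two_gt_d9
  have l2' := log_two_lt_d9
  have m0 := h.1
  rcases Nat.lt_or_ge m 2 with c | c
  · have : m = 1 := by omega
    subst this
    have e : (Finset.Icc 1 (sg 1+1)).filter Nat.Prime = {2} := by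
      simp [sg]; rfl
    rw [e]; simp [LL, sg]; norm_num; linarith
  · have h2 := sg_2m h
    have t := theta_low (sg m+1) (by omega)
    have a1 : log m + log 2 ≤ LL m := by
      rw [← log_mul (by positivity) (by norm_num), LL]
      refine log_le_log (by positivity) ?_
      have : ((2*m:ℕ):ℝ) ≤ ((sg m+1:ℕ):ℝ) := by exact_mod_cast h2
      push_cast at this ⊢; linarith
    have a2 : 2*log 2 ≤ LL m := by
      have : log 2 ≤ log m := log_le_log (by norm_num) (by exact_mod_cast c)
      linarith
    rw [← LL] at t
    linarith

theorem As_gain {m : ℕ} (h : IsPractical m) {ε : ℝ} (e0 : 0 < ε) (hy : ε*LL m ≤ 1/100) :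
    c1 (sg m+1)/m*(1+ε*LL m/25) ≤ As (1+ε) m := by
  have m0 : (0:ℝ) < m := by exact_mod_cast h.1
  have g := pr_gain2 e0 (y := sg m+1) hy
  have t := th_gain h
  set θ := ∑ p ∈ (Finset.Icc 1 (sg m+1)).filter Nat.Prime, log p/((p:ℝ)-1)
  have c0 := c1_pos (sg m+1)
  rw [As]
  calc _ ≤ c1 (sg m+1)/m*exp (ε*(98/50*θ-log m)) := by
        gcongr
        have := add_one_le_exp (ε*(98/50*θ-log m))
        nlinarith
    _ = (m:ℝ)^(-(1+ε))*(c1 (sg m+1)*exp (98/50*ε*θ)) := by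
        rw [neg_add, rpow_add m0, rpow_neg_one, rpow_def_of_pos m0, show ε*(98/50*θ-log m) = log m*(-ε) + 98/50*ε*θ by ring, Real.exp_add]; field_simp
    _ ≤ _ := by gcongr

theorem rp_low {L a : ℝ} (h : 1/3 ≤ L) (a0 : 0 ≤ a) (a1 : a ≤ 1) : L^(-a) ≤ 3 := by
  calc L^(-a) ≤ (1/3:ℝ)^(-a) := rpow_le_rpow_of_nonpos (by norm_num) h (by linarith)
    _ = 3^a := by rw [one_div, inv_rpow (by norm_num), rpow_neg (by norm_num), inv_inv]
    _ ≤ 3^(1:ℝ) := rpow_le_rpow_of_exponent_le (by norm_num) a1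
    _ = 3 := rpow_one _

theorem Xi.up {ξ : ℝ → ℝ} (H : Xi ξ) : ∃ K, 0 < K ∧ ∀ m : ℕ, 1 ≤ m → c1 (sg m+1) ≤ K/(1+log m)^2 ∧
    ∀ X : ℝ, 1 ≤ X → Phi X (sg m+1) ≤ 1 + X*(log X*c1 (sg m+1) + K/(1+log m)) := by
  obtain ⟨K, K0, hK⟩ := H.Phi_fin
  obtain ⟨R, R0, hR, -⟩ := H.lip
  have cc0 : 0 < cc := exp_pos _
  have cc1 : cc ≤ 1 := by have := cc_bd.2; linarith
  refine ⟨3*(R+2+4*K) + 9*(1+3*K), by positivity, fun m hm => ?_⟩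
  obtain ⟨l0, l1, -, -, -, -, y2⟩ := L_facts hm
  obtain ⟨h1, h2⟩ := hK (sg m+1) y2
  have c0 := c1_pos (sg m+1)
  have y1 : (1:ℝ) ≤ ((sg m+1:ℕ):ℝ) := by exact_mod_cast (by omega : 1 ≤ sg m+1)
  set y : ℝ := ((sg m+1:ℕ):ℝ) with hy
  set c := c1 (sg m+1)
  set L := log y with hL
  set N := 1+log (m:ℝ) with hN
  have N1 : 1 ≤ N := by linarith
  have L3 : 1/3 ≤ L := by linarith
  have L0 : 0 < L := by linarith
  have iL : 1/L ≤ 3/N := by rw [div_le_div_iff₀ L0 (by linarith)]; linarith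
  have iL0 : 0 < 1/L := by positivity
  clear_value y c L N
  constructor
  · have e : L^(-29/10:ℝ) = (1/L)^2*L^(-(9/10):ℝ) := by
      rw [one_div, inv_pow, ← rpow_natCast, ← rpow_neg L0.le, ← rpow_add L0]; norm_num
    have b := rp_low (a := 9/10) L3 (by norm_num) (by norm_num)
    have h1 := (abs_le.1 h1).2
    rw [e] at h1
    have s1 : (1/L)^2*L^(-(9/10):ℝ) ≤ (1/L)^2*3 := mul_le_mul_of_nonneg_left b (by positivity)
    have s2 : (1/L)^2 ≤ (3/N)^2 := pow_le_pow_left₀ iL0.le iL 2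
    have s3 : cc/L^2 ≤ (1/L)^2 := by rw [div_eq_mul_inv, one_div, inv_pow]; exact mul_le_of_le_one_left (by positivity) cc1
    calc c ≤ cc/L^2 + K*((1/L)^2*L^(-(9/10):ℝ)) := by linarith only [h1]
      _ ≤ (1/L)^2 + K*((1/L)^2*3) := by gcongr
      _ = (1+3*K)*(1/L)^2 := by ring
      _ ≤ (1+3*K)*(3/N)^2 := by gcongr
      _ = 9*(1+3*K)/N^2 := by ring
      _ ≤ _ := by gcongr; linarith
  · intro X hX
    have lX := log_nonneg hX
    have X0 : 0 < X := by linarith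
    rcases le_or_gt y X with hc | hc
    · have h2 := (abs_le.1 (h2 X hc)).2
      have u0 : 0 ≤ log X/L := by positivity
      have r := (abs_le.1 (hR _ u0)).2
      rw [Xi.rho] at r
      have e : L^(-19/10:ℝ) = (1/L)*L^(-(9/10):ℝ) := by
        rw [one_div, ← rpow_neg_one, ← rpow_add L0]; norm_num
      have b := rp_low (a := 9/10) L3 (by norm_num) (by norm_num)
      have s1 : L^(-19/10:ℝ) ≤ 1/L*3 := by rw [e]; exact mul_le_mul_of_nonneg_left b iL0.le
      have s2 : X/L*ξ (log X/L) ≤ X/L*(R+2+cc*(log X/L)) := by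
        refine mul_le_mul_of_nonneg_left ?_ (by positivity); linarith only [r, cc1]
      calc _ ≤ 1 + X/L*(R+2+cc*(log X/L)) + X*log X*(c-cc/L^2) + K*(X*L^(-19/10:ℝ)+y/L) := by linarith only [h2, s2]
        _ ≤ 1 + X/L*(R+2+cc*(log X/L)) + X*log X*(c-cc/L^2) + K*(X*(1/L*3)+X/L) := by gcongr
        _ = 1 + X*(log X*c + (R+2+4*K)*(1/L)) := by field_simp; ring
        _ ≤ 1 + X*(log X*c + (R+2+4*K)*(3/N)) := by gcongr
        _ = 1 + X*(log X*c + (3*(R+2+4*K))/N) := by ring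
        _ ≤ _ := by gcongr; linarith
    · rw [Phi_one hX (by rw [← hy]; linarith)]
      have : 0 ≤ X*(log X*c + (3*(R+2+4*K) + 9*(1+3*K))/N) := by positivity
      linarith

noncomputable def ww (m : ℕ) : ℝ := aa m/m*c1 (sg m+1)
theorem ww_nn (m : ℕ) : 0 ≤ ww m := mul_nonneg (div_nonneg (aa_nn m) (by positivity)) (c1_pos _).le
theorem bb_nn (m : ℕ) : 0 ≤ aa m/m := div_nonneg (aa_nn m) (by positivity)

theorem beta3 {M : ℝ} (M0 : 0 ≤ M) (hM : ∀ z, 0 ≤ z → fz z ≤ M) {s : Finset ℕ} (hs : ∀ m ∈ s, 1 ≤ m) (j : ℕ) :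
    ∑ m ∈ s with ⌊log ((m:ℕ):ℝ)⌋₊ = j, aa m/m ≤ 3*M := by
  refine (beta hs j).trans ?_
  have e3 : exp 1 ≤ 3 := by linarith [exp_one_lt_d9]
  exact mul_le_mul e3 (hM (j+1) (by positivity)) (fz_nn _) (by norm_num)

theorem sum_N {M : ℝ} (M0 : 0 ≤ M) (hM : ∀ z, 0 ≤ z → fz z ≤ M) : ∃ C, 0 < C ∧ ∀ z, 0 ≤ z →
    ∑ m ∈ Finset.Icc 1 ⌊exp z⌋₊, aa m/m*(1/(1+log m)) ≤ C*(1+z)^(1/10:ℝ) := by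
  obtain ⟨S, S0, hS⟩ := S11
  refine ⟨3*M*S+1, by positivity, fun z z0 => ?_⟩
  have hs : ∀ m ∈ Finset.Icc 1 ⌊exp z⌋₊, 1 ≤ m := fun m hm => (Finset.mem_Icc.1 hm).1
  have hJ : ∀ m ∈ Finset.Icc 1 ⌊exp z⌋₊, ⌊log (m:ℝ)⌋₊ < ⌊z⌋₊+1 := fun m hm => by
    refine Nat.lt_succ_of_le (Nat.floor_le_floor ?_)
    have m1 : (0:ℝ) < m := by exact_mod_cast hs m hm
    rw [log_le_iff_le_exp m1]
    exact (Nat.le_floor_iff (exp_pos z).le).1 (Finset.mem_Icc.1 hm).2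
  refine (blk (b := fun m => aa m/m) (C := fun j => 1/((j:ℝ)+1)) bb_nn hJ (beta3 M0 hM hs) (fun m hm => ?_) (fun j => by positivity)).trans ?_
  · have m1 : (1:ℝ) ≤ m := by exact_mod_cast hs m hm
    refine one_div_le_one_div_of_le (by positivity) (by linarith [Nat.floor_le (log_nonneg m1)])
  · calc _ ≤ ∑ j ∈ Finset.range (⌊z⌋₊+1), 3*M*(1+z)^(1/10:ℝ)*((j:ℝ)+1)^(-11/10:ℝ) := Finset.sum_le_sum fun j hj => by
          have jz : (j:ℝ)+1 ≤ 1+z := by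
            have := (Nat.le_floor_iff z0).1 (Nat.lt_succ_iff.1 (Finset.mem_range.1 hj)); linarith
          have j0 : (0:ℝ) < (j:ℝ)+1 := by positivity
          have e : 1/((j:ℝ)+1) = ((j:ℝ)+1)^(1/10:ℝ)*((j:ℝ)+1)^(-11/10:ℝ) := by
            rw [← rpow_add j0, one_div, ← rpow_neg_one]; norm_num
          rw [e, mul_assoc (3*M)]; gcongr
      _ ≤ 3*M*(1+z)^(1/10:ℝ)*S := by rw [← Finset.mul_sum]; gcongr; exact hS _
      _ ≤ _ := by have : 0 ≤ (1+z)^(1/10:ℝ) := by positivity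
                  linarith

theorem Xi.W1 {ξ : ℝ → ℝ} (H : Xi ξ) {M : ℝ} (M0 : 0 ≤ M) (hM : ∀ z, 0 ≤ z → fz z ≤ M) {V : ℝ}
    (hV : ∀ s : Finset ℕ, (∀ m ∈ s, 1 ≤ m) → ∑ m ∈ s, ww m ≤ V) : 1 ≤ V := by
  obtain ⟨K, K0, hK⟩ := H.up
  obtain ⟨C, C0, hC⟩ := sum_N M0 hM
  obtain ⟨D, D0, hD⟩ := DD_bd
  have key : ∀ z, 0 ≤ z → z - D ≤ M + z*V + K*(C*(1+z)^(1/10:ℝ)) := fun z z0 => by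
    have d := (abs_le.1 (hD z z0)).1
    have x1 : exp z*exp (-z) = 1 := by rw [← Real.exp_add]; simp
    have hs : ∀ m ∈ Finset.Icc 1 ⌊exp z⌋₊, 1 ≤ m := fun m hm => (Finset.mem_Icc.1 hm).1
    have b : DD (exp z)*exp (-z) ≤ fz z + z*(∑ m ∈ Finset.Icc 1 ⌊exp z⌋₊, ww m) + K*∑ m ∈ Finset.Icc 1 ⌊exp z⌋₊, aa m/m*(1/(1+log m)) := by
      rw [main_id, fz, Tprac_eq, Finset.sum_mul, Finset.sum_mul, Finset.mul_sum, Finset.mul_sum, ← Finset.sum_add_distrib, ← Finset.sum_add_distrib]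
      refine Finset.sum_le_sum fun m hm => ?_
      have m1 : (1:ℝ) ≤ m := by exact_mod_cast hs m hm
      have mx : (m:ℝ) ≤ exp z := (Nat.le_floor_iff (exp_pos z).le).1 (Finset.mem_Icc.1 hm).2
      have a0 := aa_nn m
      have c0 := c1_pos (sg m+1)
      have l0 := log_nonneg m1
      have p := (hK m (hs m hm)).2 (exp z/m) (by rw [le_div_iff₀ (by linarith)]; linarith)
      have lx : log (exp z/m) ≤ z := by rw [log_div (exp_pos z).ne' (by linarith), log_exp]; linarith
      calc _ ≤ aa m*(1+exp z/m*(z*c1 (sg m+1) + K/(1+log m)))*exp (-z) := by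
            gcongr; exact p.trans (by gcongr)
        _ = aa m*exp (-z) + (exp z*exp (-z))*(z*(aa m/m*c1 (sg m+1)) + K*(aa m/m*(1/(1+log m)))) := by ring
        _ = _ := by rw [x1, ww]; ring
    have b1 := hM z z0
    have b2 := mul_le_mul_of_nonneg_left (hV _ hs) z0
    have b3 := mul_le_mul_of_nonneg_left (hC z z0) K0.le
    linarith
  by_contra hc
  push Not at hc
  have q0 : 0 < 1-V := by linarith
  set E := M+D+1 with hE
  have E0 : 0 < E := by positivity
  set T := 1+(E+K*C)/(1-V) with hT
  have g0 : 0 < (E+K*C)/(1-V) := by positivity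
  have T1 : 1 ≤ T := by linarith only [g0, hT]
  have h3 : (1-V)*T = 1-V+(E+K*C) := by rw [hT, mul_add, mul_div_cancel₀ _ q0.ne', mul_one]
  clear hV hK hC hD hM
  clear_value T E
  have hp1 := one_le_pow₀ T1 (n := 10)
  have k := key (T^10-1) (by linarith only [hp1])
  clear hp1
  have e : (1+(T^10-1))^(1/10:ℝ) = T := by
    rw [add_sub_cancel, ← rpow_natCast, ← rpow_mul (by linarith)]; norm_num
  rw [e] at k
  have h2 : T^2 ≤ T^10 := pow_le_pow_right₀ T1 (by norm_num)
  generalize T^10 = P at h2 k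
  have h4 : (1-V)*T^2 ≤ (1-V)*P := mul_le_mul_of_nonneg_left h2 q0.le
  have h5 : (1-V)*T^2 = (1-V)*T + E*T + K*C*T := by linear_combination T*h3
  have h6 : E ≤ E*T := le_mul_of_one_le_right E0.le T1
  have h7 : 1-V ≤ (1-V)*T := le_mul_of_one_le_right q0.le T1
  have h8 : (1-V)*P ≤ E-1+(1-V)+K*C*T := by rw [hE]; linarith only [k]
  linarith only [h4, h5, h6, h7, h8]

theorem tel {U : ℝ} (U0 : 0 < U) (J : ℕ) : ∑ j ∈ Finset.range J, (if U < (j:ℝ)+1 then 1/((j:ℝ)+1)^2 else 0) ≤ 4/U := by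
  have h : ∀ j ∈ Finset.range J, (if U < (j:ℝ)+1 then 1/((j:ℝ)+1)^2 else 0) ≤ 4/(U+(j:ℕ)) - 4/(U+(j+1:ℕ)) := fun j _ => by
    have j0 : (0:ℝ) ≤ j := Nat.cast_nonneg j
    have e : 4/(U+(j:ℕ)) - 4/(U+(j+1:ℕ)) = 4/((U+j)*(U+j+1)) := by push_cast; field_simp; ring
    rw [e]
    split_ifs with c
    · rw [div_le_div_iff₀ (by positivity) (by positivity)]; nlinarith
    · positivity
  refine (Finset.sum_le_sum h).trans ?_
  rw [Finset.sum_range_sub' (fun j : ℕ => 4/(U+(j:ℝ)))]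
  have : 0 ≤ 4/(U+(J:ℝ)) := by positivity
  simp only [Nat.cast_zero, add_zero]; linarith

theorem Xi.tl {ξ : ℝ → ℝ} (H : Xi ξ) {M : ℝ} (M0 : 0 ≤ M) (hM : ∀ z, 0 ≤ z → fz z ≤ M) :
    ∃ C, 0 < C ∧ ∀ T : ℝ, 0 < T → ∀ s : Finset ℕ, (∀ m ∈ s, 1 ≤ m) → (∀ m ∈ s, T < LL m) → ∑ m ∈ s, ww m ≤ C/T := by
  obtain ⟨K, K0, hK⟩ := H.up
  refine ⟨3*M*K*(4*42)+1, by positivity, fun T T0 s hs hT => ?_⟩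
  have hJ : ∀ m ∈ s, ⌊log m⌋₊ < s.sup (fun m : ℕ => ⌊log m⌋₊) + 1 := fun m hm => Nat.lt_succ_of_le (Finset.le_sup (f := fun m : ℕ => ⌊log m⌋₊) hm)
  refine (blk (b := fun m => aa m/m) (g := fun m => c1 (sg m+1)) (C := fun j => K*(if T/42 < (j:ℝ)+1 then 1/((j:ℝ)+1)^2 else 0)) bb_nn hJ (beta3 M0 hM hs) (fun m hm => ?_) (fun j => by split_ifs <;> positivity)).trans ?_
  · have l := (hK m (hs m hm)).1
    obtain ⟨l0, -, -, -, l1, l2, -⟩ := L_facts (hs m hm)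
    have f1 := Nat.floor_le l0
    have f2 := Nat.lt_floor_add_one (log (m:ℝ))
    have l3 : (1+log (m:ℝ))^(1/10:ℝ) ≤ 1+log m := by
      calc _ ≤ (1+log (m:ℝ))^(1:ℝ) := rpow_le_rpow_of_exponent_le (by linarith) (by norm_num)
        _ = _ := rpow_one _
    have t := hT m hm
    rw [LL] at t
    have t2 : T/42 < (⌊log (m:ℝ)⌋₊:ℝ)+1 := by
      have : (0:ℝ) ≤ ⌊log (m:ℝ)⌋₊ := Nat.cast_nonneg _
      linarith only [t, l1, l3, f1, f2, this]
    simp only [if_pos t2]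
    refine l.trans ?_
    rw [div_eq_mul_one_div]
    exact mul_le_mul_of_nonneg_left (one_div_le_one_div_of_le (by positivity) (pow_le_pow_left₀ (by positivity) (by linarith only [f1]) 2)) K0.le
  · rw [← Finset.mul_sum, ← Finset.mul_sum]
    calc _ ≤ 3*M*(K*(4/(T/42))) := by gcongr; exact tel (by positivity) _
      _ = 3*M*K*(4*42)/T := by field_simp
      _ ≤ _ := by gcongr; linarith

theorem Xi.st {ξ : ℝ → ℝ} (H : Xi ξ) {M : ℝ} (M0 : 0 ≤ M) (hM : ∀ z, 0 ≤ z → fz z ≤ M) {T t : ℝ} (T0 : 0 < T)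
    (ht : ∀ s : Finset ℕ, (∀ m ∈ s, 1 ≤ m) → (∀ m ∈ s, T < LL m) → ∑ m ∈ s, ww m ≤ t)
    (s : Finset ℕ) (hs : ∀ m ∈ s, 1 ≤ m) (hs2 : ∀ m ∈ s, LL m ≤ T) : ∑ m ∈ s, ww m*LL m ≤ 2500*T*t := by
  classical
  set B := (Finset.Icc 1 ⌊exp T⌋₊).filter (fun m => LL m ≤ T) with hB
  have memB : ∀ m, m ∈ B ↔ 1 ≤ m ∧ LL m ≤ T := fun m => by
    rw [hB, Finset.mem_filter, Finset.mem_Icc]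
    refine ⟨fun h => ⟨h.1.1, h.2⟩, fun h => ⟨⟨h.1, Nat.le_floor ?_⟩, h.2⟩⟩
    have m0 : (0:ℝ) < m := by exact_mod_cast h.1
    rw [← log_le_iff_le_exp m0]
    exact ((L_facts h.1).2.2.1).trans h.2
  clear_value B
  have LLn : ∀ m, 1 ≤ m → 0 ≤ LL m := fun m hm => (L_facts hm).1.trans (L_facts hm).2.2.1
  have W := H.W1 M0 hM (V := ∑ m ∈ B, ww m + t) fun s hs => by
    rw [← Finset.sum_filter_add_sum_filter_not s (fun m => LL m ≤ T)]
    refine add_le_add (Finset.sum_le_sum_of_subset_of_nonneg (fun m hm => ?_) fun m _ _ => ww_nn m) (ht _ (fun m hm => hs m (Finset.mem_filter.1 hm).1) fun m hm => not_le.1 (Finset.mem_filter.1 hm).2)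
    rw [Finset.mem_filter] at hm
    exact (memB m).2 ⟨hs m hm.1, hm.2⟩
  have e0 : 0 < 1/(100*T) := by positivity
  have A := sum_As (s := 1+1/(100*T)) (by linarith) B (fun m hm => ((memB m).1 hm).1)
  have A2 : ∑ m ∈ B, (ww m + ww m*LL m/(2500*T)) ≤ ∑ m ∈ B, aa m*As (1+1/(100*T)) m := Finset.sum_le_sum fun m hm => by
    by_cases hP : IsPractical m
    · have b := ((memB m).1 hm).2
      have g := As_gain hP e0 (by rw [one_div_mul_eq_div, div_le_div_iff₀ (by positivity) (by norm_num)]; linarith)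
      refine le_trans (le_of_eq ?_) (mul_le_mul_of_nonneg_left g (aa_nn m))
      rw [ww]; field_simp; ring
    · simp [ww, aa, hP]
  rw [Finset.sum_add_distrib] at A2
  have A3 : ∑ m ∈ B, ww m*LL m/(2500*T) ≤ t := by linarith
  rw [← Finset.sum_div, div_le_iff₀ (by positivity)] at A3
  refine (Finset.sum_le_sum_of_subset_of_nonneg (fun m hm => (memB m).2 ⟨hs m hm, hs2 m hm⟩) fun m hm _ => mul_nonneg (ww_nn m) (LLn m ((memB m).1 hm).1)).trans ?_
  linarith

theorem Xi.unbdd {ξ : ℝ → ℝ} (H : Xi ξ) {M : ℝ} (M0 : 0 ≤ M) (hM : ∀ z, 0 ≤ z → fz z ≤ M) : False := by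
  classical
  obtain ⟨C, C0, hC⟩ := H.tl M0 hM
  have LLn : ∀ m, 1 ≤ m → 0 ≤ LL m := fun m hm => (L_facts hm).1.trans (L_facts hm).2.2.1
  have bT : ∀ s : Finset ℕ, (∀ m ∈ s, 1 ≤ m) → ∃ T, 1 ≤ T ∧ ∀ m ∈ s, LL m ≤ T := fun s hs =>
    ⟨1+∑ m ∈ s, LL m, by linarith [Finset.sum_nonneg fun m hm => LLn m (hs m hm)], fun m hm => by
      linarith [Finset.single_le_sum (f := LL) (fun m hm => LLn m (hs m hm)) hm]⟩
  have bd : ∀ s : Finset ℕ, (∀ m ∈ s, 1 ≤ m) → ∑ m ∈ s, ww m*LL m ≤ 2500*C := fun s hs => by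
    obtain ⟨T, T1, hT⟩ := bT s hs
    have T0 : 0 < T := by linarith
    refine (H.st M0 hM T0 (hC T T0) s hs hT).trans (le_of_eq ?_)
    field_simp
  set Q : Set ℝ := {x | ∃ s : Finset ℕ, (∀ m ∈ s, 1 ≤ m) ∧ x = ∑ m ∈ s, ww m*LL m} with hQ
  have Qb : BddAbove Q := ⟨2500*C, by rintro x ⟨s, hs, rfl⟩; exact bd s hs⟩
  have Qn : Q.Nonempty := ⟨_, ∅, by simp, rfl⟩
  have P1 : IsPractical 1 := ⟨one_pos, fun j h1 h2 => ⟨{1}, by simp, by simp; omega⟩⟩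
  have w1 : 0 < ww 1*LL 1 := by
    refine mul_pos (mul_pos ?_ (c1_pos _)) ?_
    · simp [aa, P1]
    · rw [LL]; exact log_pos (by simp [sg])
  set η := ww 1*LL 1/5000 with hη
  have η0 : 0 < η := by positivity
  obtain ⟨x, ⟨s0, hs0, rfl⟩, hx⟩ := exists_lt_of_lt_csSup Qn (show sSup Q - η < sSup Q by linarith)
  obtain ⟨T, T1, hT⟩ := bT (insert 1 s0) (fun m hm => by
    rcases Finset.mem_insert.1 hm with rfl | h
    exacts [le_rfl, hs0 m h])
  have T0 : 0 < T := by linarith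
  have f := H.st M0 hM (t := η/T) T0 (fun s hs hs2 => ?_) {1} (by simp) (by simpa using hT 1 (Finset.mem_insert_self _ _))
  · rw [Finset.sum_singleton, show 2500*T*(η/T) = 2500*η by field_simp, hη] at f
    linarith
  · rw [le_div_iff₀ T0, Finset.sum_mul]
    have dj : Disjoint s0 s := Finset.disjoint_left.2 fun m h1 h2 => absurd (hT m (Finset.mem_insert_of_mem h1)) (not_le.2 (hs2 m h2))
    have := le_csSup Qb ⟨s0 ∪ s, fun m hm => (Finset.mem_union.1 hm).elim (hs0 m) (hs m), rfl⟩
    rw [Finset.sum_union dj] at this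
    refine le_trans (Finset.sum_le_sum fun m hm => mul_le_mul_of_nonneg_left (hs2 m hm).le (ww_nn m)) ?_
    linarith

theorem Xi.final {ξ : ℝ → ℝ} (H : Xi ξ) : ∃ ν δ : ℝ, 0 < ν ∧ 2/3 ≤ δ ∧ δ ≤ 4/5 ∧ 1 + Xi.J ξ δ + cc/δ + cc/(δ-1) = 0 ∧
    ∃ C : ℝ, ∀ x : ℝ, 2 ≤ x → |Tprac x - ν*x*(log x)^δ| ≤ C*x := by
  obtain ⟨δ, d1, d2, hd⟩ := H.exists_delta
  obtain ⟨ν, K, K0, hK⟩ := H.asymp d1 d2 hd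
  have ν0 : 0 < ν := by
    by_contra hc
    push Not at hc
    refine H.unbdd K0.le fun z z0 => ?_
    have h1 := (abs_le.1 (hK z z0)).2
    have h2 : ν*(1+z)^δ ≤ 0 := mul_nonpos_of_nonpos_of_nonneg hc (by positivity)
    linarith
  refine ⟨ν, δ, ν0, d1, d2, hd, K+ν, fun x hx => ?_⟩
  have x0 : 0 < x := by linarith
  have z0 : 0 ≤ log x := log_nonneg (by linarith)
  have h := hK (log x) z0
  rw [fz, exp_log x0, Real.exp_neg, exp_log x0] at h
  have h2 : (1+log x)^δ ≤ 1+(log x)^δ := by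
    have := Real.rpow_add_le_add_rpow (p := δ) zero_le_one z0 (by linarith) (by linarith)
    simpa using this
  have h3 : (log x)^δ ≤ (1+log x)^δ := rpow_le_rpow z0 (by linarith) (by linarith)
  have e : Tprac x - ν*x*(log x)^δ = x*((Tprac x*x⁻¹ - ν*(1+log x)^δ) + ν*((1+log x)^δ-(log x)^δ)) := by
    field_simp; ring
  rw [e, abs_mul, abs_of_pos x0, mul_comm]
  refine mul_le_mul_of_nonneg_right ((abs_add_le _ _).trans (add_le_add h ?_)) x0.le
  rw [abs_of_nonneg (mul_nonneg ν0.le (by linarith))]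
  calc _ ≤ ν*1 := mul_le_mul_of_nonneg_left (by linarith) ν0.le
    _ = ν := mul_one _

end

theorem margenstern_conjecture4 (ξ : ℝ → ℝ)
    (hξ0 : ∀ u : ℝ, u < 1 → ξ u = 0)
    (hξ : ∀ u : ℝ, 1 ≤ u → u * ξ u = 2 + 2 * ∫ t in (1:ℝ)..(u - 1), ξ t) :
    ∃ ν δ : ℝ, 0 < ν ∧ 1 / 2 < δ ∧ δ < 1 ∧
      (0 = 1 + (∫ v in Set.Ioi (0:ℝ),
            (ξ v - (v + 2) * Real.exp (-2 * Real.eulerMascheroniConstant)) *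
              (v + 1) ^ (-δ - 1)) +
          Real.exp (-2 * Real.eulerMascheroniConstant) / δ +
          Real.exp (-2 * Real.eulerMascheroniConstant) / (δ - 1)) ∧
      ∃ C : ℝ, ∀ x : ℝ, 2 ≤ x →
        |Tprac x - ν * x * (Real.log x) ^ δ| ≤ C * x := by
  have H : Xi ξ := ⟨hξ0, hξ⟩
  obtain ⟨ν, δ, n0, d1, d2, hd, hC⟩ := H.final
  refine ⟨ν, δ, n0, by linarith, by linarith, ?_, hC⟩
  symm
  have e : (∫ v in Set.Ioi (0:ℝ), (ξ v - (v + 2) * Real.exp (-2 * Real.eulerMascheroniConstant)) * (v + 1) ^ (-δ - 1)) = Xi.J ξ δ := by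
    rw [Xi.J]; refine MeasureTheory.integral_congr_ae (Filter.Eventually.of_forall fun v => ?_)
    simp only [Xi.rho, cc]; ring
  rw [e]; exact hd
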